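/- For every sentence σ in the first-order language of rings there exists a rational number δ such that the set of primes p for which σ holds in the field ZMod p has natural density δ within the primes; that is, (#{p ≤ x : p prime and ZMod p ⊨ σ}) / (#{p ≤ x : p prime}) tends to δ as x → ∞. -/

import Mathlib

open FirstOrder

/-- Truth of a ring-language sentence in a ring `K`, with `K` viewed as a structure for
the language of rings via `compatibleRingOfRing`. -/
def RingSentenceHolds (σ : Language.ring.Sentence)
    (K : Type*) [Add K] [Mul K] [Neg K] [One K] [Zero K] : Prop :=
  letI := Ring.compatibleRingOfRing K
  K ⊨ σ

section
open Polynomial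

namespace Stp

/-- weighted degree bound -/
def WD {k : Type*} [Field k] (D B : ℕ) (H : k[X][X]) : Prop :=
  ∀ j, H.coeff j ≠ 0 → (H.coeff j).natDegree + D * j ≤ B

section
variable {k : Type*} [Field k] {D B B' : ℕ} {H G : k[X][X]}

lemma WD.mono (h : WD D B H) (hB : B ≤ B') : WD D B' H := fun j hj => (h j hj).trans hB

lemma WD.zero : WD D B (0 : k[X][X]) := fun j hj => absurd (by simp) hj

lemma WD.add (h : WD D B H) (h' : WD D B G) : WD D B (H + G) := by
  intro j hj
  rw [coeff_add] at hj ⊢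
  by_cases h1 : H.coeff j = 0
  · rw [h1, zero_add] at hj ⊢; exact h' j hj
  by_cases h2 : G.coeff j = 0
  · rw [h2, add_zero] at hj ⊢; exact h j hj
  have := h j h1
  have := h' j h2
  have := natDegree_add_le (H.coeff j) (G.coeff j)
  omega

lemma WD.neg (h : WD D B H) : WD D B (-H) := by
  intro j hj
  rw [coeff_neg] at hj ⊢
  rw [natDegree_neg]
  exact h j (by simpa using hj)

lemma WD.sub (h : WD D B H) (h' : WD D B G) : WD D B (H - G) := by
  rw [sub_eq_add_neg]; exact h.add h'.neg

lemma WD.sum {ι : Type*} (s : Finset ι) (F : ι → k[X][X]) (h : ∀ i ∈ s, WD D B (F i)) :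
    WD D B (∑ i ∈ s, F i) := by
  classical
  induction s using Finset.induction_on with
  | empty => simpa using WD.zero
  | insert a s ha ih =>
    rw [Finset.sum_insert ha]
    exact (h a (by simp)).add (ih fun i hi => h i (by simp [hi]))

lemma WD.mul (h : WD D B H) (h' : WD D B' G) : WD D (B + B') (H * G) := by
  intro j hj
  rw [coeff_mul] at hj ⊢
  have key : ∀ x ∈ Finset.HasAntidiagonal.antidiagonal j, (H.coeff x.1 * G.coeff x.2) ≠ 0 →
      (H.coeff x.1 * G.coeff x.2).natDegree + D * j ≤ B + B' := by
    intro x hx hne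
    have h1 := h x.1 (left_ne_zero_of_mul hne)
    have h2 := h' x.2 (right_ne_zero_of_mul hne)
    have h3 := natDegree_mul_le (p := H.coeff x.1) (q := G.coeff x.2)
    have h4 : x.1 + x.2 = j := by simpa using hx
    subst h4
    rw [mul_add]; omega
  obtain ⟨x, hx, hne⟩ := Finset.exists_ne_zero_of_sum_ne_zero hj
  have hDj := key x hx hne
  have : (∑ x ∈ Finset.HasAntidiagonal.antidiagonal j, H.coeff x.1 * G.coeff x.2).natDegree ≤ B + B' - D * j := by
    apply natDegree_sum_le_of_forall_le
    intro x hx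
    by_cases hne : H.coeff x.1 * G.coeff x.2 = 0
    · rw [hne]; simp
    · have := key x hx hne; omega
  omega

lemma WD.C {a : k[X]} (h : a.natDegree ≤ B) : WD D B (C a : k[X][X]) := by
  intro j hj
  rw [coeff_C] at hj ⊢
  split_ifs with h0
  · subst h0; simpa using h
  · simp [h0] at hj

lemma WD.X : WD D D (X : k[X][X]) := by
  intro j hj
  rw [coeff_X] at hj ⊢
  split_ifs with h0
  · subst h0; simp
  · simp [h0] at hj

lemma WD.pow (h : WD D B H) (n : ℕ) : WD D (n * B) (H ^ n) := by
  induction n with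
  | zero => rw [pow_zero, ← C_1]; exact WD.C (by simp)
  | succ n ih => rw [pow_succ, add_mul, one_mul]; exact ih.mul h

lemma WD.of_coeff {d : ℕ} (hd : H.natDegree ≤ d) (h : ∀ j, (H.coeff j).natDegree ≤ B) :
    WD D (B + D * d) H := by
  intro j hj
  have := h j
  have h2 : j ≤ d := (le_natDegree_of_ne_zero hj).trans hd
  have := Nat.mul_le_mul_left D h2
  omega

/-- `f` monic with coefficients of degree `≤ D`. -/
lemma WD.monic {f : k[X][X]} (hf : f.Monic) (h : ∀ j, (f.coeff j).natDegree ≤ D) :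
    WD D (D * f.natDegree) f := by
  intro j hj
  have h2 : j ≤ f.natDegree := le_natDegree_of_ne_zero hj
  rcases h2.eq_or_lt with h2 | h2
  · subst h2; simp [hf.coeff_natDegree]
  · have := h j
    have : D * (j + 1) ≤ D * f.natDegree := Nat.mul_le_mul_left D h2
    rw [mul_add] at this; omega

lemma WD.modByMonic {f : k[X][X]} (hf : f.Monic) (h : ∀ j, (f.coeff j).natDegree ≤ D)
    (hH : WD D B H) : WD D B (H %ₘ f) := by
  induction hn : H.natDegree using Nat.strong_induction_on generalizing H with
  | _ n ih =>
  by_cases hlt : H.degree < f.degree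
  · rwa [(modByMonic_eq_self_iff hf).2 hlt]
  by_cases hH0 : H = 0
  · subst hH0; simpa using hH
  push Not at hlt
  have hnd : f.natDegree ≤ H.natDegree := natDegree_le_natDegree hlt
  have hlc : H.leadingCoeff ≠ 0 := leadingCoeff_ne_zero.2 hH0
  -- subtract
  set T : k[X][X] := f * (Polynomial.C H.leadingCoeff * Polynomial.X ^ (H.natDegree - f.natDegree)) with hT
  have hTW : WD D B T := by
    have h1 := hH H.natDegree (by simpa using hlc)
    rw [coeff_natDegree] at h1
    have h2 : WD D (D * f.natDegree + (H.leadingCoeff.natDegree + (H.natDegree - f.natDegree) * D)) T :=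
      (WD.monic hf h).mul ((WD.C le_rfl).mul (WD.X.pow _))
    refine h2.mono ?_
    obtain ⟨e, he⟩ := Nat.exists_eq_add_of_le hnd
    have : H.natDegree - f.natDegree = e := by omega
    rw [this]
    rw [he] at h1
    rw [mul_add] at h1
    linarith [mul_comm D e]
  have hrem : H %ₘ f = (H - T) %ₘ f := by
    rw [sub_modByMonic, hT, mul_comm f, (modByMonic_eq_zero_iff_dvd hf).2 (dvd_mul_left _ _), sub_zero]
  rw [hrem]
  by_cases h0 : H - T = 0
  · rw [h0]; simpa using WD.zero
  have hdeg := div_wf_lemma ⟨hlt, hH0⟩ hf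
  refine ih (H - T).natDegree ?_ (hH.sub hTW) rfl
  rw [← hn]
  exact natDegree_lt_natDegree h0 hdeg

end

/-- multiplication matrix -/
noncomputable def MM {k : Type*} [Field k] (f H : k[X][X]) : Matrix (Fin f.natDegree) (Fin f.natDegree) k[X] :=
  Matrix.of fun i j => ((X ^ (j : ℕ) * H) %ₘ f).coeff i

noncomputable def NN {k : Type*} [Field k] (f H : k[X][X]) : k[X] := (MM f H).det

section
variable {k : Type*} [Field k] {D B B' : ℕ} {H G f : k[X][X]}

lemma NN_natDegree (hf : f.Monic) (h : ∀ j, (f.coeff j).natDegree ≤ D)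
    (hH : WD D B H) : (NN f H).natDegree ≤ f.natDegree * B := by
  rw [NN, Matrix.det_apply]
  apply natDegree_sum_le_of_forall_le
  intro σ _
  refine (natDegree_smul_le _ _).trans ?_
  by_cases h0 : ∃ i, MM f H (σ i) i = 0
  · obtain ⟨i, hi⟩ := h0
    have h00 : ∏ i, MM f H (σ i) i = 0 := Finset.prod_eq_zero (f := fun i => MM f H (σ i) i) (Finset.mem_univ i) hi
    rw [h00]; simp
  push Not at h0
  refine (natDegree_prod_le _ _).trans ?_
  have key : ∀ i, (MM f H (σ i) i).natDegree + D * (σ i : ℕ) ≤ B + D * (i : ℕ) := by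
    intro i
    have h1 : WD D ((i : ℕ) * D + B) ((X ^ (i : ℕ) * H) %ₘ f) :=
      ((WD.X.pow _).mul hH).modByMonic hf h
    have := h1 (σ i) (h0 i)
    rw [mul_comm D (i : ℕ)]
    simp only [MM, Matrix.of_apply]; omega
  have h2 := Finset.sum_le_sum (fun i (_ : i ∈ Finset.univ) => key i)
  rw [Finset.sum_add_distrib, Finset.sum_add_distrib,
    Equiv.sum_comp σ (fun i => D * (i : ℕ))] at h2
  simp only [Finset.sum_const, Finset.card_univ, Fintype.card_fin, smul_eq_mul] at h2
  omega

lemma NN_ne_zero (hf : f.Monic) (hirr : Irreducible f) (hH : ¬ f ∣ H) : NN f H ≠ 0 := by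
  intro h0
  obtain ⟨v, hv, hv0⟩ := Matrix.exists_mulVec_eq_zero_iff.2 h0
  set V : k[X][X] := ∑ j : Fin f.natDegree, C (v j) * X ^ (j : ℕ) with hV
  have hcoeff : ∀ j : Fin f.natDegree, V.coeff j = v j := by
    intro j
    rw [hV, finsetSum_coeff]
    rw [Finset.sum_eq_single j]
    · simp
    · intro b _ hb
      rw [coeff_C_mul, coeff_X_pow, if_neg, mul_zero]
      intro h; exact hb (Fin.ext h.symm)
    · simp
  have hdvd : f ∣ V * H := by
    rw [← modByMonic_eq_zero_iff_dvd hf]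
    have e : (V * H) %ₘ f = ∑ j : Fin f.natDegree, C (v j) * ((X ^ (j : ℕ) * H) %ₘ f) := by
      rw [hV, Finset.sum_mul]
      have : ∀ s : Finset (Fin f.natDegree), (∑ i ∈ s, C (v i) * X ^ (i : ℕ) * H) %ₘ f
        = ∑ j ∈ s, C (v j) * ((X ^ (j : ℕ) * H) %ₘ f) := by
        intro s
        classical
        induction s using Finset.induction_on with
        | empty => simp
        | insert a s ha ih =>
          rw [Finset.sum_insert ha, Finset.sum_insert ha, add_modByMonic, ih, mul_assoc,
            ← smul_eq_C_mul, smul_modByMonic, smul_eq_C_mul]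
      exact this _
    rw [e]
    ext1 i
    rw [finsetSum_coeff, coeff_zero]
    by_cases hi : i < f.natDegree
    · have := congrFun hv0 ⟨i, hi⟩
      simp only [Matrix.mulVec, dotProduct, MM, Matrix.of_apply, Pi.zero_apply] at this
      rw [← this]
      refine Finset.sum_congr rfl fun j _ => ?_
      rw [coeff_C_mul, mul_comm]
    · refine Finset.sum_eq_zero fun j _ => ?_
      rw [coeff_C_mul, coeff_eq_zero_of_degree_lt, mul_zero]
      refine (degree_modByMonic_lt _ hf).trans_le ?_
      rw [degree_eq_natDegree hf.ne_zero]
      exact_mod_cast not_lt.1 hi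
  rcases hirr.prime.dvd_or_dvd hdvd with h1 | h1
  · apply hv
    have hVdeg : V.degree < f.degree := by
      rw [degree_eq_natDegree hf.ne_zero, degree_lt_iff_coeff_zero]
      intro m hm
      rw [hV, finsetSum_coeff]
      refine Finset.sum_eq_zero fun j _ => ?_
      rw [coeff_C_mul, coeff_X_pow, if_neg, mul_zero]
      have := j.2
      omega
    have := eq_zero_of_dvd_of_degree_lt h1 hVdeg
    funext j
    rw [← hcoeff j, this]; simp
  · exact hH h1

/-- evaluation of columns at a root -/
lemma MM_vec {S : Type*} [CommRing S] (φ : k[X] →+* S) (hf : f.Monic) (y : S)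
    (hy : eval₂ φ y f = 0) (H : k[X][X]) (j : Fin f.natDegree) :
    ∑ i : Fin f.natDegree, y ^ (i : ℕ) * φ (MM f H i j) = y ^ (j : ℕ) * eval₂ φ y H := by
  have h1 : eval₂ φ y ((X ^ (j : ℕ) * H) %ₘ f) = y ^ (j : ℕ) * eval₂ φ y H := by
    have := congrArg (eval₂ φ y) (modByMonic_add_div (X ^ (j : ℕ) * H) f)
    rw [eval₂_add, eval₂_mul, hy, zero_mul, add_zero] at this
    rw [this, eval₂_mul, eval₂_X_pow]
  rw [← h1]
  have hlt : ((X ^ (j : ℕ) * H) %ₘ f).natDegree < f.natDegree := by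
    apply natDegree_modByMonic_lt _ hf
    rintro rfl
    exact absurd j.2 (by simp)
  rw [eval₂_eq_sum_range' φ hlt, Finset.sum_range]
  refine Finset.sum_congr rfl fun i _ => ?_
  simp only [MM, Matrix.of_apply]; ring

lemma NN_dvd {S : Type*} [CommRing S] (φ : k[X] →+* S) (hf : f.Monic) (hd : 0 < f.natDegree) (y : S)
    (hy : eval₂ φ y f = 0) (H : k[X][X]) : eval₂ φ y H ∣ φ (NN f H) := by
  rw [NN, RingHom.map_det]
  set M' : Matrix _ _ S := φ.mapMatrix (MM f H) with hM'
  have hv : Matrix.vecMul (fun i : Fin f.natDegree => y ^ (i : ℕ)) M' =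
      eval₂ φ y H • (fun i : Fin f.natDegree => y ^ (i : ℕ)) := by
    funext j
    simp only [Matrix.vecMul, dotProduct, Pi.smul_apply, smul_eq_mul, hM', RingHom.mapMatrix_apply,
      Matrix.map_apply]
    rw [MM_vec φ hf y hy H j, mul_comm]
  have h2 := congrArg (fun v => Matrix.vecMul v M'.adjugate) hv
  simp only [Matrix.vecMul_vecMul, Matrix.mul_adjugate, Matrix.smul_vecMul] at h2
  have h3 := congrFun h2 ⟨0, hd⟩
  simp only [Matrix.vecMul_smul, Matrix.vecMul_one, Pi.smul_apply, smul_eq_mul, pow_zero, mul_one] at h3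
  exact ⟨_, h3⟩

lemma NN_prod {S : Type*} [CommRing S] [IsDomain S] (φ : k[X] →+* S) (hf : f.Monic)
    (y : Fin f.natDegree → S) (hinj : Function.Injective y)
    (hy : ∀ s, eval₂ φ (y s) f = 0) (H : k[X][X]) : φ (NN f H) = ∏ s, eval₂ φ (y s) H := by
  rw [NN, RingHom.map_det]
  set M' : Matrix _ _ S := φ.mapMatrix (MM f H) with hM'
  have hv : Matrix.vandermonde y * M' = Matrix.diagonal (fun s => eval₂ φ (y s) H) * Matrix.vandermonde y := by
    ext s j
    rw [Matrix.diagonal_mul, Matrix.mul_apply]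
    simp only [Matrix.vandermonde_apply, hM', RingHom.mapMatrix_apply, Matrix.map_apply]
    rw [MM_vec φ hf (y s) (hy s) H j, mul_comm]
  have h2 := congrArg Matrix.det hv
  rw [Matrix.det_mul, Matrix.det_mul, Matrix.det_diagonal, mul_comm] at h2
  exact mul_right_cancel₀ (Matrix.det_vandermonde_ne_zero_iff.2 hinj) h2

end

end Stp
end

section
open Polynomial

namespace Stp

section
variable {k : Type*} [Field k]

/-- derivative in the inner variable -/
noncomputable def dx : Derivation k k[X][X] k[X][X] :=
  ((PolynomialModule.equivPolynomialSelf (R := k[X])).compDer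
    (Derivation.mapCoeffs (Polynomial.derivative' (R := k))) : Derivation k k[X][X] k[X][X])

lemma dx_coeff (H : k[X][X]) (i : ℕ) : (dx H).coeff i = derivative (H.coeff i) := rfl

lemma dx_C (a : k[X]) : dx (C a : k[X][X]) = C (derivative a) := by
  ext1 i
  rw [dx_coeff, coeff_C, coeff_C]
  split_ifs <;> simp

lemma dx_X : dx (X : k[X][X]) = 0 := by
  ext1 i
  rw [dx_coeff, coeff_X]
  split_ifs <;> simp

/-- outer derivative as a `k`-derivation -/
noncomputable def dy : Derivation k k[X][X] k[X][X] :=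
  (Polynomial.derivative' (R := k[X])).restrictScalars k

lemma dy_apply (H : k[X][X]) : dy H = derivative H := rfl

noncomputable def DD (f : k[X][X]) : Derivation k k[X][X] k[X][X] := dy f • dx - dx f • dy

lemma DD_apply (f H : k[X][X]) : DD f H = dy f * dx H - dx f * dy H := rfl

lemma WD.dx {D B : ℕ} {H : k[X][X]} (h : WD D B H) : WD D B (dx H) := by
  intro j hj
  rw [dx_coeff] at hj ⊢
  have := h j (by intro h0; simp [h0] at hj)
  have := natDegree_derivative_le (H.coeff j)
  omega

lemma WD.dy {D B : ℕ} {H : k[X][X]} (h : WD D B H) : WD D B (dy H) := by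
  intro j hj
  rw [dy_apply, coeff_derivative] at hj ⊢
  have h1 := h (j + 1) (left_ne_zero_of_mul hj)
  have h2 : (H.coeff (j + 1) * ((j : k[X]) + 1)).natDegree ≤ (H.coeff (j + 1)).natDegree := by
    have : ((j : k[X]) + 1) = Polynomial.C ((j : k) + 1) := by simp
    rw [this]
    exact natDegree_mul_C_le _ _
  rw [mul_add] at h1
  omega

lemma WD.DD {D B E : ℕ} {f H : k[X][X]} (hf : WD D E f) (h : WD D B H) : WD D (B + E) (DD f H) := by
  rw [DD_apply, add_comm B]
  exact (hf.dy.mul h.dx).sub (hf.dx.mul h.dy)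

lemma WD.DD_iter {D B E : ℕ} {f H : k[X][X]} (hf : WD D E f) (h : WD D B H) (m : ℕ) :
    WD D (B + m * E) ((Stp.DD f)^[m] H) := by
  induction m with
  | zero => simpa using h
  | succ m ih =>
    rw [Function.iterate_succ_apply', add_mul, one_mul, ← add_assoc]
    exact WD.DD hf ih

/-- Taylor expansion -/
noncomputable def tau (x0 : k) : k[X] →+* PowerSeries k :=
  eval₂RingHom (PowerSeries.C) (PowerSeries.C x0 + PowerSeries.X)

lemma tau_C (x0 a : k) : tau x0 (C a) = PowerSeries.C a := by simp [tau]
lemma tau_X (x0 : k) : tau x0 X = PowerSeries.C x0 + PowerSeries.X := by simp [tau]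

lemma tau_const (x0 : k) (a : k[X]) : PowerSeries.constantCoeff (tau x0 a) = a.eval x0 := by
  have : (PowerSeries.constantCoeff.comp (tau x0)) = evalRingHom x0 := by
    apply Polynomial.ringHom_ext
    · intro b; simp [tau_C]
    · simp [tau_X]
  exact congrArg (fun g => g a) this

lemma tau_taylor (x0 : k) (a : k[X]) : tau x0 a = ((taylor x0 a : k[X]) : PowerSeries k) := by
  have : tau x0 = (Polynomial.coeToPowerSeries.ringHom).comp (taylorAlgHom x0 : k[X] →ₐ[k] k[X]).toRingHom := by
    apply Polynomial.ringHom_ext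
    · intro b; simp [tau_C]
    · simp [tau_X, add_comm]
  exact congrArg (fun g => g a) this

lemma tau_dvd {x0 : k} {a : k[X]} {e : ℕ} (h : PowerSeries.X ^ e ∣ tau x0 a) : (X - C x0) ^ e ∣ a := by
  rw [PowerSeries.X_pow_dvd_iff] at h
  have h2 : X ^ e ∣ taylor x0 a := by
    rw [X_pow_dvd_iff]
    intro d hd
    have := h d hd
    rwa [tau_taylor, Polynomial.coeff_coe] at this
  obtain ⟨q, hq⟩ := h2
  have h3 : a = taylor (-x0) (taylor x0 a) := by rw [taylor_taylor]; simp
  rw [h3, hq, taylor_mul, taylor_pow, taylor_X]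
  have h4 : (X + C (-x0) : k[X]) = X - C x0 := by simp [sub_eq_add_neg]
  rw [h4]; exact dvd_mul_right _ _

lemma tau_deriv (x0 : k) (a : k[X]) : PowerSeries.derivative k (tau x0 a) = tau x0 (derivative a) := by
  rw [tau_taylor, tau_taylor, PowerSeries.derivative_coe]
  congr 1
  simp [taylor_apply, derivative_comp]

noncomputable def ev (x0 : k) (y : PowerSeries k) : k[X][X] →+* PowerSeries k := eval₂RingHom (tau x0) y

lemma ev_apply (x0 : k) (y : PowerSeries k) (H : k[X][X]) : ev x0 y H = eval₂ (tau x0) y H := rfl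

lemma ev_chain (x0 : k) (y : PowerSeries k) (H : k[X][X]) :
    PowerSeries.derivative k (ev x0 y H) = ev x0 y (dx H) + ev x0 y (dy H) * PowerSeries.derivative k y := by
  induction H using Polynomial.induction_on' with
  | add p q hp hq => simp only [map_add, hp, hq]; ring
  | monomial n a =>
    rw [← C_mul_X_pow_eq_monomial]
    simp only [Derivation.leibniz, Derivation.leibniz_pow, dx_C, dx_X, map_mul, map_add, map_pow, smul_eq_mul,
      nsmul_eq_mul, ev_apply, eval₂_C, eval₂_X, eval₂_add, eval₂_mul, eval₂_pow, tau_deriv, dy_apply, derivative_C,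
      derivative_X, mul_zero, eval₂_zero, eval₂_natCast, eval₂_one, mul_one]
    ring

lemma ev_DD {x0 : k} {y : PowerSeries k} {f : k[X][X]} (hy : ev x0 y f = 0) (H : k[X][X]) :
    ev x0 y (DD f H) = ev x0 y (dy f) * PowerSeries.derivative k (ev x0 y H) := by
  have h1 := ev_chain x0 y f
  rw [hy, map_zero] at h1
  rw [ev_chain, DD_apply, map_sub, map_mul, map_mul]
  linear_combination (ev x0 y (dy H)) * h1

lemma ev_DD_iter {x0 : k} {y : PowerSeries k} {f : k[X][X]} (hy : ev x0 y f = 0) (H : k[X][X]) (m : ℕ) :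
    ev x0 y ((DD f)^[m] H) =
      (fun s => ev x0 y (dy f) * PowerSeries.derivative k s)^[m] (ev x0 y H) := by
  induction m with
  | zero => rfl
  | succ m ih => rw [Function.iterate_succ_apply', Function.iterate_succ_apply', ev_DD hy, ih]

lemma order_of_iter (p : ℕ) [hp : Fact p.Prime] [CharP k p] (u : PowerSeries k) (hu : IsUnit u) (M : ℕ) (hM : M ≤ p)
    (s : PowerSeries k)
    (h : ∀ m < M, PowerSeries.constantCoeff ((fun s => u * PowerSeries.derivative k s)^[m] s) = 0) :
    PowerSeries.X ^ M ∣ s := by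
  induction M generalizing s with
  | zero => simp
  | succ M ih =>
    have h1 := ih (by omega) (u * PowerSeries.derivative k s) (fun m hm => by
      have := h (m + 1) (by omega)
      rwa [Function.iterate_succ_apply] at this)
    rw [hu.dvd_mul_left, PowerSeries.X_pow_dvd_iff] at h1
    rw [PowerSeries.X_pow_dvd_iff]
    intro n hn
    rcases n with _ | n
    · simpa using h 0 (by omega)
    · have := h1 n (by omega)
      rw [PowerSeries.coeff_derivative] at this
      rcases mul_eq_zero.1 this with h2 | h2
      · exact h2
      · exfalso
        have h3 : ((n + 1 : ℕ) : k) = 0 := by exact_mod_cast h2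
        rw [CharP.cast_eq_zero_iff k p] at h3
        have := Nat.le_of_dvd (by omega) h3
        omega

lemma DD_pow_p (p : ℕ) [CharP k p] (f G : k[X][X]) : DD f (G ^ p) = 0 := by
  rw [Derivation.leibniz_pow]
  have : ((p : ℕ) : k[X][X]) = 0 := by
    have : ((p : ℕ) : k[X][X]) = C (C (p : k)) := by simp
    rw [this]; simp
  rw [nsmul_eq_mul, this, zero_mul]

lemma DD_iter_mul_pow (p : ℕ) [CharP k p] (f G H : k[X][X]) (m : ℕ) :
    (DD f)^[m] (H * G ^ p) = (DD f)^[m] H * G ^ p := by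
  induction m with
  | zero => rfl
  | succ m ih =>
    rw [Function.iterate_succ_apply', ih, Function.iterate_succ_apply', Derivation.leibniz, DD_pow_p, smul_zero,
      zero_add, smul_eq_mul, mul_comm]

lemma DD_iter_sum {ι : Type*} (s : Finset ι) (F : ι → k[X][X]) (f : k[X][X]) (m : ℕ) :
    (DD f)^[m] (∑ i ∈ s, F i) = ∑ i ∈ s, (DD f)^[m] (F i) := by
  induction m with
  | zero => rfl
  | succ m ih => simp only [Function.iterate_succ_apply', ih, map_sum]

lemma DD_iter_smul (c : k) (f H : k[X][X]) (m : ℕ) :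
    (DD f)^[m] (c • H) = c • (DD f)^[m] H := by
  induction m with
  | zero => rfl
  | succ m ih => simp only [Function.iterate_succ_apply', ih, Derivation.map_smul]

lemma ev_const (x0 : k) (H : k[X][X]) (y : PowerSeries k) : PowerSeries.constantCoeff (ev x0 y H) =
      (H.map (evalRingHom x0)).eval (PowerSeries.constantCoeff y) := by
  rw [ev_apply, hom_eval₂, eval_map]
  congr 1
  apply Polynomial.ringHom_ext
  · intro b; simp [tau_C]
  · simp [tau_X]

/-- Hensel -/
lemma exists_branch {f : k[X][X]} (hf : f.Monic) (x0 y0 : k) (h0 : (f.map (evalRingHom x0)).eval y0 = 0)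
    (h1 : (f.map (evalRingHom x0)).derivative.eval y0 ≠ 0) :
    ∃ y : PowerSeries k, ev x0 y f = 0 ∧ PowerSeries.constantCoeff y = y0 ∧ IsUnit (ev x0 y (dy f)) := by
  have hmem : ∀ s : PowerSeries k, s ∈ (Ideal.span {PowerSeries.X} : Ideal (PowerSeries k)) ↔
      PowerSeries.constantCoeff s = 0 := by
    intro s
    rw [Ideal.mem_span_singleton, PowerSeries.X_dvd_iff]
  have hu : ∀ s : PowerSeries k, PowerSeries.constantCoeff s ≠ 0 → IsUnit s := by
    intro s hs
    rw [PowerSeries.isUnit_iff_constantCoeff]; exact hs.isUnit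
  obtain ⟨y, hy, hy2⟩ := HenselianRing.is_henselian (I := (Ideal.span {PowerSeries.X} : Ideal (PowerSeries k)))
    (f.map (tau x0)) (hf.map _) (PowerSeries.C y0) (by
      rw [eval_map, ← ev_apply, hmem, ev_const]; simpa using h0) (by
      apply IsUnit.map
      apply hu
      rw [derivative_map, eval_map, ← ev_apply, ev_const, ← derivative_map]
      simpa using h1)
  have hyc : PowerSeries.constantCoeff y = y0 := by
    rw [hmem, map_sub, sub_eq_zero] at hy2
    simpa using hy2
  refine ⟨y, ?_, hyc, ?_⟩
  · rw [ev_apply, ← eval_map]; exact hy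
  · apply hu
    rw [ev_const, dy_apply, ← derivative_map, hyc]; exact h1

end
end Stp
end

section
open Polynomial

namespace Stp

section
variable {k : Type*} [Field k]

noncomputable def e2 (x0 y0 : k) : k[X][X] →+* k := eval₂RingHom (evalRingHom x0) y0

lemma e2_apply (x0 y0 : k) (H : k[X][X]) : e2 x0 y0 H = eval₂ (evalRingHom x0) y0 H := rfl
lemma e2_C (x0 y0 : k) (a : k[X]) : e2 x0 y0 (C a) = a.eval x0 := by simp [e2]
lemma e2_X (x0 y0 : k) : e2 x0 y0 X = y0 := by simp [e2]

lemma e2_ev (x0 : k) (y : PowerSeries k) (H : k[X][X]) :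
    PowerSeries.constantCoeff (ev x0 y H) = e2 x0 (PowerSeries.constantCoeff y) H := by
  rw [ev_const, e2_apply, eval_map]

lemma low_deg {D B : ℕ} {f H : k[X][X]} (hf : f.Monic) (hirr : Irreducible f) (hd : 0 < f.natDegree)
    (hD : ∀ j, (f.coeff j).natDegree ≤ D) (hH : WD D B H) (hdeg : H.degree < f.degree)
    {x0 : k} {y : PowerSeries k} (hy : ev x0 y f = 0) {e : ℕ} (he : f.natDegree * B < e)
    (hdvd : PowerSeries.X ^ e ∣ ev x0 y H) : H = 0 := by
  by_contra h0
  have h1 : ¬ f ∣ H := fun h => absurd (degree_le_of_dvd h h0) (not_le.2 hdeg)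
  have h2 := NN_ne_zero hf hirr h1
  have h3 := NN_dvd (tau x0) hf hd y hy H
  have h4 := tau_dvd (hdvd.trans h3)
  have h5 := natDegree_le_of_dvd h4 h2
  rw [natDegree_pow, natDegree_X_sub_C, mul_one] at h5
  have h6 := NN_natDegree hf hD hH
  omega

/-- shift of a power series -/
noncomputable def sh (N : ℕ) (G : PowerSeries k) : PowerSeries k :=
  PowerSeries.mk fun n => PowerSeries.coeff (n + N) G

lemma sh_zero (G : PowerSeries k) : sh 0 G = G := by ext n; simp [sh]

lemma sh_succ (N : ℕ) (G : PowerSeries k) :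
    sh N G = PowerSeries.C (PowerSeries.coeff N G) + PowerSeries.X * sh (N + 1) G := by
  ext n
  rcases n with _ | n
  · simp [sh]
  · rw [map_add, PowerSeries.coeff_succ_X_mul, PowerSeries.coeff_C]
    simp [sh, add_assoc, add_comm 1 N]

lemma sh_pow (p : ℕ) [Fact p.Prime] [CharP k p] (N : ℕ) (G : PowerSeries k) :
    (sh N G) ^ p = PowerSeries.C ((PowerSeries.coeff N G) ^ p) + PowerSeries.X ^ p * (sh (N + 1) G) ^ p := by
  haveI : CharP (PowerSeries k) p := charP_of_injective_ringHom (PowerSeries.C_injective) p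
  rw [sh_succ, add_pow_char, mul_pow, map_pow]

lemma mono_deg {d A : ℕ} (hd : 0 < d) (c : Fin A × Fin d → k) :
    (∑ ab, C (C (c ab) * X ^ (ab.1 : ℕ)) * X ^ (ab.2 : ℕ) : k[X][X]).degree < d := by
  refine lt_of_le_of_lt (degree_sum_le _ _) ?_
  rw [Finset.sup_lt_iff (by simp)]
  intro i _
  refine lt_of_le_of_lt (degree_C_mul_X_pow_le _ _) ?_
  exact_mod_cast i.2.2

lemma mono_coeff {d A : ℕ} (c : Fin A × Fin d → k) (a : Fin A) (b : Fin d) :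
    ((∑ ab, C (C (c ab) * X ^ (ab.1 : ℕ)) * X ^ (ab.2 : ℕ) : k[X][X]).coeff b).coeff a = c (a, b) := by
  rw [finsetSum_coeff, finsetSum_coeff, Finset.sum_eq_single (a, b)]
  · rw [coeff_C_mul_X_pow, if_pos rfl, coeff_C_mul_X_pow, if_pos rfl]
  · rintro ⟨a', b'⟩ _ hne
    rw [coeff_C_mul_X_pow]
    split_ifs with h
    · rw [coeff_C_mul_X_pow, if_neg]
      intro h'
      exact hne (Prod.ext (Fin.ext h'.symm) (Fin.ext h.symm))
    · simp
  · simp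

lemma mono_WD {D d A : ℕ} (c : Fin A × Fin d → k) :
    WD D (A + d * D) (∑ ab, C (C (c ab) * X ^ (ab.1 : ℕ)) * X ^ (ab.2 : ℕ) : k[X][X]) := by
  apply WD.sum
  intro i _
  refine (WD.mul (WD.C (B := i.1) (natDegree_C_mul_X_pow_le _ _)) (WD.X.pow _)).mono ?_
  have := Nat.mul_le_mul_right D i.2.2.le
  have := i.1.2
  omega

/-- nonvanishing -/
lemma nonvan (p : ℕ) [Fact p.Prime] [CharP k p] [IsAlgClosed k] {D d A J : ℕ} {f : k[X][X]} (hf : f.Monic)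
    (hirr : Irreducible f) (hfd : f.natDegree = d) (hd : 0 < d)
    (hD : ∀ j, (f.coeff j).natDegree ≤ D) (hp : d * (A + d * D) < p)
    (c : Fin J × Fin d → Fin A × Fin d → k)
    {x0 : k} {y : PowerSeries k} (hy : ev x0 y f = 0)
    (h : ∑ i, ev x0 y (∑ ab, C (C (c i ab) * X ^ (ab.1 : ℕ)) * X ^ (ab.2 : ℕ)) *
      (ev x0 y (C (X ^ (i.1 : ℕ)) * X ^ (i.2 : ℕ))) ^ p = 0) : c = 0 := by
  set G : Fin J × Fin d → PowerSeries k := fun i => ev x0 y (C (X ^ (i.1 : ℕ)) * X ^ (i.2 : ℕ)) with hG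
  set ff : (Fin A × Fin d → k) → k[X][X] := fun c => ∑ ab, C (C (c ab) * X ^ (ab.1 : ℕ)) * X ^ (ab.2 : ℕ) with hff
  have hfdeg : f.degree = d := by rw [degree_eq_natDegree hf.ne_zero, hfd]
  set FN : ℕ → Fin A × Fin d → k := fun N ab => ∑ i, (PowerSeries.coeff N (G i)) ^ p * c i ab with hFN
  have hevF : ∀ N, ev x0 y (ff (FN N)) = ∑ i, ev x0 y (ff (c i)) * PowerSeries.C ((PowerSeries.coeff N (G i)) ^ p) := by
    intro N
    have : ff (FN N) = ∑ i, ff (c i) * C (C ((PowerSeries.coeff N (G i)) ^ p)) := by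
      simp only [hff, hFN]
      simp only [Finset.sum_mul]
      rw [Finset.sum_comm]
      refine Finset.sum_congr rfl fun ab _ => ?_
      rw [map_sum, Finset.sum_mul, map_sum, Finset.sum_mul]
      refine Finset.sum_congr rfl fun i _ => ?_
      simp only [map_mul]; ring
    rw [this, map_sum]
    refine Finset.sum_congr rfl fun i _ => ?_
    rw [map_mul]
    congr 1
    rw [ev_apply, eval₂_C, tau_C]
  have step : ∀ N, ∑ i, ev x0 y (ff (c i)) * (sh N (G i)) ^ p = 0 →
      FN N = 0 ∧ ∑ i, ev x0 y (ff (c i)) * (sh (N + 1) (G i)) ^ p = 0 := by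
    intro N hN
    have e1 : ev x0 y (ff (FN N)) + PowerSeries.X ^ p * ∑ i, ev x0 y (ff (c i)) * (sh (N + 1) (G i)) ^ p = 0 := by
      rw [hevF, Finset.mul_sum, ← Finset.sum_add_distrib, ← hN]
      refine Finset.sum_congr rfl fun i _ => ?_
      rw [sh_pow p N]; ring
    have e2 : ff (FN N) = 0 := by
      refine low_deg hf hirr (by omega) hD (B := A + d * D) (mono_WD _) (by rw [hfdeg]; exact mono_deg hd _) hy
        (e := p) (by rw [hfd]; exact hp) ?_
      rw [eq_neg_of_add_eq_zero_left e1]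
      exact (Dvd.intro _ rfl).neg_right
    refine ⟨?_, ?_⟩
    · funext ab
      have := mono_coeff (FN N) ab.1 ab.2
      change ((ff (FN N)).coeff _).coeff _ = _ at this
      rw [e2] at this
      simpa using this.symm
    · rw [e2, map_zero, zero_add] at e1
      exact (mul_eq_zero.1 e1).resolve_left (pow_ne_zero _ PowerSeries.X_ne_zero)
  have all : ∀ N, ∑ i, ev x0 y (ff (c i)) * (sh N (G i)) ^ p = 0 := by
    intro N
    induction N with
    | zero => simpa only [sh_zero] using h
    | succ N ih => exact (step N ih).2
  funext i ab
  have hroot : ∀ i, ∃ e : k, e ^ p = c i ab := fun i =>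
    IsAlgClosed.exists_pow_nat_eq _ (Fact.out : p.Prime).pos
  choose e he using hroot
  have hser : ∑ i, PowerSeries.C (e i) * G i = 0 := by
    ext N
    have h1 := congrFun (step N (all N)).1 ab
    simp only [hFN, Pi.zero_apply] at h1
    rw [map_sum, map_zero]
    simp only [PowerSeries.coeff_C_mul]
    have h2 : (∑ i, e i * PowerSeries.coeff N (G i)) ^ p = 0 := by
      rw [sum_pow_char, ← h1]
      refine Finset.sum_congr rfl fun i _ => ?_
      rw [mul_pow, he, mul_comm]
    exact pow_eq_zero_iff (Fact.out : p.Prime).ne_zero |>.1 h2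
  have hE : (∑ i, C (C (e i) * X ^ (i.1 : ℕ)) * X ^ (i.2 : ℕ) : k[X][X]) = 0 := by
    refine low_deg hf hirr (by omega) hD (B := J + d * D) (mono_WD _) (by rw [hfdeg]; exact mono_deg hd _) hy
        (e := f.natDegree * (J + d * D) + 1) (Nat.lt_succ_self _) ?_
    convert dvd_zero _
    rw [← hser, map_sum]
    refine Finset.sum_congr rfl fun i _ => ?_
    rw [hG, map_mul C, mul_assoc, map_mul (ev x0 y)]
    congr 1
    rw [ev_apply, eval₂_C, tau_C]
  have h3 := mono_coeff e i.1 i.2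
  rw [hE] at h3
  rw [← he i, ← Prod.mk.eta (p := i), ← h3]
  simp [(Fact.out : p.Prime).ne_zero]

end
end Stp
end

section
open Polynomial

namespace Stp

section
variable {k : Type*} [Field k]

/-- linear algebra: nontrivial relation -/
lemma exists_rel {ι κ : Type*} [Fintype ι] [Fintype κ] (h : Fintype.card κ < Fintype.card ι)
    (v : ι → κ → k) : ∃ c : ι → k, c ≠ 0 ∧ ∀ t, ∑ i, c i * v i t = 0 := by
  have h1 : ¬ LinearIndependent k v := by
    intro hl
    have := hl.fintype_card_le_finrank
    rw [Module.finrank_fintype_fun_eq_card] at this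
    omega
  rw [Fintype.not_linearIndependent_iff] at h1
  obtain ⟨g, hg, i, hi⟩ := h1
  refine ⟨g, fun h => hi (by simp [h]), fun t => ?_⟩
  have := congrFun hg t
  simpa using this

lemma sum_mod {ι : Type*} (s : Finset ι) (f : k[X][X]) (c : ι → k) (H : ι → k[X][X]) :
    (∑ i ∈ s, C (C (c i)) * H i) %ₘ f = ∑ i ∈ s, C (C (c i)) * (H i %ₘ f) := by
  classical
  induction s using Finset.induction_on with
  | empty => simp
  | insert a s ha ih =>
    rw [Finset.sum_insert ha, Finset.sum_insert ha, add_modByMonic, ih, ← smul_eq_C_mul, smul_modByMonic,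
      smul_eq_C_mul]

lemma wd_coeff_zero {D B : ℕ} {f H : k[X][X]} (hf : f.Monic) (hd : 0 < f.natDegree)
    (hD : ∀ j, (f.coeff j).natDegree ≤ D) (hH : WD D B H)
    (h0 : ∀ i < f.natDegree, ∀ e ≤ B, ((H %ₘ f).coeff i).coeff e = 0) : f ∣ H := by
  rw [← modByMonic_eq_zero_iff_dvd hf]
  have h1 := WD.modByMonic hf hD hH
  ext i e
  rw [coeff_zero, coeff_zero]
  by_cases hi : i < f.natDegree
  · by_cases he : e ≤ B
    · exact h0 i hi e he
    · by_contra hne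
      have h2 : (H %ₘ f).coeff i ≠ 0 := by intro h; rw [h] at hne; simp at hne
      have h3 := h1 i h2
      have h4 := le_natDegree_of_ne_zero hne
      omega
  · have := natDegree_modByMonic_lt H hf (by rintro rfl; simp at hd)
    rw [coeff_eq_zero_of_natDegree_lt (p := H %ₘ f) (n := i) (by omega), coeff_zero]

/-- `Σ_j F_j Z^j - Σ_j F_j P^j` factorization -/
lemma factor {R : Type*} [CommRing R] (d : ℕ) (F : ℕ → R) (z P : R) :
    ∑ j ∈ Finset.range (d + 1), F j * z ^ j - ∑ j ∈ Finset.range (d + 1), F j * P ^ j =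
      (z - P) * ∑ l ∈ Finset.range d, (∑ j ∈ Finset.Ico (l + 1) (d + 1), F j * P ^ (j - l - 1)) * z ^ l := by
  have h1 : ∀ j, z ^ j - P ^ j = (z - P) * ∑ l ∈ Finset.range j, z ^ l * P ^ (j - 1 - l) := by
    intro j
    rw [mul_comm, (Commute.all z P).geom_sum₂_mul]
  rw [← Finset.sum_sub_distrib]
  have h2 : ∀ j ∈ Finset.range (d + 1), F j * z ^ j - F j * P ^ j =
      (z - P) * ∑ l ∈ Finset.range j, F j * P ^ (j - l - 1) * z ^ l := by
    intro j _
    rw [← mul_sub, h1, mul_left_comm, Finset.mul_sum]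
    congr 1
    refine Finset.sum_congr rfl fun l _ => ?_
    rw [show j - 1 - l = j - l - 1 by omega]; ring
  rw [Finset.sum_congr rfl h2, ← Finset.mul_sum]
  congr 1
  simp only [Finset.sum_mul]
  rw [Finset.sum_sigma', Finset.sum_sigma']
  refine Finset.sum_bij' (fun x _ => ⟨x.2, x.1⟩) (fun x _ => ⟨x.2, x.1⟩) ?_ ?_ ?_ ?_ ?_ <;>
    simp <;> intros <;> omega

/-- number of F_p points -/
lemma exists_Fp (p : ℕ) [Fact p.Prime] [CharP k p] : ∃ S : Finset k, S.card = p ∧ ∀ x ∈ S, x ^ p = x := by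
  classical
  refine ⟨Finset.univ.image (ZMod.castHom (dvd_refl p) k), ?_, ?_⟩
  · rw [Finset.card_image_of_injective _ (ZMod.castHom_injective k), Finset.card_univ, ZMod.card]
  · intro x hx
    obtain ⟨a, _, rfl⟩ := Finset.mem_image.1 hx
    rw [← map_pow, ZMod.pow_card]

/-- good points have `d` branches -/
lemma branches [IsAlgClosed k] {f : k[X][X]} (hf : f.Monic) (hd : 0 < f.natDegree) {x0 : k}
    (h : (NN f (dy f)).eval x0 ≠ 0) :
    ∃ y : Fin f.natDegree → PowerSeries k, Function.Injective y ∧ ∀ s, ev x0 (y s) f = 0 ∧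
      IsUnit (ev x0 (y s) (dy f)) := by
  classical
  set g := f.map (evalRingHom x0) with hg
  have hgm : g.Monic := hf.map _
  have hgd : g.natDegree = f.natDegree := hf.natDegree_map _
  have hsimple : ∀ y0, g.eval y0 = 0 → g.derivative.eval y0 ≠ 0 := by
    intro y0 h0 h1
    apply h
    have := NN_dvd (evalRingHom x0) hf hd y0 (by rw [← eval_map]; exact h0) (dy f)
    rw [dy_apply, ← eval_map, ← derivative_map, h1, zero_dvd_iff] at this
    exact this
  have hnodup : g.roots.Nodup := by
    rw [Multiset.nodup_iff_count_le_one]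
    intro a
    rw [count_roots]
    by_contra hc
    push Not at hc
    have := (one_lt_rootMultiplicity_iff_isRoot hgm.ne_zero).1 hc
    exact hsimple a this.1 this.2
  have hcard : g.roots.toFinset.card = f.natDegree := by
    rw [Multiset.toFinset_card_of_nodup hnodup, ← hgd]
    exact (IsAlgClosed.splits g).natDegree_eq_card_roots.symm
  let e := (Finset.equivFinOfCardEq hcard).symm
  have hroot : ∀ s, g.eval (e s : k) = 0 := by
    intro s
    have := (e s).2
    rw [Multiset.mem_toFinset, mem_roots hgm.ne_zero] at this
    exact this
  have hb := fun s => exists_branch hf x0 (e s : k) (hroot s) (hsimple _ (hroot s))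
  choose y hy1 hy2 hy3 using hb
  refine ⟨y, fun s t hst => ?_, fun s => ⟨hy1 s, hy3 s⟩⟩
  have := congrArg PowerSeries.constantCoeff hst
  rw [hy2, hy2] at this
  exact e.injective (Subtype.ext this)

end
end Stp
end

section
open Polynomial

namespace Stp

section
variable {k : Type*} [Field k]

noncomputable def gl (d : ℕ) (F : ℕ → k[X]) (P : k[X][X]) (l : ℕ) : k[X][X] :=
  ∑ j ∈ Finset.Ico (l + 1) (d + 1), C (F j) * P ^ (j - l - 1)

lemma gl_WD {d D c0 : ℕ} {F : ℕ → k[X]} {P : k[X][X]} (hF : ∀ j, (F j).natDegree ≤ c0) (hP : WD D c0 P) (hdD : d ≤ D)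
    (l : ℕ) : WD D (c0 + D * c0) (gl d F P l) := by
  apply WD.sum
  intro j hj
  rw [Finset.mem_Ico] at hj
  refine (WD.mul (WD.C (hF j)) (hP.pow _)).mono ?_
  have := Nat.mul_le_mul_right c0 (show j - l - 1 ≤ D by omega)
  omega

/-- auxiliary coefficients -/
lemma aux_coeffs {D d A J M B c0 c1 : ℕ} {f : k[X][X]} (hf : f.Monic) (hfd : f.natDegree = d) (hd : 0 < d) (hdD : d ≤ D)
    (hD : ∀ j, (f.coeff j).natDegree ≤ D) (Δ : k[X]) (hΔ : Δ.natDegree ≤ D) (g : ℕ → k[X][X])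
    (hg : ∀ l, WD D c0 (g l)) (hc1 : c1 = D * D + M * (D * D) + D * D + c0) (hB : B = A + J + c1)
    (hcount : M * ((d - 1) * (d * (B + 1))) < (J * d) * (A * d)) :
    ∃ c : (Fin J × Fin d) × (Fin A × Fin d) → k, c ≠ 0 ∧ ∀ m < M, ∀ l < d - 1,
      f ∣ C (Δ ^ (d - 1 - l)) * (∑ i, C (C (c i)) * (if (i.1.2 : ℕ) = l then
            (DD f)^[m] (C (X ^ (i.2.1 : ℕ)) * X ^ (i.2.2 : ℕ)) * C (X ^ (i.1.1 : ℕ)) else 0))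
        - (∑ i, C (C (c i)) * (if (i.1.2 : ℕ) = d - 1 then
            (DD f)^[m] (C (X ^ (i.2.1 : ℕ)) * X ^ (i.2.2 : ℕ)) * C (X ^ (i.1.1 : ℕ)) else 0)) * g l := by
  classical
  set U : ℕ → (Fin J × Fin d) × (Fin A × Fin d) → k[X][X] := fun m i =>
    (DD f)^[m] (C (X ^ (i.2.1 : ℕ)) * X ^ (i.2.2 : ℕ)) * C (X ^ (i.1.1 : ℕ)) with hU
  set T : ℕ → ℕ → (Fin J × Fin d) × (Fin A × Fin d) → k[X][X] := fun m l i =>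
    C (Δ ^ (d - 1 - l)) * (if (i.1.2 : ℕ) = l then U m i else 0) - (if (i.1.2 : ℕ) = d - 1 then U m i else 0) * g l with hT
  obtain ⟨c, hc, hc2⟩ := exists_rel (k := k) (ι := (Fin J × Fin d) × (Fin A × Fin d))
    (κ := Fin M × Fin (d - 1) × Fin d × Fin (B + 1)) (by simpa using hcount)
    (fun i t => ((T t.1 t.2.1 i %ₘ f).coeff t.2.2.1).coeff t.2.2.2)
  refine ⟨c, hc, fun m hm l hl => ?_⟩
  have hrw : C (Δ ^ (d - 1 - l)) * (∑ i, C (C (c i)) * (if (i.1.2 : ℕ) = l then U m i else 0))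
        - (∑ i, C (C (c i)) * (if (i.1.2 : ℕ) = d - 1 then U m i else 0)) * g l = ∑ i, C (C (c i)) * T m l i := by
    rw [Finset.mul_sum, Finset.sum_mul, ← Finset.sum_sub_distrib]
    refine Finset.sum_congr rfl fun i _ => ?_
    simp only [hT]; ring
  rw [hrw]
  have hUW : ∀ i, WD D (A + J + (D * D + M * (D * D))) (U m i) := by
    intro i
    have h1 : WD D (A + D * D) (C (X ^ (i.2.1 : ℕ)) * X ^ (i.2.2 : ℕ) : k[X][X]) := by
      refine (WD.mul (WD.C (natDegree_X_pow_le _)) (WD.X.pow _)).mono ?_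
      have := i.2.1.2
      have := i.2.2.2
      have := Nat.mul_le_mul_right D (show (i.2.2 : ℕ) ≤ D by omega)
      omega
    have h2 := WD.DD_iter (WD.monic hf hD) h1 m
    refine (WD.mul h2 (WD.C (natDegree_X_pow_le _))).mono ?_
    have := i.1.1.2
    have h3 : m * (D * f.natDegree) ≤ M * (D * D) :=
      Nat.mul_le_mul hm.le (Nat.mul_le_mul_left _ (by omega))
    omega
  have hTW : ∀ i, WD D B (T m l i) := by
    intro i
    have h0 : ∀ (q : Prop) [Decidable q], WD D (A + J + (D * D + M * (D * D))) (if q then U m i else 0) := by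
      intro q _
      split_ifs
      · exact hUW i
      · exact WD.zero
    apply WD.sub
    · refine (WD.mul (WD.C (B := D * D) ?_) (h0 _)).mono (by omega)
      refine (natDegree_pow_le).trans (Nat.mul_le_mul (by omega) hΔ)
    · exact (WD.mul (h0 _) (hg l)).mono (by omega)
  apply wd_coeff_zero hf (by omega) hD (B := B)
  · apply WD.sum
    intro i _
    have := (WD.mul (WD.C (B := 0) (a := C (c i)) (by simp)) (hTW i))
    rwa [zero_add] at this
  · intro i hi e he
    have := hc2 (⟨m, hm⟩, ⟨l, hl⟩, ⟨i, by omega⟩, ⟨e, by omega⟩)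
    rw [sum_mod, finsetSum_coeff, finsetSum_coeff]
    simpa only [coeff_C_mul] using this

end
end Stp
end

section
open Polynomial

namespace Stp

section
variable {k : Type*} [Field k]

lemma stepanov_aux (p : ℕ) [Fact p.Prime] [CharP k p] [IsAlgClosed k] {D d A J M c1 : ℕ} {f P : k[X][X]} {Δ : k[X]}
    (hf : f.Monic) (hirr : Irreducible f) (hfd : f.natDegree = d) (hd : 0 < d) (hdD : d ≤ D)
    (hD : ∀ j, (f.coeff j).natDegree ≤ D) (hPd : P.natDegree ≤ D) (hPD : ∀ j, (P.coeff j).natDegree ≤ D)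
    (hΔ0 : Δ ≠ 0) (hΔ : Δ.natDegree ≤ D)
    (hdvd : f ∣ ∑ j ∈ Finset.range (d + 1), C (Δ ^ (d - j) * (f.coeff j).map (frobenius k p)) * P ^ j)
    (hc1 : c1 = D * D + M * (D * D) + D * D + ((D + D * D) + D * (D + D * D)))
    (hcount : M * ((d - 1) * (d * (A + J + c1 + 1))) < (J * d) * (A * d))
    (hM : M = J + D * D + 1)
    (hp1 : D * (A + D * D) < p) (hp2 : A + D * D + M * (D + D * (D * D)) < p) :
    ∃ x0 y0 : k, x0 ^ p = x0 ∧ e2 x0 y0 f = 0 ∧ Δ.eval x0 ≠ 0 ∧ Δ.eval x0 * y0 ^ p = e2 x0 y0 P := by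
  classical
  by_contra! hbad
  have hpp : p.Prime := Fact.out
  have hfdeg : f.degree = d := by rw [degree_eq_natDegree hf.ne_zero, hfd]
  set F : ℕ → k[X] := fun j => Δ ^ (d - j) * (f.coeff j).map (frobenius k p) with hF
  have hFdeg : ∀ j, (F j).natDegree ≤ D + D * D := by
    intro j
    refine natDegree_mul_le.trans ?_
    have h1 : (Δ ^ (d - j)).natDegree ≤ D * D := natDegree_pow_le.trans (Nat.mul_le_mul (by omega) hΔ)
    have h2 : ((f.coeff j).map (frobenius k p)).natDegree ≤ D := natDegree_map_le.trans (hD j)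
    omega
  have hPW : WD D (D + D * D) P := WD.of_coeff hPd hPD
  have hdp : d < p := by
    have : d * 1 ≤ D * (A + D * D) := Nat.mul_le_mul hdD (by nlinarith)
    omega
  obtain ⟨c, hc0, hc⟩ := aux_coeffs (A := A) (J := J) (M := M) hf hfd hd hdD hD Δ hΔ (gl d F P)
    (fun l => gl_WD hFdeg hPW hdD l) hc1 rfl hcount
  set u : ℕ → ℕ → k[X][X] := fun m l => ∑ i, C (C (c i)) * (if (i.1.2 : ℕ) = l then
            (DD f)^[m] (C (X ^ (i.2.1 : ℕ)) * X ^ (i.2.2 : ℕ)) * C (X ^ (i.1.1 : ℕ)) else 0) with hu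
  set H : k[X][X] := ∑ jl : Fin J × Fin d, (∑ ab : Fin A × Fin d, C (C (c (jl, ab)) * X ^ (ab.1 : ℕ)) * X ^ (ab.2 : ℕ)) *
      (C (X ^ (jl.1 : ℕ)) * X ^ (jl.2 : ℕ)) ^ p with hH
  have hHW : WD D (A + D * D + p * (J + D * D)) H := by
    apply WD.sum
    intro i _
    have h1 : WD D (J + D * D) (C (X ^ (i.1 : ℕ)) * X ^ (i.2 : ℕ) : k[X][X]) := by
      refine (WD.mul (WD.C (natDegree_X_pow_le _)) (WD.X.pow _)).mono ?_
      have := i.1.2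
      have := i.2.2
      have := Nat.mul_le_mul_right D (show (i.2 : ℕ) ≤ D by omega)
      omega
    refine (WD.mul (mono_WD _) (h1.pow p)).mono ?_
    have := Nat.mul_le_mul_right D hdD
    omega
  have hDH : ∀ m, (DD f)^[m] H = ∑ i : (Fin J × Fin d) × (Fin A × Fin d), C (C (c i)) *
      (DD f)^[m] (C (X ^ (i.2.1 : ℕ)) * X ^ (i.2.2 : ℕ)) * (C (X ^ (i.1.1 : ℕ)) * X ^ (i.1.2 : ℕ)) ^ p := by
    intro m
    rw [hH, DD_iter_sum]
    refine Eq.trans ?_ (Fintype.sum_prod_type _).symm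
    refine Finset.sum_congr rfl fun jl _ => ?_
    rw [DD_iter_mul_pow, DD_iter_sum, Finset.sum_mul]
    refine Finset.sum_congr rfl fun ab _ => ?_
    congr 1
    have h1 : ∀ G : k[X][X], C (C (c (jl, ab))) * G = c (jl, ab) • G := by
      intro G; rw [← smul_eq_C_mul]; ext; simp
    rw [map_mul C, mul_assoc, h1, DD_iter_smul, h1]
  -- vanishing
  have hvan : ∀ x0 y0 : k, x0 ^ p = x0 → e2 x0 y0 f = 0 → Δ.eval x0 ≠ 0 → ∀ m < M,
      e2 x0 y0 ((DD f)^[m] H) = 0 := by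
    intro x0 y0 hx hy hΔx m hm
    have hne := hbad x0 y0 hx hy hΔx
    set z := Δ.eval x0 * y0 ^ p with hz
    have hFev : ∀ j, (F j).eval x0 = (Δ.eval x0) ^ (d - j) * ((f.coeff j).eval x0) ^ p := by
      intro j
      rw [hF, eval_mul, eval_pow]
      congr 1
      conv_lhs => rw [← hx]
      rw [← frobenius_def, eval_map, eval₂_hom, frobenius_def]
    have hsumz : ∑ j ∈ Finset.range (d + 1), (F j).eval x0 * z ^ j = 0 := by
      have h1 : ∀ j ∈ Finset.range (d + 1), (F j).eval x0 * z ^ j =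
          (Δ.eval x0) ^ d * ((f.coeff j).eval x0 * y0 ^ j) ^ p := by
        intro j hj
        rw [Finset.mem_range] at hj
        rw [hFev, hz, mul_pow, mul_pow, ← pow_mul, ← pow_mul, mul_comm p j,
          show d = (d - j) + j by omega, pow_add, show d - j + j - j = d - j by omega]
        ring
      rw [Finset.sum_congr rfl h1, ← Finset.mul_sum, ← sum_pow_char]
      have h2 : ∑ j ∈ Finset.range (d + 1), (f.coeff j).eval x0 * y0 ^ j = 0 := by
        rw [e2_apply, eval₂_eq_sum_range, hfd] at hy
        exact hy
      rw [h2, zero_pow hpp.ne_zero, mul_zero]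
    have hsumP : ∑ j ∈ Finset.range (d + 1), (F j).eval x0 * (e2 x0 y0 P) ^ j = 0 := by
      obtain ⟨q, hq⟩ := hdvd
      have := congrArg (e2 x0 y0) hq
      rw [map_mul, hy, zero_mul, map_sum] at this
      rw [← this]
      refine Finset.sum_congr rfl fun j _ => ?_
      rw [map_mul, map_pow, e2_C]
    have hfac := factor d (fun j => (F j).eval x0) z (e2 x0 y0 P)
    rw [hsumz, hsumP, sub_zero] at hfac
    have hg0 := (mul_eq_zero.1 hfac.symm).resolve_left (sub_ne_zero.2 hne)
    have hgl : ∀ l, e2 x0 y0 (gl d F P l) =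
        ∑ j ∈ Finset.Ico (l + 1) (d + 1), (F j).eval x0 * (e2 x0 y0 P) ^ (j - l - 1) := by
      intro l
      rw [gl, map_sum]
      refine Finset.sum_congr rfl fun j _ => ?_
      rw [map_mul, map_pow, e2_C]
    have hgtop : e2 x0 y0 (gl d F P (d - 1)) = 1 := by
      rw [hgl, show d - 1 + 1 = d by omega, Nat.Ico_succ_singleton, Finset.sum_singleton,
        show d - (d - 1) - 1 = 0 by omega, hFev, ← hfd, hf.coeff_natDegree]
      simp
    have hul : ∀ l < d, (Δ.eval x0) ^ (d - 1 - l) * e2 x0 y0 (u m l) =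
        e2 x0 y0 (u m (d - 1)) * e2 x0 y0 (gl d F P l) := by
      intro l hl
      by_cases h : l = d - 1
      · rw [h, hgtop]; simp
      · obtain ⟨q, hq⟩ := hc m hm l (by omega)
        have := congrArg (e2 x0 y0) hq
        rw [map_mul _ f, hy, zero_mul, map_sub, map_mul, map_mul, e2_C, eval_pow, sub_eq_zero] at this
        exact this
    have hsum : e2 x0 y0 ((DD f)^[m] H) = ∑ l ∈ Finset.range d, e2 x0 y0 (u m l) * (y0 ^ p) ^ l := by
      rw [hDH, map_sum]
      simp only [hu, map_sum, Finset.sum_mul]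
      rw [Finset.sum_comm]
      refine Finset.sum_congr rfl fun i _ => ?_
      rw [Finset.sum_eq_single (i.1.2 : ℕ)]
      · rw [if_pos rfl]
        simp only [map_mul, map_pow, e2_C, e2_X, eval_X, eval_C, eval_pow]
        rw [mul_pow, ← pow_mul, ← pow_mul, ← pow_mul, mul_comm (i.1.1 : ℕ) p, pow_mul x0, hx, mul_comm (i.1.2 : ℕ) p]
        ring
      · intro l _ hl
        rw [if_neg (Ne.symm hl)]; simp
      · intro h
        exact absurd (Finset.mem_range.2 i.1.2.2) h
    have hfin : (Δ.eval x0) ^ (d - 1) * e2 x0 y0 ((DD f)^[m] H) = 0 := by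
      rw [hsum, Finset.mul_sum]
      have h1 : ∀ l ∈ Finset.range d, (Δ.eval x0) ^ (d - 1) * (e2 x0 y0 (u m l) * (y0 ^ p) ^ l) =
          e2 x0 y0 (u m (d - 1)) * (e2 x0 y0 (gl d F P l) * z ^ l) := by
        intro l hl
        rw [Finset.mem_range] at hl
        rw [← mul_assoc (e2 x0 y0 (u m (d - 1))), ← hul l hl, hz, mul_pow]
        conv_lhs => rw [show d - 1 = (d - 1 - l) + l by omega, pow_add]
        ring
      rw [Finset.sum_congr rfl h1, ← Finset.mul_sum]
      simp only [hgl]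
      rw [hg0, mul_zero]
    exact (mul_eq_zero.1 hfin).resolve_left (pow_ne_zero _ hΔx)
  -- good points
  have hdyf : ¬ f ∣ dy f := by
    intro h
    have hne : dy f ≠ 0 := by
      intro h0
      have h1 := congrArg (fun q => coeff q (d - 1)) h0
      simp only [dy_apply, coeff_derivative, coeff_zero] at h1
      rw [show d - 1 + 1 = d by omega, ← hfd, hf.coeff_natDegree, one_mul, hfd] at h1
      have h2 : ((d : ℕ) : k[X]) = 0 := by
        rw [← h1, Nat.cast_sub hd]; simp
      rw [CharP.cast_eq_zero_iff k[X] p] at h2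
      exact absurd (Nat.le_of_dvd hd h2) (by omega)
    have := degree_le_of_dvd h hne
    rw [dy_apply] at this
    exact absurd (degree_derivative_lt hf.ne_zero) (not_lt.2 this)
  set E : k[X] := Δ * NN f (dy f) with hE
  have hNdy := NN_ne_zero hf hirr hdyf
  have hE0 : E ≠ 0 := mul_ne_zero hΔ0 hNdy
  have hEdeg : E.natDegree ≤ D + D * (D * D) := by
    refine natDegree_mul_le.trans ?_
    have h1 := NN_natDegree hf hD (WD.monic hf hD).dy
    have h2 : f.natDegree * (D * f.natDegree) ≤ D * (D * D) := by
      rw [hfd]; exact Nat.mul_le_mul hdD (Nat.mul_le_mul_left _ hdD)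
    omega
  obtain ⟨S, hS, hSp⟩ := exists_Fp (k := k) p
  set S' := S \ E.roots.toFinset with hS'
  have hS'card : p ≤ S'.card + (D + D * (D * D)) := by
    have h1 := Finset.card_le_card_sdiff_add_card (t := E.roots.toFinset) (s := S)
    have h2 : E.roots.toFinset.card ≤ D + D * (D * D) :=
      (Multiset.toFinset_card_le _).trans ((card_roots' _).trans hEdeg)
    rw [hS'] ; omega
  have hgood : ∀ x0 ∈ S', x0 ^ p = x0 ∧ Δ.eval x0 ≠ 0 ∧ (NN f (dy f)).eval x0 ≠ 0 := by
    intro x0 hx0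
    rw [hS', Finset.mem_sdiff, Multiset.mem_toFinset, mem_roots hE0, IsRoot, hE, eval_mul] at hx0
    exact ⟨hSp _ hx0.1, left_ne_zero_of_mul hx0.2, right_ne_zero_of_mul hx0.2⟩
  have hMp : M ≤ p := by
    have : M ≤ M * (D + D * (D * D)) := Nat.le_mul_of_pos_right _ (by omega)
    omega
  have hS'ne : S'.Nonempty := by
    rw [← Finset.card_pos]
    have : D + D * (D * D) ≤ M * (D + D * (D * D)) := Nat.le_mul_of_pos_left _ (by omega)
    omega
  -- f does not divide H
  have hfH : ¬ f ∣ H := by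
    rintro ⟨q, hq⟩
    obtain ⟨x0, hx0⟩ := hS'ne
    obtain ⟨_, _, h3⟩ := hgood x0 hx0
    obtain ⟨y, _, hy⟩ := branches hf (by omega) h3
    have hy0 := (hy ⟨0, by omega⟩).1
    have h0 : ev x0 (y ⟨0, by omega⟩) H = 0 := by rw [hq, map_mul, hy0, zero_mul]
    have := nonvan p hf hirr hfd hd hD (A := A) (J := J) (by
      have : d * (A + d * D) ≤ D * (A + D * D) :=
        Nat.mul_le_mul hdD (Nat.add_le_add_left (Nat.mul_le_mul_right _ hdD) _)
      omega) (fun jl ab => c (jl, ab)) hy0 (by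
        rw [hH, map_sum] at h0
        rw [← h0]
        refine Finset.sum_congr rfl fun i _ => ?_
        exact ((map_mul _ _ _).trans (by rw [map_pow (ev x0 (y ⟨0, by omega⟩))])).symm)
    apply hc0
    funext i
    exact congrFun (congrFun this i.1) i.2
  have hNH := NN_ne_zero hf hirr hfH
  have hloc : ∀ x0 ∈ S', (X - C x0) ^ (M * d) ∣ NN f H := by
    intro x0 hx0
    obtain ⟨h1, h2, h3⟩ := hgood x0 hx0
    obtain ⟨y, hyinj, hy⟩ := branches hf (by omega) h3
    apply tau_dvd
    rw [NN_prod (tau x0) hf y hyinj (fun s => (hy s).1) H]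
    have h4 : ∀ s, PowerSeries.X ^ M ∣ eval₂ (tau x0) (y s) H := by
      intro s
      apply order_of_iter p _ (hy s).2 M hMp
      intro m hm
      rw [← ev_apply, ← ev_DD_iter (hy s).1, e2_ev]
      refine hvan _ _ h1 ?_ h2 m hm
      rw [← e2_ev, (hy s).1, map_zero]
    have h5 := Finset.prod_dvd_prod_of_dvd (s := Finset.univ) (fun _ : Fin f.natDegree => (PowerSeries.X ^ M : PowerSeries k)) _
      (fun s _ => h4 s)
    rw [Finset.prod_const, Finset.card_univ, Fintype.card_fin, ← pow_mul] at h5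
    exact (pow_dvd_pow _ (by rw [hfd])).trans h5
  have hprod : ∏ x0 ∈ S', (X - C x0) ^ (M * d) ∣ NN f H := by
    apply Finset.prod_dvd_of_coprime
    · intro a _ b _ hab
      exact (pairwise_coprime_X_sub_C Function.injective_id hab).pow
    · exact hloc
  have hdeg := natDegree_le_of_dvd hprod hNH
  rw [natDegree_prod _ _ (fun x _ => pow_ne_zero _ (X_sub_C_ne_zero x))] at hdeg
  simp only [natDegree_pow, natDegree_X_sub_C, mul_one, Finset.sum_const, smul_eq_mul] at hdeg
  have hdeg2 := NN_natDegree hf hD hHW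
  rw [hfd] at hdeg2
  have h6 : S'.card * M * d ≤ (A + D * D + p * (J + D * D)) * d := by
    calc S'.card * M * d = S'.card * (M * d) := by ring
      _ ≤ _ := hdeg.trans hdeg2
      _ = _ := by ring
  have h7 := Nat.le_of_mul_le_mul_right h6 hd
  have h8 : p * M ≤ (S'.card + (D + D * (D * D))) * M := Nat.mul_le_mul_right _ hS'card
  rw [hM] at h7 h8 hp2
  nlinarith

/-- the Stepanov lemma -/
theorem stepanov (D : ℕ) : ∃ p0 : ℕ, ∀ p : ℕ, p0 ≤ p → p.Prime → ∀ (k : Type*) [Field k] [CharP k p] [ExpChar k p] [IsAlgClosed k]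
    (f P : k[X][X]) (Δ : k[X]), f.Monic → Irreducible f → 0 < f.natDegree → f.natDegree ≤ D →
    (∀ j, (f.coeff j).natDegree ≤ D) → P.natDegree ≤ D → (∀ j, (P.coeff j).natDegree ≤ D) → Δ ≠ 0 → Δ.natDegree ≤ D →
    f ∣ ∑ j ∈ Finset.range (f.natDegree + 1), C (Δ ^ (f.natDegree - j) * (f.coeff j).map (frobenius k p)) * P ^ j →
    ∃ x0 y0 : k, x0 ^ p = x0 ∧ e2 x0 y0 f = 0 ∧ Δ.eval x0 ≠ 0 ∧ Δ.eval x0 * y0 ^ p = e2 x0 y0 P := by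
  set J := (D * D + 1) * D + 1 with hJ
  set M := J + D * D + 1 with hM
  set c1 := D * D + M * (D * D) + D * D + ((D + D * D) + D * (D + D * D)) with hc1
  set A := M * D * (J + c1 + 1) + 1 with hA
  refine ⟨D * (A + D * D) + (A + D * D + M * (D + D * (D * D))) + 1, ?_⟩
  intro p hp hpp k _ _ _ _ f P Δ hf hirr hd hdD hD hPd hPD hΔ0 hΔ hdvd
  haveI : Fact p.Prime := ⟨hpp⟩
  refine stepanov_aux p hf hirr rfl hd hdD hD hPd hPD hΔ0 hΔ hdvd hc1 (J := J) (A := A) (M := M) ?_ hM (by omega) (by omega)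
  obtain ⟨e, he⟩ : ∃ e, f.natDegree = e + 1 := ⟨f.natDegree - 1, by omega⟩
  rw [he] at hdD ⊢
  rw [Nat.add_sub_cancel]
  have h1 : M * e * (A + J + c1 + 1) < J * (A * (e + 1)) := by
    have h2 : M * e + 1 ≤ J * (e + 1) := by
      have : (D * D + 1) * e ≤ (D * D + 1) * D := Nat.mul_le_mul_left _ (by omega)
      rw [hM, hJ]; nlinarith
    have h3 : M * e * (J + c1 + 1) < A := by
      have : M * e * (J + c1 + 1) ≤ M * D * (J + c1 + 1) :=
        Nat.mul_le_mul_right _ (Nat.mul_le_mul_left _ (by omega))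
      omega
    calc M * e * (A + J + c1 + 1) = M * e * A + M * e * (J + c1 + 1) := by ring
      _ < M * e * A + A := by omega
      _ = (M * e + 1) * A := by ring
      _ ≤ J * (e + 1) * A := Nat.mul_le_mul_right _ h2
      _ = _ := by ring
  calc M * (e * ((e + 1) * (A + J + c1 + 1))) = (M * e * (A + J + c1 + 1)) * (e + 1) := by ring
    _ < J * (A * (e + 1)) * (e + 1) := Nat.mul_lt_mul_of_pos_right h1 (by omega)
    _ = _ := by ring

end
end Stp
end

section
open Polynomial

namespace QE

lemma loc_ext {B K K' : Type*} [CommRing B] [Field K] [Field K'] (ε : B →+* K) (ε' : B →+* K')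
    (h : ∀ u, ε u = 0 → ε' u = 0) :
    ∃ (T : Subring K) (π : T →+* K'), ∀ (r : K) (u w : B), ε' w ≠ 0 → r * ε w = ε u →
      ∃ hr : r ∈ T, π ⟨r, hr⟩ * ε' w = ε' u := by
  set P := RingHom.ker ε' with hP
  haveI : P.IsPrime := RingHom.ker_isPrime ε'
  set S := P.primeCompl with hS
  have hS' : ∀ s : S, ε' s ≠ 0 := fun s hs => s.2 hs
  have hS0 : ∀ s : S, ε s ≠ 0 := fun s hs => hS' s (h _ hs)
  let f : Localization S →+* K := IsLocalization.lift (M := S) (g := ε) (fun s => (hS0 s).isUnit)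
  let g : Localization S →+* K' := IsLocalization.lift (M := S) (g := ε') (fun s => (hS' s).isUnit)
  have hf : ∀ u, f (algebraMap B _ u) = ε u := fun u => IsLocalization.lift_eq _ _
  have hg : ∀ u, g (algebraMap B _ u) = ε' u := fun u => IsLocalization.lift_eq _ _
  have hker : RingHom.ker f.rangeRestrict ≤ RingHom.ker g := by
    intro x hx
    rw [RingHom.mem_ker] at hx ⊢
    have hx : f x = 0 := congrArg Subtype.val hx
    obtain ⟨u, s, rfl⟩ := IsLocalization.exists_mk'_eq S x
    have h1 := congrArg f (IsLocalization.mk'_spec (Localization S) u s)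
    rw [map_mul, hx, zero_mul, hf] at h1
    have h2 := congrArg g (IsLocalization.mk'_spec (Localization S) u s)
    rw [map_mul, hg, hg, h u h1.symm] at h2
    exact (mul_eq_zero.1 h2).resolve_right (hS' s)
  let π : f.range →+* K' := RingHom.liftOfSurjective f.rangeRestrict f.rangeRestrict_surjective ⟨g, hker⟩
  have hπ : ∀ x, π (f.rangeRestrict x) = g x := fun x =>
    RingHom.liftOfRightInverse_comp_apply _ _ _ ⟨g, hker⟩ x
  refine ⟨f.range, π, fun r u w hw hr => ?_⟩
  have hwS : w ∈ S := hw
  have h1 : f (IsLocalization.mk' (Localization S) u ⟨w, hwS⟩) = r := by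
    have h1 := congrArg f (IsLocalization.mk'_spec (Localization S) u ⟨w, hwS⟩)
    rw [map_mul, hf, hf, ← hr] at h1
    exact mul_right_cancel₀ (hS0 ⟨w, hwS⟩) h1
  refine ⟨⟨_, h1⟩, ?_⟩
  have h2 : (⟨r, ⟨_, h1⟩⟩ : f.range) = f.rangeRestrict (IsLocalization.mk' (Localization S) u ⟨w, hwS⟩) :=
    Subtype.ext h1.symm
  rw [h2, hπ, ← hg, ← map_mul, ← hg]
  congr 1
  exact IsLocalization.mk'_spec (Localization S) u ⟨w, hwS⟩

/-- specialization of the coefficients -/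
noncomputable def spec {n : ℕ} {K : Type*} [CommRing K] (a : Fin n → K) (g : (MvPolynomial (Fin n) ℤ)[X]) : K[X] :=
  g.map (MvPolynomial.eval₂Hom (Int.castRingHom K) a)

lemma spec_map {n : ℕ} {K L : Type*} [CommRing K] [CommRing L] (f : K →+* L) (a : Fin n → K) (g : (MvPolynomial (Fin n) ℤ)[X]) :
    (spec a g).map f = spec (f ∘ a) g := by
  rw [spec, spec, Polynomial.map_map]
  congr 1
  ext i <;> simp

lemma pow_iter {K : Type*} [Field K] (φ : K →+* K) (m v : ℕ) (hmv : v.Coprime m) (z : K)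
    (hm : φ^[m] z = z) (hv : φ^[v] z = z) : φ z = z := by
  have h1 : Function.IsPeriodicPt φ m z := hm
  have h2 : Function.IsPeriodicPt φ v z := hv
  have := h2.gcd h1
  rw [hmv] at this
  exact this

/-- pattern lemma -/
lemma pattern {n : ℕ} {K K' : Type*} [Field K] [Field K'] [IsAlgClosed K] (φ : K →+* K) (φ' : K' →+* K')
    (T : Subring K) (π : T →+* K') (a : Fin n → K) (a' : Fin n → K')
    (ha : ∀ i, φ (a i) = a i)
    (hT : ∀ i, ∃ h : a i ∈ T, π ⟨a i, h⟩ = a' i) (m v : ℕ) (hmv : v.Coprime m)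
    (g : (MvPolynomial (Fin n) ℤ)[X])
    (hlead : (spec a g).leadingCoeff⁻¹ ∈ T)
    (hroot : ∀ z, spec a g ≠ 0 → (spec a g).eval z = 0 → φ^[m] z = z ∧ ∃ h : z ∈ T, ∃ h' : φ^[v] z ∈ T, π ⟨_, h'⟩ = φ' (π ⟨z, h⟩))
    (hdiff : ∀ z w, spec a g ≠ 0 → (spec a g).eval z = 0 → (spec a g).eval w = 0 → (z - w)⁻¹ ∈ T) :
    (∃ z, φ z = z ∧ (spec a g).eval z = 0) ↔ (∃ z', φ' z' = z' ∧ (spec a' g).eval z' = 0) := by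
  choose hT1 hT2 using hT
  set aT : Fin n → T := fun i => ⟨a i, hT1 i⟩ with haT
  have hG : (spec aT g).map T.subtype = spec a g := by rw [spec_map]; rfl
  have hG' : (spec aT g).map π = spec a' g := by
    rw [spec_map]; congr 1; funext i; exact hT2 i
  have hinj : Function.Injective T.subtype := Subtype.val_injective
  by_cases h0 : spec a g = 0
  · have h0' : spec a' g = 0 := by
      rw [← hG', (Polynomial.map_eq_zero_iff hinj).1 (hG.trans h0), Polynomial.map_zero]
    exact ⟨fun _ => ⟨0, map_zero _, by simp [h0']⟩, fun _ => ⟨0, map_zero _, by simp [h0]⟩⟩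
  have hinv : ∀ x : T, x ≠ 0 → (x : K)⁻¹ ∈ T → π x ≠ 0 := by
    intro x hx hxi h
    have h1 : x * ⟨(x : K)⁻¹, hxi⟩ = 1 := by
      apply Subtype.ext
      exact mul_inv_cancel₀ (fun h => hx (Subtype.ext h))
    have h2 := congrArg π h1
    rw [map_mul, h, zero_mul, map_one] at h2
    exact zero_ne_one h2
  have heval : ∀ x : T, (spec a' g).eval (π x) = π ((spec aT g).eval x) := by
    intro x; rw [← hG', eval_map, eval₂_hom]
  have heval2 : ∀ x : T, (spec a g).eval (x : K) = ((spec aT g).eval x : T) := by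
    intro x
    have : (x : K) = T.subtype x := rfl
    rw [← hG, eval_map, this, eval₂_hom]; rfl
  constructor
  · rintro ⟨z, hz, hz0⟩
    obtain ⟨_, h1, h2, h3⟩ := hroot z h0 hz0
    refine ⟨π ⟨z, h1⟩, ?_, ?_⟩
    · rw [← h3]
      congr 1
      apply Subtype.ext
      exact Function.iterate_fixed hz v
    · rw [heval]
      have : (spec aT g).eval ⟨z, h1⟩ = 0 := Subtype.ext ((heval2 ⟨z, h1⟩).symm.trans hz0)
      rw [this, map_zero]
  · rintro ⟨z', hz', hz0'⟩
    have hsplit := (IsAlgClosed.splits (spec a g)).eq_prod_roots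
    have hmem : ∀ z ∈ (spec a g).roots, z ∈ T := fun z hz => by
      rw [mem_roots h0] at hz
      exact (hroot z h0 hz).2.1
    set rT : Multiset T := (spec a g).roots.attach.map fun z => ⟨z.1, hmem z.1 z.2⟩ with hrT
    have hrmap : rT.map T.subtype = (spec a g).roots := by
      rw [hrT, Multiset.map_map]
      exact (spec a g).roots.attach_map_val
    have hfac : spec aT g = C (spec aT g).leadingCoeff * (rT.map fun z => X - C z).prod := by
      apply Polynomial.map_injective _ hinj
      rw [hG, Polynomial.map_mul, map_C, Polynomial.map_multiset_prod, Multiset.map_map]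
      rw [← leadingCoeff_map_of_injective hinj, hG]
      conv_lhs => rw [hsplit, ← hrmap, Multiset.map_map]
      congr 3
      funext z
      simp
    have hlc : π (spec aT g).leadingCoeff ≠ 0 := by
      have h1 : (((spec aT g).leadingCoeff : T) : K) = (spec a g).leadingCoeff := by
        rw [← hG, leadingCoeff_map_of_injective hinj]; rfl
      apply hinv
      · intro h
        rw [h] at h1
        exact h0 (leadingCoeff_eq_zero.1 h1.symm)
      · rw [h1]; exact hlead
    rw [← hG', hfac, Polynomial.map_mul, map_C, Polynomial.map_multiset_prod, Multiset.map_map, eval_mul, eval_C,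
      mul_eq_zero, or_iff_right hlc, eval_multiset_prod, Multiset.map_map, Multiset.prod_eq_zero_iff, Multiset.mem_map] at hz0'
    obtain ⟨z, hz, hzz⟩ := hz0'
    have hzz' : z' = π z := by
      simpa [sub_eq_zero] using hzz
    have hzroot : (spec a g).eval (z : K) = 0 := by
      have : (z : K) ∈ rT.map T.subtype := Multiset.mem_map.2 ⟨z, hz, rfl⟩
      rw [hrmap, mem_roots h0] at this
      exact this
    obtain ⟨h1, h2, h3, h4⟩ := hroot z h0 hzroot
    refine ⟨z, ?_, hzroot⟩
    apply pow_iter φ m v hmv z h1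
    by_contra hne
    have hroot2 : (spec a g).eval (φ^[v] (z : K)) = 0 := by
      have hcoef : ∀ k, φ^[k] ((spec a g).eval (z : K)) = (spec a g).eval (φ^[k] (z : K)) := by
        intro k
        induction k with
        | zero => rfl
        | succ k ih =>
          rw [Function.iterate_succ_apply', ih, Function.iterate_succ_apply']
          rw [← eval₂_hom, ← eval_map, spec_map]
          congr 2
          funext i; exact ha i
      rw [← hcoef, hzroot]
      exact Function.iterate_fixed (map_zero φ) v
    have h5 := hdiff _ _ h0 hroot2 hzroot
    have h6 : π (⟨_, h3⟩ - z) ≠ 0 := by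
      apply hinv
      · intro h
        rw [sub_eq_zero] at h
        exact hne (congrArg Subtype.val h)
      · exact h5
    apply h6
    rw [map_sub, h4, sub_eq_zero]
    change φ' (π z) = π z
    rw [← hzz', hz']

end QE
end

section
open Polynomial IntermediateField

namespace QE

lemma conj_half {k E : Type*} [Field k] [Field E] [Algebra k E] [FiniteDimensional k E] [IsGalois k E]
    (g g' : Gal(E/k)) (H : ∀ p : k[X], p ≠ 0 → (p.map (algebraMap k E)).Splits → (∃ z : E, g z = z ∧ aeval z p = 0) → (∃ z : E, g' z = z ∧ aeval z p = 0)) :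
    ∃ (σ : Gal(E/k)) (v : ℕ), g' = σ * g ^ v * σ⁻¹ := by
  classical
  obtain ⟨θ, hθ⟩ := Field.exists_primitive_element k (fixedField (Subgroup.zpowers g))
  have hθg : g (θ : E) = θ := θ.2 ⟨g, Subgroup.mem_zpowers g⟩
  have hInt : IsIntegral k (θ : E) := Algebra.IsIntegral.isIntegral _
  obtain ⟨z, hz, hz0⟩ := H (minpoly k (θ : E)) (minpoly.ne_zero hInt) (Normal.splits inferInstance _) ⟨θ, hθg, minpoly.aeval _ _⟩
  obtain ⟨σ, hσ⟩ := minpoly.exists_algEquiv_of_root hInt.isAlgebraic hz0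
  have h1 : σ * g' * σ⁻¹ ∈ (fixedField (Subgroup.zpowers g)).fixingSubgroup := by
    have h2 : k⟮(θ : E)⟯ = fixedField (Subgroup.zpowers g) := by
      have := congrArg (IntermediateField.lift) hθ
      rwa [IntermediateField.lift_adjoin_simple, IntermediateField.lift_top] at this
    rw [← h2, IntermediateField.mem_fixingSubgroup_iff]
    have h3 : k⟮(θ : E)⟯ ≤ fixedField (Subgroup.zpowers (σ * g' * σ⁻¹)) := by
      rw [adjoin_simple_le_iff]
      rintro ⟨w, hw⟩
      have h4 : σ * g' * σ⁻¹ ∈ MulAction.stabilizer Gal(E/k) (θ : E) := by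
        rw [MulAction.mem_stabilizer_iff]
        change σ (g' (σ⁻¹ (θ : E))) = θ
        have : σ⁻¹ (θ : E) = z := by rw [← hσ]; exact σ.symm_apply_apply z
        rw [this, hz, hσ]
      exact (Subgroup.zpowers_le.2 h4) hw
    intro y hy
    exact h3 hy ⟨_, Subgroup.mem_zpowers _⟩
  rw [fixingSubgroup_fixedField, mem_zpowers_iff_mem_range_orderOf] at h1
  obtain ⟨v, -, hv⟩ := Finset.mem_image.1 h1
  refine ⟨σ⁻¹, v, ?_⟩
  rw [hv]; group

lemma conj_cyc {k E : Type*} [Field k] [Field E] [Algebra k E] [FiniteDimensional k E] [IsGalois k E]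
    (g g' : Gal(E/k)) (H : ∀ p : k[X], p ≠ 0 → (p.map (algebraMap k E)).Splits → ((∃ z : E, g z = z ∧ aeval z p = 0) ↔ (∃ z : E, g' z = z ∧ aeval z p = 0))) :
    ∃ (σ : Gal(E/k)) (v : ℕ), v.Coprime (orderOf g) ∧ g' = σ * g ^ v * σ⁻¹ := by
  obtain ⟨σ, v, h⟩ := conj_half g g' (fun p hp hp' => (H p hp hp').1)
  obtain ⟨τ, w, h'⟩ := conj_half g' g (fun p hp hp' => (H p hp hp').2)
  refine ⟨σ, v, ?_, h⟩
  have o1 : ∀ (s x : Gal(E/k)), orderOf (s * x * s⁻¹) = orderOf x := fun s x => by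
    rw [← MulAut.conj_apply, orderOf_injective (MulAut.conj s).toMonoidHom (MulAut.conj s).injective x |>.symm]; rfl
  have h1 : orderOf g' = orderOf g / (orderOf g).gcd v := by rw [h, o1, orderOf_pow]
  have h2 : orderOf g = orderOf g' / (orderOf g').gcd w := by
    conv_lhs => rw [h', o1, orderOf_pow]
  have h3 : orderOf g ≤ orderOf g' := by
    conv_lhs => rw [h2]
    exact Nat.div_le_self _ _
  have hpos : 0 < orderOf g := orderOf_pos g
  rw [h1] at h3
  rw [Nat.coprime_comm]
  by_contra hne
  have h4 : 0 < (orderOf g).gcd v := Nat.gcd_pos_of_pos_left _ hpos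
  have h5 : 1 < (orderOf g).gcd v := by unfold Nat.Coprime at hne; omega
  have := Nat.div_lt_self hpos h5
  omega

lemma adj_coprime (v e m : ℕ) (he : e ≠ 0) (hm : m ≠ 0) (h : v.Coprime e) : ∃ w : ℕ, w.Coprime m ∧ w ≡ v [MOD e] := by
  haveI : NeZero (e * m) := ⟨mul_ne_zero he hm⟩
  obtain ⟨u, hu⟩ := ZMod.unitsMap_surjective (Dvd.intro m rfl : e ∣ e * m) (ZMod.unitOfCoprime v h)
  refine ⟨(u : ZMod (e * m)).val, ?_, ?_⟩
  · have := ZMod.val_coe_unit_coprime u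
    exact Nat.Coprime.coprime_mul_left_right this
  · have := congrArg Units.val hu
    rw [ZMod.coe_unitOfCoprime, ZMod.unitsMap_val] at this
    rw [← ZMod.natCast_eq_natCast_iff, ← this]
    exact ZMod.natCast_val _

lemma exists_emb {k k0 K' : Type*} [Field k] [Field k0] [Field K'] [Algebra k k0] [Algebra k K'] [CharZero k]
    [IsAlgClosed k0] [Algebra.IsAlgebraic k k0] [IsAlgClosed K'] (φ : k0 →ₐ[k] k0) (φ' : K' →ₐ[k] K')
    (R : ∀ p : k[X], p ≠ 0 → ((∃ z : k0, φ z = z ∧ aeval z p = 0) ↔ (∃ z : K', φ' z = z ∧ aeval z p = 0)))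
    (S : Finset k0) (m : ℕ) (hm : m ≠ 0) :
    ∃ (ι : k0 →ₐ[k] K') (v : ℕ), v.Coprime m ∧ ∀ x ∈ S, φ' (ι x) = ι (φ^[v] x) := by
  haveI : IsAlgClosure k k0 := ⟨inferInstance, inferInstance⟩
  haveI : Normal k k0 := IsAlgClosure.normal k k0
  let ι : k0 →ₐ[k] K' := IsAlgClosed.lift
  letI := ι.toRingHom.toAlgebra
  haveI : IsScalarTower k k0 K' := IsScalarTower.of_algebraMap_eq fun x => (ι.commutes x).symm
  let φ2 : Gal(k0/k) := φ'.restrictNormal' k0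
  have hφ2 : ∀ x, ι (φ2 x) = φ' (ι x) := fun x => φ'.restrictNormal_commutes k0 x
  let φ1 : Gal(k0/k) := AlgEquiv.ofBijective φ (Algebra.IsAlgebraic.algHom_bijective φ)
  have hφ1 : ∀ x, φ1 x = φ x := fun x => rfl
  haveI : FiniteDimensional k (adjoin k (S : Set k0)) :=
    finiteDimensional_adjoin fun x _ => Algebra.IsIntegral.isIntegral x
  let E : IntermediateField k k0 := normalClosure k (adjoin k (S : Set k0)) k0
  haveI : Normal k E := normalClosure.normal k (adjoin k (S : Set k0)) k0
  haveI : FiniteDimensional k E := normalClosure.is_finiteDimensional k (adjoin k (S : Set k0)) k0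
  haveI : IsGalois k E := ⟨⟩
  have hSE : ∀ x ∈ S, x ∈ E := fun x hx =>
    (IntermediateField.le_normalClosure (adjoin k (S : Set k0))) (subset_adjoin k _ hx)
  have hres : ∀ (s : Gal(k0/k)) (x : E), ((s.restrictNormal E x : E) : k0) = s x := fun s x =>
    s.restrictNormal_commutes E x
  obtain ⟨σ, v, hv, hg⟩ := conj_cyc (φ1.restrictNormal E) (φ2.restrictNormal E) (by
    have key : ∀ (s : Gal(k0/k)) (p : k[X]), p ≠ 0 → (p.map (algebraMap k E)).Splits →
      ((∃ z : E, s.restrictNormal E z = z ∧ aeval z p = 0) ↔ (∃ z : k0, s z = z ∧ aeval z p = 0)) := by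
      intro s p hp hsp
      constructor
      · rintro ⟨z, hz, hz0⟩
        refine ⟨z, by rw [← hres, hz], ?_⟩
        have := congrArg (algebraMap E k0) hz0
        rwa [← aeval_algebraMap_apply, map_zero] at this
      · rintro ⟨z, hz, hz0⟩
        have hzE : z ∈ (algebraMap E k0).range := by
          apply hsp.mem_range_of_isRoot (Polynomial.map_ne_zero hp)
          rw [IsRoot, eval_map, eval₂_map]
          exact hz0
        obtain ⟨y, rfl⟩ := hzE
        refine ⟨y, Subtype.ext ((hres s y).trans hz), ?_⟩
        rw [aeval_algebraMap_apply] at hz0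
        exact (map_eq_zero _).1 hz0
    intro p hp hsp
    rw [key _ p hp hsp, key _ p hp hsp]
    have h1 := R p hp
    simp only [hφ1]
    rw [h1]
    constructor
    · rintro ⟨z, hz, hz0⟩
      have hzE : z ∈ (algebraMap k0 K').range := by
        apply (IsAlgClosed.splits (p.map (algebraMap k k0))).mem_range_of_isRoot (Polynomial.map_ne_zero hp)
        rw [IsRoot, eval_map, eval₂_map, ← IsScalarTower.algebraMap_eq]
        exact hz0
      obtain ⟨y, rfl⟩ := hzE
      refine ⟨y, ι.injective ((hφ2 y).trans hz), ?_⟩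
      rw [aeval_algebraMap_apply] at hz0
      exact (map_eq_zero _).1 hz0
    · rintro ⟨z, hz, hz0⟩
      refine ⟨ι z, by rw [← hφ2, hz], ?_⟩
      change aeval (algebraMap k0 K' z) p = 0
      rw [aeval_algebraMap_apply, hz0, map_zero])
  obtain ⟨τ, rfl⟩ := AlgEquiv.restrictNormalHom_surjective (F := k) (K₁ := E) k0 σ
  obtain ⟨w, hw, hwv⟩ := adj_coprime v (orderOf (φ1.restrictNormal E)) m (orderOf_pos _).ne' hm hv
  refine ⟨ι.comp (τ : k0 →ₐ[k] k0), w, hw, fun x hx => ?_⟩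
  have hpw : (φ1.restrictNormal E) ^ w = (φ1.restrictNormal E) ^ v := (pow_eq_pow_iff_modEq).2 hwv
  rw [← hpw] at hg
  have h2 : (φ2.restrictNormal E) * (AlgEquiv.restrictNormalHom E τ) = (AlgEquiv.restrictNormalHom E τ) * (φ1.restrictNormal E) ^ w := by
    rw [hg]; group
  have h3 : ∀ (s : Gal(k0/k)), AlgEquiv.restrictNormalHom E s = s.restrictNormal E := fun s => rfl
  rw [← h3, ← h3, ← map_pow, ← map_mul, ← map_mul, h3, h3] at h2
  have h4 := congrArg (algebraMap E k0) (DFunLike.congr_fun h2 (⟨x, hSE x hx⟩ : E))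
  have h5 : φ2 (τ x) = τ ((φ1 ^ w) x) := by
    have a1 := hres (φ2 * τ) ⟨x, hSE x hx⟩
    have a2 := hres (τ * φ1 ^ w) ⟨x, hSE x hx⟩
    exact a1.symm.trans (h4.trans a2)
  have h6 : (φ1 ^ w) x = φ^[w] x := by
    have : ∀ n : ℕ, (φ1 ^ n) x = φ^[n] x := by
      intro n
      induction n with
      | zero => rfl
      | succ n ih => rw [pow_succ', Function.iterate_succ_apply', ← ih]; rfl
    exact this w
  change φ' (ι (τ x)) = ι (τ (φ^[w] x))
  rw [← hφ2, h5, h6]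

end QE
end

section
open Polynomial

namespace QE

lemma exists_point {k A : Type*} [Field k] [IsAlgClosed k] [CommRing A] [Nontrivial A] [Algebra k A]
    [Algebra.FiniteType k A] : Nonempty (A →ₐ[k] k) := by
  obtain ⟨M, hM⟩ := Ideal.exists_maximal A
  letI := Ideal.Quotient.field M
  haveI : Algebra.FiniteType k (A ⧸ M) := Algebra.FiniteType.of_surjective (Ideal.Quotient.mkₐ k M) (Ideal.Quotient.mkₐ_surjective k M)
  haveI : Module.Finite k (A ⧸ M) := finite_of_finite_type_of_isJacobsonRing k (A ⧸ M)
  have hb : Function.Bijective (algebraMap k (A ⧸ M)) := IsAlgClosed.algebraMap_bijective_of_isIntegral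
  let e : k ≃ₐ[k] (A ⧸ M) := AlgEquiv.ofBijective (Algebra.ofId k _) hb
  exact ⟨(e.symm : (A ⧸ M) →ₐ[k] k).comp (Ideal.Quotient.mkₐ k M)⟩

lemma absirr {k K : Type*} [Field k] [IsAlgClosed k] [Field K] (ι : k →+* K) (f : k[X][X]) (hf : f.Monic)
    (hirr : Irreducible f) : Irreducible (f.map (mapRingHom ι)) := by
  letI := ι.toAlgebra
  have hι : ι = algebraMap k K := rfl
  rw [Polynomial.Monic.irreducible_iff_natDegree' (hf.map _)]
  rw [Polynomial.Monic.irreducible_iff_natDegree' hf] at hirr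
  refine ⟨fun h => hirr.1 ?_, fun F G hF hG hFG hd => ?_⟩
  · apply Polynomial.map_injective (mapRingHom ι) (Polynomial.map_injective ι ι.injective)
    change Polynomial.map (mapRingHom ι) f = _
    rw [h, Polynomial.map_one]
  classical
  let cs : K[X][X] → Finset K := fun F => F.support.biUnion fun i => (F.coeff i).support.image fun j => (F.coeff i).coeff j
  let A0 : Subalgebra k K := Algebra.adjoin k ((cs F ∪ cs G : Finset K) : Set K)
  haveI : Algebra.FiniteType k A0 := (Subalgebra.fg_iff_finiteType _).1 ⟨_, rfl⟩
  have hcs : ∀ H : K[X][X], (∀ c ∈ cs H, c ∈ A0) → H ∈ lifts (mapRingHom (A0.val : A0 →+* K)) := by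
    intro H h
    rw [lifts_iff_coeff_lifts]
    intro i
    have : H.coeff i ∈ lifts (A0.val : A0 →+* K) := by
      rw [lifts_iff_coeff_lifts]
      intro j
      by_cases hij : (H.coeff i).coeff j = 0
      · rw [hij]; exact ⟨0, map_zero _⟩
      · refine ⟨⟨_, h _ ?_⟩, rfl⟩
        simp only [cs, Finset.mem_biUnion, Finset.mem_image]
        refine ⟨i, ?_, j, mem_support_iff.2 hij, rfl⟩
        rw [mem_support_iff]
        rintro h0
        rw [h0] at hij
        exact hij (coeff_zero _)
    obtain ⟨q, hq⟩ := this
    exact ⟨q, hq⟩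
  obtain ⟨F1, hF1, hF1d, hF1m⟩ := lifts_and_natDegree_eq_and_monic (hcs F fun c hc =>
    Algebra.subset_adjoin (Finset.mem_coe.2 (Finset.mem_union_left _ hc))) hF
  obtain ⟨G1, hG1, hG1d, hG1m⟩ := lifts_and_natDegree_eq_and_monic (hcs G fun c hc =>
    Algebra.subset_adjoin (Finset.mem_coe.2 (Finset.mem_union_right _ hc))) hG
  have hprod : F1 * G1 = f.map (mapRingHom (algebraMap k A0)) := by
    apply Polynomial.map_injective (mapRingHom (A0.val : A0 →+* K)) (Polynomial.map_injective (A0.val : A0 →+* K) Subtype.val_injective)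
    change Polynomial.map (mapRingHom (A0.val : A0 →+* K)) _ = Polynomial.map (mapRingHom (A0.val : A0 →+* K)) _
    rw [Polynomial.map_mul, hF1, hG1, hFG, Polynomial.map_map, mapRingHom_comp]
    rfl
  obtain ⟨ρ⟩ := exists_point (k := k) (A := A0)
  have h3 := congrArg (Polynomial.map (mapRingHom (ρ : A0 →+* k))) hprod
  rw [Polynomial.map_mul, Polynomial.map_map, mapRingHom_comp] at h3
  have h4 : (ρ : A0 →+* k).comp (algebraMap k A0) = RingHom.id k := by
    ext x; exact ρ.commutes x
  rw [h4, mapRingHom_id, Polynomial.map_id] at h3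
  apply hirr.2 _ _ (hF1m.map _) (hG1m.map _) h3
  rw [hG1m.natDegree_map, hG1d]
  rwa [hf.natDegree_map] at hd

end QE
end

section
open Polynomial

namespace QE

noncomputable def evA {n : ℕ} {K : Type*} [CommRing K] (a : Fin n → K) : MvPolynomial (Fin n) ℤ →+* K :=
  MvPolynomial.eval₂Hom (Int.castRingHom K) a

lemma evA_comp {n : ℕ} {K L : Type*} [CommRing K] [CommRing L] (f : K →+* L) (a : Fin n → K) :
    f.comp (evA a) = evA (f ∘ a) := by
  unfold evA; ext i <;> simp

lemma evA_apply {n : ℕ} {K L : Type*} [CommRing K] [CommRing L] (f : K →+* L) (a : Fin n → K) (u) :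
    f (evA a u) = evA (f ∘ a) u := by rw [← evA_comp]; rfl

lemma base_field {n : ℕ} {K K' : Type*} [Field K] [Field K'] [CharZero K] (a : Fin n → K) (a' : Fin n → K')
    (h : ∀ u, evA a u = 0 ↔ evA a' u = 0) :
    ∃ (k : Type) (_ : Field k) (i : k →+* K) (i' : k →+* K') (α : Fin n → k), CharZero k ∧ i ∘ α = a ∧ i' ∘ α = a' ∧
      (∀ x : k, ∃ u w, evA α w ≠ 0 ∧ x * evA α w = evA α u) ∧
      (∀ p : k[X], ∃ c : k, c ≠ 0 ∧ ∃ g : (MvPolynomial (Fin n) ℤ)[X], C c * p = spec α g) := by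
  set P := RingHom.ker (evA a) with hP
  haveI : P.IsPrime := RingHom.ker_isPrime _
  let A := MvPolynomial (Fin n) ℤ ⧸ P
  let j : A →+* K := Ideal.Quotient.lift P (evA a) (fun u hu => hu)
  let j' : A →+* K' := Ideal.Quotient.lift P (evA a') (fun u hu => (h u).1 hu)
  have hj : Function.Injective j := by
    rw [injective_iff_map_eq_zero]
    intro x hx
    obtain ⟨u, rfl⟩ := Ideal.Quotient.mk_surjective x
    exact Ideal.Quotient.eq_zero_iff_mem.2 hx
  have hj' : Function.Injective j' := by
    rw [injective_iff_map_eq_zero]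
    intro x hx
    obtain ⟨u, rfl⟩ := Ideal.Quotient.mk_surjective x
    exact Ideal.Quotient.eq_zero_iff_mem.2 ((h u).2 hx)
  let k := FractionRing A
  let i : k →+* K := IsFractionRing.lift hj
  let i' : k →+* K' := IsFractionRing.lift hj'
  have hi : ∀ x, i (algebraMap A k x) = j x := fun x => IsFractionRing.lift_algebraMap hj x
  have hi' : ∀ x, i' (algebraMap A k x) = j' x := fun x => IsFractionRing.lift_algebraMap hj' x
  let α : Fin n → k := fun l => algebraMap A k (Ideal.Quotient.mk P (MvPolynomial.X l))
  have hα : evA α = (algebraMap A k).comp (Ideal.Quotient.mk P) := by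
    unfold evA; ext l <;> simp [α]
  refine ⟨k, inferInstance, i, i', α, ?_, ?_, ?_, ?_, ?_⟩
  · exact ⟨fun x y hxy => by
      have := congrArg i hxy
      rw [map_natCast, map_natCast] at this
      exact_mod_cast this⟩
  · funext l; simp only [Function.comp, α]; rw [hi]
    change evA a (MvPolynomial.X l) = a l
    simp [evA]
  · funext l; simp only [Function.comp, α]; rw [hi']
    change evA a' (MvPolynomial.X l) = a' l
    simp [evA]
  · intro x
    obtain ⟨p, q, hq, rfl⟩ := IsFractionRing.div_surjective (A := A) x
    obtain ⟨u, rfl⟩ := Ideal.Quotient.mk_surjective p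
    obtain ⟨w, rfl⟩ := Ideal.Quotient.mk_surjective q
    have hq0 : algebraMap A k (Ideal.Quotient.mk P w) ≠ 0 := by
      rw [map_ne_zero_iff _ (IsFractionRing.injective A k)]
      exact nonZeroDivisors.ne_zero hq
    refine ⟨u, w, ?_, ?_⟩
    · rw [hα]; exact hq0
    · rw [hα]; exact div_mul_cancel₀ _ hq0
  · intro p
    obtain ⟨b, hb, hb2⟩ := IsLocalization.integerNormalization_spec (nonZeroDivisors A) p
    refine ⟨algebraMap A k b, ?_, ?_⟩
    · rw [map_ne_zero_iff _ (IsFractionRing.injective A k)]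
      exact nonZeroDivisors.ne_zero hb
    · obtain ⟨g, hg⟩ := Polynomial.map_surjective (Ideal.Quotient.mk P) Ideal.Quotient.mk_surjective
        (IsLocalization.integerNormalization (nonZeroDivisors A) p)
      refine ⟨g, ?_⟩
      have : spec α g = g.map (evA α) := rfl
      rw [this, hα, ← Polynomial.map_map, hg, hb2, ← smul_eq_C_mul, algebraMap_smul]

end QE
end

section
open Polynomial

namespace QE

lemma minp {A K : Type*} [CommRing A] [IsDomain A] [IsIntegrallyClosed A] [Field K] (i : A →+* K)
    (hi : Function.Injective i) (y : K) (hy : i.IsIntegralElem y) :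
    ∃ f : A[X], f.Monic ∧ Irreducible f ∧ eval₂ i y f = 0 ∧ ∀ g, eval₂ i y g = 0 → f ∣ g := by
  letI := i.toAlgebra
  haveI : FaithfulSMul A K := (faithfulSMul_iff_algebraMap_injective A K).2 hi
  haveI : Module.IsTorsionFree A K := inferInstance
  have hy : IsIntegral A y := hy
  exact ⟨minpoly A y, minpoly.monic hy, minpoly.irreducible hy, minpoly.aeval A y,
    fun g hg => minpoly.isIntegrallyClosed_dvd hy hg⟩

/-- evaluation of bivariate polynomials through a coefficient map -/
noncomputable def ev {k K : Type*} [CommRing k] [CommRing K] (i : k →+* K) (x y : K) : k[X][X] →+* K :=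
  eval₂RingHom (eval₂RingHom i x) y

lemma ev_apply {k K : Type*} [CommRing k] [CommRing K] (i : k →+* K) (x y : K) (Z : k[X][X]) :
    ev i x y Z = eval₂ (eval₂RingHom i x) y Z := rfl

lemma ev_C {k K : Type*} [CommRing k] [CommRing K] (i : k →+* K) (x y : K) (p : k[X]) :
    ev i x y (C p) = eval₂ i x p := by simp [ev]

lemma ev_X {k K : Type*} [CommRing k] [CommRing K] (i : k →+* K) (x y : K) :
    ev i x y X = y := by simp [ev]

lemma ev_hom {k K L : Type*} [CommRing k] [CommRing K] [CommRing L] (i : k →+* K) (x y : K) (φ : K →+* L) (Z : k[X][X]) :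
    φ (ev i x y Z) = ev (φ.comp i) (φ x) (φ y) Z := by
  have : φ.comp (ev i x y) = ev (φ.comp i) (φ x) (φ y) := by
    ext <;> simp [ev]
  exact DFunLike.congr_fun this Z

lemma ev_map {k k' K : Type*} [CommRing k] [CommRing k'] [CommRing K] (i : k' →+* K) (j : k →+* k') (x y : K) (Z : k[X][X]) :
    ev i x y (Z.map (mapRingHom j)) = ev (i.comp j) x y Z := by
  have : (ev i x y).comp (mapRingHom (mapRingHom j)) = ev (i.comp j) x y := by
    ext <;> simp [ev]
  exact DFunLike.congr_fun this Z

open scoped IntermediateField.algebraAdjoinAdjoin in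
lemma rep {k K : Type*} [Field k] [Field K] [Algebra k K] [CharZero k] (b : K) (W : Finset K)
    (hW : ∀ w ∈ W, IsAlgebraic (IntermediateField.adjoin k {b}) w) :
    ∃ y : K, (eval₂RingHom (algebraMap k K) b).IsIntegralElem y ∧
      y ∈ IntermediateField.adjoin (IntermediateField.adjoin k {b}) (W : Set K) ∧
      ∀ r ∈ IntermediateField.adjoin (IntermediateField.adjoin k {b}) (W : Set K),
        ∃ (Z : k[X][X]) (δ : k[X]), eval₂ (algebraMap k K) b δ ≠ 0 ∧ r * eval₂ (algebraMap k K) b δ = ev (algebraMap k K) b y Z := by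
  set L := IntermediateField.adjoin k {b} with hL
  haveI : CharZero L := charZero_of_injective_algebraMap (algebraMap k L).injective
  set E := IntermediateField.adjoin L (W : Set K) with hE
  haveI : FiniteDimensional L E := IntermediateField.finiteDimensional_adjoin fun x hx => (hW x hx).isIntegral
  obtain ⟨θ, hθ⟩ := Field.exists_primitive_element L E
  have hθE : IntermediateField.adjoin L {(θ : K)} = E := by
    have := congrArg (IntermediateField.lift) hθ
    rwa [IntermediateField.lift_adjoin_simple, IntermediateField.lift_top] at this
  have halgL : IsAlgebraic L (θ : K) := (Algebra.IsAlgebraic.isAlgebraic θ).algebraMap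
  -- integral multiple
  obtain ⟨c, hc0, hc⟩ : ∃ c : k[X], eval₂ (algebraMap k K) b c ≠ 0 ∧
      (eval₂RingHom (algebraMap k K) b).IsIntegralElem (eval₂ (algebraMap k K) b c * θ) := by
    have h1 : IsAlgebraic (Algebra.adjoin k {b}) (θ : K) := by
      exact halgL.restrictScalars _
    obtain ⟨⟨z, hz⟩, hz0, hzi⟩ := h1.exists_integral_multiple
    obtain ⟨c, hc⟩ : ∃ c : k[X], aeval b c = z := by
      rw [Algebra.adjoin_singleton_eq_range_aeval] at hz
      exact hz
    refine ⟨c, ?_, ?_⟩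
    · change aeval b c ≠ 0
      rw [hc]
      intro h
      exact hz0 (Subtype.ext h)
    · obtain ⟨p, hp, hpe⟩ := hzi
      have hsurj : Function.Surjective (((aeval b : k[X] →ₐ[k] K).codRestrict (Algebra.adjoin k {b})
          (fun x => aeval_mem_adjoin_singleton k b) : k[X] →ₐ[k] _) : k[X] →+* Algebra.adjoin k {b}) := by
        rintro ⟨x, hx⟩
        have hx' := hx
        rw [Algebra.adjoin_singleton_eq_range_aeval] at hx'
        obtain ⟨q, hq⟩ := hx'
        exact ⟨q, Subtype.ext hq⟩
      obtain ⟨q, hq, -, hqm⟩ := lifts_and_natDegree_eq_and_monic ((mem_lifts _).2 (Polynomial.map_surjective _ hsurj p)) hp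
      refine ⟨q, hqm, ?_⟩
      rw [← hq, eval₂_map] at hpe
      have : eval₂ (algebraMap k K) b c * θ = (⟨z, hz⟩ : Algebra.adjoin k {b}) • (θ : K) := by
        change aeval b c * θ = _
        rw [hc]; rfl
      rw [this, ← hpe]
      rfl
  set y : K := eval₂ (algebraMap k K) b c * θ with hy
  have hcL : ∀ c : k[X], eval₂ (algebraMap k K) b c ∈ L := fun c => by
    have h1 : aeval b c ∈ Algebra.adjoin k {b} := aeval_mem_adjoin_singleton k b
    exact IntermediateField.algebra_adjoin_le_adjoin k {b} h1
  have hyE : y ∈ E := E.mul_mem (E.algebraMap_mem ⟨_, hcL c⟩) θ.2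
  have hyE' : E = IntermediateField.adjoin L {y} := by
    apply le_antisymm
    · rw [← hθE, IntermediateField.adjoin_simple_le_iff]
      have : (θ : K) = (algebraMap L K ⟨_, hcL c⟩)⁻¹ * y := by
        rw [hy]; change _ = (eval₂ (algebraMap k K) b c)⁻¹ * _
        field_simp
      rw [this]
      exact mul_mem (inv_mem (IntermediateField.algebraMap_mem _ _)) (IntermediateField.mem_adjoin_simple_self L y)
    · rw [IntermediateField.adjoin_simple_le_iff]; exact hyE
  have hyint : IsIntegral L y := by
    have h2 : IsAlgebraic L (⟨y, hyE⟩ : E) := Algebra.IsAlgebraic.isAlgebraic _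
    exact (h2.algebraMap (A := K)).isIntegral
  refine ⟨y, hc, hyE, fun r hr => ?_⟩
  rw [hyE'] at hr
  have hr' : r ∈ Algebra.adjoin L {y} := by
    rw [← IntermediateField.adjoin_simple_toSubalgebra_of_isAlgebraic hyint.isAlgebraic]; exact hr
  clear hr
  induction hr' using Algebra.adjoin_induction with
  | mem x hx =>
    rw [Set.mem_singleton_iff] at hx
    exact ⟨X, 1, by simp, by simp [ev_X, hx]⟩
  | algebraMap x =>
    obtain ⟨p, q, hq⟩ := (IntermediateField.mem_adjoin_simple_iff k (x : K)).1 x.2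
    by_cases hq0 : aeval b q = 0
    · refine ⟨0, 1, by simp, ?_⟩
      have : (algebraMap L K) x = 0 := by
        change (x : K) = 0
        rw [hq, hq0, div_zero]
      simp [this]
    · refine ⟨C p, q, hq0, ?_⟩
      rw [ev_C]
      change (x : K) * aeval b q = aeval b p
      rw [hq]; field_simp
  | add u w _ _ hu hw =>
    obtain ⟨Z1, δ1, h1, h1'⟩ := hu
    obtain ⟨Z2, δ2, h2, h2'⟩ := hw
    refine ⟨Z1 * C δ2 + Z2 * C δ1, δ1 * δ2, ?_, ?_⟩
    · rw [eval₂_mul]; exact mul_ne_zero h1 h2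
    · simp only [eval₂_mul, map_add, map_mul, ev_C, ← h1', ← h2']; ring
  | mul u w _ _ hu hw =>
    obtain ⟨Z1, δ1, h1, h1'⟩ := hu
    obtain ⟨Z2, δ2, h2, h2'⟩ := hw
    refine ⟨Z1 * Z2, δ1 * δ2, ?_, ?_⟩
    · rw [eval₂_mul]; exact mul_ne_zero h1 h2
    · simp only [eval₂_mul, map_mul, ← h1', ← h2']; ring

lemma periodic_fin {K : Type*} [Field K] (φ : K →+* K) (W : Finset K) (h : ∀ w ∈ W, φ w ∈ W) :
    ∃ m : ℕ, m ≠ 0 ∧ ∀ w ∈ W, φ^[m] w = w := by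
  classical
  let ψ : W → W := fun w => ⟨φ w, h w w.2⟩
  have hψ : Function.Injective ψ := fun x y hxy => Subtype.ext (φ.injective (congrArg Subtype.val hxy))
  let e : Equiv.Perm W := Equiv.ofBijective ψ (Finite.injective_iff_bijective.1 hψ)
  refine ⟨orderOf e, (orderOf_pos e).ne', fun w hw => ?_⟩
  have : ∀ m : ℕ, (((e ^ m) ⟨w, hw⟩ : W) : K) = φ^[m] w := by
    intro m
    induction m with
    | zero => rfl
    | succ n ih => rw [pow_succ', Function.iterate_succ_apply', ← ih]; rfl
  rw [← this, pow_orderOf_eq_one]; rfl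

end QE
end

section
open Polynomial

namespace QE

/-- the Stepanov-type property of a field with an endomorphism -/
def HasStep {K : Type*} [Field K] (φ : K →+* K) : Prop :=
  ∀ (f P : K[X][X]) (Δ : K[X]), f.Monic → Irreducible f → 0 < f.natDegree → Δ ≠ 0 →
    f ∣ ∑ j ∈ Finset.range (f.natDegree + 1), C (Δ ^ (f.natDegree - j) * (f.coeff j).map φ) * P ^ j →
    ∃ x0 y0 : K, φ x0 = x0 ∧ ev (RingHom.id K) x0 y0 f = 0 ∧ Δ.eval x0 ≠ 0 ∧
      Δ.eval x0 * φ y0 = ev (RingHom.id K) x0 y0 P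

/-- extend a tuple -/
def snoc1 {n : ℕ} {K : Type*} (a : Fin n → K) (b : K) : Fin (n + 1) → K := Fin.snoc (α := fun _ => K) a b

lemma snoc1_comp {n : ℕ} {K L : Type*} (f : K → L) (a : Fin n → K) (b : K) :
    f ∘ snoc1 a b = snoc1 (f ∘ a) (f b) := Fin.comp_snoc (α := K) (β := L) f a b

lemma root_mem {n : ℕ} {k0 K : Type*} [Field k0] [IsAlgClosed k0] [Field K] (i : k0 →+* K) (a : Fin n → k0)
    (g : (MvPolynomial (Fin n) ℤ)[X]) (h0 : spec (i ∘ a) g ≠ 0) (z : K) (hz : (spec (i ∘ a) g).eval z = 0) : z ∈ i.range := by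
  rw [← spec_map] at h0 hz
  apply (IsAlgClosed.splits (spec a g)).mem_range_of_isRoot (i := i) _ hz
  intro h
  simp [h] at h0

/-- the core algebraic data for transcendental b -/
lemma core {k k0 K K' : Type*} [Field k] [Field k0] [Field K] [Field K'] [IsAlgClosed k0] [CharZero k]
    (j : k →+* k0) (i0 : k0 →+* K) (φ0 : k0 →+* k0) (φ : K →+* K) (φ' : K' →+* K') (ι : k0 →+* K')
    (hC : HasStep φ') (b y : K) (hbt : Function.Injective (eval₂RingHom i0 b)) (hb : φ b = b)
    (hk : φ.comp (i0.comp j) = i0.comp j) (hk' : φ'.comp (ι.comp j) = ι.comp j)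
    (h0 : ∀ x, i0 (φ0 x) = φ (i0 x))
    (f : k0[X][X]) (hfm : f.Monic) (hfi : Irreducible f) (hf0 : ev i0 b y f = 0) (hfd : ∀ g, ev i0 b y g = 0 → f ∣ g)
    (v : ℕ) (hv : ∀ i l, φ' (ι ((f.coeff i).coeff l)) = ι (φ0^[v] ((f.coeff i).coeff l)))
    (P : k[X][X]) (Δ : k[X]) (hΔ0 : Δ ≠ 0)
    (hP : φ^[v] y * eval₂ (i0.comp j) b Δ = ev (i0.comp j) b y P) :
    ∃ (b' y' : K'), φ' b' = b' ∧ ev ι b' y' f = 0 ∧ eval₂ (ι.comp j) b' Δ ≠ 0 ∧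
      eval₂ (ι.comp j) b' Δ * φ' y' = ev (ι.comp j) b' y' P := by
  set Δ0 := Δ.map j with hΔ0'
  set P0 := P.map (mapRingHom j) with hP0
  have hpow : ∀ x, i0 ((φ0 ^ v) x) = (φ ^ v) (i0 x) := by
    intro x
    rw [RingHom.coe_pow, RingHom.coe_pow]
    generalize v = v'
    induction v' with
    | zero => rfl
    | succ n ih => rw [Function.iterate_succ_apply', Function.iterate_succ_apply', h0, ih]
  have hbv : (φ ^ v) b = b := by rw [RingHom.coe_pow]; exact Function.iterate_fixed hb v
  have hdiv : f ∣ ∑ j ∈ Finset.range (f.natDegree + 1), C (Δ0 ^ (f.natDegree - j) * (f.coeff j).map (φ0 ^ v)) * P0 ^ j := by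
    apply hfd
    have hPe : ev i0 b y P0 = eval₂ i0 b Δ0 * (φ ^ v) y := by
      rw [hP0, ev_map, ← hP, hΔ0', eval₂_map, RingHom.coe_pow, mul_comm]
    have hfe : ev i0 b y f = ∑ j ∈ Finset.range (f.natDegree + 1), eval₂ i0 b (f.coeff j) * y ^ j := by
      rw [ev_apply, eval₂_eq_sum_range]; rfl
    have hce : ∀ j, eval₂ i0 b ((f.coeff j).map (φ0 ^ v)) = (φ ^ v) (eval₂ i0 b (f.coeff j)) := by
      intro j
      rw [eval₂_map, hom_eval₂, hbv]
      congr 1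
      ext x; exact hpow x
    have : (φ ^ v) (ev i0 b y f) = 0 := by rw [hf0, map_zero]
    rw [hfe, map_sum] at this
    rw [map_sum]
    calc _ = ∑ j ∈ Finset.range (f.natDegree + 1), (eval₂ i0 b Δ0) ^ f.natDegree * ((φ ^ v) (eval₂ i0 b (f.coeff j) * y ^ j)) := by
          refine Finset.sum_congr rfl fun j hj => ?_
          rw [Finset.mem_range] at hj
          rw [map_mul, map_pow, ev_C, hPe, eval₂_mul, eval₂_pow, hce, map_mul, map_pow, mul_pow]
          have : f.natDegree = (f.natDegree - j) + j := by omega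
          conv_rhs => rw [this, pow_add]
          ring
      _ = 0 := by rw [← Finset.mul_sum, this, mul_zero]
  have hd : 0 < f.natDegree := by
    rcases Nat.eq_zero_or_pos f.natDegree with h | h
    · exfalso
      rw [hfm.natDegree_eq_zero.1 h] at hfi
      exact not_irreducible_one hfi
    · exact h
  have hdeg : (f.map (mapRingHom ι)).natDegree = f.natDegree := hfm.natDegree_map _
  obtain ⟨b', y', h1, h2, h3, h4⟩ := hC (f.map (mapRingHom ι)) (P0.map (mapRingHom ι)) (Δ0.map ι) (hfm.map _)
    (absirr ι f hfm hfi) (by rw [hdeg]; exact hd)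
    (Polynomial.map_ne_zero (Polynomial.map_ne_zero hΔ0)) (by
      have := map_dvd (mapRingHom (mapRingHom ι)) hdiv
      rw [map_sum] at this
      rw [hdeg]
      refine this.trans (dvd_of_eq ?_)
      refine Finset.sum_congr rfl fun l hl => ?_
      have hcc : ((f.coeff l).map (φ0 ^ v)).map ι = ((f.map (mapRingHom ι)).coeff l).map φ' := by
        ext c
        simp only [coeff_map, coe_mapRingHom]
        rw [hv, RingHom.coe_pow]
      rw [← hcc]
      simp)
  refine ⟨b', y', h1, ?_, ?_, ?_⟩
  · rwa [ev_map, RingHom.id_comp] at h2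
  · rw [hΔ0', map_map, eval_map] at h3; exact h3
  · rw [hΔ0', map_map, eval_map, ev_map, RingHom.id_comp, hP0, ev_map] at h4; exact h4

end QE
end

section
open Polynomial

namespace QE

lemma R_restrict {k K : Type*} [Field k] [Field K] [Algebra k K] (φ : K →ₐ[k] K) (k0 : IntermediateField k K) (hk0 : ∀ x, x ∈ k0 ↔ IsAlgebraic k x) (φ0 : k0 →ₐ[k] k0)
    (h0 : ∀ x, (φ0 x : K) = φ x) (p : k[X]) (hp : p ≠ 0) :
    (∃ z : k0, φ0 z = z ∧ aeval z p = 0) ↔ (∃ z : K, φ z = z ∧ aeval z p = 0) := by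
  constructor
  · rintro ⟨z, hz, hz0⟩
    refine ⟨z, by rw [← h0, hz], ?_⟩
    have := congrArg (algebraMap (k0) K) hz0
    rwa [← aeval_algebraMap_apply, map_zero] at this
  · rintro ⟨z, hz, hz0⟩
    have hz1 : z ∈ k0 := (hk0 _).2 ⟨p, hp, hz0⟩
    refine ⟨⟨z, hz1⟩, Subtype.ext ((h0 _).trans hz), ?_⟩
    apply (algebraMap (k0) K).injective
    rw [← aeval_algebraMap_apply, map_zero]
    exact hz0

variable {n : ℕ} {k K K' : Type*} [Field k] [Field K] [Field K'] [Algebra k K] [Algebra k K']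
    [CharZero k] [IsAlgClosed K] [IsAlgClosed K']

lemma step_alg (φ : K →ₐ[k] K) (φ' : K' →ₐ[k] K') 
    (R : ∀ p : k[X], p ≠ 0 → ((∃ z : K, φ z = z ∧ aeval z p = 0) ↔ (∃ z : K', φ' z = z ∧ aeval z p = 0)))
    (α : Fin n → k) (b : K) (hb : φ b = b) (hba : IsAlgebraic k b) (Γ : Finset (MvPolynomial (Fin (n + 1)) ℤ)[X])
    (k0 : IntermediateField k K) [IsAlgClosed k0] [Algebra.IsAlgebraic k k0] (hk0 : ∀ x, x ∈ k0 ↔ IsAlgebraic k x) (φ0 : k0 →ₐ[k] k0)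
    (h0 : ∀ x, (φ0 x : K) = φ x) (W : Finset K) (hW : ∀ g ∈ Γ, spec (snoc1 (algebraMap k K ∘ α) b) g ≠ 0 → 
      ∀ z, (spec (snoc1 (algebraMap k K ∘ α) b) g).eval z = 0 → z ∈ W) (m : ℕ) (hm : m ≠ 0) (hmW : ∀ w ∈ W, φ^[m] w = w) :
    ∃ b' : K', φ' b' = b' ∧ ∀ g ∈ Γ, ((∃ z, φ z = z ∧ (spec (snoc1 (algebraMap k K ∘ α) b) g).eval z = 0) ↔
      (∃ z, φ' z = z ∧ (spec (snoc1 (algebraMap k K' ∘ α) b') g).eval z = 0)) := by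
  classical
  have hbk : b ∈ k0 := (hk0 _).2 hba
  obtain ⟨ι, v, hv, hι⟩ := exists_emb φ0 φ' (fun p hp => (R_restrict φ k0 hk0 φ0 h0 p hp).trans (R p hp)) 
    ((insert b W).subtype (· ∈ k0)) m hm
  have hιb : φ' (ι ⟨b, hbk⟩) = ι ⟨b, hbk⟩ := by
    rw [hι ⟨b, hbk⟩ (by simp)]
    congr 1
    exact Function.iterate_fixed (Subtype.ext ((h0 _).trans hb)) v
  have hit : ∀ (v : ℕ) x, ((φ0^[v] x : k0) : K) = φ^[v] x := by
    intro v x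
    induction v with
    | zero => rfl
    | succ n ih => rw [Function.iterate_succ_apply', Function.iterate_succ_apply', h0, ih]
  refine ⟨ι ⟨b, hbk⟩, hιb, fun g hg => ?_⟩
  set a1 := snoc1 (algebraMap k K ∘ α) b with ha1
  have ha0 : (algebraMap k0 K) ∘ (snoc1 (algebraMap k k0 ∘ α) ⟨b, hbk⟩) = a1 := by
    rw [snoc1_comp]; rfl
  have hmem : ∀ z, spec a1 g ≠ 0 → (spec a1 g).eval z = 0 → z ∈ k0 := by
    intro z hz hz0
    rw [← ha0] at hz hz0
    obtain ⟨y, hy⟩ := root_mem (algebraMap k0 K) _ g hz z hz0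
    rw [← hy]; exact y.2
  have hroots : ∀ i, φ (a1 i) = a1 i := by
    intro i
    refine Fin.lastCases ?_ (fun i => ?_) i
    · simp [ha1, snoc1, hb]
    · simp [ha1, snoc1]
  refine pattern (φ : K →+* K) (φ' : K' →+* K') k0.toSubfield.toSubring (ι : k0 →+* K') a1 _ hroots ?_ m v hv g ?_ ?_ ?_
  · intro i
    refine ⟨?_, ?_⟩
    · rw [← ha0]; exact Subtype.property _
    · have h1 : snoc1 (algebraMap k K' ∘ α) (ι ⟨b, hbk⟩) = ι ∘ (snoc1 (algebraMap k k0 ∘ α) ⟨b, hbk⟩) := by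
        rw [snoc1_comp]
        congr 1
        funext i; simp
      rw [h1]
      change ι _ = ι _
      congr 1
      exact Subtype.ext (congrFun ha0 i).symm
  · have : spec a1 g = (spec (snoc1 (algebraMap k k0 ∘ α) ⟨b, hbk⟩) g).map (algebraMap k0 K) := by rw [spec_map, ha0]
    rw [this, leadingCoeff_map]
    exact k0.inv_mem (Subtype.property _)
  · intro z hz hz0
    have hzk := hmem z hz hz0
    have hzW := hW g hg hz z hz0
    refine ⟨hmW z hzW, hzk, ?_, ?_⟩
    · have := (φ0^[v] ⟨z, hzk⟩).2
      rw [hit] at this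
      exact this
    · have h2 := hι ⟨z, hzk⟩ (by simp [hzW])
      change ι _ = φ' (ι _)
      rw [h2]
      congr 1
      exact Subtype.ext (hit v ⟨z, hzk⟩).symm
  · intro z w hz hz0 hw0
    exact k0.inv_mem (k0.sub_mem (hmem z hz hz0) (hmem w hz hw0))

end QE
end

section
open Polynomial

namespace QE

variable {n : ℕ} {k K K' : Type*} [Field k] [Field K] [Field K'] [Algebra k K] [Algebra k K']
    [CharZero k] [IsAlgClosed K] [IsAlgClosed K']

lemma step_tr (φ : K →ₐ[k] K) (φ' : K' →ₐ[k] K') 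
    (R : ∀ p : k[X], p ≠ 0 → ((∃ z : K, φ z = z ∧ aeval z p = 0) ↔ (∃ z : K', φ' z = z ∧ aeval z p = 0)))
    (hC : HasStep (φ' : K' →+* K'))
    (α : Fin n → k) (b : K) (hb : φ b = b) (hbt : Transcendental k b) (Γ : Finset (MvPolynomial (Fin (n + 1)) ℤ)[X])
    (k0 : IntermediateField k K) [IsAlgClosed k0] [Algebra.IsAlgebraic k k0] (hk0 : ∀ x, x ∈ k0 ↔ IsAlgebraic k x) (φ0 : k0 →ₐ[k] k0)
    (h0 : ∀ x, (φ0 x : K) = φ x) (W : Finset K) (hW : ∀ g ∈ Γ, spec (snoc1 (algebraMap k K ∘ α) b) g ≠ 0 → 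
      ∀ z, (spec (snoc1 (algebraMap k K ∘ α) b) g).eval z = 0 → z ∈ W)
    (hW' : ∀ w ∈ W, φ w ∈ W)
    (hWa : ∀ w ∈ W, IsAlgebraic (IntermediateField.adjoin k {b}) w)
    (m : ℕ) (hm : m ≠ 0) (hmW : ∀ w ∈ W, φ^[m] w = w) :
    ∃ b' : K', φ' b' = b' ∧ ∀ g ∈ Γ, ((∃ z, φ z = z ∧ (spec (snoc1 (algebraMap k K ∘ α) b) g).eval z = 0) ↔
      (∃ z, φ' z = z ∧ (spec (snoc1 (algebraMap k K' ∘ α) b') g).eval z = 0)) := by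
  classical
  set a1 := snoc1 (algebraMap k K ∘ α) b with ha1
  obtain ⟨y, hyi, hyE, hrep⟩ := rep (k := k) b W hWa
  set L := IntermediateField.adjoin k {b} with hL
  set E := IntermediateField.adjoin L (W : Set K) with hE
  have hWE : ∀ w ∈ W, w ∈ E := fun w hw => IntermediateField.subset_adjoin L _ hw
  have hφL : ∀ x : L, φ (x : K) = x := by
    intro x
    obtain ⟨p, q, hq⟩ := (IntermediateField.mem_adjoin_simple_iff k (x : K)).1 x.2
    rw [hq, map_div₀, ← aeval_algHom_apply, ← aeval_algHom_apply, hb]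
  have hφE : ∀ x ∈ E, φ x ∈ E := by
    intro x hx
    induction hx using IntermediateField.adjoin_induction with
    | mem x hx => exact hWE _ (hW' x hx)
    | algebraMap x =>
      have : φ (algebraMap L K x) = algebraMap L K x := hφL x
      rw [this]; exact E.algebraMap_mem x
    | add x y _ _ h1 h2 => rw [map_add]; exact E.add_mem h1 h2
    | mul x y _ _ h1 h2 => rw [map_mul]; exact E.mul_mem h1 h2
    | inv x _ h1 => rw [map_inv₀]; exact E.inv_mem h1
  have hφvE : ∀ (v : ℕ), ∀ x ∈ E, φ^[v] x ∈ E := by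
    intro v x hx
    induction v with
    | zero => exact hx
    | succ n ih => rw [Function.iterate_succ_apply']; exact hφE _ ih
  have hφvW : ∀ (v : ℕ), ∀ x ∈ W, φ^[v] x ∈ W := by
    intro v x hx
    induction v with
    | zero => exact hx
    | succ n ih => rw [Function.iterate_succ_apply']; exact hW' _ ih
  have hspecE : ∀ g, ∀ i, (spec a1 g).coeff i ∈ E := by
    intro g i
    have h1 : a1 = (algebraMap L K) ∘ (snoc1 (algebraMap k L ∘ α) ⟨b, IntermediateField.mem_adjoin_simple_self k b⟩) := by
      rw [snoc1_comp]; rfl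
    rw [h1, ← spec_map, coeff_map]
    exact E.algebraMap_mem _
  have hrep' : ∀ r : K, ∃ (Z : k[X][X]) (δ : k[X]), r ∈ E → eval₂ (algebraMap k K) b δ ≠ 0 ∧
      r * eval₂ (algebraMap k K) b δ = ev (algebraMap k K) b y Z := by
    intro r
    by_cases hr : r ∈ E
    · obtain ⟨Z, δ, h1, h2⟩ := hrep r hr
      exact ⟨Z, δ, fun _ => ⟨h1, h2⟩⟩
    · exact ⟨0, 0, fun h => absurd h hr⟩
  choose Z δ hZ using hrep'
  let L0 : Finset K := W ∪ (W ×ˢ W).image (fun p => (p.1 - p.2)⁻¹) ∪ Γ.image (fun g => (spec a1 g).leadingCoeff⁻¹)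
  have hL0E : ∀ r ∈ L0, r ∈ E := by
    intro r hr
    simp only [L0, Finset.mem_union, Finset.mem_image, Finset.mem_product] at hr
    rcases hr with (hr | ⟨p, hp, rfl⟩) | ⟨g, hg, rfl⟩
    · exact hWE r hr
    · exact E.inv_mem (E.sub_mem (hWE _ hp.1) (hWE _ hp.2))
    · exact E.inv_mem (hspecE g _)
  let δ0 : k[X] := ∏ r ∈ L0, δ r
  have hδ0 : eval₂ (algebraMap k K) b δ0 ≠ 0 := by
    change (eval₂RingHom (algebraMap k K) b) δ0 ≠ 0
    rw [map_prod]
    exact Finset.prod_ne_zero_iff.2 fun r hr => (hZ r (hL0E r hr)).1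
  -- f
  set j := algebraMap k k0 with hj
  set i0 := algebraMap k0 K with hi0
  have hij : i0.comp j = algebraMap k K := (IsScalarTower.algebraMap_eq k k0 K).symm
  have hbt0 : Function.Injective (eval₂RingHom i0 b) := by
    have h1 : Transcendental k0 b := fun h => hbt (h.restrictScalars k)
    exact transcendental_iff_injective.1 h1
  obtain ⟨f, hfm, hfi, hf0, hfd⟩ := minp (eval₂RingHom i0 b) hbt0 y (by
    obtain ⟨p, hp, hpe⟩ := hyi
    refine ⟨p.map (mapRingHom j), hp.map _, ?_⟩
    have h1 := ev_map i0 j b y p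
    rw [hij] at h1
    exact h1.trans hpe)
  obtain ⟨ι, v, hv, hι⟩ := exists_emb φ0 φ' (fun p hp => (R_restrict φ k0 hk0 φ0 h0 p hp).trans (R p hp)) 
    (f.support.biUnion fun i => (f.coeff i).support.image fun l => (f.coeff i).coeff l) m hm
  have hιj : (ι : k0 →+* K').comp j = algebraMap k K' := ι.comp_algebraMap
  have hιc : ∀ i l, φ' (ι ((f.coeff i).coeff l)) = ι (φ0^[v] ((f.coeff i).coeff l)) := by
    intro i l
    by_cases hil : (f.coeff i).coeff l = 0
    · rw [hil, map_zero, map_zero, Function.iterate_fixed (map_zero φ0), map_zero]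
    · apply hι
      simp only [Finset.mem_biUnion, Finset.mem_image]
      refine ⟨i, ?_, l, mem_support_iff.2 hil, rfl⟩
      rw [mem_support_iff]
      rintro h
      rw [h] at hil
      exact hil (coeff_zero _)
  obtain ⟨P, δ1, hδ1, hP⟩ := hrep _ (hφvE v y hyE)
  set Δ : k[X] := δ0 * δ1 with hΔ
  have hΔb : eval₂ (algebraMap k K) b Δ ≠ 0 := by rw [hΔ, eval₂_mul]; exact mul_ne_zero hδ0 hδ1
  obtain ⟨b', y', hb', hf', hΔ', hP'⟩ := core j i0 (φ0 : k0 →+* k0) (φ : K →+* K) (φ' : K' →+* K') (ι : k0 →+* K') hC b y hbt0 hb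
    (by rw [hij]; exact φ.comp_algebraMap) (by rw [hιj]; exact φ'.comp_algebraMap) h0 f hfm hfi hf0 hfd v hιc (C δ0 * P) Δ
    (by rintro h; rw [h, eval₂_zero] at hΔb; exact hΔb rfl)
    (by rw [hij, map_mul, ev_C, hΔ, eval₂_mul]
        have : (φ : K →+* K)^[v] y = φ^[v] y := rfl
        rw [this, mul_left_comm, hP])
  rw [hιj] at hΔ' hP'
  refine ⟨b', hb', fun g hg => ?_⟩
  obtain ⟨T, π, hT⟩ := loc_ext (ev i0 b y) (ev (ι : k0 →+* K') b' y') (fun u hu => by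
    obtain ⟨w, rfl⟩ := hfd u hu
    rw [map_mul, hf', zero_mul])
  -- transfer for coefficients in k
  have hTk : ∀ (r : K) (u : k[X][X]) (w : k[X]), eval₂ (algebraMap k K') b' w ≠ 0 →
      r * eval₂ (algebraMap k K) b w = ev (algebraMap k K) b y u →
      ∃ hr : r ∈ T, π ⟨r, hr⟩ * eval₂ (algebraMap k K') b' w = ev (algebraMap k K') b' y' u := by
    intro r u w hw hr
    have e1 : ∀ w : k[X], ev i0 b y ((C w).map (mapRingHom j)) = eval₂ (algebraMap k K) b w := fun w => by rw [ev_map, hij, ev_C]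
    have e2 : ∀ w : k[X], ev (ι : k0 →+* K') b' y' ((C w).map (mapRingHom j)) = eval₂ (algebraMap k K') b' w := fun w => by
      rw [ev_map, hιj, ev_C]
    have := hT r (u.map (mapRingHom j)) ((C w).map (mapRingHom j)) (by rw [e2]; exact hw) (by rw [e1, hr, ev_map, hij])
    rwa [e2, ev_map, hιj] at this
  have hδr : ∀ r ∈ L0, eval₂ (algebraMap k K') b' (δ r) ≠ 0 := by
    intro r hr h
    apply hΔ'
    have : δ r ∣ Δ := (Finset.dvd_prod_of_mem δ hr).trans (dvd_mul_right _ _)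
    exact eval₂_eq_zero_of_dvd_of_eval₂_eq_zero _ _ this h
  have hL0T : ∀ r ∈ L0, ∃ hr : r ∈ T, π ⟨r, hr⟩ * eval₂ (algebraMap k K') b' (δ r) = ev (algebraMap k K') b' y' (Z r) := by
    intro r hr
    exact hTk r (Z r) (δ r) (hδr r hr) (hZ r (hL0E r hr)).2
  have hkT : ∀ c : k, ∃ hr : algebraMap k K c ∈ T, π ⟨_, hr⟩ = algebraMap k K' c := by
    intro c
    have := hTk (algebraMap k K c) (C (C c)) 1 (by simp) (by simp [ev_C])
    simpa [ev_C] using this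
  have hbT : ∃ hr : b ∈ T, π ⟨_, hr⟩ = b' := by
    have := hTk b (C X) 1 (by simp) (by simp [ev_C])
    simpa [ev_C] using this
  have hyT : ∃ hr : φ^[v] y ∈ T, π ⟨_, hr⟩ = φ' y' := by
    obtain ⟨hr, hr'⟩ := hTk (φ^[v] y) (C δ0 * P) Δ hΔ' (by rw [map_mul, ev_C, hΔ, eval₂_mul, mul_left_comm, hP])
    refine ⟨hr, ?_⟩
    rw [← hP', mul_comm] at hr'
    exact mul_left_cancel₀ hΔ' hr'
  obtain ⟨hbT, hbT'⟩ := hbT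
  obtain ⟨hyT, hyT'⟩ := hyT
  choose hkT hkT' using hkT
  let jT : k →+* T := (algebraMap k K).codRestrict T hkT
  have hjT : T.subtype.comp jT = algebraMap k K := rfl
  have hjT' : π.comp jT = algebraMap k K' := by ext c; exact hkT' c
  have hWT : ∀ z ∈ W, ∃ h : z ∈ T, ∃ h' : φ^[v] z ∈ T, π ⟨_, h'⟩ = φ' (π ⟨z, h⟩) := by
    intro z hz
    have hzL : z ∈ L0 := by simp [L0, hz]
    obtain ⟨h1, h2⟩ := hL0T z hzL
    obtain ⟨h3, -⟩ := hL0T (φ^[v] z) (by simp [L0, hφvW v z hz])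
    refine ⟨h1, h3, ?_⟩
    -- φ^v z * δ(b) = Z(b, φ^v y)
    have hbv : (φ ^ v) b = b := by rw [AlgHom.coe_pow]; exact Function.iterate_fixed hb v
    have h4 : φ^[v] z * eval₂ (algebraMap k K) b (δ z) = ev (algebraMap k K) b (φ^[v] y) (Z z) := by
      have h5 := congrArg ((φ ^ v : K →ₐ[k] K) : K →+* K) (hZ z (hL0E z hzL)).2
      have h6 : (((φ ^ v : K →ₐ[k] K) : K →+* K)).comp (algebraMap k K) = algebraMap k K := (φ ^ v).comp_algebraMap
      rw [map_mul, hom_eval₂, h6, ev_hom, h6] at h5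
      have h7 : ((φ ^ v : K →ₐ[k] K) : K →+* K) b = b := hbv
      rw [h7] at h5
      have h8 : ∀ x, ((φ ^ v : K →ₐ[k] K) : K →+* K) x = φ^[v] x := fun x => by
        change (φ ^ v) x = _
        rw [AlgHom.coe_pow]
      rw [h8, h8] at h5
      exact h5
    have h9 : (⟨_, h3⟩ : T) * eval₂ jT ⟨b, hbT⟩ (δ z) = ev jT ⟨b, hbT⟩ ⟨_, hyT⟩ (Z z) := by
      apply (show Function.Injective T.subtype from Subtype.val_injective)
      rw [map_mul, hom_eval₂, ev_hom, hjT]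
      exact h4
    have h10 := congrArg π h9
    rw [map_mul, hom_eval₂, ev_hom, hjT', hbT', hyT'] at h10
    have h11 := congrArg (φ' : K' →+* K') h2
    have h12 : (φ' : K' →+* K').comp (algebraMap k K') = algebraMap k K' := φ'.comp_algebraMap
    rw [map_mul, hom_eval₂, ev_hom, h12] at h11
    have h13 : (φ' : K' →+* K') b' = b' := hb'
    rw [h13] at h11
    exact mul_right_cancel₀ (hδr z hzL) (h10.trans h11.symm)
  refine pattern (φ : K →+* K) (φ' : K' →+* K') T π a1 _ ?_ ?_ m v hv g ?_ ?_ ?_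
  · intro i
    refine Fin.lastCases ?_ (fun i => ?_) i
    · simp [ha1, snoc1, hb]
    · simp [ha1, snoc1]
  · intro i
    refine Fin.lastCases ?_ (fun i => ?_) i
    · simp only [ha1, snoc1, Fin.snoc_last]; exact ⟨hbT, hbT'⟩
    · simp only [ha1, snoc1, Fin.snoc_castSucc]; exact ⟨hkT _, hkT' _⟩
  · exact (hL0T _ (by
      simp only [L0, Finset.mem_union, Finset.mem_image]
      exact Or.inr ⟨g, hg, rfl⟩)).1
  · intro z hz hz0
    have hzW := hW g hg hz z hz0
    exact ⟨hmW z hzW, hWT z hzW⟩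
  · intro z w hz hz0 hw0
    exact (hL0T _ (by
      simp only [L0, Finset.mem_union, Finset.mem_image, Finset.mem_product]
      exact Or.inl (Or.inr ⟨(z, w), ⟨hW g hg hz z hz0, hW g hg hz w hw0⟩, rfl⟩))).1

lemma fix_base {n : ℕ} {k K : Type*} [Field k] [Field K] (α : Fin n → k)
    (hfr : ∀ x : k, ∃ u w, evA α w ≠ 0 ∧ x * evA α w = evA α u) (φ : K →+* K) (i : k →+* K)
    (h : ∀ l, φ (i (α l)) = i (α l)) (x : k) : φ (i x) = i x := by
  obtain ⟨u, w, hw, hx⟩ := hfr x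
  have h1 : ∀ u, φ (i (evA α u)) = i (evA α u) := by
    intro u
    rw [evA_apply, evA_apply]
    congr 2
    funext l; exact h l
  have h2 := congrArg i hx
  have h3 := congrArg φ h2
  rw [h1, map_mul, map_mul, h1, ← h2, map_mul] at h3
  exact mul_right_cancel₀ ((map_ne_zero i).2 hw) h3

lemma aeval_base {n : ℕ} {k K : Type*} [Field k] [Field K] [Algebra k K] (α : Fin n → k) (p : k[X]) (c : k) (hc : c ≠ 0) (g)
    (hg : C c * p = spec α g) (z : K) : aeval z p = 0 ↔ (spec (algebraMap k K ∘ α) g).eval z = 0 := by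
  rw [← spec_map, ← hg, Polynomial.map_mul, eval_mul, map_C, eval_C, mul_eq_zero, or_iff_right ((_root_.map_ne_zero _).2 hc), eval_map]
  rfl

/-- the one-variable extension step -/
theorem step {n : ℕ} {K K' : Type*} [Field K] [Field K'] [CharZero K] [IsAlgClosed K] [IsAlgClosed K']
    (φ : K →+* K) (φ' : K' →+* K') (hC : HasStep φ') (a : Fin n → K) (a' : Fin n → K') (ha : ∀ i, φ (a i) = a i)
    (ha' : ∀ i, φ' (a' i) = a' i)
    (R : ∀ g, (∃ z, φ z = z ∧ (spec a g).eval z = 0) ↔ (∃ z, φ' z = z ∧ (spec a' g).eval z = 0))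
    (b : K) (hb : φ b = b) (Γ : Finset (MvPolynomial (Fin (n + 1)) ℤ)[X]) :
    ∃ b' : K', φ' b' = b' ∧ ∀ g ∈ Γ, ((∃ z, φ z = z ∧ (spec (snoc1 a b) g).eval z = 0) ↔
      (∃ z, φ' z = z ∧ (spec (snoc1 a' b') g).eval z = 0)) := by
  classical
  have hconst : ∀ u, evA a u = 0 ↔ evA a' u = 0 := by
    intro u
    have := R (C u)
    constructor
    · intro h
      obtain ⟨z, -, hz⟩ := this.1 ⟨0, map_zero φ, by rw [spec, map_C, eval_C]; exact h⟩
      rw [spec, map_C, eval_C] at hz; exact hz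
    · intro h
      obtain ⟨z, -, hz⟩ := this.2 ⟨0, map_zero φ', by rw [spec, map_C, eval_C]; exact h⟩
      rw [spec, map_C, eval_C] at hz; exact hz
  obtain ⟨k, _, i, i', α, hch, hia, hia', hfr, hpol⟩ := base_field a a' hconst
  letI := i.toAlgebra
  letI := i'.toAlgebra
  let φk : K →ₐ[k] K := ⟨φ, fix_base α hfr φ i (fun l => by have := ha l; rwa [← hia] at this)⟩
  let φk' : K' →ₐ[k] K' := ⟨φ', fix_base α hfr φ' i' (fun l => by have := ha' l; rwa [← hia'] at this)⟩
  have hroot : ∀ p : k[X], p ≠ 0 → ((∃ z : K, φk z = z ∧ aeval z p = 0) ↔ (∃ z : K', φk' z = z ∧ aeval z p = 0)) := by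
    intro p hp
    obtain ⟨c, hc, g, hg⟩ := hpol p
    have h1 := R g
    have e1 : ∀ z : K, aeval z p = 0 ↔ (spec a g).eval z = 0 := fun z => by
      rw [aeval_base α p c hc g hg z]
      have : algebraMap k K ∘ α = a := hia
      rw [this]
    have e2 : ∀ z : K', aeval z p = 0 ↔ (spec a' g).eval z = 0 := fun z => by
      rw [aeval_base α p c hc g hg z]
      have : algebraMap k K' ∘ α = a' := hia'
      rw [this]
    simp only [e1, e2]
    exact h1
  have hia : algebraMap k K ∘ α = a := hia
  have hia' : algebraMap k K' ∘ α = a' := hia'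
  subst hia
  subst hia'
  set a1 := snoc1 (algebraMap k K ∘ α) b with ha1
  have ha1f : ∀ l, φ (a1 l) = a1 l := by
    intro l
    refine Fin.lastCases ?_ (fun l => ?_) l
    · simp [ha1, snoc1, hb]
    · simpa [ha1, snoc1] using ha l
  haveI : IsAlgClosed (algebraicClosure k K) := IsAlgClosure.isAlgClosed k
  haveI : Algebra.IsAlgebraic k (algebraicClosure k K) := IsAlgClosure.isAlgebraic
  have hk0 : ∀ x, x ∈ algebraicClosure k K ↔ IsAlgebraic k x := fun x => mem_algebraicClosure_iff
  let φ0 : algebraicClosure k K →ₐ[k] algebraicClosure k K :=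
    (φk.comp (algebraicClosure k K).val).codRestrict (algebraicClosure k K).toSubalgebra (fun x => by
      have h1 : IsAlgebraic k (x : K) := (hk0 _).1 x.2
      exact (hk0 _).2 (h1.algHom φk))
  have h0 : ∀ x, (φ0 x : K) = φk x := fun x => rfl
  let W : Finset K := Γ.biUnion fun g => (spec a1 g).roots.toFinset
  have hWm : ∀ w, w ∈ W ↔ ∃ g ∈ Γ, spec a1 g ≠ 0 ∧ (spec a1 g).eval w = 0 := by
    intro w
    simp only [W, Finset.mem_biUnion, Multiset.mem_toFinset, mem_roots']
    rfl
  have hW' : ∀ w ∈ W, φ w ∈ W := by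
    intro w hw
    rw [hWm] at hw ⊢
    obtain ⟨g, hg, hg0, hw⟩ := hw
    refine ⟨g, hg, hg0, ?_⟩
    have h1 := congrArg φ hw
    rw [← eval₂_hom, ← eval_map, spec_map, map_zero] at h1
    have h2 : φ ∘ a1 = a1 := funext ha1f
    rwa [h2] at h1
  obtain ⟨m, hm, hmW⟩ := periodic_fin φ W hW'
  have hW : ∀ g ∈ Γ, spec a1 g ≠ 0 → ∀ z, (spec a1 g).eval z = 0 → z ∈ W := fun g hg hg0 z hz =>
    (hWm z).2 ⟨g, hg, hg0, hz⟩
  by_cases hba : IsAlgebraic k b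
  · exact step_alg φk φk' hroot α b hb hba Γ (algebraicClosure k K) hk0 φ0 h0 W hW m hm hmW
  · refine step_tr φk φk' hroot hC α b hb hba Γ (algebraicClosure k K) hk0 φ0 h0 W hW hW' ?_ m hm hmW
    intro w hw
    obtain ⟨g, hg, hg0, hw⟩ := (hWm w).1 hw
    have h1 : a1 = (algebraMap (IntermediateField.adjoin k {b}) K) ∘
        (snoc1 (algebraMap k (IntermediateField.adjoin k {b}) ∘ α) ⟨b, IntermediateField.mem_adjoin_simple_self k b⟩) := by
      rw [snoc1_comp]; rfl
    rw [h1, ← spec_map] at hg0 hw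
    rw [eval_map] at hw
    exact ⟨_, fun h => hg0 (by rw [h, Polynomial.map_zero]), hw⟩

end QE
end

section
open Polynomial Filter

namespace QE

lemma coeff_swap {R : Type*} [CommRing R] (p : R[X][X]) (i j : ℕ) : ((Bivariate.swap p).coeff i).coeff j = (p.coeff j).coeff i := by
  induction p using Polynomial.induction_on' with
  | add p q hp hq => simp [hp, hq]
  | monomial n f =>
    induction f using Polynomial.induction_on' with
    | add p q hp hq => simp only [map_add, coeff_add, hp, hq]
    | monomial m r =>
      rw [Bivariate.swap_monomial_monomial]
      simp only [coeff_monomial]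
      split_ifs <;> simp_all [coeff_monomial]

lemma swap_deg {R : Type*} [CommRing R] (p : R[X][X]) (D : ℕ) :
    (Bivariate.swap p).natDegree ≤ D ↔ ∀ j, (p.coeff j).natDegree ≤ D := by
  constructor
  · intro h j
    rw [natDegree_le_iff_coeff_eq_zero]
    intro N hN
    rw [← coeff_swap, coeff_eq_zero_of_natDegree_lt (lt_of_le_of_lt h hN), coeff_zero]
  · intro h
    rw [natDegree_le_iff_coeff_eq_zero]
    intro N hN
    ext j
    rw [coeff_swap, coeff_zero]
    exact coeff_eq_zero_of_natDegree_lt (lt_of_le_of_lt (h j) hN)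

lemma factor_deg {R : Type*} [CommRing R] [IsDomain R] (A B F : R[X][X]) (h : A * B = F) (hF : F ≠ 0) (D : ℕ)
    (hD : ∀ j, (F.coeff j).natDegree ≤ D) (j : ℕ) : (A.coeff j).natDegree ≤ D := by
  revert j
  rw [← swap_deg] at hD ⊢
  have h1 : Bivariate.swap A * Bivariate.swap B = Bivariate.swap F := by rw [← map_mul, h]
  have h2 : Bivariate.swap F ≠ 0 := (map_ne_zero_iff _ Bivariate.swap.injective).2 hF
  rw [← h1] at h2
  have h3 := natDegree_mul (left_ne_zero_of_mul h2) (right_ne_zero_of_mul h2)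
  rw [h1] at h3
  omega

section UP

variable (K : ℕ → Type) [∀ i, Field (K i)] (U : Ultrafilter ℕ)

/-- the ideal of sequences vanishing along U -/
def uI : Ideal (∀ i, K i) where
  carrier := {x | ∀ᶠ i in (U : Filter ℕ), x i = 0}
  add_mem' := by
    intro x y hx hy
    filter_upwards [hx, hy] with i h1 h2
    rw [Pi.add_apply, h1, h2, add_zero]
  zero_mem' := Eventually.of_forall fun i => rfl
  smul_mem' := by
    intro c x hx
    filter_upwards [hx] with i h1
    rw [smul_eq_mul, Pi.mul_apply, h1, mul_zero]

instance uI_max : (uI K U).IsMaximal := by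
  classical
  rw [Ideal.isMaximal_iff]
  constructor
  · intro h
    have h : ∀ᶠ i in (U : Filter ℕ), (1 : ∀ i, K i) i = 0 := h
    obtain ⟨i, hi⟩ := h.exists
    exact one_ne_zero hi
  · intro J x hJ hx hxJ
    have hx' : ∀ᶠ i in (U : Filter ℕ), x i ≠ 0 := by
      rw [← Ultrafilter.frequently_iff_eventually]
      exact fun h => hx (h.mono fun i hi => not_not.1 hi)
    have h1 : (1 - x⁻¹ * x : ∀ i, K i) ∈ uI K U := by
      change ∀ᶠ i in (U : Filter ℕ), (1 - x⁻¹ * x : ∀ i, K i) i = 0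
      filter_upwards [hx'] with i hi
      simp [hi]
    have h2 : (1 : ∀ i, K i) = (1 - x⁻¹ * x) + x⁻¹ * x := by ring
    rw [h2]
    exact J.add_mem (hJ h1) (J.mul_mem_left _ hxJ)

/-- the ultraproduct -/
abbrev UP := (∀ i, K i) ⧸ uI K U

noncomputable instance : Field (UP K U) := Ideal.Quotient.field (uI K U)

/-- the projection -/
noncomputable def mk : (∀ i, K i) →+* UP K U := Ideal.Quotient.mk (uI K U)

lemma mk_surj : Function.Surjective (mk K U) := Ideal.Quotient.mk_surjective

lemma mk_zero (x : ∀ i, K i) : mk K U x = 0 ↔ ∀ᶠ i in (U : Filter ℕ), x i = 0 := Ideal.Quotient.eq_zero_iff_mem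

lemma mk_eq (x y : ∀ i, K i) : mk K U x = mk K U y ↔ ∀ᶠ i in (U : Filter ℕ), x i = y i := by
  rw [← sub_eq_zero, ← map_sub, mk_zero]
  simp [sub_eq_zero]

lemma eval_mk (F : (∀ i, K i)[X]) (x : ∀ i, K i) : (F.map (mk K U)).eval (mk K U x) = mk K U (F.eval x) := by
  rw [eval_map, eval₂_hom]

lemma eval_pi (F : (∀ i, K i)[X]) (x : ∀ i, K i) (i : ℕ) : F.eval x i = (F.map (Pi.evalRingHom K i)).eval (x i) := by
  have := (eval_map (Pi.evalRingHom K i) (p := F) (Pi.evalRingHom K i x)).trans (eval₂_hom (p := F) (Pi.evalRingHom K i) x)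
  exact this.symm

instance [∀ i, IsAlgClosed (K i)] : IsAlgClosed (UP K U) := by
  apply IsAlgClosed.of_exists_root
  intro p hp hirr
  obtain ⟨F, hF, hFd, hFm⟩ := lifts_and_natDegree_eq_and_monic ((mem_lifts _).2 (Polynomial.map_surjective _ (mk_surj K U) p)) hp
  have hroot : ∀ i, ∃ x : K i, (F.map (Pi.evalRingHom K i)).eval x = 0 := by
    intro i
    apply IsAlgClosed.exists_root
    rw [degree_eq_natDegree (hFm.map _).ne_zero, hFm.natDegree_map, hFd]
    have := hirr.natDegree_pos
    exact_mod_cast this.ne'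
  choose x hx using hroot
  refine ⟨mk K U x, ?_⟩
  rw [← hF]
  change (F.map (mk K U)).eval _ = 0
  rw [eval_mk, mk_zero]
  exact Eventually.of_forall fun i => by rw [eval_pi]; exact hx i

lemma UP_charZero (h : ∀ N : ℕ, N ≠ 0 → ∀ᶠ i in (U : Filter ℕ), (N : K i) ≠ 0) : CharZero (UP K U) := by
  apply charZero_of_inj_zero
  intro N hN
  by_contra hne
  have h1 : mk K U (N : ∀ i, K i) = 0 := by rw [map_natCast]; exact hN
  rw [mk_zero] at h1
  obtain ⟨i, h2, h3⟩ := (h1.and (h N hne)).exists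
  exact h3 h2

variable {K} (φ : ∀ i, K i →+* K i)

/-- product endomorphism -/
def piφ : (∀ i, K i) →+* (∀ i, K i) := Pi.ringHom fun i => (φ i).comp (Pi.evalRingHom K i)

lemma piφ_apply (x : ∀ i, K i) (i : ℕ) : piφ φ x i = φ i (x i) := rfl

/-- induced endomorphism of the ultraproduct -/
noncomputable def uφ : UP K U →+* UP K U :=
  Ideal.Quotient.lift (uI K U) ((mk K U).comp (piφ φ)) (fun x hx => by
    rw [RingHom.comp_apply, mk_zero]
    have hx : ∀ᶠ i in (U : Filter ℕ), x i = 0 := hx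
    filter_upwards [hx] with i hi
    rw [piφ_apply, hi, map_zero])

lemma uφ_mk (x : ∀ i, K i) : uφ U φ (mk K U x) = mk K U (piφ φ x) := rfl

lemma uφ_fix (x : ∀ i, K i) : uφ U φ (mk K U x) = mk K U x ↔ ∀ᶠ i in (U : Filter ℕ), φ i (x i) = x i := by
  rw [uφ_mk, mk_eq]; rfl

lemma pattern_UP {n : ℕ} (a : ∀ i, Fin n → K i) (g : (MvPolynomial (Fin n) ℤ)[X]) :
    (∃ z, uφ U φ z = z ∧ (spec (fun l => mk K U (fun i => a i l)) g).eval z = 0) ↔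
      ∀ᶠ i in (U : Filter ℕ), ∃ z, φ i z = z ∧ (spec (a i) g).eval z = 0 := by
  have h1 : spec (fun l => mk K U (fun i => a i l)) g = (spec (fun l i => a i l) g).map (mk K U) := by
    rw [spec_map]; rfl
  have h2 : ∀ i, (spec (fun l i => a i l) g).map (Pi.evalRingHom K i) = spec (a i) g := by
    intro i; rw [spec_map]; rfl
  constructor
  · rintro ⟨z, hz, hz0⟩
    obtain ⟨x, rfl⟩ := mk_surj K U z
    rw [h1, eval_mk, mk_zero] at hz0
    rw [uφ_fix] at hz
    filter_upwards [hz, hz0] with i h3 h4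
    rw [eval_pi, h2] at h4
    exact ⟨x i, h3, h4⟩
  · intro h
    classical
    let x : ∀ i, K i := fun i => if hi : ∃ z, φ i z = z ∧ (spec (a i) g).eval z = 0 then hi.choose else 0
    refine ⟨mk K U x, ?_, ?_⟩
    · rw [uφ_fix]
      filter_upwards [h] with i hi
      simp only [x, dif_pos hi]
      exact hi.choose_spec.1
    · rw [h1, eval_mk, mk_zero]
      filter_upwards [h] with i hi
      rw [eval_pi, h2]
      simp only [x, dif_pos hi]
      exact hi.choose_spec.2

end UP
end QE
end

section
open Polynomial Filter

namespace QE

/-- bounded step property -/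
def StepD {K : Type*} [Field K] (φ : K →+* K) (D : ℕ) : Prop :=
  ∀ (f P : K[X][X]) (Δ : K[X]), f.Monic → Irreducible f → 0 < f.natDegree → f.natDegree ≤ D →
    (∀ j, (f.coeff j).natDegree ≤ D) → P.natDegree ≤ D → (∀ j, (P.coeff j).natDegree ≤ D) → Δ ≠ 0 → Δ.natDegree ≤ D →
    f ∣ ∑ j ∈ Finset.range (f.natDegree + 1), C (Δ ^ (f.natDegree - j) * (f.coeff j).map φ) * P ^ j →
    ∃ x0 y0 : K, φ x0 = x0 ∧ ev (RingHom.id K) x0 y0 f = 0 ∧ Δ.eval x0 ≠ 0 ∧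
      Δ.eval x0 * φ y0 = ev (RingHom.id K) x0 y0 P

lemma inner_bound {R : Type*} [CommRing R] (F : R[X][X]) : ∃ D, ∀ j, (F.coeff j).natDegree ≤ D :=
  ⟨(Bivariate.swap F).natDegree, (swap_deg F _).1 le_rfl⟩

section
variable {K : ℕ → Type} [∀ i, Field (K i)] (U : Ultrafilter ℕ)

lemma zero1 (F : (∀ i, K i)[X]) : F.map (mk K U) = 0 ↔ ∀ᶠ i in (U : Filter ℕ), F.map (Pi.evalRingHom K i) = 0 := by
  constructor
  · intro h
    have h1 : ∀ l ∈ Finset.range (F.natDegree + 1), ∀ᶠ i in (U : Filter ℕ), F.coeff l i = 0 := by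
      intro l _
      rw [← mk_zero, ← coeff_map, h, coeff_zero]
    rw [← eventually_all_finset] at h1
    filter_upwards [h1] with i hi
    ext l
    rw [coeff_map, coeff_zero]
    by_cases hl : l < F.natDegree + 1
    · exact hi l (Finset.mem_range.2 hl)
    · rw [coeff_eq_zero_of_natDegree_lt (by omega), map_zero]
  · intro h
    ext l
    rw [coeff_map, coeff_zero, mk_zero]
    filter_upwards [h] with i hi
    have := congrArg (fun q => coeff q l) hi
    simpa using this

lemma zero2 (F : (∀ i, K i)[X][X]) : F.map (mapRingHom (mk K U)) = 0 ↔
    ∀ᶠ i in (U : Filter ℕ), F.map (mapRingHom (Pi.evalRingHom K i)) = 0 := by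
  constructor
  · intro h
    have h1 : ∀ l ∈ Finset.range (F.natDegree + 1), ∀ᶠ i in (U : Filter ℕ), (F.coeff l).map (Pi.evalRingHom K i) = 0 := by
      intro l _
      rw [← zero1, ← coe_mapRingHom, ← coeff_map, h, coeff_zero]
    rw [← eventually_all_finset] at h1
    filter_upwards [h1] with i hi
    ext l : 1
    rw [coeff_map, coeff_zero]
    by_cases hl : l < F.natDegree + 1
    · exact hi l (Finset.mem_range.2 hl)
    · rw [coeff_eq_zero_of_natDegree_lt (by omega), map_zero]
  · intro h
    ext l : 1
    rw [coeff_map, coeff_zero, coe_mapRingHom, zero1]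
    filter_upwards [h] with i hi
    have := congrArg (fun q => coeff q l) hi
    simpa using this

lemma eq2 (F G : (∀ i, K i)[X][X]) : F.map (mapRingHom (mk K U)) = G.map (mapRingHom (mk K U)) ↔
    ∀ᶠ i in (U : Filter ℕ), F.map (mapRingHom (Pi.evalRingHom K i)) = G.map (mapRingHom (Pi.evalRingHom K i)) := by
  rw [← sub_eq_zero, ← Polynomial.map_sub, zero2]
  simp only [Polynomial.map_sub, sub_eq_zero]

lemma assemble (d D : ℕ) (A : ∀ i, (K i)[X][X]) : ∃ A' : (∀ i, K i)[X][X], ∀ i, (A i).natDegree ≤ d →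
    (∀ j, ((A i).coeff j).natDegree ≤ D) → A'.map (mapRingHom (Pi.evalRingHom K i)) = A i := by
  refine ⟨∑ j ∈ Finset.range (d+1), monomial j (∑ l ∈ Finset.range (D+1), monomial l (fun i => ((A i).coeff j).coeff l)), ?_⟩
  intro i h1 h2
  rw [Polynomial.map_sum]
  rw [as_sum_range' (A i) (d+1) (by omega)]
  refine Finset.sum_congr rfl fun j hj => ?_
  rw [map_monomial]
  congr 1
  rw [coe_mapRingHom, Polynomial.map_sum]
  conv_rhs => rw [as_sum_range' ((A i).coeff j) (D+1) (by have := h2 j; omega)]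
  refine Finset.sum_congr rfl fun l hl => ?_
  rw [map_monomial]
  rfl

lemma irr_transfer (F : (∀ i, K i)[X][X]) (hF : F.Monic) (hirr : Irreducible (F.map (mapRingHom (mk K U)))) :
    ∀ᶠ i in (U : Filter ℕ), Irreducible (F.map (mapRingHom (Pi.evalRingHom K i))) := by
  classical
  by_contra hcon
  rw [← Ultrafilter.eventually_not] at hcon
  have hd : 0 < F.natDegree := by
    have h1 := hirr.not_isUnit
    by_contra h0
    have : F.natDegree = 0 := by omega
    rw [hF.natDegree_eq_zero] at this
    rw [this] at h1
    simp at h1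
  obtain ⟨D, hD⟩ := inner_bound F
  have h1 : ∀ i, ∃ A B : (K i)[X][X], ¬ Irreducible (F.map (mapRingHom (Pi.evalRingHom K i))) →
      A.Monic ∧ B.Monic ∧ A * B = F.map (mapRingHom (Pi.evalRingHom K i)) ∧ A.natDegree ≠ 0 ∧ B.natDegree ≠ 0 := by
    intro i
    by_cases h : Irreducible (F.map (mapRingHom (Pi.evalRingHom K i)))
    · exact ⟨0, 0, fun h' => absurd h h'⟩
    · have hm := hF.map (mapRingHom (Pi.evalRingHom K i))
      have hne : F.map (mapRingHom (Pi.evalRingHom K i)) ≠ 1 := by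
        intro h1
        have := hF.natDegree_map (mapRingHom (Pi.evalRingHom K i))
        rw [h1, natDegree_one] at this
        omega
      rw [hm.irreducible_iff_natDegree] at h
      push Not at h
      obtain ⟨A, B, hA, hB, hAB, h3, h4⟩ := h hne
      exact ⟨A, B, fun _ => ⟨hA, hB, hAB, h3, h4⟩⟩
  choose A B hAB using h1
  obtain ⟨A', hA'⟩ := assemble F.natDegree D A
  obtain ⟨B', hB'⟩ := assemble F.natDegree D B
  have hDi : ∀ i j, ((F.map (mapRingHom (Pi.evalRingHom K i))).coeff j).natDegree ≤ D := by
    intro i j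
    rw [coeff_map]
    exact (natDegree_map_le).trans (hD j)
  have hA2 : ∀ᶠ i in (U : Filter ℕ), A'.map (mapRingHom (Pi.evalRingHom K i)) = A i := by
    filter_upwards [hcon] with i hi
    obtain ⟨ha, hb, hab, h3, h4⟩ := hAB i hi
    apply hA'
    · have := ha.natDegree_mul hb
      rw [hab, hF.natDegree_map] at this
      omega
    · exact factor_deg _ _ _ hab (hF.map _).ne_zero D (hDi i)
  have hB2 : ∀ᶠ i in (U : Filter ℕ), B'.map (mapRingHom (Pi.evalRingHom K i)) = B i := by
    filter_upwards [hcon] with i hi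
    obtain ⟨ha, hb, hab, h3, h4⟩ := hAB i hi
    apply hB'
    · have := ha.natDegree_mul hb
      rw [hab, hF.natDegree_map] at this
      omega
    · exact factor_deg _ _ _ ((mul_comm _ _).trans hab) (hF.map _).ne_zero D (hDi i)
  have hmul : (A' * B').map (mapRingHom (mk K U)) = F.map (mapRingHom (mk K U)) := by
    rw [eq2]
    filter_upwards [hA2, hB2, hcon] with i ha hb hi
    rw [Polynomial.map_mul, ha, hb]
    exact (hAB i hi).2.2.1
  have key : ∀ (A' : (∀ i, K i)[X][X]) (A : ∀ i, (K i)[X][X]), (∀ᶠ i in (U : Filter ℕ), A'.map (mapRingHom (Pi.evalRingHom K i)) = A i) →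
      (∀ᶠ i in (U : Filter ℕ), (A i).natDegree ≠ 0) → ¬ IsUnit (A'.map (mapRingHom (mk K U))) := by
    intro A' A h1 h2 h3
    have h4 := eq_C_of_natDegree_eq_zero (natDegree_eq_zero_of_isUnit h3)
    rw [coeff_map, ← map_C, eq2] at h4
    obtain ⟨i, h5, h6, h7⟩ := (h1.and (h2.and h4)).exists
    rw [← h5, h7, map_C, natDegree_C] at h6
    exact h6 rfl
  rw [← hmul, Polynomial.map_mul] at hirr
  rcases hirr.isUnit_or_isUnit rfl with h | h
  · exact key A' A hA2 (hcon.mono fun i hi => (hAB i hi).2.2.2.1) h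
  · exact key B' B hB2 (hcon.mono fun i hi => (hAB i hi).2.2.2.2) h

lemma ev_mk (F : (∀ i, K i)[X][X]) (x y : ∀ i, K i) : ev (RingHom.id _) (mk K U x) (mk K U y) (F.map (mapRingHom (mk K U)))
    = mk K U (ev (RingHom.id _) x y F) := by
  rw [ev_map, ev_hom]; rfl

lemma ev_pi (F : (∀ i, K i)[X][X]) (x y : ∀ i, K i) (i : ℕ) : ev (RingHom.id _) x y F i =
    ev (RingHom.id _) (x i) (y i) (F.map (mapRingHom (Pi.evalRingHom K i))) := by
  rw [ev_map]
  exact ev_hom (RingHom.id _) x y (Pi.evalRingHom K i) F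

theorem hasStep_UP (φ : ∀ i, K i →+* K i) (h : ∀ D, ∀ᶠ i in (U : Filter ℕ), StepD (φ i) D) : HasStep (uφ U φ) := by
  classical
  intro f P Δ hf hirr hd hΔ hdvd
  have hsurj : Function.Surjective (mapRingHom (mk K U)) := Polynomial.map_surjective _ (mk_surj K U)
  obtain ⟨F, hFf, hFd, hFm⟩ := lifts_and_natDegree_eq_and_monic ((mem_lifts _).2 (Polynomial.map_surjective _ hsurj f)) hf
  obtain ⟨P', rfl⟩ := Polynomial.map_surjective _ hsurj P
  obtain ⟨Δ', rfl⟩ := hsurj Δ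
  obtain ⟨h', hh⟩ := hdvd
  obtain ⟨H, rfl⟩ := Polynomial.map_surjective _ hsurj h'
  subst hFf
  obtain ⟨D1, hD1⟩ := inner_bound F
  obtain ⟨D2, hD2⟩ := inner_bound P'
  set D := D1 + D2 + F.natDegree + P'.natDegree + Δ'.natDegree with hDdef
  have e1 := irr_transfer U F hFm hirr
  have e2 : ∀ᶠ i in (U : Filter ℕ), Δ'.map (Pi.evalRingHom K i) ≠ 0 := by
    rw [Ultrafilter.eventually_not, ← zero1]; exact hΔ
  have e3 : (∑ j ∈ Finset.range (F.natDegree + 1), C (Δ' ^ (F.natDegree - j) * (F.coeff j).map (piφ φ)) * P' ^ j).map (mapRingHom (mk K U))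
      = (F * H).map (mapRingHom (mk K U)) := by
    rw [Polynomial.map_mul, ← hh, Polynomial.map_sum, hFd]
    refine Finset.sum_congr rfl fun j hj => ?_
    rw [Polynomial.map_mul, Polynomial.map_pow, map_C, map_mul, map_pow]
    congr 4
    rw [coeff_map, coe_mapRingHom, Polynomial.map_map, Polynomial.map_map]
    rfl
  rw [eq2] at e3
  have main : ∀ᶠ i in (U : Filter ℕ), ∃ x0 y0 : K i, φ i x0 = x0 ∧ ev (RingHom.id _) x0 y0 (F.map (mapRingHom (Pi.evalRingHom K i))) = 0 ∧
     (Δ'.map (Pi.evalRingHom K i)).eval x0 ≠ 0 ∧ (Δ'.map (Pi.evalRingHom K i)).eval x0 * φ i y0 = ev (RingHom.id _) x0 y0 (P'.map (mapRingHom (Pi.evalRingHom K i))) := by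
    filter_upwards [h D, e1, e2, e3] with i hi hi1 hi2 hi3
    apply hi _ _ _ (hFm.map _) hi1
    · rw [hFm.natDegree_map]; omega
    · rw [hFm.natDegree_map]; omega
    · intro j; rw [coeff_map]; refine natDegree_map_le.trans ((hD1 j).trans (by omega))
    · refine natDegree_map_le.trans (by omega)
    · intro j; rw [coeff_map]; refine natDegree_map_le.trans ((hD2 j).trans (by omega))
    · exact hi2
    · refine natDegree_map_le.trans (by omega)
    · refine ⟨H.map (mapRingHom (Pi.evalRingHom K i)), ?_⟩
      rw [← Polynomial.map_mul, ← hi3, Polynomial.map_sum, hFm.natDegree_map]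
      refine Finset.sum_congr rfl fun j hj => ?_
      rw [Polynomial.map_mul, Polynomial.map_pow, map_C, map_mul (mapRingHom _), map_pow (mapRingHom _)]
      have hc : ((F.map (mapRingHom (Pi.evalRingHom K i))).coeff j).map (φ i) =
          mapRingHom (Pi.evalRingHom K i) ((F.coeff j).map (piφ φ)) := by
        rw [coeff_map, coe_mapRingHom, Polynomial.map_map, Polynomial.map_map]
        rfl
      rw [hc]
      rfl
  have main2 : ∀ i, ∃ x0 y0 : K i, (∃ x0 y0 : K i, φ i x0 = x0 ∧ ev (RingHom.id _) x0 y0 (F.map (mapRingHom (Pi.evalRingHom K i))) = 0 ∧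
     (Δ'.map (Pi.evalRingHom K i)).eval x0 ≠ 0 ∧ (Δ'.map (Pi.evalRingHom K i)).eval x0 * φ i y0 = ev (RingHom.id _) x0 y0 (P'.map (mapRingHom (Pi.evalRingHom K i)))) →
     φ i x0 = x0 ∧ ev (RingHom.id _) x0 y0 (F.map (mapRingHom (Pi.evalRingHom K i))) = 0 ∧
     (Δ'.map (Pi.evalRingHom K i)).eval x0 ≠ 0 ∧ (Δ'.map (Pi.evalRingHom K i)).eval x0 * φ i y0 = ev (RingHom.id _) x0 y0 (P'.map (mapRingHom (Pi.evalRingHom K i))) := by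
    intro i
    by_cases hex : (∃ x0 y0 : K i, φ i x0 = x0 ∧ ev (RingHom.id _) x0 y0 (F.map (mapRingHom (Pi.evalRingHom K i))) = 0 ∧
     (Δ'.map (Pi.evalRingHom K i)).eval x0 ≠ 0 ∧ (Δ'.map (Pi.evalRingHom K i)).eval x0 * φ i y0 = ev (RingHom.id _) x0 y0 (P'.map (mapRingHom (Pi.evalRingHom K i))))
    · obtain ⟨x0, y0, h⟩ := hex
      exact ⟨x0, y0, fun _ => h⟩
    · exact ⟨0, 0, fun h => absurd h hex⟩
  choose x y hxy using main2
  refine ⟨mk K U x, mk K U y, ?_, ?_, ?_, ?_⟩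
  · rw [uφ_fix]
    filter_upwards [main] with i hi using (hxy i hi).1
  · change ev (RingHom.id _) (mk K U x) (mk K U y) (F.map (mapRingHom (mk K U))) = 0
    rw [ev_mk, mk_zero]
    filter_upwards [main] with i hi
    rw [ev_pi]; exact (hxy i hi).2.1
  · rw [coe_mapRingHom, eval_mk, Ne, mk_zero, ← Ultrafilter.eventually_not]
    filter_upwards [main] with i hi
    rw [eval_pi]; exact (hxy i hi).2.2.1
  · rw [coe_mapRingHom, eval_mk, uφ_mk, ← map_mul]
    change _ = ev (RingHom.id _) (mk K U x) (mk K U y) (P'.map (mapRingHom (mk K U)))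
    rw [ev_mk, mk_eq]
    filter_upwards [main] with i hi
    rw [ev_pi, Pi.mul_apply, eval_pi]; exact (hxy i hi).2.2.2

end

lemma stepD_frob (D : ℕ) : ∃ p0, ∀ p, p0 ≤ p → ∀ hp : p.Prime, haveI := Fact.mk hp
    StepD (frobenius (AlgebraicClosure (ZMod p)) p) D := by
  obtain ⟨p0, h⟩ := Stp.stepanov D
  refine ⟨p0, fun p hp hpp => ?_⟩
  haveI := Fact.mk hpp
  intro f P Δ h1 h2 h3 h4 h5 h6 h7 h8 h9 h10
  obtain ⟨x0, y0, a, b, c, d⟩ := h p hp hpp _ f P Δ h1 h2 h3 h4 h5 h6 h7 h8 h9 h10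
  exact ⟨x0, y0, a, b, c, d⟩

end QE
end

section
open Polynomial Filter

namespace QE

local instance factP (p : Nat.Primes) : Fact p.1.Prime := ⟨p.2⟩

/-- `g(a,Z)` has a root -/
def HR {n : ℕ} {K : Type*} [CommRing K] (a : Fin n → K) (g : (MvPolynomial (Fin n) ℤ)[X]) : Prop :=
  ∃ z : K, (spec a g).eval z = 0

/-- determined by root patterns -/
def Det {n : ℕ} (T : ∀ p : Nat.Primes, (Fin n → ZMod p.1) → Prop) : Prop :=
  ∃ (Γ : Finset (MvPolynomial (Fin n) ℤ)[X]) (p0 : ℕ), ∀ p q : Nat.Primes, p0 ≤ p.1 → p0 ≤ q.1 → ∀ a a',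
    (∀ g ∈ Γ, HR a g ↔ HR a' g) → (T p a ↔ T q a')

lemma Det_false {n : ℕ} : Det (n := n) (fun _ _ => False) := ⟨∅, 0, fun _ _ _ _ _ _ _ => Iff.rfl⟩

lemma Det_imp {n : ℕ} {T S : ∀ p : Nat.Primes, (Fin n → ZMod p.1) → Prop} (hT : Det T) (hS : Det S) :
    Det (fun p a => T p a → S p a) := by
  classical
  obtain ⟨Γ, p0, h⟩ := hT
  obtain ⟨Γ', p0', h'⟩ := hS
  refine ⟨Γ ∪ Γ', max p0 p0', fun p q hp hq a a' hg => ?_⟩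
  exact imp_congr (h p q (le_of_max_le_left hp) (le_of_max_le_left hq) a a' fun g hg' => hg g (Finset.mem_union_left _ hg'))
    (h' p q (le_of_max_le_right hp) (le_of_max_le_right hq) a a' fun g hg' => hg g (Finset.mem_union_right _ hg'))

lemma Det_not {n : ℕ} {T : ∀ p : Nat.Primes, (Fin n → ZMod p.1) → Prop} (hT : Det T) : Det (fun p a => ¬ T p a) :=
  Det_imp hT Det_false

lemma Det_eq {n : ℕ} (P Q : MvPolynomial (Fin n) ℤ) :
    Det (fun p a => MvPolynomial.eval₂Hom (Int.castRingHom (ZMod p.1)) a P = MvPolynomial.eval₂Hom (Int.castRingHom (ZMod p.1)) a Q) := by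
  refine ⟨{C (P - Q)}, 0, fun p q _ _ a a' h => ?_⟩
  have h1 := h _ (Finset.mem_singleton_self _)
  simp only [HR, spec, Polynomial.map_C, eval_C, exists_const] at h1
  rw [map_sub (MvPolynomial.eval₂Hom _ _), map_sub (MvPolynomial.eval₂Hom _ _), sub_eq_zero, sub_eq_zero] at h1
  exact h1

lemma frob_fix (p : ℕ) [Fact p.Prime] (x : AlgebraicClosure (ZMod p)) (hx : frobenius (AlgebraicClosure (ZMod p)) p x = x) :
    ∃ y : ZMod p, algebraMap (ZMod p) _ y = x := by
  rw [frobenius_def] at hx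
  rw [← Subfield.mem_bot_iff_pow_eq_self] at hx
  have : (⊥ : Subfield (AlgebraicClosure (ZMod p))) ≤ (algebraMap (ZMod p) (AlgebraicClosure (ZMod p))).fieldRange := bot_le
  exact this hx

lemma fix_frob (p : ℕ) [Fact p.Prime] (y : ZMod p) : frobenius (AlgebraicClosure (ZMod p)) p (algebraMap (ZMod p) _ y) = algebraMap (ZMod p) _ y := by
  rw [frobenius_def, ← map_pow, ZMod.pow_card]

lemma HR_iff {n : ℕ} (p : ℕ) [Fact p.Prime] (a : Fin n → ZMod p) (g : (MvPolynomial (Fin n) ℤ)[X]) :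
    (∃ z, frobenius (AlgebraicClosure (ZMod p)) p z = z ∧ (spec (fun l => algebraMap (ZMod p) (AlgebraicClosure (ZMod p)) (a l)) g).eval z = 0) ↔ HR a g := by
  have h1 : spec (fun l => algebraMap (ZMod p) (AlgebraicClosure (ZMod p)) (a l)) g = (spec a g).map (algebraMap (ZMod p) (AlgebraicClosure (ZMod p))) := by
    rw [spec_map]; rfl
  rw [h1]
  constructor
  · rintro ⟨z, hz, h0⟩
    obtain ⟨y, rfl⟩ := frob_fix p z hz
    rw [eval_map, eval₂_hom, map_eq_zero] at h0
    exact ⟨y, h0⟩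
  · rintro ⟨y, h⟩
    refine ⟨algebraMap _ _ y, fix_frob p y, ?_⟩
    rw [eval_map, eval₂_hom, h, map_zero]

lemma Det_ex_aux {n : ℕ} {T : ∀ p : Nat.Primes, (Fin (n + 1) → ZMod p.1) → Prop} (hT : Det T)
    (p q : ℕ → Nat.Primes) (hp : ∀ i, i ≤ (p i).1) (hq : ∀ i, i ≤ (q i).1) (a : ∀ i, Fin n → ZMod (p i).1) (a' : ∀ i, Fin n → ZMod (q i).1)
    (hR : ∀ g, ∃ j, ∀ i, j ≤ i → (HR (a i) g ↔ HR (a' i) g)) (b : ∀ i, ZMod (p i).1) (hb : ∀ i, T (p i) (snoc1 (a i) (b i)))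
    (hb' : ∀ i b', ¬ T (q i) (snoc1 (a' i) b')) : False := by
  classical
  obtain ⟨Γ, p0, hΓ⟩ := hT
  let U : Ultrafilter ℕ := hyperfilter ℕ
  have hU : ∀ j : ℕ, ∀ᶠ i in (U : Filter ℕ), j ≤ i := fun j => by
    have : (U : Filter ℕ) ≤ atTop := by
      rw [← Nat.cofinite_eq_atTop]; exact hyperfilter_le_cofinite
    exact this (eventually_ge_atTop j)
  let K : ℕ → Type := fun i => AlgebraicClosure (ZMod (p i).1)
  let K' : ℕ → Type := fun i => AlgebraicClosure (ZMod (q i).1)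
  letI : ∀ i, Field (K i) := fun i => inferInstanceAs (Field (AlgebraicClosure (ZMod (p i).1)))
  letI : ∀ i, Field (K' i) := fun i => inferInstanceAs (Field (AlgebraicClosure (ZMod (q i).1)))
  haveI : ∀ i, IsAlgClosed (K i) := fun i => inferInstanceAs (IsAlgClosed (AlgebraicClosure (ZMod (p i).1)))
  haveI : ∀ i, IsAlgClosed (K' i) := fun i => inferInstanceAs (IsAlgClosed (AlgebraicClosure (ZMod (q i).1)))
  let φ : ∀ i, K i →+* K i := fun i => frobenius (AlgebraicClosure (ZMod (p i).1)) (p i).1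
  let φ' : ∀ i, K' i →+* K' i := fun i => frobenius (AlgebraicClosure (ZMod (q i).1)) (q i).1
  let α : ∀ i, ZMod (p i).1 →+* K i := fun i => algebraMap (ZMod (p i).1) (AlgebraicClosure (ZMod (p i).1))
  let α' : ∀ i, ZMod (q i).1 →+* K' i := fun i => algebraMap (ZMod (q i).1) (AlgebraicClosure (ZMod (q i).1))
  haveI : CharZero (UP K U) := by
    apply UP_charZero
    intro N hN
    filter_upwards [hU (N+1)] with i hi h0
    have h0 : ((N : ℕ) : AlgebraicClosure (ZMod (p i).1)) = 0 := h0
    rw [CharP.cast_eq_zero_iff _ (p i).1] at h0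
    have := Nat.le_of_dvd (by omega) h0
    have := hp i
    omega
  have hstep : HasStep (uφ U φ') := by
    apply hasStep_UP
    intro D
    obtain ⟨P0, hP0⟩ := stepD_frob D
    filter_upwards [hU P0] with i hi
    exact hP0 (q i).1 (hi.trans (hq i)) (q i).2
  have pat : ∀ {m : ℕ} (c : ∀ i, Fin m → ZMod (p i).1) g, (∃ z, uφ U φ z = z ∧ (spec (fun l => mk K U (fun i => α i (c i l))) g).eval z = 0) ↔
      ∀ᶠ i in (U : Filter ℕ), HR (c i) g := by
    intro m c g
    rw [pattern_UP U φ (fun i l => α i (c i l)) g]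
    exact eventually_congr (Eventually.of_forall fun i => HR_iff (p i).1 (c i) g)
  have pat' : ∀ {m : ℕ} (c : ∀ i, Fin m → ZMod (q i).1) g, (∃ z, uφ U φ' z = z ∧ (spec (fun l => mk K' U (fun i => α' i (c i l))) g).eval z = 0) ↔
      ∀ᶠ i in (U : Filter ℕ), HR (c i) g := by
    intro m c g
    rw [pattern_UP U φ' (fun i l => α' i (c i l)) g]
    exact eventually_congr (Eventually.of_forall fun i => HR_iff (q i).1 (c i) g)
  obtain ⟨β, hβ, hβΓ⟩ := step (uφ U φ) (uφ U φ') hstep (fun l => mk K U (fun i => α i (a i l))) (fun l => mk K' U (fun i => α' i (a' i l)))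
    (fun l => by rw [uφ_fix]; exact Eventually.of_forall fun i => fix_frob _ _)
    (fun l => by rw [uφ_fix]; exact Eventually.of_forall fun i => fix_frob _ _)
    (fun g => by
      rw [pat, pat']
      obtain ⟨j, hj⟩ := hR g
      exact eventually_congr ((hU j).mono hj))
    (mk K U (fun i => α i (b i))) (by rw [uφ_fix]; exact Eventually.of_forall fun i => fix_frob _ _) Γ
  obtain ⟨β, rfl⟩ := mk_surj K' U β
  rw [uφ_fix] at hβ
  have hc : ∀ i, ∃ c : ZMod (q i).1, φ' i (β i) = β i → α' i c = β i := by
    intro i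
    by_cases h : φ' i (β i) = β i
    · obtain ⟨c, hc⟩ := frob_fix _ _ h
      exact ⟨c, fun _ => hc⟩
    · exact ⟨0, fun h' => absurd h' h⟩
  choose c hc using hc
  have hβc : mk K' U β = mk K' U (fun i => α' i (c i)) := by
    rw [mk_eq]
    filter_upwards [hβ] with i hi using (hc i hi).symm
  rw [hβc] at hβΓ
  have s1 : snoc1 (fun l => mk K U (fun i => α i (a i l))) (mk K U (fun i => α i (b i))) = fun l => mk K U (fun i => α i (snoc1 (a i) (b i) l)) := by
    funext l
    refine Fin.lastCases ?_ (fun l => ?_) l <;> simp [snoc1]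
  have s2 : snoc1 (fun l => mk K' U (fun i => α' i (a' i l))) (mk K' U (fun i => α' i (c i))) = fun l => mk K' U (fun i => α' i (snoc1 (a' i) (c i) l)) := by
    funext l
    refine Fin.lastCases ?_ (fun l => ?_) l <;> simp [snoc1]
  rw [s1, s2] at hβΓ
  have fin : ∀ g ∈ Γ, ∀ᶠ i in (U : Filter ℕ), (HR (snoc1 (a i) (b i)) g ↔ HR (snoc1 (a' i) (c i)) g) := by
    intro g hg
    have h1 := hβΓ g hg
    rw [pat, pat'] at h1
    by_cases h2 : ∀ᶠ i in (U : Filter ℕ), HR (snoc1 (a i) (b i)) g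
    · filter_upwards [h2, h1.1 h2] with i h3 h4 using iff_of_true h3 h4
    · have h3 : ¬ ∀ᶠ i in (U : Filter ℕ), HR (snoc1 (a' i) (c i)) g := fun h => h2 (h1.2 h)
      rw [← Ultrafilter.eventually_not] at h2 h3
      filter_upwards [h2, h3] with i h4 h5 using iff_of_false h4 h5
  rw [← eventually_all_finset] at fin
  obtain ⟨i, hi, hi2⟩ := (fin.and (hU p0)).exists
  exact hb' i (c i) ((hΓ (p i) (q i) (hi2.trans (hp i)) (hi2.trans (hq i)) _ _ hi).1 (hb i))

lemma Det_ex {n : ℕ} {T : ∀ p : Nat.Primes, (Fin (n + 1) → ZMod p.1) → Prop} (hT : Det T) :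
    Det (fun p a => ∃ b, T p (snoc1 a b)) := by
  classical
  by_contra hcon
  haveI c1 : Countable (MvPolynomial (Fin n) ℤ) := by
    rw [← Cardinal.mk_le_aleph0_iff]
    exact MvPolynomial.cardinalMk_le_max_lift.trans (by simp)
  haveI c2 : Countable (MvPolynomial (Fin n) ℤ)[X] := by
    rw [← Cardinal.mk_le_aleph0_iff]
    exact Polynomial.cardinalMk_le_max.trans (by simp)
  obtain ⟨e, he⟩ := exists_surjective_nat (MvPolynomial (Fin n) ℤ)[X]
  have h1 : ∀ i : ℕ, ∃ p q : Nat.Primes, ∃ (a : Fin n → ZMod p.1) (a' : Fin n → ZMod q.1) (b : ZMod p.1), i ≤ p.1 ∧ i ≤ q.1 ∧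
      (∀ j < i, HR a (e j) ↔ HR a' (e j)) ∧ T p (snoc1 a b) ∧ ∀ b', ¬ T q (snoc1 a' b') := by
    intro i
    by_contra h2
    apply hcon
    refine ⟨(Finset.range i).image e, i, fun p q hp hq a a' hg => ?_⟩
    have hg' : ∀ j < i, HR a (e j) ↔ HR a' (e j) := fun j hj => hg _ (Finset.mem_image_of_mem e (Finset.mem_range.2 hj))
    constructor
    · rintro ⟨b, hb⟩
      by_contra h3
      push Not at h3
      exact h2 ⟨p, q, a, a', b, hp, hq, hg', hb, h3⟩
    · rintro ⟨b, hb⟩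
      by_contra h3
      push Not at h3
      exact h2 ⟨q, p, a', a, b, hq, hp, fun j hj => (hg' j hj).symm, hb, h3⟩
  choose p q a a' b hp hq hR hb hb' using h1
  refine Det_ex_aux hT p q hp hq a a' (fun g => ?_) b hb hb'
  obtain ⟨j, rfl⟩ := he g
  exact ⟨j + 1, fun i hi => hR i j hi⟩

lemma Det_all {n : ℕ} {T : ∀ p : Nat.Primes, (Fin (n + 1) → ZMod p.1) → Prop} (hT : Det T) :
    Det (fun p a => ∀ b, T p (snoc1 a b)) := by
  have := Det_not (Det_ex (Det_not hT))
  simpa only [not_exists, not_not] using this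

open FirstOrder in
lemma term_poly {n : ℕ} (t : Language.ring.Term (Empty ⊕ Fin n)) : ∃ P : MvPolynomial (Fin n) ℤ, ∀ (R : Type) [CommRing R] (e : Empty → R) (v : Fin n → R),
    letI := Ring.compatibleRingOfRing R
    t.realize (Sum.elim e v) = MvPolynomial.eval₂Hom (Int.castRingHom R) v P := by
  induction t with
  | var x =>
    rcases x with x | x
    · exact x.elim
    · exact ⟨MvPolynomial.X x, fun R _ e v => by simp⟩
  | func f ts ih =>
    choose P hP using ih
    cases f with
    | add =>
      refine ⟨P 0 + P 1, fun R _ e v => ?_⟩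
      letI := Ring.compatibleRingOfRing R
      rw [map_add, ← hP, ← hP]
      exact Ring.CompatibleRing.funMap_add _
    | mul =>
      refine ⟨P 0 * P 1, fun R _ e v => ?_⟩
      letI := Ring.compatibleRingOfRing R
      rw [map_mul, ← hP, ← hP]
      exact Ring.CompatibleRing.funMap_mul _
    | neg =>
      refine ⟨- P 0, fun R _ e v => ?_⟩
      letI := Ring.compatibleRingOfRing R
      rw [map_neg, ← hP]
      exact Ring.CompatibleRing.funMap_neg _
    | zero =>
      refine ⟨0, fun R _ e v => ?_⟩
      letI := Ring.compatibleRingOfRing R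
      rw [map_zero]
      exact Ring.CompatibleRing.funMap_zero _
    | one =>
      refine ⟨1, fun R _ e v => ?_⟩
      letI := Ring.compatibleRingOfRing R
      rw [map_one]
      exact Ring.CompatibleRing.funMap_one _

open FirstOrder in
lemma formula_det {n : ℕ} (ψ : Language.ring.BoundedFormula Empty n) :
    Det (fun p a => letI := Ring.compatibleRingOfRing (ZMod p.1); ψ.Realize default a) := by
  induction ψ with
  | falsum => exact Det_false
  | equal t₁ t₂ =>
    obtain ⟨P, hP⟩ := term_poly t₁
    obtain ⟨Q, hQ⟩ := term_poly t₂
    have := Det_eq P Q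
    simp only [← hP _ default, ← hQ _ default] at this
    exact this
  | rel R _ => cases R
  | imp f g hf hg => exact Det_imp hf hg
  | all f hf => exact Det_all hf

open FirstOrder in
/-- truth of a sentence is determined by which polynomials have roots mod `p` -/
theorem sentence_det (σ : Language.ring.Sentence) : ∃ (Γ : Finset ℤ[X]) (p0 : ℕ), ∀ p q : Nat.Primes, p0 ≤ p.1 → p0 ≤ q.1 →
    (∀ g ∈ Γ, (∃ z : ZMod p.1, (g.map (Int.castRingHom _)).eval z = 0) ↔ (∃ z : ZMod q.1, (g.map (Int.castRingHom _)).eval z = 0)) →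
    ((letI := Ring.compatibleRingOfRing (ZMod p.1); ZMod p.1 ⊨ σ) ↔ (letI := Ring.compatibleRingOfRing (ZMod q.1); ZMod q.1 ⊨ σ)) := by
  classical
  obtain ⟨Γ, p0, h⟩ := formula_det (n := 0) σ
  let r : MvPolynomial (Fin 0) ℤ →+* ℤ := MvPolynomial.eval₂Hom (RingHom.id ℤ) default
  have hr : ∀ (p : ℕ) (a : Fin 0 → ZMod p) g, spec a g = (g.map r).map (Int.castRingHom (ZMod p)) := by
    intro p a g
    rw [spec, Polynomial.map_map]
    congr 1
    ext i
    · simp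
    · exact i.elim0
  refine ⟨Γ.image (fun g => g.map r), p0, fun p q hp hq hg => ?_⟩
  have h2 := h p q hp hq default default (fun g hgΓ => by
    rw [HR, HR, hr, hr]
    exact hg _ (Finset.mem_image_of_mem _ hgΓ))
  have e1 : ∀ (R : Type) [CommRing R] (x y : Empty → R) (a b : Fin 0 → R),
      letI := Ring.compatibleRingOfRing R
      (Language.BoundedFormula.Realize (L := Language.ring) (M := R) σ x a ↔ Language.BoundedFormula.Realize (L := Language.ring) (M := R) σ y b) := by
    intro R _ x y a b
    rw [Subsingleton.elim x y, Subsingleton.elim a b]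
  exact (e1 (ZMod p.1) _ _ _ _).trans (h2.trans (e1 (ZMod q.1) _ _ _ _))

end QE
end

section
open Filter Topology MeasureTheory Set

namespace WI

/-- the Fejer kernel -/
noncomputable def k (v : ℝ) : ℝ := ∫ t in (0:ℝ)..1, 2 * (1 - t) * Real.cos (t * v)

lemma k_eq (v : ℝ) (hv : v ≠ 0) : k v = 2 * (1 - Real.cos v) / v ^ 2 := by
  have hd : ∀ t ∈ uIcc (0:ℝ) 1, HasDerivAt (fun t => 2 * ((1 - t) * Real.sin (t * v) / v - Real.cos (t * v) / v ^ 2))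
      (2 * (1 - t) * Real.cos (t * v)) t := by
    intro t _
    have h1 : HasDerivAt (fun t : ℝ => t * v) v t := by simpa using (hasDerivAt_id t).mul_const v
    have h2 := h1.sin
    have h3 := h1.cos
    have h4 : HasDerivAt (fun t : ℝ => 1 - t) (-1) t := by simpa using (hasDerivAt_id t).const_sub 1
    have h5 := (((h4.mul h2).div_const v).sub (h3.div_const (v ^ 2))).const_mul 2
    refine h5.congr_deriv ?_
    field_simp
    ring
  rw [k, intervalIntegral.integral_eq_sub_of_hasDerivAt hd (by apply Continuous.intervalIntegrable; fun_prop)]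
  simp
  field_simp
  ring

lemma k_cont : Continuous k := by
  unfold k
  apply intervalIntegral.continuous_parametric_intervalIntegral_of_continuous'
  fun_prop

lemma k_zero : k 0 = 1 := by
  unfold k
  simp only [mul_zero, Real.cos_zero, mul_one]
  rw [intervalIntegral.integral_const_mul, intervalIntegral.integral_sub (by simp) (by simp)]
  simp
  norm_num

lemma k_nonneg (v : ℝ) : 0 ≤ k v := by
  by_cases hv : v = 0
  · rw [hv, k_zero]; norm_num
  · rw [k_eq v hv]
    have := Real.cos_le_one v
    apply div_nonneg <;> nlinarith

lemma k_le_one (v : ℝ) : k v ≤ 1 := by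
  rw [← k_zero]
  unfold k
  apply intervalIntegral.integral_mono_on (by norm_num)
  · apply Continuous.intervalIntegrable; fun_prop
  · apply Continuous.intervalIntegrable; fun_prop
  · intro t ht
    have := Real.cos_le_one (t * v)
    rw [mul_zero, Real.cos_zero]
    have := ht.2
    nlinarith

lemma k_le (v : ℝ) : k v ≤ 5 * (1 + v ^ 2)⁻¹ := by
  rw [← div_eq_mul_inv, le_div_iff₀ (by positivity), mul_add, mul_one]
  have h1 := k_le_one v
  by_cases hv : v = 0
  · rw [hv]; linarith [k_le_one v, k_le_one 0]
  · have h2 : k v * v ^ 2 = 2 * (1 - Real.cos v) := by rw [k_eq v hv]; field_simp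
    have := Real.neg_one_le_cos v
    linarith

lemma k_int : Integrable k := by
  refine Integrable.mono' (integrable_inv_one_add_sq.const_mul 5) k_cont.aestronglyMeasurable (Eventually.of_forall fun v => ?_)
  rw [Real.norm_of_nonneg (k_nonneg v)]
  exact k_le v

/-- total mass -/
noncomputable def I0 : ℝ := ∫ v, k v

lemma I0_pos : 0 < I0 := by
  rw [I0, integral_pos_iff_support_of_nonneg k_nonneg k_int]
  have h1 : IsOpen (Function.support k) := k_cont.isOpen_support
  exact h1.measure_pos _ ⟨0, by simp [k_zero]⟩

lemma k_even (v : ℝ) : k (-v) = k v := by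
  unfold k
  simp

lemma tail : Tendsto (fun R : ℝ => ∫ v in Icc (-R) R, k v) atTop (𝓝 I0) := by
  have h := intervalIntegral_tendsto_integral k_int tendsto_neg_atTop_atBot tendsto_id
  refine h.congr' ?_
  filter_upwards [eventually_ge_atTop 0] with R hR
  rw [intervalIntegral.integral_of_le (by simp only [id]; linarith), integral_Icc_eq_integral_Ioc]
  rfl

lemma scaled (l : ℝ) (hl : 0 < l) (η : ℝ) : ∫ v in Icc (-η) η, l * k (l * v) = ∫ v in Icc (-(l * η)) (l * η), k v := by
  by_cases hη : 0 ≤ η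
  · rw [integral_Icc_eq_integral_Ioc, integral_Icc_eq_integral_Ioc, ← intervalIntegral.integral_of_le (by linarith),
      ← intervalIntegral.integral_of_le (by have := mul_nonneg hl.le hη; linarith), intervalIntegral.integral_const_mul,
      intervalIntegral.mul_integral_comp_mul_left]
    congr 1; ring
  · push Not at hη
    rw [Icc_eq_empty (by linarith), Icc_eq_empty (by nlinarith)]
    simp

lemma k_l_int (l : ℝ) (hl : 0 < l) (y : ℝ) : Integrable (fun u => l * k (l * (y - u))) := by
  have h1 : Integrable (fun v => k (l * v)) := (integrable_comp_mul_left_iff k hl.ne').2 k_int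
  exact (h1.comp_sub_left y).const_mul l

lemma k_l_integral (l : ℝ) (hl : 0 < l) (y : ℝ) : ∫ u, l * k (l * (y - u)) = I0 := by
  rw [integral_const_mul, integral_sub_left_eq_self (fun v => k (l * v)) volume y, Measure.integral_comp_mul_left]
  rw [abs_of_pos (inv_pos.2 hl), smul_eq_mul, ← mul_assoc, mul_inv_cancel₀ hl.ne', one_mul, I0]

lemma win (l : ℝ) (hl : 0 < l) (y η : ℝ) : ∫ u in Icc (y - η) (y + η), l * k (l * (y - u)) = ∫ v in Icc (-(l * η)) (l * η), k v := by
  rw [← scaled l hl η]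
  have h1 := integral_sub_left_eq_self (fun v => (Icc (-η) η).indicator (fun v => l * k (l * v)) v) volume y
  rw [integral_indicator measurableSet_Icc] at h1
  rw [← h1, ← integral_indicator measurableSet_Icc]
  congr 1
  funext u
  simp only [indicator, mem_Icc]
  have : (y - η ≤ u ∧ u ≤ y + η) ↔ (-η ≤ y - u ∧ y - u ≤ η) := by constructor <;> rintro ⟨h1, h2⟩ <;> constructor <;> linarith
  simp only [this]

section
variable (B : ℝ → ℝ) (hm : Measurable B) (M : ℝ) (h0 : ∀ u, 0 ≤ B u) (hM : ∀ u, B u ≤ M)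

lemma Bk_int (B : ℝ → ℝ)
    (hm : Measurable B)
    (M : ℝ)
    (h0 : ∀ u, 0 ≤ B u)
    (hM : ∀ u, B u ≤ M)
    (l : ℝ) (hl : 0 < l) (y : ℝ) : Integrable (fun u => B u * (l * k (l * (y - u)))) := by
  refine (k_l_int l hl y).bdd_mul (c := M) hm.aestronglyMeasurable (Eventually.of_forall fun u => ?_)
  rw [Real.norm_of_nonneg (h0 u)]
  exact hM u

lemma upper (B : ℝ → ℝ)
    (hm : Measurable B)
    (M : ℝ)
    (h0 : ∀ u, 0 ≤ B u)
    (hM : ∀ u, B u ≤ M)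
    (hmono : ∀ u h, 0 ≤ h → B u * Real.exp (-h) ≤ B (u + h)) (l η y : ℝ) (hl : 0 < l) (hη : 0 < η) :
    B y * Real.exp (-(2 * η)) * ∫ v in Icc (-(l * η)) (l * η), k v ≤ ∫ u, B u * (l * k (l * ((y + η) - u))) := by
  calc B y * Real.exp (-(2 * η)) * ∫ v in Icc (-(l * η)) (l * η), k v
      = ∫ u in Icc ((y + η) - η) ((y + η) + η), B y * Real.exp (-(2 * η)) * (l * k (l * ((y + η) - u))) := by
        rw [integral_const_mul, win l hl (y + η) η]
    _ ≤ ∫ u in Icc ((y + η) - η) ((y + η) + η), B u * (l * k (l * ((y + η) - u))) := by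
        apply setIntegral_mono_on
        · exact ((k_l_int l hl _).const_mul _).integrableOn
        · exact (Bk_int B hm M h0 hM l hl _).integrableOn
        · exact measurableSet_Icc
        · intro u hu
          apply mul_le_mul_of_nonneg_right _ (mul_nonneg hl.le (k_nonneg _))
          have h1 := hmono y (u - y) (by have := hu.1; linarith)
          rw [add_sub_cancel] at h1
          refine le_trans ?_ h1
          apply mul_le_mul_of_nonneg_left _ (h0 y)
          apply Real.exp_le_exp.2
          have := hu.2; linarith
    _ ≤ _ := setIntegral_le_integral (Bk_int B hm M h0 hM l hl _) (Eventually.of_forall fun u => mul_nonneg (h0 u) (mul_nonneg hl.le (k_nonneg _)))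

lemma lower (B : ℝ → ℝ)
    (hm : Measurable B)
    (M : ℝ)
    (h0 : ∀ u, 0 ≤ B u)
    (hM : ∀ u, B u ≤ M)
    (hmono : ∀ u h, 0 ≤ h → B u * Real.exp (-h) ≤ B (u + h)) (l η y : ℝ) (hl : 0 < l) (hη : 0 < η) :
    ∫ u, B u * (l * k (l * ((y - η) - u))) ≤ B y * Real.exp (2 * η) * I0 + M * (I0 - ∫ v in Icc (-(l * η)) (l * η), k v) := by
  have hMn : 0 ≤ M := (h0 0).trans (hM 0)
  have hi := Bk_int B hm M h0 hM l hl (y - η)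
  have hk := k_l_int l hl (y - η)
  have hkn : ∀ u, 0 ≤ l * k (l * (y - η - u)) := fun u => mul_nonneg hl.le (k_nonneg _)
  rw [← integral_add_compl (s := Icc ((y - η) - η) ((y - η) + η)) measurableSet_Icc hi]
  apply add_le_add
  · calc ∫ u in Icc ((y - η) - η) ((y - η) + η), B u * (l * k (l * ((y - η) - u)))
        ≤ ∫ u in Icc ((y - η) - η) ((y - η) + η), B y * Real.exp (2 * η) * (l * k (l * ((y - η) - u))) := by
          apply setIntegral_mono_on hi.integrableOn (hk.const_mul _).integrableOn measurableSet_Icc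
          intro u hu
          apply mul_le_mul_of_nonneg_right _ (hkn u)
          have h1 := hmono u (y - u) (by have := hu.2; linarith)
          rw [add_sub_cancel] at h1
          rw [Real.exp_neg, ← div_eq_mul_inv, div_le_iff₀ (Real.exp_pos _)] at h1
          refine h1.trans (mul_le_mul_of_nonneg_left (Real.exp_le_exp.2 ?_) (h0 y))
          have := hu.1; linarith
      _ = B y * Real.exp (2 * η) * ∫ u in Icc ((y - η) - η) ((y - η) + η), (l * k (l * ((y - η) - u))) := by
          rw [integral_const_mul]
      _ ≤ _ := by
          apply mul_le_mul_of_nonneg_left _ (mul_nonneg (h0 y) (Real.exp_pos _).le)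
          rw [← k_l_integral l hl (y - η)]
          exact setIntegral_le_integral hk (Eventually.of_forall hkn)
  · calc ∫ u in (Icc ((y - η) - η) ((y - η) + η))ᶜ, B u * (l * k (l * ((y - η) - u)))
        ≤ ∫ u in (Icc ((y - η) - η) ((y - η) + η))ᶜ, M * (l * k (l * ((y - η) - u))) := by
          apply setIntegral_mono_on hi.integrableOn (hk.const_mul _).integrableOn measurableSet_Icc.compl
          intro u hu
          exact mul_le_mul_of_nonneg_right (hM u) (hkn u)
      _ = M * (I0 - ∫ v in Icc (-(l * η)) (l * η), k v) := by
          rw [integral_const_mul, ← win l hl (y - η) η, ← k_l_integral l hl (y - η), ← integral_add_compl (s := Icc ((y - η) - η) ((y - η) + η)) measurableSet_Icc hk]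
          ring

theorem taub (B : ℝ → ℝ)
    (hm : Measurable B)
    (M : ℝ)
    (h0 : ∀ u, 0 ≤ B u)
    (hM : ∀ u, B u ≤ M)
    (hmono : ∀ u h, 0 ≤ h → B u * Real.exp (-h) ≤ B (u + h))
    (hk : ∀ l, 0 < l → Tendsto (fun y => ∫ u, B u * (l * k (l * (y - u)))) atTop (𝓝 I0)) : Tendsto B atTop (𝓝 1) := by
  have hMn : 0 ≤ M := (h0 0).trans (hM 0)
  rw [tendsto_order]
  constructor
  · intro a ha
    -- lower bound
    have c1 : Tendsto (fun η : ℝ => (1 - a * Real.exp (2 * η)) * I0) (𝓝[>] 0) (𝓝 ((1 - a * Real.exp (2 * 0)) * I0)) := by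
      apply tendsto_nhdsWithin_of_tendsto_nhds
      apply Continuous.tendsto; fun_prop
    have c2 : 0 < (1 - a * Real.exp (2 * 0)) * I0 := by
      simp only [mul_zero, Real.exp_zero, mul_one]
      exact mul_pos (by linarith) I0_pos
    obtain ⟨η, hη1, hη⟩ := ((c1.eventually (lt_mem_nhds c2)).and self_mem_nhdsWithin).exists
    have hη : 0 < η := hη
    have t2 : Tendsto (fun l : ℝ => M * (I0 - ∫ v in Icc (-(l * η)) (l * η), k v)) atTop (𝓝 (M * (I0 - I0))) :=
      ((tail.comp (tendsto_id.atTop_mul_const hη)).const_sub I0).const_mul M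
    rw [sub_self, mul_zero] at t2
    obtain ⟨l, hl1, hl⟩ := ((t2.eventually (gt_mem_nhds hη1)).and (eventually_gt_atTop 0)).exists
    have t3 : Tendsto (fun y => ∫ u, B u * (l * k (l * ((y - η) - u)))) atTop (𝓝 I0) :=
      (hk l hl).comp (tendsto_atTop_add_const_right _ (-η) tendsto_id)
    have hlt : a * Real.exp (2 * η) * I0 + M * (I0 - ∫ v in Icc (-(l * η)) (l * η), k v) < I0 := by nlinarith
    filter_upwards [t3.eventually (lt_mem_nhds hlt)] with y hy
    have h1 := lower B hm M h0 hM hmono l η y hl hη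
    by_contra hcon
    push Not at hcon
    have h2 : B y * (Real.exp (2 * η) * I0) ≤ a * (Real.exp (2 * η) * I0) :=
      mul_le_mul_of_nonneg_right hcon (mul_pos (Real.exp_pos _) I0_pos).le
    linarith
  · intro a ha
    have c1 : Tendsto (fun η : ℝ => a * Real.exp (-(2 * η)) * I0) (𝓝[>] 0) (𝓝 (a * Real.exp (-(2 * 0)) * I0)) := by
      apply tendsto_nhdsWithin_of_tendsto_nhds
      apply Continuous.tendsto; fun_prop
    have c2 : I0 < a * Real.exp (-(2 * 0)) * I0 := by
      simp only [mul_zero, Real.exp_zero, mul_one, neg_zero]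
      have := I0_pos
      nlinarith
    obtain ⟨η, hη1, hη⟩ := ((c1.eventually (lt_mem_nhds c2)).and self_mem_nhdsWithin).exists
    have hη : 0 < η := hη
    have t2 : Tendsto (fun l : ℝ => a * Real.exp (-(2 * η)) * (∫ v in Icc (-(l * η)) (l * η), k v)) atTop (𝓝 (a * Real.exp (-(2 * η)) * I0)) :=
      ((tail.comp (tendsto_id.atTop_mul_const hη))).const_mul _
    obtain ⟨l, hl1, hl⟩ := ((t2.eventually (lt_mem_nhds hη1)).and (eventually_gt_atTop 0)).exists
    have t3 : Tendsto (fun y => ∫ u, B u * (l * k (l * ((y + η) - u)))) atTop (𝓝 I0) :=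
      (hk l hl).comp (tendsto_atTop_add_const_right _ η tendsto_id)
    filter_upwards [t3.eventually (gt_mem_nhds hl1)] with y hy
    have h1 := upper B hm M h0 hM hmono l η y hl hη
    by_contra hcon
    push Not at hcon
    have h3 : 0 ≤ ∫ v in Icc (-(l * η)) (l * η), k v := integral_nonneg k_nonneg
    have h2 : a * (Real.exp (-(2 * η)) * ∫ v in Icc (-(l * η)) (l * η), k v) ≤ B y * (Real.exp (-(2 * η)) * ∫ v in Icc (-(l * η)) (l * η), k v) :=
      mul_le_mul_of_nonneg_right hcon (mul_nonneg (Real.exp_pos _).le h3)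
    linarith

end
end WI
end

section
open Filter Topology MeasureTheory Set

namespace WI

section
variable (B : ℝ → ℝ) (hm : Measurable B) (M : ℝ) (h0 : ∀ u, 0 ≤ B u) (hM : ∀ u, B u ≤ M)
  (h : ℝ → ℝ → ℂ) (hc : Continuous (Function.uncurry h))
  (H : ∀ δ : ℝ, 0 < δ → ∀ t : ℝ, ∫ u in Ioi (0:ℝ), (((B u - 1) * Real.exp (-δ * u) : ℝ) : ℂ) * Complex.exp (-(Complex.I * t * u)) = h δ t)

/-- the smoothed boundary function -/
noncomputable def Phi (h : ℝ → ℝ → ℂ) (l δ y : ℝ) : ℝ :=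
  ∫ t in (0:ℝ)..1, l * (2 * (1 - t)) * (Complex.exp (Complex.I * ((t * (l * y) : ℝ) : ℂ)) * h δ (l * t)).re

lemma Phi_cont (h : ℝ → ℝ → ℂ)
    (hc : Continuous (Function.uncurry h))
    (l y : ℝ) : Continuous (fun δ => Phi h l δ y) := by
  unfold Phi
  apply intervalIntegral.continuous_parametric_intervalIntegral_of_continuous'
  have : Continuous (fun p : ℝ × ℝ => h p.1 (l * p.2)) := hc.comp (by fun_prop : Continuous (fun p : ℝ × ℝ => (p.1, l * p.2)))
  unfold Function.uncurry
  simp only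
  fun_prop

lemma absB (B : ℝ → ℝ)
    (hm : Measurable B)
    (M : ℝ)
    (h0 : ∀ u, 0 ≤ B u)
    (hM : ∀ u, B u ≤ M)
    (u : ℝ) : |B u - 1| ≤ M + 1 := by
  have := h0 u; have := hM u
  rw [abs_le]; constructor <;> linarith

lemma intBe (B : ℝ → ℝ)
    (hm : Measurable B)
    (M : ℝ)
    (h0 : ∀ u, 0 ≤ B u)
    (hM : ∀ u, B u ≤ M)
    (δ : ℝ) (hδ : 0 < δ) : IntegrableOn (fun u => (B u - 1) * Real.exp (-δ * u)) (Ioi 0) := by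
  have h1 : IntegrableOn (fun u => Real.exp (-δ * u)) (Ioi 0) := exp_neg_integrableOn_Ioi 0 hδ
  refine h1.bdd_mul (c := M + 1) (hm.sub_const 1).aestronglyMeasurable (Eventually.of_forall fun u => ?_)
  exact absB B hm M h0 hM u

lemma re_eq (B : ℝ → ℝ)
    (hm : Measurable B)
    (M : ℝ)
    (h0 : ∀ u, 0 ≤ B u)
    (hM : ∀ u, B u ≤ M)
    (h : ℝ → ℝ → ℂ)
    (H : ∀ δ : ℝ, 0 < δ → ∀ t : ℝ, ∫ u in Ioi (0:ℝ), (((B u - 1) * Real.exp (-δ * u) : ℝ) : ℂ) * Complex.exp (-(Complex.I * t * u)) = h δ t)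
    (δ : ℝ) (hδ : 0 < δ) (l y t : ℝ) : (Complex.exp (Complex.I * ((t * (l * y) : ℝ) : ℂ)) * h δ (l * t)).re =
    ∫ u in Ioi (0:ℝ), (B u - 1) * Real.exp (-δ * u) * Real.cos (t * (l * (y - u))) := by
  rw [← H δ hδ (l * t), ← integral_const_mul]
  have hi : IntegrableOn (fun u : ℝ => Complex.exp (Complex.I * ((t * (l * y) : ℝ) : ℂ)) * ((((B u - 1) * Real.exp (-δ * u) : ℝ) : ℂ) * Complex.exp (-(Complex.I * (l * t : ℝ) * u)))) (Ioi 0) := by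
    apply Integrable.const_mul
    refine Integrable.mul_bdd (c := 1) (intBe B hm M h0 hM δ hδ).ofReal ?_ (Eventually.of_forall fun u => ?_)
    · apply Continuous.aestronglyMeasurable; fun_prop
    · rw [Complex.norm_exp]
      simp
  have h1 := integral_re (𝕜 := ℂ) hi
  refine Eq.trans h1.symm ?_
  refine integral_congr_ae (Eventually.of_forall fun u => ?_)
  have e1 : Complex.exp (Complex.I * ((t * (l * y) : ℝ) : ℂ)) * ((((B u - 1) * Real.exp (-δ * u) : ℝ) : ℂ) * Complex.exp (-(Complex.I * (l * t : ℝ) * u)))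
    = (((B u - 1) * Real.exp (-δ * u) : ℝ) : ℂ) * Complex.exp (((t * (l * (y - u)) : ℝ) : ℂ) * Complex.I) := by
    rw [mul_left_comm, ← Complex.exp_add]
    congr 2
    push_cast
    ring
  change (Complex.re _) = _
  rw [e1, Complex.re_ofReal_mul, Complex.exp_ofReal_mul_I_re]

lemma Phi_eq (B : ℝ → ℝ)
    (hm : Measurable B)
    (M : ℝ)
    (h0 : ∀ u, 0 ≤ B u)
    (hM : ∀ u, B u ≤ M)
    (h : ℝ → ℝ → ℂ)
    (H : ∀ δ : ℝ, 0 < δ → ∀ t : ℝ, ∫ u in Ioi (0:ℝ), (((B u - 1) * Real.exp (-δ * u) : ℝ) : ℂ) * Complex.exp (-(Complex.I * t * u)) = h δ t)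
    (δ : ℝ) (hδ : 0 < δ) (l y : ℝ) (hl : 0 < l) :
    Phi h l δ y = ∫ u in Ioi (0:ℝ), (B u - 1) * Real.exp (-δ * u) * (l * k (l * (y - u))) := by
  unfold Phi
  simp_rw [re_eq B hm M h0 hM h H δ hδ l y]
  rw [intervalIntegral.integral_of_le zero_le_one]
  simp_rw [← integral_const_mul]
  rw [integral_integral_swap]
  · refine integral_congr_ae (Eventually.of_forall fun u => ?_)
    simp only
    rw [k, intervalIntegral.integral_of_le zero_le_one, ← integral_const_mul, ← integral_const_mul]
    refine integral_congr_ae (Eventually.of_forall fun t => ?_)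
    simp only
    ring
  · have hb : Integrable (fun z : ℝ × ℝ => (l * 2 : ℝ) * ((M + 1) * Real.exp (-δ * z.2))) ((volume.restrict (Ioc (0:ℝ) 1)).prod (volume.restrict (Ioi 0))) := by
      exact Integrable.mul_prod (f := fun _ : ℝ => (l * 2 : ℝ)) (g := fun u : ℝ => (M + 1) * Real.exp (-δ * u)) (integrable_const _) ((exp_neg_integrableOn_Ioi 0 hδ).const_mul _)
    refine hb.mono' ?_ ?_
    · apply Measurable.aestronglyMeasurable
      unfold Function.uncurry
      fun_prop
    · have hmem : ∀ᵐ z ∂((volume.restrict (Ioc (0:ℝ) 1)).prod (volume.restrict (Ioi (0:ℝ)))), z.1 ∈ Ioc (0:ℝ) 1 := by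
        rw [Measure.prod_restrict]
        filter_upwards [ae_restrict_mem (measurableSet_Ioc.prod measurableSet_Ioi)] with z hz using hz.1
      filter_upwards [hmem] with z hz
      simp only [Function.uncurry, norm_mul, Real.norm_eq_abs, abs_of_pos hl, abs_two, abs_of_pos (Real.exp_pos _)]
      have h1 := absB B hm M h0 hM z.2
      have h2 := Real.abs_cos_le_one (z.1 * (l * (y - z.2)))
      have h3 : |1 - z.1| ≤ 1 := by rw [abs_le]; constructor <;> linarith [hz.1, hz.2]
      have hM1 : 0 ≤ M + 1 := (abs_nonneg _).trans h1
      calc l * (2 * |1 - z.1|) * (|B z.2 - 1| * Real.exp (-δ * z.2) * |Real.cos (z.1 * (l * (y - z.2)))|)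
          ≤ l * (2 * 1) * ((M + 1) * Real.exp (-δ * z.2) * 1) := by gcongr
        _ = _ := by ring

lemma Phi_zero (B : ℝ → ℝ)
    (hm : Measurable B)
    (M : ℝ)
    (h0 : ∀ u, 0 ≤ B u)
    (hM : ∀ u, B u ≤ M)
    (h : ℝ → ℝ → ℂ)
    (hc : Continuous (Function.uncurry h))
    (H : ∀ δ : ℝ, 0 < δ → ∀ t : ℝ, ∫ u in Ioi (0:ℝ), (((B u - 1) * Real.exp (-δ * u) : ℝ) : ℂ) * Complex.exp (-(Complex.I * t * u)) = h δ t)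
    (l y : ℝ) (hl : 0 < l) : Phi h l 0 y = ∫ u in Ioi (0:ℝ), (B u - 1) * (l * k (l * (y - u))) := by
  have t1 : Tendsto (fun δ => Phi h l δ y) (𝓝[>] 0) (𝓝 (Phi h l 0 y)) :=
    tendsto_nhdsWithin_of_tendsto_nhds ((Phi_cont h hc l y).tendsto 0)
  have t2 : Tendsto (fun δ => ∫ u in Ioi (0:ℝ), (B u - 1) * Real.exp (-δ * u) * (l * k (l * (y - u)))) (𝓝[>] 0)
      (𝓝 (∫ u in Ioi (0:ℝ), (B u - 1) * (l * k (l * (y - u))))) := by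
    apply tendsto_integral_filter_of_dominated_convergence (fun u => (M + 1) * (l * k (l * (y - u))))
    · filter_upwards [self_mem_nhdsWithin] with δ hδ
      apply Measurable.aestronglyMeasurable
      have := k_cont.measurable
      fun_prop
    · filter_upwards [self_mem_nhdsWithin] with δ hδ
      filter_upwards [ae_restrict_mem measurableSet_Ioi] with u hu
      have hδ : 0 < δ := hδ
      have hu : 0 < u := hu
      rw [norm_mul, norm_mul, Real.norm_eq_abs, Real.norm_eq_abs, Real.norm_of_nonneg (mul_nonneg hl.le (k_nonneg _)), abs_of_pos (Real.exp_pos _)]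
      have h1 := absB B hm M h0 hM u
      have h2 : Real.exp (-δ * u) ≤ 1 := Real.exp_le_one_iff.2 (by nlinarith)
      have := mul_nonneg hl.le (k_nonneg (l * (y - u)))
      calc _ ≤ (M + 1) * 1 * (l * k (l * (y - u))) := by gcongr; exact (abs_nonneg _).trans h1
        _ = _ := by ring
    · exact ((k_l_int l hl y).const_mul _).integrableOn
    · refine Eventually.of_forall fun u => ?_
      have hcont : Continuous (fun δ : ℝ => (B u - 1) * Real.exp (-δ * u) * (l * k (l * (y - u)))) := by fun_prop
      have := hcont.tendsto 0
      simp only [neg_zero, zero_mul, Real.exp_zero, mul_one] at this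
      exact tendsto_nhdsWithin_of_tendsto_nhds this
  refine tendsto_nhds_unique t1 (t2.congr' ?_)
  filter_upwards [self_mem_nhdsWithin] with δ hδ
  exact (Phi_eq B hm M h0 hM h H δ hδ l y hl).symm

lemma RL (h : ℝ → ℝ → ℂ)
    (hc : Continuous (Function.uncurry h))
    (l : ℝ) (hl : 0 < l) : Tendsto (fun y => Phi h l 0 y) atTop (𝓝 0) := by
  let f : ℝ → ℂ := (Ioc (0:ℝ) 1).indicator (fun t => ((l * (2 * (1 - t)) : ℝ) : ℂ) * h 0 (l * t))
  have h1 := Real.tendsto_integral_exp_smul_cocompact f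
  have h2 : Tendsto (fun y : ℝ => (-(l / (2 * Real.pi))) * y) atTop (cocompact ℝ) := by
    refine Tendsto.mono_right ?_ atBot_le_cocompact
    exact tendsto_id.const_mul_atTop_of_neg (by have := Real.pi_pos; simp; positivity)
  have h3 := (Complex.continuous_re.tendsto 0).comp (h1.comp h2)
  rw [Complex.zero_re] at h3
  refine h3.congr fun y => ?_
  simp only [Function.comp]
  unfold Phi
  rw [intervalIntegral.integral_of_le zero_le_one]
  have hf : ∀ v : ℝ, Real.fourierChar (-(v * (-(l / (2 * Real.pi)) * y))) • f v = (Ioc (0:ℝ) 1).indicator (fun t => ((l * (2 * (1 - t)) : ℝ) : ℂ) * (Complex.exp (Complex.I * ((t * (l * y) : ℝ) : ℂ)) * h 0 (l * t))) v := by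
    intro v
    simp only [f, indicator]
    split_ifs
    · rw [Circle.smul_def, Real.fourierChar_apply, smul_eq_mul]
      have : (Complex.I * ((v * (l * y) : ℝ) : ℂ)) = ((2 * Real.pi * (-(v * (-(l / (2 * Real.pi)) * y))) : ℝ) : ℂ) * Complex.I := by
        have := Real.pi_ne_zero
        rw [mul_comm]
        congr 2
        field_simp
      rw [this]
      ring
    · simp
  simp_rw [hf]
  rw [integral_indicator measurableSet_Ioc]
  have hcc : Continuous (fun t => ((l * (2 * (1 - t)) : ℝ) : ℂ) * (Complex.exp (Complex.I * ((t * (l * y) : ℝ) : ℂ)) * h 0 (l * t))) := by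
    have : Continuous (fun t : ℝ => h 0 (l * t)) := hc.comp (by fun_prop : Continuous (fun t : ℝ => ((0:ℝ), l * t)))
    fun_prop
  have hi : IntegrableOn (fun t => ((l * (2 * (1 - t)) : ℝ) : ℂ) * (Complex.exp (Complex.I * ((t * (l * y) : ℝ) : ℂ)) * h 0 (l * t))) (Ioc 0 1) :=
    (hcc.integrableOn_Icc).mono_set Ioc_subset_Icc_self
  have h4 := integral_re (𝕜 := ℂ) hi
  refine Eq.trans h4.symm ?_
  refine integral_congr_ae (Eventually.of_forall fun t => ?_)
  exact Complex.re_ofReal_mul _ _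

theorem taub2 (B : ℝ → ℝ)
    (hm : Measurable B)
    (M : ℝ)
    (h0 : ∀ u, 0 ≤ B u)
    (hM : ∀ u, B u ≤ M)
    (h : ℝ → ℝ → ℂ)
    (hc : Continuous (Function.uncurry h))
    (H : ∀ δ : ℝ, 0 < δ → ∀ t : ℝ, ∫ u in Ioi (0:ℝ), (((B u - 1) * Real.exp (-δ * u) : ℝ) : ℂ) * Complex.exp (-(Complex.I * t * u)) = h δ t)
    (hneg : ∀ u, u ≤ 0 → B u = 0) (hmono : ∀ u h, 0 ≤ h → B u * Real.exp (-h) ≤ B (u + h)) : Tendsto B atTop (𝓝 1) := by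
  apply taub B hm M h0 hM hmono
  intro l hl
  have t1 := RL h hc l hl
  have t2 : Tendsto (fun y => ∫ u in Ioi (0:ℝ), l * k (l * (y - u))) atTop (𝓝 I0) := by
    have e : ∀ y : ℝ, ∫ u in Ioi (0:ℝ), l * k (l * (y - u)) = ∫ v in Iic y, l * k (l * v) := by
      intro y
      have := integral_sub_left_eq_self (fun v => (Iio y).indicator (fun v => l * k (l * v)) v) volume y
      rw [integral_indicator measurableSet_Iio] at this
      rw [integral_Iic_eq_integral_Iio, ← this, ← integral_indicator measurableSet_Ioi]
      congr 1
      funext u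
      simp [indicator]
    simp_rw [e]
    have hi : Integrable (fun v => l * k (l * v)) := ((integrable_comp_mul_left_iff k hl.ne').2 k_int).const_mul l
    have hI : ∫ v, l * k (l * v) = I0 := by
      rw [integral_const_mul, Measure.integral_comp_mul_left, abs_of_pos (inv_pos.2 hl), smul_eq_mul, ← mul_assoc, mul_inv_cancel₀ hl.ne', one_mul, I0]
    rw [← hI]
    have := (aecover_Iic (μ := volume) (tendsto_id (α := ℝ) (x := atTop))).integral_tendsto_of_countably_generated hi
    exact this
  have t3 := t1.add t2
  rw [zero_add] at t3
  refine t3.congr fun y => ?_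
  have hi1 : Integrable (fun u => l * k (l * (y - u))) := k_l_int l hl y
  have hi2 := Bk_int B hm M h0 hM l hl y
  rw [Phi_zero B hm M h0 hM h hc H l y hl, ← integral_add]
  · rw [← integral_indicator measurableSet_Ioi]
    congr 1
    funext u
    simp only [indicator, mem_Ioi]
    split_ifs with hu
    · ring
    · rw [hneg u (not_lt.1 hu), zero_mul]
  · have := (hi2.sub hi1).integrableOn (s := Ioi 0)
    refine this.congr (Eventually.of_forall fun u => ?_)
    simp; ring
  · exact hi1.integrableOn

end
end WI
end

section
open Filter Topology MeasureTheory Set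

namespace WI

/-- Wiener-Ikehara theorem (with an a priori Chebyshev bound). -/
theorem wiener_ikehara (b : ℕ → ℝ) (hb : ∀ m, 0 ≤ b m) (M : ℝ)
    (hM : ∀ n : ℕ, ∑ m ∈ Finset.Icc 1 n, b m ≤ M * n) (g : ℂ → ℂ)
    (hg : ContinuousOn g {s | 1 ≤ s.re})
    (hgs : ∀ s : ℂ, 1 < s.re → g s = LSeries (fun m => (b m : ℂ)) s - 1 / (s - 1)) :
    Tendsto (fun x : ℝ => (∑ m ∈ Finset.Icc 1 ⌊x⌋₊, b m) / x) atTop (𝓝 1) := by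
  set S : ℝ → ℝ := fun x => ∑ m ∈ Finset.Icc 1 ⌊x⌋₊, b m with hS
  have S0 : ∀ x, 0 ≤ S x := fun x => Finset.sum_nonneg fun m _ => hb m
  have Smono : Monotone S := fun x y hxy =>
    Finset.sum_le_sum_of_subset_of_nonneg (Finset.Icc_subset_Icc_right (Nat.floor_mono hxy)) fun m _ _ => hb m
  have M0 : 0 ≤ M := by
    have := hM 1
    simp at this
    exact (hb 1).trans this
  have SM : ∀ x, 0 ≤ x → S x ≤ M * x := fun x hx =>
    (hM _).trans (mul_le_mul_of_nonneg_left (Nat.floor_le hx) M0)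
  set B : ℝ → ℝ := (Ioi (0:ℝ)).indicator (fun u => Real.exp (-u) * S (Real.exp u)) with hBdef
  have Bpos : ∀ u, 0 < u → B u = Real.exp (-u) * S (Real.exp u) := fun u hu => by
    simp [hBdef, indicator, hu]
  have Bneg : ∀ u, u ≤ 0 → B u = 0 := fun u hu => by
    simp [hBdef, indicator, not_lt.2 hu]
  have B0 : ∀ u, 0 ≤ B u := fun u => indicator_nonneg (fun u _ => mul_nonneg (Real.exp_pos _).le (S0 _)) u
  have hBm : Measurable B := by
    apply Measurable.indicator _ measurableSet_Ioi
    exact (by fun_prop : Measurable fun u : ℝ => Real.exp (-u)).mul (Smono.measurable.comp Real.measurable_exp)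
  have BM : ∀ u, B u ≤ M := by
    intro u
    rcases le_or_gt u 0 with hu | hu
    · rw [Bneg u hu]; exact M0
    · rw [Bpos u hu]
      calc Real.exp (-u) * S (Real.exp u) ≤ Real.exp (-u) * (M * Real.exp u) := by
            gcongr; exact SM _ (Real.exp_pos _).le
        _ = M * (Real.exp (-u) * Real.exp u) := by ring
        _ = M := by rw [← Real.exp_add]; simp
  have key : Tendsto B atTop (𝓝 1) := by
    refine taub2 B hBm M B0 BM (fun δ t => (g (1 + |δ| + Complex.I * t) - 1) / (1 + |δ| + Complex.I * t)) ?_ ?_ Bneg ?_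
    · have hre : ∀ x : ℝ × ℝ, ((1 : ℂ) + ((|x.1| : ℝ) : ℂ) + Complex.I * (x.2 : ℂ)).re = 1 + |x.1| := by
        intro x; simp
      have hcc : Continuous (fun x : ℝ × ℝ => (1 : ℂ) + ((|x.1| : ℝ) : ℂ) + Complex.I * (x.2 : ℂ)) := by fun_prop
      have h1 : Continuous (fun x : ℝ × ℝ => g ((1 : ℂ) + ((|x.1| : ℝ) : ℂ) + Complex.I * (x.2 : ℂ))) := by
        refine hg.comp_continuous hcc fun x => ?_
        simp only [mem_setOf_eq, hre]
        linarith [abs_nonneg x.1]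
      refine Continuous.div (h1.sub continuous_const) hcc fun x hx => ?_
      have := hre x
      rw [hx] at this
      simp at this
      linarith [abs_nonneg x.1]
    · intro δ hδ t
      have habs : |δ| = δ := abs_of_pos hδ
      simp only [habs]
      set s : ℂ := 1 + δ + Complex.I * t with hs
      have hsre : s.re = 1 + δ := by simp [hs]
      have hs1 : 1 < s.re := by rw [hsre]; linarith
      rw [hgs s hs1]
      have hL := LSeries_eq_mul_integral_of_nonneg b (r := 1) zero_le_one (s := s) hs1 (by
        refine Asymptotics.IsBigO.of_bound M (Eventually.of_forall fun n => ?_)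
        rw [Real.norm_of_nonneg (Finset.sum_nonneg fun m _ => hb m), Real.rpow_one, Real.norm_of_nonneg (Nat.cast_nonneg _)]
        exact hM n) hb
      have hsub := integral_comp_exp_Ioi (fun x : ℝ => (∑ k ∈ Finset.Icc 1 ⌊x⌋₊, (b k : ℂ)) * (x : ℂ) ^ (-(s + 1))) 0
      rw [Real.exp_zero] at hsub
      rw [← hsub] at hL
      have hs0 : s ≠ 0 := fun h => by rw [h] at hs1; simp at hs1; linarith
      have hs2 : s - 1 ≠ 0 := fun h => by rw [sub_eq_zero.1 h] at hs1; simp at hs1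
      have e1 : ∀ u ∈ Ioi (0:ℝ), Real.exp u • ((∑ k ∈ Finset.Icc 1 ⌊Real.exp u⌋₊, (b k : ℂ)) * (Real.exp u : ℂ) ^ (-(s + 1)))
          = ((B u * Real.exp (-δ * u) : ℝ) : ℂ) * Complex.exp (-(Complex.I * t * u)) := by
        intro u hu
        rw [Bpos u hu]
        have hSc : (∑ k ∈ Finset.Icc 1 ⌊Real.exp u⌋₊, (b k : ℂ)) = ((S (Real.exp u) : ℝ) : ℂ) := by
          simp [hS]
        rw [hSc, Complex.ofReal_exp, ← Complex.ofReal_exp, Complex.ofReal_exp, Complex.cpow_def_of_ne_zero (Complex.exp_ne_zero _),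
          ← Complex.ofReal_exp, ← Complex.ofReal_log (Real.exp_pos _).le, Real.log_exp, Complex.real_smul]
        push_cast
        have : Complex.exp u * Complex.exp (u * -(s + 1)) = Complex.exp (-u) * Complex.exp (-δ * u) * Complex.exp (-(Complex.I * t * u)) := by
          rw [← Complex.exp_add, ← Complex.exp_add, ← Complex.exp_add, hs]
          congr 1
          ring
        linear_combination ((S (Real.exp u) : ℝ) : ℂ) * this
      rw [setIntegral_congr_fun measurableSet_Ioi e1] at hL
      have e2 : ∀ u : ℝ, (((B u - 1) * Real.exp (-δ * u) : ℝ) : ℂ) * Complex.exp (-(Complex.I * t * u))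
          = ((B u * Real.exp (-δ * u) : ℝ) : ℂ) * Complex.exp (-(Complex.I * t * u)) - Complex.exp (-(s - 1) * u) := by
        intro u
        have : Complex.exp (-(s - 1) * u) = Complex.exp (-δ * u) * Complex.exp (-(Complex.I * t * u)) := by
          rw [← Complex.exp_add, hs]; congr 1; ring
        rw [this]; push_cast; ring
      have hre1 : (-(s - 1)).re < 0 := by simp [hsre]; linarith
      have hIe := integrableOn_exp_mul_complex_Ioi hre1 0
      have hIB : IntegrableOn (fun u : ℝ => ((B u * Real.exp (-δ * u) : ℝ) : ℂ) * Complex.exp (-(Complex.I * t * u))) (Ioi 0) := by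
        have h1 : IntegrableOn (fun u => Real.exp (-δ * u)) (Ioi 0) := exp_neg_integrableOn_Ioi 0 hδ
        have h2 : IntegrableOn (fun u => B u * Real.exp (-δ * u)) (Ioi 0) := by
          refine h1.bdd_mul (c := M) hBm.aestronglyMeasurable (Eventually.of_forall fun u => ?_)
          rw [Real.norm_of_nonneg (B0 u)]; exact BM u
        refine Integrable.mul_bdd (c := 1) h2.ofReal ?_ (Eventually.of_forall fun u => ?_)
        · apply Continuous.aestronglyMeasurable; fun_prop
        · rw [Complex.norm_exp]; simp
      simp_rw [e2]
      rw [integral_sub hIB hIe, integral_exp_mul_complex_Ioi hre1, hL]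
      simp only [Complex.ofReal_zero, mul_zero, Complex.exp_zero]
      generalize (∫ u in Ioi (0:ℝ), ((B u * Real.exp (-δ * u) : ℝ) : ℂ) * Complex.exp (-(Complex.I * t * u))) = J
      have e : -(s-1) ≠ 0 := neg_ne_zero.2 hs2
      field_simp
      ring
    · intro u h hh
      rcases le_or_gt u 0 with hu | hu
      · rw [Bneg u hu, zero_mul]; exact B0 _
      · rw [Bpos u hu, Bpos _ (by linarith), neg_add, Real.exp_add]
        have : S (Real.exp u) ≤ S (Real.exp (u + h)) := Smono (Real.exp_le_exp.2 (by linarith))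
        calc _ = Real.exp (-u) * Real.exp (-h) * S (Real.exp u) := by ring
          _ ≤ _ := by gcongr
  have := key.comp Real.tendsto_log_atTop
  refine this.congr' ?_
  filter_upwards [eventually_gt_atTop 1] with x hx
  simp only [Function.comp]
  rw [Bpos _ (Real.log_pos hx), Real.exp_neg, Real.exp_log (by linarith)]
  rw [div_eq_inv_mul]

end WI
end

section
open Filter Topology MeasureTheory Set

namespace WI

section lattice
variable {E ι : Type*} [NormedAddCommGroup E] [NormedSpace ℝ E] [FiniteDimensional ℝ E] [MeasurableSpace E] [BorelSpace E]
  [Finite ι] (b : Module.Basis ι ℝ E)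

lemma lat_finite (ρ : ℝ) : {α : Submodule.span ℤ (Set.range b) | ‖(α : E)‖ ≤ ρ}.Finite := by
  have h := ZSpan.setFinite_inter b (s := Metric.closedBall (0:E) ρ) Metric.isBounded_closedBall
  refine Set.Finite.of_finite_image (f := Subtype.val) (h.subset ?_) Subtype.val_injective.injOn
  rintro _ ⟨α, hα, rfl⟩
  exact ⟨by simpa using hα, α.2⟩

/-- Riemann sum estimate: a Lipschitz function with bounded support summed over a scaled lattice. -/
theorem lattice_sum (W : E → ℝ) (L : NNReal) (hL : LipschitzWith L W) (R : ℝ) (hR : ∀ x, R < ‖x‖ → W x = 0) :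
    ∃ c C : ℝ, ∀ T : ℝ, 1 ≤ T →
      |∑' α : Submodule.span ℤ (Set.range b), W (T⁻¹ • (α : E)) - c * T ^ (Module.finrank ℝ E)|
        ≤ C * T ^ (Module.finrank ℝ E) / T := by
  classical
  have := Fintype.ofFinite ι
  set n := Module.finrank ℝ E
  let μ : Measure E := Measure.addHaar
  let D := ZSpan.fundamentalDomain b
  have hD : IsAddFundamentalDomain (Submodule.span ℤ (Set.range b)) D μ := ZSpan.isAddFundamentalDomain b μ
  have hinv : VAddInvariantMeasure (Submodule.span ℤ (Set.range b)) E μ :=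
    ⟨fun c s hs => by
      have : (fun x : E => c +ᵥ x) = fun x : E => (c : E) + x := rfl
      rw [this, measure_preimage_add]⟩
  obtain ⟨d, hd0, hd⟩ : ∃ d, 0 < d ∧ ∀ x ∈ D, ‖x‖ ≤ d := by
    obtain ⟨d, hd⟩ := (ZSpan.fundamentalDomain_isBounded b).exists_norm_le
    exact ⟨max d 1, by positivity, fun x hx => (hd x hx).trans (le_max_left _ _)⟩
  wlog hR0 : 0 ≤ R generalizing R
  · exact this 0 (fun x hx => hR x (by linarith)) le_rfl
  have hDfin : μ D < ⊤ := (ZSpan.fundamentalDomain_isBounded b).measure_lt_top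
  set v := μ.real D
  have hv : 0 < v := by
    have : μ D ≠ 0 := ZSpan.measure_fundamentalDomain_ne_zero b
    exact ENNReal.toReal_pos this hDfin.ne
  have hDm : MeasurableSet D := ZSpan.fundamentalDomain_measurableSet b
  -- lattice point count
  have hcount : ∀ ρ, 0 ≤ ρ → ((lat_finite b ρ).toFinset.card : ℝ) * v ≤ μ.real (Metric.closedBall (0:E) 1) * (ρ + d) ^ n := by
    intro ρ hρ
    let F := (lat_finite b ρ).toFinset
    have h1 : μ.real (Metric.closedBall (0:E) (ρ + d)) = μ.real (Metric.closedBall (0:E) 1) * (ρ + d) ^ n := by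
      rw [measureReal_def, Measure.addHaar_closedBall' μ _ (by positivity : 0 ≤ ρ + d), ENNReal.toReal_mul, ENNReal.toReal_ofReal (by positivity), mul_comm]
      rfl
    rw [← h1]
    have h2 : ∫ x, (Metric.closedBall (0:E) (ρ + d)).indicator (fun _ => (1:ℝ)) x ∂μ = μ.real (Metric.closedBall (0:E) (ρ + d)) := by
      rw [integral_indicator Metric.isClosed_closedBall.measurableSet]; simp
    have hInt : Integrable ((Metric.closedBall (0:E) (ρ + d)).indicator (fun _ => (1:ℝ))) μ := by
      rw [integrable_indicator_iff Metric.isClosed_closedBall.measurableSet]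
      exact integrableOn_const (by exact (measure_closedBall_lt_top).ne)
    have h3 := hD.integral_eq_tsum'' _ hInt
    have hsum : Summable fun g : Submodule.span ℤ (Set.range b) => ∫ x in D, (Metric.closedBall (0:E) (ρ + d)).indicator (fun _ => (1:ℝ)) (g +ᵥ x) ∂μ := by
      refine summable_of_finite_support ((lat_finite b (ρ + d + d)).subset fun g hg => ?_)
      by_contra hcon
      apply hg
      simp only [mem_setOf_eq, not_le] at hcon
      refine (setIntegral_congr_fun hDm (g := fun _ => (0:ℝ)) fun x hx => ?_).trans (by simp)
      apply indicator_of_notMem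
      simp only [Metric.mem_closedBall, dist_zero_right, not_le]
      have e1 : ‖(g : E)‖ ≤ ‖g +ᵥ x‖ + ‖x‖ := by
        have : (g : E) = (g +ᵥ x) - x := by simp [Submodule.vadd_def]
        calc ‖(g:E)‖ = ‖(g +ᵥ x) - x‖ := by rw [← this]
          _ ≤ _ := norm_sub_le _ _
      linarith [hd x hx]
    rw [h2] at h3
    rw [h3]
    calc (F.card : ℝ) * v = ∑ g ∈ F, ∫ x in D, (Metric.closedBall (0:E) (ρ + d)).indicator (fun _ => (1:ℝ)) (g +ᵥ x) ∂μ := by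
          rw [← nsmul_eq_mul, ← Finset.sum_const]
          refine Finset.sum_congr rfl fun g hg => ?_
          have hg' : ‖(g : E)‖ ≤ ρ := by simpa [F] using hg
          rw [setIntegral_congr_fun hDm (g := fun _ => (1:ℝ))]
          · simp [v]
          · intro x hx
            apply indicator_of_mem
            simp only [Metric.mem_closedBall, dist_zero_right]
            calc ‖g +ᵥ x‖ = ‖(g:E) + x‖ := rfl
              _ ≤ ‖(g:E)‖ + ‖x‖ := norm_add_le _ _
              _ ≤ _ := by linarith [hd x hx]
      _ ≤ _ := by
        refine hsum.sum_le_tsum F fun g _ => ?_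
        exact integral_nonneg fun x => indicator_nonneg (fun _ _ => zero_le_one) _
  have hWc : Continuous W := hL.continuous
  have hcs : HasCompactSupport W := by
    refine HasCompactSupport.intro (isCompact_closedBall (0:E) R) fun x hx => hR x ?_
    simpa using hx
  set I := ∫ x, W x ∂μ
  set V := μ.real (Metric.closedBall (0:E) 1)
  refine ⟨I / v, (L * d / v) * (V * (R + 2 * d) ^ n), fun T hT => ?_⟩
  have hT0 : 0 < T := by linarith
  let F := (lat_finite b (R * T + d)).toFinset
  have hF : ∀ g : Submodule.span ℤ (Set.range b), g ∉ F → R * T + d < ‖(g:E)‖ := by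
    intro g hg; simpa [F] using hg
  have hs1 : ∑' α : Submodule.span ℤ (Set.range b), W (T⁻¹ • (α : E)) = ∑ α ∈ F, W (T⁻¹ • (α : E)) := by
    refine tsum_eq_sum fun g hg => hR _ ?_
    have := hF g hg
    rw [norm_smul, norm_inv, Real.norm_of_nonneg hT0.le, lt_inv_mul_iff₀ hT0]
    linarith
  have hcs' : HasCompactSupport (fun x => W (T⁻¹ • x)) := by
    refine HasCompactSupport.intro (isCompact_closedBall (0:E) (T * R)) fun x hx => hR _ ?_
    simp only [Metric.mem_closedBall, dist_zero_right, not_le] at hx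
    rw [norm_smul, norm_inv, Real.norm_of_nonneg hT0.le, lt_inv_mul_iff₀ hT0]
    exact hx
  have hcont' : Continuous (fun x => W (T⁻¹ • x)) := by fun_prop
  have hInt' : Integrable (fun x => W (T⁻¹ • x)) μ := hcont'.integrable_of_hasCompactSupport hcs'
  have hs2 : T ^ n * I = ∑ α ∈ F, ∫ x in D, W (T⁻¹ • ((α:E) + x)) ∂μ := by
    have h1 : ∫ x, W (T⁻¹ • x) ∂μ = T ^ n * I := by
      rw [Measure.integral_comp_inv_smul, smul_eq_mul, abs_of_nonneg (by positivity)]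
    rw [← h1, hD.integral_eq_tsum'' _ hInt']
    refine tsum_eq_sum fun g hg => ?_
    refine (setIntegral_congr_fun hDm (g := fun _ => (0:ℝ)) fun x hx => hR _ ?_).trans (by simp)
    have := hF g hg
    rw [norm_smul, norm_inv, Real.norm_of_nonneg hT0.le, lt_inv_mul_iff₀ hT0]
    have e1 : ‖(g : E)‖ ≤ ‖g +ᵥ x‖ + ‖x‖ := by
      have : (g : E) = (g +ᵥ x) - x := by simp [Submodule.vadd_def]
      calc ‖(g:E)‖ = ‖(g +ᵥ x) - x‖ := by rw [← this]
        _ ≤ _ := norm_sub_le _ _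
    linarith [hd x hx]
  have hs3 : ∀ α : E, |v * W (T⁻¹ • α) - ∫ x in D, W (T⁻¹ • (α + x)) ∂μ| ≤ L * d / T * v := by
    intro α
    have e1 : v * W (T⁻¹ • α) = ∫ x in D, W (T⁻¹ • α) ∂μ := by simp [v]
    have hi2 : IntegrableOn (fun x => W (T⁻¹ • (α + x))) D μ := by
      have : Integrable (fun x => W (T⁻¹ • (α + x))) μ := hInt'.comp_add_left α
      exact this.integrableOn
    have hi1 : IntegrableOn (fun _ : E => W (T⁻¹ • α)) D μ := integrableOn_const hDfin.ne
    rw [e1, ← integral_sub hi1 hi2]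
    rw [← Real.norm_eq_abs]
    refine norm_setIntegral_le_of_norm_le_const hDfin fun x hx => ?_
    rw [← dist_eq_norm]
    have e3 := hL.dist_le_mul (T⁻¹ • α) (T⁻¹ • (α + x))
    rw [dist_eq_norm (T⁻¹ • α), ← smul_sub, sub_add_cancel_left, norm_smul, norm_neg, norm_inv, Real.norm_of_nonneg hT0.le] at e3
    refine e3.trans ?_
    have e4 := hd x hx
    calc (L:ℝ) * (T⁻¹ * ‖x‖) ≤ L * (T⁻¹ * d) := by gcongr
      _ = _ := by field_simp
  rw [hs1]
  have hs4 : v * (∑ α ∈ F, W (T⁻¹ • (α : E)) - I / v * T ^ n) = ∑ α ∈ F, (v * W (T⁻¹ • (α:E)) - ∫ x in D, W (T⁻¹ • ((α:E) + x)) ∂μ) := by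
    rw [Finset.sum_sub_distrib, ← hs2, ← Finset.mul_sum]
    field_simp
  have hs5 : v * |∑ α ∈ F, W (T⁻¹ • (α : E)) - I / v * T ^ n| ≤ F.card * (L * d / T * v) := by
    rw [← abs_of_pos hv, ← abs_mul, abs_of_pos hv, hs4]
    refine (Finset.abs_sum_le_sum_abs _ _).trans ?_
    rw [← nsmul_eq_mul, ← Finset.sum_const]
    exact Finset.sum_le_sum fun α _ => hs3 α
  have hc := hcount (R * T + d) (by positivity)
  have hc2 : (F.card : ℝ) * v ≤ V * ((R + 2 * d) * T) ^ n := by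
    refine hc.trans ?_
    have : R * T + d + d ≤ (R + 2 * d) * T := by nlinarith
    gcongr
  rw [mul_pow] at hc2
  rw [← mul_le_mul_iff_right₀ hv]
  calc _ ≤ (F.card : ℝ) * (L * d / T * v) := hs5
    _ = (L * d / T) * (F.card * v) := by ring
    _ ≤ (L * d / T) * (V * ((R + 2 * d) ^ n * T ^ n)) := by gcongr
    _ = _ := by field_simp

end lattice
end WI
end

section
open Filter Topology Set

namespace WI

/-- hat function -/
noncomputable def hat (t : ℝ) : ℝ := max 0 (1 - |t|)

lemma hat_nonneg (t : ℝ) : 0 ≤ hat t := le_max_left _ _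
lemma hat_le_one (t : ℝ) : hat t ≤ 1 := max_le zero_le_one (by linarith [abs_nonneg t])
lemma hat_lip (s t : ℝ) : |hat s - hat t| ≤ |s - t| := by
  unfold hat
  calc _ ≤ |(1 - |s|) - (1 - |t|)| := by
        rw [max_comm 0, max_comm 0]; exact abs_max_sub_max_le_abs _ _ _
    _ = |(|t| - |s|)| := by congr 1; ring
    _ ≤ |t - s| := abs_abs_sub_abs_le _ _
    _ = |s - t| := abs_sub_comm _ _
lemma hat_supp (t : ℝ) (h : hat t ≠ 0) : |t| < 1 := by
  by_contra hc
  exact h (max_eq_left (by linarith))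

/-- cut-off -/
noncomputable def cut (t : ℝ) : ℝ := t * max 0 (1 - t)
lemma cut_nonneg (t : ℝ) (h : 0 ≤ t) : 0 ≤ cut t := mul_nonneg h (le_max_left _ _)
lemma cut_le (t : ℝ) (h : 0 ≤ t) : cut t ≤ t := by
  unfold cut
  exact mul_le_of_le_one_right h (max_le zero_le_one (by linarith))
lemma cut_zero : cut 0 = 0 := by simp [cut]
lemma cut_lt (t : ℝ) (h : cut t ≠ 0) : t < 1 := by
  by_contra hc
  apply h
  rw [cut, max_eq_left (by linarith), mul_zero]
lemma cut_lip (s t : ℝ) (hs : 0 ≤ s) (ht : 0 ≤ t) : |cut s - cut t| ≤ |s - t| := by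
  unfold cut
  wlog h : t ≤ s generalizing s t
  · rw [abs_sub_comm, abs_sub_comm s]; exact this t s ht hs (by linarith)
  rw [abs_of_nonneg (by linarith : 0 ≤ s - t), abs_le]
  rcases le_total 1 s with h1 | h1 <;> rcases le_total 1 t with h2 | h2
  · rw [max_eq_left (by linarith), max_eq_left (by linarith)]; constructor <;> linarith
  · rw [max_eq_left (by linarith), max_eq_right (by linarith)]; constructor <;> nlinarith
  · have e : s = t := by linarith
    rw [e]; simp
  · rw [max_eq_right (by linarith), max_eq_right (by linarith)]; constructor <;> nlinarith

lemma prod_lip {I : Type*} (s : Finset I) (a b : I → ℝ) (ha : ∀ i, 0 ≤ a i) (ha1 : ∀ i, a i ≤ 1) (hb : ∀ i, 0 ≤ b i) (hb1 : ∀ i, b i ≤ 1)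
    (η : ℝ) (h : ∀ i, |a i - b i| ≤ η) : |∏ i ∈ s, a i - ∏ i ∈ s, b i| ≤ s.card * η := by
  classical
  induction s using Finset.induction_on with
  | empty => simp
  | insert i s hi ih =>
    rw [Finset.prod_insert hi, Finset.prod_insert hi, Finset.card_insert_of_notMem hi]
    have e : a i * ∏ i ∈ s, a i - b i * ∏ i ∈ s, b i = (a i - b i) * ∏ i ∈ s, a i + b i * (∏ i ∈ s, a i - ∏ i ∈ s, b i) := by ring
    rw [e]
    have h1 : ∏ i ∈ s, a i ≤ 1 := Finset.prod_le_one (fun i _ => ha i) fun i _ => ha1 i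
    have h0 : 0 ≤ ∏ i ∈ s, a i := Finset.prod_nonneg (fun i _ => ha i)
    refine (abs_add_le _ _).trans ?_
    rw [abs_mul, abs_mul, abs_of_nonneg h0, abs_of_nonneg (hb i)]
    have h2 := h i
    have h3 := hb1 i
    have h4 := abs_nonneg (a i - b i)
    have h5 := abs_nonneg (∏ i ∈ s, a i - ∏ i ∈ s, b i)
    push_cast
    nlinarith [hb i]

section
variable {V I : Type*} [Fintype V] [Nonempty V] [Fintype I] (d : V → ℕ) (hd : ∀ w, 1 ≤ d w)
  (ℓ : I → (V → ℝ) → ℝ) (K : ℝ) (hK : ∀ i t t' η, (∀ w, |t w - t' w| ≤ η) → |ℓ i t - ℓ i t'| ≤ K * η)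
  (C : ℝ) (hC : ∀ t, (∀ i, |ℓ i t| ≤ 1) → ∀ w, |t w - (∑ w, d w * t w) / (∑ w, d w : ℕ)| ≤ C)

/-- the weight function in terms of absolute values -/
noncomputable def WF (ν : V → ℝ) : ℝ := (∏ i, hat (ℓ i fun w => Real.log (ν w))) * cut (∏ w, ν w ^ d w)

lemma WF_nonneg (ν : V → ℝ) (h : ∀ w, 0 ≤ ν w) : 0 ≤ WF d ℓ ν :=
  mul_nonneg (Finset.prod_nonneg fun i _ => hat_nonneg _) (cut_nonneg _ (Finset.prod_nonneg fun w _ => pow_nonneg (h w) _))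

lemma WF_le (ν : V → ℝ) (h : ∀ w, 0 ≤ ν w) : WF d ℓ ν ≤ ∏ w, ν w ^ d w := by
  have h0 : 0 ≤ ∏ w, ν w ^ d w := Finset.prod_nonneg fun w _ => pow_nonneg (h w) _
  refine le_trans (mul_le_of_le_one_left (cut_nonneg _ h0) ?_) (cut_le _ h0)
  exact Finset.prod_le_one (fun i _ => hat_nonneg _) fun i _ => hat_le_one _

lemma WF_supp (d : V → ℕ)
    (hd : ∀ w, 1 ≤ d w)
    (ℓ : I → (V → ℝ) → ℝ)
    (C : ℝ)
    (hC : ∀ t, (∀ i, |ℓ i t| ≤ 1) → ∀ w, |t w - (∑ w, d w * t w) / (∑ w, d w : ℕ)| ≤ C)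
    (ν : V → ℝ) (h : ∀ w, 0 ≤ ν w) (hW : WF d ℓ ν ≠ 0) :
    ∃ m : ℝ, 0 < m ∧ m < 1 ∧ m ^ (∑ w, d w) = ∏ w, ν w ^ d w ∧ ∀ w, m * Real.exp (-C) ≤ ν w ∧ ν w ≤ m * Real.exp C := by
  have h1 := left_ne_zero_of_mul hW
  have h2 := right_ne_zero_of_mul hW
  have hN0 : ∏ w, ν w ^ d w ≠ 0 := fun hz => h2 (by rw [hz, cut_zero])
  have hν : ∀ w, 0 < ν w := fun w => lt_of_le_of_ne (h w) fun hz => by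
    apply hN0
    refine Finset.prod_eq_zero (Finset.mem_univ w) ?_
    rw [← hz, zero_pow (by have := hd w; omega)]
  have hN1 := cut_lt _ h2
  have hn : 0 < ∑ w, d w := Finset.sum_pos (fun w _ => hd w) Finset.univ_nonempty
  have hn' : (0:ℝ) < (∑ w, d w : ℕ) := by exact_mod_cast hn
  set t : V → ℝ := fun w => Real.log (ν w) with ht
  have hlog : Real.log (∏ w, ν w ^ d w) = ∑ w, d w * t w := by
    rw [Real.log_prod (fun w _ => (pow_pos (hν w) _).ne')]
    simp [ht]
  have hl0 : ∑ w, d w * t w < 0 := by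
    rw [← hlog]
    exact Real.log_neg (lt_of_le_of_ne (Finset.prod_nonneg fun w _ => pow_nonneg (h w) _) (Ne.symm hN0)) hN1
  have hb := hC t (fun i => (hat_supp _ (Finset.prod_ne_zero_iff.1 h1 i (Finset.mem_univ i))).le)
  refine ⟨Real.exp ((∑ w, d w * t w) / (∑ w, d w : ℕ)), Real.exp_pos _, ?_, ?_, fun w => ?_⟩
  · rw [Real.exp_lt_one_iff]
    exact div_neg_of_neg_of_pos hl0 hn'
  · rw [← Real.exp_nat_mul, mul_div_cancel₀ _ hn'.ne', ← hlog, Real.exp_log (lt_of_le_of_ne (Finset.prod_nonneg fun w _ => pow_nonneg (h w) _) (Ne.symm hN0))]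
  · have hb' := abs_le.1 (hb w)
    have : ν w = Real.exp (t w) := by simp [ht, Real.exp_log (hν w)]
    rw [this, ← Real.exp_add, ← Real.exp_add, Real.exp_le_exp, Real.exp_le_exp]
    constructor <;> linarith

lemma WF_lip_core (d : V → ℕ)
    (hd : ∀ w, 1 ≤ d w)
    (ℓ : I → (V → ℝ) → ℝ)
    (K : ℝ)
    (hK : ∀ i t t' η, (∀ w, |t w - t' w| ≤ η) → |ℓ i t - ℓ i t'| ≤ K * η)
    (C : ℝ)
    (hC : ∀ t, (∀ i, |ℓ i t| ≤ 1) → ∀ w, |t w - (∑ w, d w * t w) / (∑ w, d w : ℕ)| ≤ C)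
    (hK0 : 0 ≤ K) : ∃ L : ℝ, 0 ≤ L ∧ ∀ ν ν' : V → ℝ, (∀ w, 0 ≤ ν w) → (∀ w, 0 ≤ ν' w) → WF d ℓ ν ≠ 0 →
    WF d ℓ ν' ≤ ∏ w, ν w ^ d w → ∀ ε, (∀ w, |ν w - ν' w| ≤ ε) → |WF d ℓ ν - WF d ℓ ν'| ≤ L * ε := by
  set n := ∑ w, d w with hn_def
  have hn : 0 < ∑ w, d w := Finset.sum_pos (fun w _ => hd w) Finset.univ_nonempty
  set c := Real.exp (-C) with hc_def
  have hc : 0 < c := Real.exp_pos _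
  refine ⟨2 / c * (Fintype.card I * K + n * Real.exp n) + 2 / c, by positivity, fun ν ν' h h' hW hN ε hε => ?_⟩
  obtain ⟨m, hm0, hm1, hmn, hm⟩ := WF_supp d hd ℓ C hC ν h hW
  have hε0 : 0 ≤ ε := (abs_nonneg _).trans (hε (Classical.arbitrary V))
  set N := ∏ w, ν w ^ d w with hNdef
  have hmle : N ≤ m := by
    rw [← hmn]
    exact pow_le_of_le_one hm0.le hm1.le hn.ne'
  have hA : 0 ≤ 2 / c * (Fintype.card I * K + n * Real.exp n) * ε := by positivity
  rcases le_or_gt (c / 2 * m) ε with hcase | hcase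
  · have h1 := WF_le d ℓ ν h
    have h2 := WF_nonneg d ℓ ν h
    have h3 := WF_nonneg d ℓ ν' h'
    have h4 : N ≤ 2 / c * ε := by
      calc N ≤ m := hmle
        _ = 2 / c * (c / 2 * m) := by field_simp
        _ ≤ _ := by gcongr
    rw [add_mul, abs_le]
    constructor <;> linarith
  · set η := ε / (c / 2 * m) with hη
    have hη1 : η ≤ 1 := (div_le_one (by positivity)).2 hcase.le
    have hη0 : 0 ≤ η := by positivity
    have hνlow : ∀ w, c * m ≤ ν w := fun w => by linarith [(hm w).1]
    have hν'low : ∀ w, c / 2 * m ≤ ν' w := fun w => by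
      have := (abs_le.1 (hε w)).2
      have := hνlow w
      linarith
    have hνp : ∀ w, 0 < ν w := fun w => lt_of_lt_of_le (by positivity) (hνlow w)
    have hν'p : ∀ w, 0 < ν' w := fun w => lt_of_lt_of_le (by positivity) (hν'low w)
    have hlog1 : ∀ x y : ℝ, c / 2 * m ≤ x → c / 2 * m ≤ y → |x - y| ≤ ε → Real.log x - Real.log y ≤ η := by
      intro x y hx hy hxy
      have hcm : 0 < c / 2 * m := by positivity
      have hx0 : 0 < x := lt_of_lt_of_le hcm hx
      have hy0 : 0 < y := lt_of_lt_of_le hcm hy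
      rw [← Real.log_div hx0.ne' hy0.ne']
      refine (Real.log_le_sub_one_of_pos (by positivity)).trans ?_
      rw [div_sub_one hy0.ne']
      calc (x - y) / y ≤ ε / y := by gcongr; exact (le_abs_self _).trans hxy
        _ ≤ ε / (c / 2 * m) := by gcongr
    have hlog : ∀ w, |Real.log (ν w) - Real.log (ν' w)| ≤ η := by
      intro w
      have a1 : c / 2 * m ≤ ν w := le_trans (by nlinarith [mul_pos hc hm0]) (hνlow w)
      rw [abs_le]
      constructor
      · have := hlog1 _ _ (hν'low w) a1 (by rw [abs_sub_comm]; exact hε w)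
        linarith
      · exact hlog1 _ _ a1 (hν'low w) (hε w)
    set N' := ∏ w, ν' w ^ d w with hN'def
    have hNp : 0 < N := Finset.prod_pos fun w _ => pow_pos (hνp w) _
    have hN'p : 0 < N' := Finset.prod_pos fun w _ => pow_pos (hν'p w) _
    have hlogN : |Real.log N' - Real.log N| ≤ n * η := by
      rw [hNdef, hN'def, Real.log_prod (fun w _ => (pow_pos (hνp w) _).ne'), Real.log_prod (fun w _ => (pow_pos (hν'p w) _).ne'), ← Finset.sum_sub_distrib]
      refine (Finset.abs_sum_le_sum_abs _ _).trans ?_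
      rw [hn_def]
      push_cast
      rw [Finset.sum_mul]
      refine Finset.sum_le_sum fun w _ => ?_
      rw [Real.log_pow, Real.log_pow, ← mul_sub, abs_mul, Nat.abs_cast, abs_sub_comm]
      exact mul_le_mul_of_nonneg_left (hlog w) (Nat.cast_nonneg _)
    have hNN : |N - N'| ≤ N * (n * Real.exp n * η) := by
      have e1 : N' = N * Real.exp (Real.log N' - Real.log N) := by
        rw [Real.exp_sub, Real.exp_log hNp, Real.exp_log hN'p]; field_simp
      set x := Real.log N' - Real.log N with hx
      have e2 : |Real.exp x - 1| ≤ n * Real.exp n * η := by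
        have hnη : (n:ℝ) * η ≤ n := mul_le_of_le_one_right (Nat.cast_nonneg _) hη1
        have hxx := abs_le.1 hlogN
        have hge1 : 1 ≤ Real.exp n := Real.one_le_exp (Nat.cast_nonneg _)
        have hq : 0 ≤ (n:ℝ) * η := by positivity
        rw [abs_le]
        constructor
        · have := Real.add_one_le_exp x
          nlinarith
        · have h3 := Real.add_one_le_exp (-x)
          have h4 : Real.exp x * Real.exp (-x) = 1 := by rw [← Real.exp_add]; simp
          have h5 := Real.exp_pos x
          have h6 : Real.exp x ≤ Real.exp n := Real.exp_le_exp.2 (by linarith)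
          have h7 : Real.exp x - 1 ≤ Real.exp x * x := by nlinarith
          calc _ ≤ Real.exp x * x := h7
            _ ≤ Real.exp x * (n * η) := by gcongr; exact hxx.2
            _ ≤ Real.exp n * (n * η) := by gcongr
            _ = _ := by ring
      rw [e1, show N - N * Real.exp x = -(N * (Real.exp x - 1)) by ring, abs_neg, abs_mul, abs_of_pos hNp]
      gcongr
    have hprod := prod_lip Finset.univ (fun i => hat (ℓ i fun w => Real.log (ν w))) (fun i => hat (ℓ i fun w => Real.log (ν' w)))
      (fun _ => hat_nonneg _) (fun _ => hat_le_one _) (fun _ => hat_nonneg _) (fun _ => hat_le_one _) (K * η)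
      (fun i => (hat_lip _ _).trans (hK i _ _ η hlog))
    have hcut := (cut_lip N N' hNp.le hN'p.le).trans hNN
    have hcutN := cut_le N hNp.le
    have hcut0 := cut_nonneg N hNp.le
    unfold WF
    rw [← hNdef, ← hN'def]
    set P := ∏ i, hat (ℓ i fun w => Real.log (ν w))
    set P' := ∏ i, hat (ℓ i fun w => Real.log (ν' w))
    have hP'0 : 0 ≤ P' := Finset.prod_nonneg fun i _ => hat_nonneg _
    have hP'1 : P' ≤ 1 := Finset.prod_le_one (fun i _ => hat_nonneg _) fun i _ => hat_le_one _
    have e : P * cut N - P' * cut N' = (P - P') * cut N + P' * (cut N - cut N') := by ring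
    rw [e]
    have hbound : |(P - P') * cut N + P' * (cut N - cut N')| ≤ (Fintype.card I * (K * η)) * N + N * (n * Real.exp n * η) := by
      refine (abs_add_le _ _).trans ?_
      rw [abs_mul, abs_mul, abs_of_nonneg hcut0, abs_of_nonneg hP'0]
      have hq := abs_nonneg (cut N - cut N')
      rw [Finset.card_univ] at hprod
      have hz : P' * |cut N - cut N'| ≤ |cut N - cut N'| := mul_le_of_le_one_left hq hP'1
      exact add_le_add (mul_le_mul hprod hcutN hcut0 (by positivity)) (hz.trans hcut)
    refine hbound.trans ?_
    have hNη : N * η ≤ 2 / c * ε := by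
      calc N * η ≤ m * η := by gcongr
        _ = _ := by rw [hη]; field_simp
    have h2 : 0 ≤ 2 / c * ε := by positivity
    calc _ = (Fintype.card I * K + n * Real.exp n) * (N * η) := by ring
      _ ≤ (Fintype.card I * K + n * Real.exp n) * (2 / c * ε) := by gcongr
      _ ≤ _ := by rw [add_mul]; linarith

lemma WF_lip (d : V → ℕ)
    (hd : ∀ w, 1 ≤ d w)
    (ℓ : I → (V → ℝ) → ℝ)
    (K : ℝ)
    (hK : ∀ i t t' η, (∀ w, |t w - t' w| ≤ η) → |ℓ i t - ℓ i t'| ≤ K * η)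
    (C : ℝ)
    (hC : ∀ t, (∀ i, |ℓ i t| ≤ 1) → ∀ w, |t w - (∑ w, d w * t w) / (∑ w, d w : ℕ)| ≤ C)
    (hK0 : 0 ≤ K) : ∃ L : ℝ, 0 ≤ L ∧ ∀ ν ν' : V → ℝ, (∀ w, 0 ≤ ν w) → (∀ w, 0 ≤ ν' w) →
    ∀ ε, (∀ w, |ν w - ν' w| ≤ ε) → |WF d ℓ ν - WF d ℓ ν'| ≤ L * ε := by
  obtain ⟨L, hL0, hL⟩ := WF_lip_core d hd ℓ K hK C hC hK0
  refine ⟨L, hL0, fun ν ν' h h' ε hε => ?_⟩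
  have hε0 : 0 ≤ ε := (abs_nonneg _).trans (hε (Classical.arbitrary V))
  have hε' : ∀ w, |ν' w - ν w| ≤ ε := fun w => by rw [abs_sub_comm]; exact hε w
  have hN : 0 ≤ ∏ w, ν w ^ d w := Finset.prod_nonneg fun w _ => pow_nonneg (h w) _
  have hN' : 0 ≤ ∏ w, ν' w ^ d w := Finset.prod_nonneg fun w _ => pow_nonneg (h' w) _
  by_cases h1 : WF d ℓ ν = 0 <;> by_cases h2 : WF d ℓ ν' = 0
  · rw [h1, h2]; simp; positivity
  · rw [abs_sub_comm]; exact hL ν' ν h' h h2 (by rw [h1]; exact hN') ε hε'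
  · exact hL ν ν' h h' h1 (by rw [h2]; exact hN) ε hε
  · rcases le_total (∏ w, ν w ^ d w) (∏ w, ν' w ^ d w) with hle | hle
    · rw [abs_sub_comm]; exact hL ν' ν h' h h2 ((WF_le d ℓ ν h).trans hle) ε hε'
    · exact hL ν ν' h h' h1 ((WF_le d ℓ ν' h').trans hle) ε hε

end
end WI
end

section
open Filter Topology Set

namespace WI
open scoped Classical
open NumberField NumberField.InfinitePlace NumberField.mixedEmbedding NumberField.Units NumberField.Units.dirichletUnitTheorem
open NumberField.mixedEmbedding.fundamentalCone

variable (K : Type*) [Field K] [NumberField K]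

/-- linearised log map -/
noncomputable def Lg : (InfinitePlace K → ℝ) →ₗ[ℝ] logSpace K where
  toFun t := fun w => mult w.val * (t w.val - (∑ v, mult v * t v) * (Module.finrank ℚ K : ℝ)⁻¹)
  map_add' x y := by
    ext w
    simp only [Pi.add_apply, mul_add, Finset.sum_add_distrib]
    ring
  map_smul' c x := by
    ext w
    have : ∑ v, (mult v : ℝ) * (c * x v) = c * ∑ v, (mult v : ℝ) * x v := by
      rw [Finset.mul_sum]; exact Finset.sum_congr rfl fun _ _ => by ring
    simp only [Pi.smul_apply, smul_eq_mul, RingHom.id_apply, this]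
    ring

/-- real basis of the log space -/
noncomputable def lb : Module.Basis (Fin (rank K)) ℝ (logSpace K) :=
  (basisUnitLattice K).ofZLatticeBasis ℝ (unitLattice K)

/-- coordinate functionals -/
noncomputable def lc (i : Fin (rank K)) : (InfinitePlace K → ℝ) →ₗ[ℝ] ℝ := (lb K).coord i ∘ₗ Lg K

lemma mult_ge (w : InfinitePlace K) : 1 ≤ mult w := Nat.one_le_iff_ne_zero.2 mult_ne_zero

lemma lc_bd : ∃ M : ℝ, 0 ≤ M ∧ ∀ (i : Fin (rank K)) (t t' : InfinitePlace K → ℝ) η, (∀ w, |t w - t' w| ≤ η) → |lc K i t - lc K i t'| ≤ M * η := by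
  refine ⟨∑ i, ‖(lc K i).toContinuousLinearMap‖, Finset.sum_nonneg fun _ _ => norm_nonneg _, fun i t t' η h => ?_⟩
  have hη : 0 ≤ η := (abs_nonneg _).trans (h (Classical.arbitrary _))
  have h1 : ‖t - t'‖ ≤ η := (pi_norm_le_iff_of_nonneg hη).2 fun w => h w
  have h2 := (lc K i).toContinuousLinearMap.le_opNorm (t - t')
  simp only [LinearMap.coe_toContinuousLinearMap', map_sub, Real.norm_eq_abs] at h2
  refine h2.trans ?_
  have h3 : ‖(lc K i).toContinuousLinearMap‖ ≤ ∑ i, ‖(lc K i).toContinuousLinearMap‖ :=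
    Finset.single_le_sum (f := fun i => ‖(lc K i).toContinuousLinearMap‖) (fun _ _ => norm_nonneg _) (Finset.mem_univ i)
  exact mul_le_mul h3 h1 (norm_nonneg _) (Finset.sum_nonneg fun _ _ => norm_nonneg _)

lemma lc_supp : ∃ C : ℝ, ∀ t : InfinitePlace K → ℝ, (∀ i, |lc K i t| ≤ 1) → ∀ w, |t w - (∑ w, mult w * t w) / (∑ w : InfinitePlace K, mult w : ℕ)| ≤ C := by
  classical
  set C1 : ℝ := ∑ i, ‖lb K i‖ with hC1
  have hC10 : 0 ≤ C1 := Finset.sum_nonneg fun _ _ => norm_nonneg _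
  refine ⟨C1 + Fintype.card (InfinitePlace K) * C1, fun t ht => ?_⟩
  have hn : (∑ w : InfinitePlace K, mult w : ℕ) = Module.finrank ℚ K := sum_mult_eq
  have hn0 : (0:ℝ) < Module.finrank ℚ K := by exact_mod_cast Module.finrank_pos
  rw [hn]
  have hv : ‖Lg K t‖ ≤ C1 := by
    rw [← (lb K).sum_repr (Lg K t)]
    refine (norm_sum_le _ _).trans (Finset.sum_le_sum fun i _ => ?_)
    rw [_root_.norm_smul]
    exact mul_le_of_le_one_left (norm_nonneg _) (ht i)
  set a := (∑ w, mult w * t w) / (Module.finrank ℚ K : ℝ) with ha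
  have h1 : ∀ w : InfinitePlace K, w ≠ w₀ → |mult w * (t w - a)| ≤ C1 := fun w hw => (norm_le_pi_norm (Lg K t) ⟨w, hw⟩).trans hv
  have h1' : ∀ w : InfinitePlace K, |t w - a| ≤ |mult w * (t w - a)| := fun w => by
    rw [abs_mul, Nat.abs_cast]
    have : (1:ℝ) ≤ mult w := by exact_mod_cast mult_ge K w
    nlinarith [abs_nonneg (t w - a)]
  have h2 : ∑ w : InfinitePlace K, (mult w : ℝ) * (t w - a) = 0 := by
    simp_rw [mul_sub]
    rw [Finset.sum_sub_distrib, ← Finset.sum_mul]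
    have : ∑ w : InfinitePlace K, (mult w : ℝ) = Module.finrank ℚ K := by rw [← hn]; push_cast; rfl
    rw [this, ha]
    field_simp
    ring
  intro w
  by_cases hw : w = w₀
  · subst hw
    rw [← Finset.add_sum_erase _ _ (Finset.mem_univ w₀)] at h2
    refine (h1' _).trans ?_
    rw [eq_neg_of_add_eq_zero_left h2, abs_neg]
    refine (Finset.abs_sum_le_sum_abs _ _).trans ?_
    calc _ ≤ ∑ w ∈ Finset.univ.erase (w₀ : InfinitePlace K), C1 := Finset.sum_le_sum fun w hw => h1 w (Finset.ne_of_mem_erase hw)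
      _ = ((Finset.univ.erase (w₀ : InfinitePlace K)).card : ℝ) * C1 := by rw [Finset.sum_const, nsmul_eq_mul]
      _ ≤ Fintype.card (InfinitePlace K) * C1 := by gcongr; exact Finset.card_le_univ _
      _ ≤ _ := by linarith
  · have := (h1' w).trans (h1 w hw)
    have : 0 ≤ Fintype.card (InfinitePlace K) * C1 := by positivity
    linarith

/-- the weight function on the mixed space -/
noncomputable def Wt (x : mixedSpace K) : ℝ := WF (fun w => mult w) (fun i t => lc K i t) (fun w => normAtPlace w x)

lemma Wt_lip : ∃ L : NNReal, LipschitzWith L (Wt K) := by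
  obtain ⟨M, hM0, hM⟩ := lc_bd K
  obtain ⟨C, hC⟩ := lc_supp K
  obtain ⟨L, hL0, hL⟩ := WF_lip (fun w : InfinitePlace K => mult w) (mult_ge K) (fun i t => lc K i t) M hM C hC hM0
  refine ⟨⟨L, hL0⟩, LipschitzWith.of_dist_le_mul fun x y => ?_⟩
  rw [Real.dist_eq, dist_eq_norm]
  refine hL _ _ (fun w => normAtPlace_nonneg w x) (fun w => normAtPlace_nonneg w y) _ fun w => ?_
  have hle : ∀ z : mixedSpace K, normAtPlace w z ≤ ‖z‖ := fun z => by
    rw [norm_eq_sup'_normAtPlace]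
    exact Finset.le_sup' (fun w => normAtPlace w z) (Finset.mem_univ w)
  have h1 := normAtPlace_add_le w (x - y) y
  have h2 := normAtPlace_add_le w (y - x) x
  have h3 := hle (x - y)
  have h4 := hle (y - x)
  rw [norm_sub_rev] at h4
  rw [sub_add_cancel] at h1 h2
  rw [abs_le]
  constructor <;> linarith

lemma Wt_supp : ∃ R : ℝ, ∀ x, R < ‖x‖ → Wt K x = 0 := by
  obtain ⟨C, hC⟩ := lc_supp K
  refine ⟨Real.exp C, fun x hx => ?_⟩
  by_contra hne
  obtain ⟨m, hm0, hm1, -, hm⟩ := WF_supp (fun w : InfinitePlace K => mult w) (mult_ge K) (fun i t => lc K i t) C hC _ (fun w => normAtPlace_nonneg w x) hne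
  rw [norm_eq_sup'_normAtPlace] at hx
  obtain ⟨w, -, hw⟩ := (Finset.lt_sup'_iff _).1 hx
  have := (hm w).2
  have := Real.exp_pos C
  nlinarith

lemma Wt_eq (x : mixedSpace K) : Wt K x = (∏ i, hat ((lb K).coord i (logMap x))) * cut (mixedEmbedding.norm x) := by
  unfold Wt WF
  rw [← mixedEmbedding.norm_apply]
  by_cases hx : mixedEmbedding.norm x = 0
  · rw [hx, cut_zero]; simp
  · congr 1
    refine Finset.prod_congr rfl fun i _ => ?_
    congr 1
    change (lb K).coord i (Lg K _) = _
    congr 1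
    ext w
    rw [logMap_apply, mixedEmbedding.norm_apply, Real.log_prod]
    · simp [Lg, Real.log_pow]
    · intro w _
      exact pow_ne_zero _ (mixedEmbedding.norm_ne_zero_iff.1 hx w)

lemma Wt_smul (x : mixedSpace K) (T : ℝ) (hT : 0 < T) : Wt K (T⁻¹ • x) = (∏ i, hat ((lb K).coord i (logMap x))) * cut (mixedEmbedding.norm x / T ^ Module.finrank ℚ K) := by
  rw [Wt_eq, mixedEmbedding.norm_smul, abs_of_pos (inv_pos.2 hT)]
  by_cases hx : mixedEmbedding.norm x = 0
  · rw [hx, mul_zero, zero_div, cut_zero]; simp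
  · rw [logMap_real_smul hx (inv_pos.2 hT).ne', inv_pow, div_eq_inv_mul]

lemma hat_sum (c : ℝ) : ∑ k ∈ ({-⌊c⌋, -⌊c⌋ - 1} : Finset ℤ), hat (c + k) = 1 := by
  rw [Finset.sum_pair (by omega)]
  have h1 := Int.floor_le c
  have h2 := Int.lt_floor_add_one c
  unfold hat
  push_cast
  rw [abs_of_nonneg (by linarith), abs_of_nonpos (by linarith), max_eq_right (by linarith), max_eq_right (by linarith)]
  ring

lemma hat_zero (c : ℝ) (k : ℤ) (hk : k ∉ ({-⌊c⌋, -⌊c⌋ - 1} : Finset ℤ)) : hat (c + k) = 0 := by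
  by_contra h
  have := abs_lt.1 (hat_supp _ h)
  apply hk
  have h1 : -k ≤ ⌊c⌋ + 1 := by
    have : -(k:ℝ) < c + 1 := by linarith
    have h3 := Int.lt_floor_add_one c
    have : ((-k : ℤ) : ℝ) < ((⌊c⌋ + 2 : ℤ) : ℝ) := by push_cast; linarith
    have := Int.cast_lt.1 this
    omega
  have h2 : ⌊c⌋ ≤ -k := by
    have : c < -(k:ℝ) + 1 := by linarith
    have h3 := Int.floor_le c
    have : ((⌊c⌋ : ℤ) : ℝ) < ((-k + 1 : ℤ) : ℝ) := by push_cast; linarith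
    have := Int.cast_lt.1 this
    omega
  simp only [Finset.mem_insert, Finset.mem_singleton]
  omega

/-- units as torsion times a free part -/
noncomputable def unitEquiv : (torsion K × (Fin (rank K) → ℤ)) ≃ (𝓞 K)ˣ :=
  Equiv.ofBijective (fun ζe => ζe.1 * ∏ i, (fundSystem K i) ^ (ζe.2 i)) (by
    constructor
    · intro a b hab
      exact (exist_unique_eq_mul_prod K _).unique rfl hab
    · intro x
      obtain ⟨z, hz, -⟩ := exist_unique_eq_mul_prod K x
      exact ⟨z, hz.symm⟩)

lemma coord_unit (z : torsion K × (Fin (rank K) → ℤ)) (i : Fin (rank K)) :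
    (lb K).coord i (logEmbedding K (Additive.ofMul (unitEquiv K z))) = z.2 i := by
  have h : logEmbedding K (Additive.ofMul (unitEquiv K z)) = ∑ j, (z.2 j : ℝ) • lb K j := by
    change logEmbedding K (Additive.ofMul ((z.1 : (𝓞 K)ˣ) * ∏ i, (fundSystem K i) ^ (z.2 i))) = _
    rw [ofMul_mul, map_add, ofMul_prod, map_sum]
    have : logEmbedding K (Additive.ofMul (z.1 : (𝓞 K)ˣ)) = 0 := logEmbedding_eq_zero_iff.2 z.1.2
    rw [this, zero_add]
    refine Finset.sum_congr rfl fun j _ => ?_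
    rw [ofMul_zpow, map_zsmul, logEmbedding_fundSystem, lb, Module.Basis.ofZLatticeBasis_apply, Int.cast_smul_eq_zsmul]
  rw [h, Module.Basis.coord_apply, Module.Basis.repr_sum_self]

open Classical in
lemma unit_sum (x : mixedSpace K) (hx : mixedEmbedding.norm x ≠ 0) :
    ∑' u : (𝓞 K)ˣ, ∏ i, hat ((lb K).coord i (logMap (u • x))) = torsionOrder K := by
  haveI : Fintype (torsion K) := Fintype.ofFinite _
  rw [← (unitEquiv K).tsum_eq]
  set c : Fin (rank K) → ℝ := fun i => (lb K).coord i (logMap x) with hc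
  have e : ∀ z : torsion K × (Fin (rank K) → ℤ), ∏ i, hat ((lb K).coord i (logMap ((unitEquiv K z) • x))) = ∏ i, hat (c i + z.2 i) := by
    intro z
    refine Finset.prod_congr rfl fun i _ => ?_
    rw [logMap_unit_smul _ hx, map_add, coord_unit, add_comm]
  simp_rw [e]
  rw [tsum_eq_sum (s := (Finset.univ : Finset (torsion K)) ×ˢ Fintype.piFinset fun i => ({-⌊c i⌋, -⌊c i⌋ - 1} : Finset ℤ))]
  · rw [Finset.sum_product]
    simp only
    rw [← Finset.prod_univ_sum (fun i => ({-⌊c i⌋, -⌊c i⌋ - 1} : Finset ℤ)) (fun i k => hat (c i + k))]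
    simp_rw [hat_sum]
    simp [torsionOrder]
  · rintro ⟨ζ, k⟩ hk
    simp only [Finset.mem_product, Finset.mem_univ, true_and, Fintype.mem_piFinset, not_forall] at hk
    obtain ⟨i, hi⟩ := hk
    exact Finset.prod_eq_zero (Finset.mem_univ i) (hat_zero _ _ hi)

end WI
end

section
open Filter Topology Set

namespace WI
open scoped Classical nonZeroDivisors
open NumberField NumberField.InfinitePlace NumberField.mixedEmbedding NumberField.Units NumberField.Units.dirichletUnitTheorem
open NumberField.mixedEmbedding.fundamentalCone

variable (K : Type*) [Field K] [NumberField K]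

/-- principal multiples of `J` -/
abbrev PM (J : (Ideal (𝓞 K))⁰) := {P : (Ideal (𝓞 K))⁰ // J ∣ P ∧ (P : Ideal (𝓞 K)).IsPrincipal}

lemma norm_emb (a : 𝓞 K) : mixedEmbedding.norm (mixedEmbedding K (a : K)) = Ideal.absNorm (Ideal.span {a}) := by
  rw [norm_eq_norm, Ideal.absNorm_span_singleton, Nat.cast_natAbs, ← Algebra.coe_norm_int]
  push_cast
  rfl

lemma class_sum (J : (Ideal (𝓞 K))⁰) (T : ℝ) (hT : 0 < T) :
    ∑' α : Submodule.span ℤ (Set.range (fractionalIdealLatticeBasis K (FractionalIdeal.mk0 K J))), Wt K (T⁻¹ • (α : mixedSpace K))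
      = torsionOrder K * ∑' P : PM K J, cut ((Ideal.absNorm (P.1 : Ideal (𝓞 K)) : ℝ) / T ^ Module.finrank ℚ K) := by
  have hgen : ∀ P : PM K J, ∃ a : 𝓞 K, Ideal.span {a} = (P.1 : Ideal (𝓞 K)) := fun P => by
    obtain ⟨a, ha⟩ := P.2.2.principal
    exact ⟨a, ha.symm⟩
  choose gen hg using hgen
  have hg0 : ∀ P : PM K J, gen P ≠ 0 := fun P h0 => by
    have := hg P
    rw [h0, Ideal.span_singleton_eq_bot.2 rfl] at this
    exact nonZeroDivisors.coe_ne_zero P.1 this.symm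
  have hmem : ∀ (P : PM K J) (u : (𝓞 K)ˣ), (u : 𝓞 K) * gen P ∈ (J : Ideal (𝓞 K)) := fun P u => by
    refine Ideal.mul_mem_left _ _ ?_
    have h1 : (J : Ideal (𝓞 K)) ∣ P.1 := nonZeroDivisors_dvd_iff_dvd_coe.1 P.2.1
    have h2 := Ideal.le_of_dvd h1
    rw [← hg P, Ideal.span_singleton_le_iff_mem] at h2
    exact h2
  have hL : ∀ x : mixedSpace K, x ∈ Submodule.span ℤ (Set.range (fractionalIdealLatticeBasis K (FractionalIdeal.mk0 K J))) ↔ ∃ a : 𝓞 K, a ∈ (J : Ideal (𝓞 K)) ∧ mixedEmbedding K (a : K) = x := fun x => by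
    rw [mem_span_fractionalIdealLatticeBasis]
    simp only [FractionalIdeal.coe_mk0, Set.mem_image, SetLike.mem_coe, FractionalIdeal.mem_coeIdeal]
    constructor
    · rintro ⟨_, ⟨a, ha, rfl⟩, rfl⟩; exact ⟨a, ha, rfl⟩
    · rintro ⟨a, ha, rfl⟩; exact ⟨_, ⟨a, ha, rfl⟩, rfl⟩
  let φ : PM K J × (𝓞 K)ˣ → Submodule.span ℤ (Set.range (fractionalIdealLatticeBasis K (FractionalIdeal.mk0 K J))) :=
    fun z => ⟨mixedEmbedding K (((z.2 : 𝓞 K) * gen z.1 : 𝓞 K) : K), (hL _).2 ⟨_, hmem z.1 z.2, rfl⟩⟩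
  have hφ : Function.Injective φ := by
    rintro ⟨P, u⟩ ⟨Q, v⟩ h
    have h1 : (u : 𝓞 K) * gen P = v * gen Q := by
      have := congrArg Subtype.val h
      exact RingOfIntegers.ext (mixedEmbedding_injective K this)
    have h2 : P = Q := by
      apply Subtype.ext; apply Subtype.ext
      rw [← hg P, ← hg Q, Ideal.span_singleton_eq_span_singleton]
      exact ⟨u * v⁻¹, by
        rw [Units.val_mul, ← mul_assoc, mul_comm (gen P) u, h1, mul_comm (v : 𝓞 K), mul_assoc, Units.mul_inv, mul_one]⟩
    subst h2
    rw [mul_right_cancel₀ (hg0 P) h1 |> Units.ext]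
  set f : Submodule.span ℤ (Set.range (fractionalIdealLatticeBasis K (FractionalIdeal.mk0 K J))) → ℝ := fun α => Wt K (T⁻¹ • (α : mixedSpace K)) with hf
  have hsupp : Function.support f ⊆ Set.range φ := by
    intro α hα
    obtain ⟨a, ha, hae⟩ := (hL _).1 α.2
    have ha0 : a ≠ 0 := by
      rintro rfl
      apply hα
      simp only [hf]
      rw [← hae, Wt_smul K _ T hT, norm_emb]
      simp [cut_zero]
    have hsn : Ideal.span {a} ∈ (Ideal (𝓞 K))⁰ := mem_nonZeroDivisors_of_ne_zero (by rwa [Ne, Ideal.zero_eq_bot, Ideal.span_singleton_eq_bot])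
    let P : PM K J := ⟨⟨Ideal.span {a}, hsn⟩, nonZeroDivisors_dvd_iff_dvd_coe.2 (Ideal.dvd_iff_le.2 ((Ideal.span_singleton_le_iff_mem _).2 ha)), ⟨a, rfl⟩⟩
    have h1 := hg P
    obtain ⟨u, hu⟩ := Ideal.span_singleton_eq_span_singleton.1 h1
    refine ⟨(P, u), Subtype.ext ?_⟩
    rw [← hae, ← hu, mul_comm]
  have hsum : Summable f := by
    obtain ⟨R, hR⟩ := Wt_supp K
    refine summable_of_finite_support ((lat_finite _ (R * T)).subset fun α hα => ?_)
    simp only [Set.mem_setOf_eq]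
    by_contra hcon
    refine hα (hR _ ?_)
    rw [_root_.norm_smul, norm_inv, Real.norm_of_nonneg hT.le, lt_inv_mul_iff₀ hT, mul_comm]
    exact not_le.1 hcon
  have hcs : Summable fun z : PM K J × (𝓞 K)ˣ => f (φ z) := hsum.comp_injective hφ
  rw [← hφ.tsum_eq hsupp, hcs.tsum_prod, ← tsum_mul_left]
  refine tsum_congr fun P => ?_
  have e : ∀ u : (𝓞 K)ˣ, (f ∘ φ) (P, u) = (∏ i, hat ((lb K).coord i (logMap (u • mixedEmbedding K (gen P : K))))) * cut ((Ideal.absNorm (P.1 : Ideal (𝓞 K)) : ℝ) / T ^ Module.finrank ℚ K) := fun u => by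
    simp only [Function.comp_apply, hf]
    rw [Wt_smul K _ T hT]
    simp only [φ]
    rw [norm_emb]
    congr 1
    · refine Finset.prod_congr rfl fun i _ => ?_
      rw [unitSMul_smul, ← map_mul]
      rfl
    · rw [← hg P]
      congr 4
      rw [Ideal.span_singleton_eq_span_singleton]
      exact ⟨u⁻¹, by rw [mul_comm (u : 𝓞 K), mul_assoc, Units.mul_inv, mul_one]⟩
  have e' : ∀ u : (𝓞 K)ˣ, f (φ (P, u)) = _ := e
  rw [tsum_congr e', tsum_mul_right, unit_sum]
  rw [norm_emb, hg]
  exact_mod_cast (Ideal.absNorm_ne_zero_of_nonZeroDivisors P.1)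

lemma fin_supp (X : ℝ) (hX : 0 < X) : (Function.support fun I : (Ideal (𝓞 K))⁰ => cut ((Ideal.absNorm (I : Ideal (𝓞 K)) : ℝ) / X)).Finite := by
  refine (Ideal.finite_setOfPred_absNorm_le₀ (S := 𝓞 K) ⌊X⌋₊).subset fun I hI => ?_
  have := (div_lt_one hX).1 (cut_lt _ hI)
  exact Nat.le_floor this.le

lemma ideal_sum : ∃ c C : ℝ, 0 ≤ C ∧ ∀ X : ℝ, 1 ≤ X →
    |∑' I : (Ideal (𝓞 K))⁰, cut ((Ideal.absNorm (I : Ideal (𝓞 K)) : ℝ) / X) - c * X| ≤ C * X ^ (1 - 1 / (Module.finrank ℚ K : ℝ)) := by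
  obtain ⟨L, hL⟩ := Wt_lip K
  obtain ⟨R, hR⟩ := Wt_supp K
  set n := Module.finrank ℚ K with hn
  have hn0 : n ≠ 0 := Module.finrank_pos.ne'
  have hn0' : (n:ℝ) ≠ 0 := by exact_mod_cast hn0
  have ht0 : (0:ℝ) < torsionOrder K := by exact_mod_cast torsionOrder_pos K
  have key : ∀ C : ClassGroup (𝓞 K), ∃ c M : ℝ, 0 ≤ M ∧ ∀ X : ℝ, 1 ≤ X →
      |∑' I : {I : (Ideal (𝓞 K))⁰ // ClassGroup.mk0 I = C}, cut ((Ideal.absNorm (I.1 : Ideal (𝓞 K)) : ℝ) / X) - c * X| ≤ M * X ^ (1 - 1 / (n : ℝ)) := by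
    intro C
    obtain ⟨J, hJ⟩ := ClassGroup.mk0_surjective C⁻¹
    obtain ⟨c, M, h⟩ := lattice_sum (fractionalIdealLatticeBasis K (FractionalIdeal.mk0 K J)) (Wt K) L hL R hR
    rw [mixedEmbedding.finrank K, ← hn] at h
    have hM0 : 0 ≤ M := by
      have := (abs_nonneg _).trans (h 1 le_rfl)
      simpa using this
    set N : ℝ := ((Ideal.absNorm (J : Ideal (𝓞 K)) : ℕ) : ℝ) with hN
    have hN1 : 1 ≤ N := by
      rw [hN]
      exact_mod_cast Nat.one_le_iff_ne_zero.2 (Ideal.absNorm_ne_zero_of_nonZeroDivisors J)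
    refine ⟨c * N / torsionOrder K, M * N ^ (1 - 1 / (n:ℝ)) / torsionOrder K, by positivity, fun X hX => ?_⟩
    have hX0 : 0 < X := by linarith
    have hXN : 1 ≤ X * N := one_le_mul_of_one_le_of_one_le hX hN1
    set T := (X * N) ^ (1 / (n:ℝ)) with hT
    have hT1 : 1 ≤ T := Real.one_le_rpow hXN (by positivity)
    have hTn : T ^ n = X * N := by
      rw [hT, one_div, Real.rpow_inv_natCast_pow (by linarith) hn0]
    have h1 := h T hT1
    rw [class_sum K J T (by linarith), ← hn, hTn] at h1
    have e : ∑' P : PM K J, cut ((Ideal.absNorm (P.1 : Ideal (𝓞 K)) : ℝ) / (X * N)) = ∑' I : {I : (Ideal (𝓞 K))⁰ // ClassGroup.mk0 I = C}, cut ((Ideal.absNorm (I.1 : Ideal (𝓞 K)) : ℝ) / X) := by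
      let eq : {I : (Ideal (𝓞 K))⁰ // ClassGroup.mk0 I = C} ≃ PM K J :=
        ((Equiv.dvd J).subtypeEquiv (q := fun I => (I.1 : Ideal (𝓞 K)).IsPrincipal) fun I => by
          rw [← ClassGroup.mk0_eq_one_iff (SetLike.coe_mem _)]
          simp_rw [Equiv.dvd_apply, Submonoid.coe_mul, ← Submonoid.mul_def, _root_.map_mul, hJ, inv_mul_eq_one, eq_comm]).trans
          (Equiv.subtypeSubtypeEquivSubtypeInter (fun I : (Ideal (𝓞 K))⁰ ↦ J ∣ I) (fun I => (I : Ideal (𝓞 K)).IsPrincipal))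
      rw [← eq.tsum_eq]
      refine tsum_congr fun I => ?_
      have : ((eq I).1 : Ideal (𝓞 K)) = J * I.1 := rfl
      rw [this, map_mul, Nat.cast_mul, ← hN, mul_comm N, mul_div_mul_right _ _ (by linarith : N ≠ 0)]
    rw [e] at h1
    have h2 : M * (X * N) / T = M * N ^ (1 - 1 / (n:ℝ)) * X ^ (1 - 1 / (n:ℝ)) := by
      rw [hT, mul_div_assoc, mul_assoc, ← Real.mul_rpow (by linarith) (by linarith), mul_comm N, Real.rpow_sub (by linarith), Real.rpow_one]
    rw [h2] at h1
    have h3 : ∀ S : ℝ, S - c * N / torsionOrder K * X = (torsionOrder K * S - c * (X * N)) / torsionOrder K := fun S => by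
      field_simp
    rw [h3, abs_div, abs_of_pos ht0, div_mul_eq_mul_div]
    gcongr
  choose c M hM0 h using key
  refine ⟨∑ C, c C, ∑ C, M C, Finset.sum_nonneg fun C _ => hM0 C, fun X hX => ?_⟩
  have hs : Summable fun I : (Ideal (𝓞 K))⁰ => cut ((Ideal.absNorm (I : Ideal (𝓞 K)) : ℝ) / X) := summable_of_finite_support (fin_supp K X (by linarith))
  have hs2 : Summable fun z => cut ((Ideal.absNorm ((Equiv.sigmaFiberEquiv fun I : (Ideal (𝓞 K))⁰ => ClassGroup.mk0 I) z : Ideal (𝓞 K)) : ℝ) / X) := (Equiv.sigmaFiberEquiv fun I : (Ideal (𝓞 K))⁰ => ClassGroup.mk0 I).summable_iff.2 hs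
  rw [← (Equiv.sigmaFiberEquiv fun I : (Ideal (𝓞 K))⁰ => ClassGroup.mk0 I).tsum_eq, hs2.tsum_sigma, tsum_fintype, Finset.sum_mul, Finset.sum_mul, ← Finset.sum_sub_distrib]
  refine (Finset.abs_sum_le_sum_abs _ _).trans (Finset.sum_le_sum fun C _ => ?_)
  exact h C X hX

end WI
end

section
open Filter Topology Set

namespace WI
open MeasureTheory

lemma cut_cont : Continuous cut := by unfold cut; fun_prop

lemma cpow_sub_one' {x s : ℂ} (hx : x ≠ 0) : x ^ (s - 1) = x ^ s / x := by
  rw [Complex.cpow_sub _ _ hx, Complex.cpow_one]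

lemma cut_mellin (m : ℕ) (hm : 1 ≤ m) (s : ℂ) (hs : 0 < s.re) :
    IntegrableOn (fun X : ℝ => (cut (m / X) : ℂ) * (X : ℂ) ^ (-s - 1)) (Ioi 1) ∧
    ∫ X in Ioi (1:ℝ), (cut (m / X) : ℂ) * (X : ℂ) ^ (-s - 1) = (m : ℂ) ^ (-s) / ((s + 1) * (s + 2)) := by
  have hm1 : (1:ℝ) ≤ m := by exact_mod_cast hm
  have hm0 : (0:ℝ) < m := by linarith
  have hmc : (m:ℂ) ≠ 0 := by exact_mod_cast hm0.ne'
  have hs1 : s + 1 ≠ 0 := fun h => by have := congrArg Complex.re h; simp at this; linarith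
  have hs2 : s + 2 ≠ 0 := fun h => by have := congrArg Complex.re h; simp at this; linarith
  have e : ∀ X ∈ Ioi (1:ℝ), (cut (m / X) : ℂ) * (X : ℂ) ^ (-s - 1) = (Ioi (m:ℝ)).indicator (fun X : ℝ => (m : ℂ) * (X : ℂ) ^ (-s - 2) - (m:ℂ) ^ 2 * (X : ℂ) ^ (-s - 3)) X := by
    intro X hX
    have hX0 : 0 < X := lt_trans one_pos hX
    have hXc : (X : ℂ) ≠ 0 := by exact_mod_cast hX0.ne'
    by_cases h : X ∈ Ioi (m:ℝ)
    · rw [indicator_of_mem h]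
      have h1 : m / X ≤ 1 := (div_le_one hX0).2 (le_of_lt h)
      rw [cut, max_eq_right (by linarith), show -s - 2 = (-s - 1) - 1 by ring, show -s - 3 = (-s - 1) - 1 - 1 by ring]
      generalize -s - 1 = t
      rw [cpow_sub_one' (s := t - 1) hXc, cpow_sub_one' (s := t) hXc]
      push_cast
      field_simp
    · rw [indicator_of_notMem h, cut, max_eq_left (by
        have : 1 ≤ m / X := (one_le_div hX0).2 (not_lt.1 h)
        linarith)]
      simp
  have hi1 := (integrableOn_Ioi_cpow_of_lt (a := -s - 2) (by simp; linarith) hm0)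
  have hi2 := (integrableOn_Ioi_cpow_of_lt (a := -s - 3) (by simp; linarith) hm0)
  have hI : IntegrableOn (fun X : ℝ => (m : ℂ) * (X : ℂ) ^ (-s - 2) - (m:ℂ) ^ 2 * (X : ℂ) ^ (-s - 3)) (Ioi (m:ℝ)) := (hi1.const_mul _).sub (hi2.const_mul _)
  constructor
  · rw [integrableOn_congr_fun e measurableSet_Ioi]
    exact ((integrable_indicator_iff measurableSet_Ioi).2 hI).integrableOn
  · rw [setIntegral_congr_fun measurableSet_Ioi e, setIntegral_indicator measurableSet_Ioi, inter_eq_right.2 (Ioi_subset_Ioi hm1), integral_sub (hi1.const_mul _) (hi2.const_mul _), integral_const_mul, integral_const_mul,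
      integral_Ioi_cpow_of_lt (by simp; linarith) hm0, integral_Ioi_cpow_of_lt (by simp; linarith) hm0]
    have e1 : ((m:ℝ):ℂ) ^ (-s - 2 + 1) = (m:ℂ) ^ (-s) / m := by
      rw [show -s - 2 + 1 = -s - 1 by ring, Complex.ofReal_natCast, cpow_sub_one' hmc]
    have e2 : ((m:ℝ):ℂ) ^ (-s - 3 + 1) = (m:ℂ) ^ (-s) / m / m := by
      rw [show -s - 3 + 1 = -s - 1 - 1 by ring, Complex.ofReal_natCast, cpow_sub_one' hmc, cpow_sub_one' hmc]
    rw [e1, e2, show -s - 2 + 1 = -(s+1) by ring, show -s - 3 + 1 = -(s+2) by ring]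
    field_simp
    ring

lemma LS_term (a : ℕ → ℝ) (s : ℂ) (m : ℕ) (hm : m ≠ 0) : LSeries.term (fun m => (a m : ℂ)) s m = a m * (m:ℂ) ^ (-s) := by
  rw [LSeries.term_of_ne_zero hm, Complex.cpow_neg]; rfl

theorem zeta_ext (a : ℕ → ℝ) (ha : ∀ m, 0 ≤ a m) (hs : ∀ s : ℂ, 1 < s.re → LSeriesSummable (fun m => (a m : ℂ)) s)
    (c C ε : ℝ) (hε : 0 < ε) (hC : 0 ≤ C) (h : ∀ X : ℝ, 1 ≤ X → |∑' m : ℕ, a m * cut (m / X) - c * X| ≤ C * X ^ (1 - ε)) :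
    ∃ M : ℂ → ℂ, (∀ s, 1 - ε < s.re → DifferentiableAt ℂ M s) ∧ ∀ s, 1 < s.re → LSeries (fun m => (a m : ℂ)) s = (s + 1) * (s + 2) * (c / (s - 1) + M s) := by
  set S : ℝ → ℝ := fun X => ∑' m : ℕ, a m * cut (m / X) with hS
  set E : ℝ → ℝ := (Ioi 1).indicator fun X => S X - c * X with hE
  have hcz : ∀ (X : ℝ) (m : ℕ), 0 < X → X ≤ m → cut (m / X) = 0 := fun X m hX hm => by
    by_contra hne
    have := (div_lt_one hX).1 (cut_lt _ hne)
    linarith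
  have hsum : ∀ X : ℝ, 0 < X → Summable fun m : ℕ => a m * cut (m / X) := fun X hX => by
    refine summable_of_finite_support ((Finset.range (⌈X⌉₊)).finite_toSet.subset fun m hm => ?_)
    simp only [Finset.coe_range, mem_Iio]
    by_contra hcon
    apply hm
    have : X ≤ m := (Nat.le_ceil X).trans (by exact_mod_cast not_lt.1 hcon)
    simp only [hcz X m hX this, mul_zero]
  have hEm : Measurable E := by
    refine measurable_of_tendsto_metrizable (f := fun N : ℕ => (Ioi 1).indicator fun X => ∑ m ∈ Finset.range N, a m * cut (m / X) - c * X) (fun N => ?_) ?_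
    · refine Measurable.indicator ?_ measurableSet_Ioi
      refine (Finset.measurable_sum _ fun m _ => ?_).sub (measurable_const.mul measurable_id)
      exact measurable_const.mul (cut_cont.measurable.comp (measurable_const.div measurable_id))
    · rw [tendsto_pi_nhds]
      intro X
      by_cases hX : X ∈ Ioi (1:ℝ)
      · simp only [hE, indicator_of_mem hX]
        exact ((hsum X (lt_trans one_pos hX)).hasSum.tendsto_sum_nat).sub tendsto_const_nhds
      · simp only [hE, indicator_of_notMem hX]
        exact tendsto_const_nhds
  have hEb : ∀ X, 0 < X → |E X| ≤ C * X ^ (1 - ε) := fun X hX0 => by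
    by_cases hX : X ∈ Ioi (1:ℝ)
    · simp only [hE, indicator_of_mem hX]; exact h X (le_of_lt hX)
    · simp only [hE, indicator_of_notMem hX, abs_zero]; positivity
  have hloc : LocallyIntegrableOn (fun X => (E X : ℂ)) (Ioi 0) := by
    have h1 : LocallyIntegrableOn (fun X : ℝ => C * X ^ (1 - ε)) (Ioi 0) := by
      refine ContinuousOn.locallyIntegrableOn (fun X hX => ?_) measurableSet_Ioi
      exact (continuousAt_const.mul (Real.continuousAt_rpow_const _ _ (Or.inl (ne_of_gt hX)))).continuousWithinAt
    intro x hx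
    obtain ⟨U, hU, hUi⟩ := h1 x hx
    refine ⟨U ∩ Ioi 0, inter_mem hU self_mem_nhdsWithin, Integrable.mono (hUi.mono_set inter_subset_left) ((Complex.measurable_ofReal.comp hEm).aestronglyMeasurable) ?_⟩
    have : ∀ᵐ y ∂(volume.restrict (Ioi (0:ℝ))), ‖(E y : ℂ)‖ ≤ ‖C * y ^ (1 - ε)‖ := by
      refine (ae_restrict_iff' measurableSet_Ioi).2 (Eventually.of_forall fun y hy => ?_)
      rw [Complex.norm_real, Real.norm_eq_abs, Real.norm_eq_abs]
      exact (hEb y hy).trans (le_abs_self _)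
    exact ae_mono (Measure.restrict_mono inter_subset_right le_rfl) this
  have hzero : ∀ b : ℝ, (fun X => (E X : ℂ)) =O[𝓝[>] 0] fun x : ℝ => x ^ (-b) := fun b => by
    refine (Asymptotics.isBigO_zero _ _).congr' ?_ EventuallyEq.rfl
    have : Iio (1:ℝ) ∈ 𝓝[>] (0:ℝ) := mem_nhdsWithin_of_mem_nhds (Iio_mem_nhds one_pos)
    filter_upwards [this] with x hx
    simp only [hE]
    rw [indicator_of_notMem (by simp only [mem_Ioi, not_lt]; exact le_of_lt hx)]
    simp
  have htop : (fun X => (E X : ℂ)) =O[atTop] fun x : ℝ => x ^ (-(-(1 - ε))) := by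
    rw [neg_neg]
    refine Asymptotics.IsBigO.of_bound C ?_
    filter_upwards [eventually_gt_atTop 0] with x hx
    rw [Complex.norm_real, Real.norm_eq_abs, Real.norm_of_nonneg (by positivity)]
    exact hEb x hx
  refine ⟨fun s => mellin (fun X => (E X : ℂ)) (-s), fun s hs' => ?_, fun s hs1 => ?_⟩
  · have := mellin_differentiableAt_of_isBigO_rpow (s := -s) hloc htop (by simp; linarith) (hzero ((-s).re - 1)) (by linarith)
    exact this.comp s differentiableAt_id.neg
  · have hconv := mellinConvergent_of_isBigO_rpow (s := -s) hloc htop (by simp; linarith) (hzero ((-s).re - 1)) (by linarith)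
    have hs0 : 0 < s.re := by linarith
    have hp1 : s + 1 ≠ 0 := fun h => by have := congrArg Complex.re h; simp at this; linarith
    have hp2 : s + 2 ≠ 0 := fun h => by have := congrArg Complex.re h; simp at this; linarith
    have hp3 : s - 1 ≠ 0 := fun h => by have := congrArg Complex.re h; simp at this; linarith
    have hset : ∫ X in Ioi (0:ℝ), (X:ℂ) ^ (-s - 1) • (E X : ℂ) = ∫ X in Ioi (1:ℝ), (X:ℂ) ^ (-s - 1) * ((S X : ℂ) - c * X) := by
      have : ∀ X : ℝ, (X:ℂ) ^ (-s - 1) • (E X : ℂ) = (Ioi (1:ℝ)).indicator (fun X : ℝ => (X:ℂ) ^ (-s - 1) * ((S X : ℂ) - c * X)) X := fun X => by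
        by_cases hX : X ∈ Ioi (1:ℝ)
        · simp only [hE, indicator_of_mem hX, smul_eq_mul]; push_cast; rfl
        · simp only [hE, indicator_of_notMem hX]; simp
      simp_rw [this]
      rw [setIntegral_indicator measurableSet_Ioi, inter_eq_right.2 (Ioi_subset_Ioi zero_le_one)]
    -- interchange
    have hF_int : ∀ m : ℕ, IntegrableOn (fun X : ℝ => (a m : ℂ) * ((cut (m / X) : ℂ) * (X : ℂ) ^ (-s - 1))) (Ioi 1) := fun m => by
      rcases Nat.eq_zero_or_pos m with rfl | hm
      · simp [cut_zero]
      · exact (cut_mellin m hm s hs0).1.const_mul _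
    have hval : ∀ m : ℕ, ∫ X in Ioi (1:ℝ), (a m : ℂ) * ((cut (m / X) : ℂ) * (X : ℂ) ^ (-s - 1)) = LSeries.term (fun m => (a m : ℂ)) s m / ((s+1) * (s+2)) := fun m => by
      rcases Nat.eq_zero_or_pos m with rfl | hm
      · simp [cut_zero]
      · rw [integral_const_mul, (cut_mellin m hm s hs0).2, LS_term _ _ _ hm.ne', mul_div_assoc]
    have hnorm : ∀ m : ℕ, ∫ X in Ioi (1:ℝ), ‖(a m : ℂ) * ((cut (m / X) : ℂ) * (X : ℂ) ^ (-s - 1))‖ = ‖LSeries.term (fun m => (a m : ℂ)) s m‖ / ((s.re+1) * (s.re+2)) := fun m => by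
      rcases Nat.eq_zero_or_pos m with rfl | hm
      · simp [cut_zero]
      · have hm0 : (0:ℝ) < m := by exact_mod_cast hm
        have h1 : ∀ X ∈ Ioi (1:ℝ), ((‖(a m : ℂ) * ((cut (m / X) : ℂ) * (X : ℂ) ^ (-s - 1))‖ : ℝ) : ℂ) = (a m : ℂ) * ((cut (m / X) : ℂ) * (X : ℂ) ^ (-(s.re : ℂ) - 1)) := fun X hX => by
          have hX0 : 0 < X := lt_trans one_pos hX
          rw [norm_mul, norm_mul, Complex.norm_real, Complex.norm_real, Real.norm_of_nonneg (ha m), Real.norm_of_nonneg (cut_nonneg _ (by positivity)), Complex.norm_cpow_eq_rpow_re_of_pos hX0]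
          push_cast
          rw [Complex.ofReal_cpow hX0.le]
          simp
        have h2 := (cut_mellin m hm (s.re : ℂ) (by simpa using hs0)).2
        have h3 : ((∫ X in Ioi (1:ℝ), ‖(a m : ℂ) * ((cut (m / X) : ℂ) * (X : ℂ) ^ (-s - 1))‖ : ℝ) : ℂ) = ((‖LSeries.term (fun m => (a m : ℂ)) s m‖ / ((s.re+1) * (s.re+2)) : ℝ) : ℂ) := by
          rw [← integral_complex_ofReal, setIntegral_congr_fun measurableSet_Ioi h1, integral_const_mul, h2, LS_term _ _ _ hm.ne', norm_mul, Complex.norm_real, Real.norm_of_nonneg (ha m), ← Complex.ofReal_natCast, Complex.norm_cpow_eq_rpow_re_of_pos hm0]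
          push_cast
          rw [Complex.ofReal_cpow hm0.le]
          simp [mul_div_assoc]
        exact_mod_cast h3
    have hF_sum : Summable fun m : ℕ => ∫ X in Ioi (1:ℝ), ‖(a m : ℂ) * ((cut (m / X) : ℂ) * (X : ℂ) ^ (-s - 1))‖ := by
      simp_rw [hnorm]
      exact (hs s hs1).norm.div_const _
    have hInt := hasSum_integral_of_summable_integral_norm hF_int hF_sum
    have hmain : ∫ X in Ioi (1:ℝ), ∑' m : ℕ, (a m : ℂ) * ((cut (m / X) : ℂ) * (X : ℂ) ^ (-s - 1)) = LSeries (fun m => (a m : ℂ)) s / ((s+1) * (s+2)) := by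
      rw [← hInt.tsum_eq]
      simp_rw [hval]
      rw [tsum_div_const]
      rfl
    have hS' : ∀ X : ℝ, ∑' m : ℕ, (a m : ℂ) * ((cut (m / X) : ℂ) * (X : ℂ) ^ (-s - 1)) = (X:ℂ) ^ (-s - 1) * (S X : ℂ) := fun X => by
      simp_rw [← mul_assoc]
      rw [tsum_mul_right, mul_comm]
      congr 1
      rw [hS, Complex.ofReal_tsum]
      push_cast
      rfl
    simp_rw [hS'] at hmain
    have hcx : ∀ X ∈ Ioi (1:ℝ), (X:ℂ) ^ (-s - 1) * (c * X : ℂ) = c * (X:ℂ) ^ (-s) := fun X hX => by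
      have hX0 : 0 < X := lt_trans one_pos hX
      have hXc : (X : ℂ) ≠ 0 := by exact_mod_cast hX0.ne'
      rw [cpow_sub_one' hXc]
      field_simp
    have hci : IntegrableOn (fun X : ℝ => (X:ℂ) ^ (-s - 1) * (c * X : ℂ)) (Ioi 1) := by
      rw [integrableOn_congr_fun hcx measurableSet_Ioi]
      exact (integrableOn_Ioi_cpow_of_lt (by simp; linarith) one_pos).const_mul _
    have hcv : ∫ X in Ioi (1:ℝ), (X:ℂ) ^ (-s - 1) * (c * X : ℂ) = c / (s - 1) := by
      rw [setIntegral_congr_fun measurableSet_Ioi hcx, integral_const_mul, integral_Ioi_cpow_of_lt (by simp; linarith) one_pos]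
      simp only [Complex.ofReal_one, Complex.one_cpow]
      rw [show -s + 1 = -(s - 1) by ring, neg_div_neg_eq]
      ring
    have hEi : IntegrableOn (fun X : ℝ => (X:ℂ) ^ (-s - 1) * ((S X : ℂ) - c * X)) (Ioi 1) := by
      have := hconv.mono_set (Ioi_subset_Ioi zero_le_one : Ioi (1:ℝ) ⊆ Ioi 0)
      refine (integrableOn_congr_fun (fun X hX => ?_) measurableSet_Ioi).1 this
      simp only [hE, indicator_of_mem hX, smul_eq_mul]; push_cast; rfl
    have hsplit : ∫ X in Ioi (1:ℝ), (X:ℂ) ^ (-s - 1) * (S X : ℂ) = c / (s - 1) + mellin (fun X => (E X : ℂ)) (-s) := by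
      rw [mellin, hset, ← hcv, ← integral_add hci hEi]
      refine setIntegral_congr_fun measurableSet_Ioi fun X _ => ?_
      ring
    rw [← hsplit, hmain]
    field_simp

end WI
end

section
open Filter Topology Set

namespace WI

/-- Behaviour of the logarithmic derivative near a point. -/
lemma ord_lim (F : ℂ → ℂ) (z : ℂ) (hF : AnalyticAt ℂ F z) (hnz : ¬ ∀ᶠ w in 𝓝 z, F w = 0) :
    ∃ k : ℕ, Tendsto (fun t : ℝ => (t : ℂ) * (deriv F (z + t) / F (z + t))) (𝓝[>] 0) (𝓝 (k : ℂ)) ∧ (F z = 0 → 1 ≤ k) ∧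
      ∀ᶠ t : ℝ in 𝓝[>] 0, F (z + t) ≠ 0 := by
  have hlim : Tendsto (fun t : ℝ => z + t) (𝓝[>] 0) (𝓝[≠] z) := by
    refine tendsto_nhdsWithin_of_tendsto_nhds_of_eventually_within _ ?_ ?_
    · have : Continuous fun t : ℝ => z + t := by fun_prop
      have h := this.tendsto 0
      simp only [Complex.ofReal_zero, add_zero] at h
      exact h.mono_left nhdsWithin_le_nhds
    · filter_upwards [self_mem_nhdsWithin] with t ht
      have : t ≠ 0 := ne_of_gt ht
      simpa using this
  obtain ⟨n, g, hg, hg0, hev⟩ := hF.exists_eventuallyEq_pow_smul_nonzero_iff.2 hnz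
  have hev' : F =ᶠ[𝓝 z] fun w => (w - z) ^ n * g w := hev
  have hne : ∀ᶠ w in 𝓝[≠] z, g w ≠ 0 := (hg.continuousAt.eventually_ne hg0).filter_mono nhdsWithin_le_nhds
  have hd : ∀ᶠ w in 𝓝[≠] z, deriv F w / F w = n / (w - z) + deriv g w / g w := by
    have h1 := hev'.eventuallyEq_nhds
    filter_upwards [h1.filter_mono nhdsWithin_le_nhds, hne, self_mem_nhdsWithin, hg.eventually_analyticAt.filter_mono nhdsWithin_le_nhds] with w hw hgw hwz hga
    have hwz' : w - z ≠ 0 := sub_ne_zero.2 hwz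
    rw [hw.deriv_eq, hw.eq_of_nhds]
    have : HasDerivAt (fun w => (w - z) ^ n * g w) ((n * (w - z) ^ (n - 1) * 1) * g w + (w - z) ^ n * deriv g w) w :=
      (((hasDerivAt_id w).sub_const z).pow n).mul hga.differentiableAt.hasDerivAt
    rw [this.deriv]
    rcases n with _ | n
    · simp
    · simp only [Nat.add_sub_cancel]
      field_simp
      ring
  refine ⟨n, ?_, fun h => ?_, ?_⟩
  · have h1 : Tendsto (fun t : ℝ => (n:ℂ) + t * (deriv g (z + t) / g (z + t))) (𝓝[>] 0) (𝓝 ((n:ℂ) + 0 * (deriv g z / g z))) := by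
      refine tendsto_const_nhds.add (Tendsto.mul ?_ ?_)
      · have := (Complex.continuous_ofReal.tendsto 0).mono_left (nhdsWithin_le_nhds (s := Ioi 0))
        simpa using this
      · exact ((hg.deriv.continuousAt.div hg.continuousAt hg0).tendsto.mono_left nhdsWithin_le_nhds).comp hlim
    rw [zero_mul, add_zero] at h1
    refine h1.congr' ?_
    filter_upwards [hlim.eventually hd, self_mem_nhdsWithin] with t ht ht0
    rw [ht]
    have : (t:ℂ) ≠ 0 := by exact_mod_cast (ne_of_gt ht0)
    simp only [add_sub_cancel_left]
    field_simp
  · by_contra hn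
    have hn0 : n = 0 := by omega
    subst hn0
    have := hev'.eq_of_nhds
    rw [h] at this
    simp at this
    exact hg0 this.symm
  · refine hlim.eventually (p := fun w => F w ≠ 0) ?_
    filter_upwards [hev'.filter_mono nhdsWithin_le_nhds, hne, self_mem_nhdsWithin] with w hw hgw hwz
    rw [hw]
    exact mul_ne_zero (pow_ne_zero _ (sub_ne_zero.2 hwz)) hgw

lemma re341 (w : ℂ) (hw : ‖w‖ = 1) : 0 ≤ (3 + 4 * w + w ^ 2).re := by
  have h : w.re * w.re + w.im * w.im = 1 := by
    have := Complex.normSq_eq_norm_sq w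
    rw [hw, Complex.normSq_apply] at this; linarith
  simp [pow_two]
  nlinarith [sq_nonneg (1 + w.re)]

theorem pnt_abs (a b : ℕ → ℝ) (hb : ∀ m, 0 ≤ b m)
    (has : ∀ s : ℂ, 1 < s.re → LSeriesSummable (fun m => (a m : ℂ)) s)
    (hbs : ∀ s : ℂ, 1 < s.re → LSeriesSummable (fun m => (b m : ℂ)) s)
    (c : ℂ) (hc : c ≠ 0) (ε : ℝ) (hε : 0 < ε) (M : ℂ → ℂ) (hM : ∀ s, 1 - ε < s.re → DifferentiableAt ℂ M s)
    (hz : ∀ s, 1 < s.re → LSeries (fun m => (a m : ℂ)) s = (s + 1) * (s + 2) * (c / (s - 1) + M s))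
    (hd : ∀ s, 1 < s.re → deriv (LSeries fun m => (a m : ℂ)) s = - (LSeries (fun m => (a m : ℂ)) s * LSeries (fun m => (b m : ℂ)) s))
    (B : ℝ) (hB : ∀ n : ℕ, ∑ m ∈ Finset.Icc 1 n, b m ≤ B * n) :
    Tendsto (fun x : ℝ => (∑ m ∈ Finset.Icc 1 ⌊x⌋₊, b m) / x) atTop (𝓝 1) := by
  set Z := LSeries fun m => (a m : ℂ) with hZ
  set L := LSeries fun m => (b m : ℂ) with hL
  set F : ℂ → ℂ := fun s => (s + 1) * (s + 2) * (c + (s - 1) * M s) with hF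
  set H : Set ℂ := {s | 1 - ε < s.re} with hH
  have hHo : IsOpen H := isOpen_lt continuous_const Complex.continuous_re
  have hHc : IsPreconnected H := (convex_halfSpace_re_gt (1 - ε)).isPreconnected
  have hFd : DifferentiableOn ℂ F H := fun s hs => by
    have := hM s hs
    have : DifferentiableAt ℂ F s := by simp only [hF]; fun_prop
    exact this.differentiableWithinAt
  have hFa : AnalyticOnNhd ℂ F H := hFd.analyticOnNhd hHo
  have h1H : (1:ℂ) ∈ H := by simp [hH, hε]
  have hF1 : F 1 ≠ 0 := by simp only [hF]; simp [hc]; norm_num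
  have hnz : ∀ z ∈ H, ¬ ∀ᶠ w in 𝓝 z, F w = 0 := fun z hz hev => by
    have := hFa.eqOn_zero_of_preconnected_of_eventuallyEq_zero hHc hz hev
    exact hF1 (this h1H)
  have hs1 : ∀ s : ℂ, 1 < s.re → s - 1 ≠ 0 := fun s hs h => by
    have := congrArg Complex.re h; simp at this; linarith
  have hFZ : ∀ s : ℂ, 1 < s.re → F s = (s - 1) * Z s := fun s hs => by
    have := hs1 s hs
    rw [hz s hs]
    simp only [hF]
    field_simp
  have hopen : IsOpen {s : ℂ | 1 < s.re} := isOpen_lt continuous_const Complex.continuous_re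
  have habs : ∀ f : ℕ → ℝ, (∀ s : ℂ, 1 < s.re → LSeriesSummable (fun m => (f m : ℂ)) s) → ∀ s : ℂ, 1 < s.re → LSeries.abscissaOfAbsConv (fun m => (f m : ℂ)) < s.re := fun f hf s hs => by
    obtain ⟨y, hy1, hy2⟩ := exists_between hs
    refine lt_of_le_of_lt (LSeriesSummable.abscissaOfAbsConv_le (hf (y:ℂ) (by simpa using hy1))) ?_
    simpa using hy2
  have hZd : ∀ s : ℂ, 1 < s.re → DifferentiableAt ℂ Z s := fun s hs => (LSeries_hasDerivAt (habs a has s hs)).differentiableAt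
  have hLd : ∀ s : ℂ, 1 < s.re → DifferentiableAt ℂ L s := fun s hs => (LSeries_hasDerivAt (habs b hbs s hs)).differentiableAt
  have hFdv : ∀ s : ℂ, 1 < s.re → deriv F s = F s * (1 / (s - 1) - L s) := fun s hs => by
    have h1 : F =ᶠ[𝓝 s] fun s => (s - 1) * Z s := by
      filter_upwards [hopen.mem_nhds hs] with w hw using hFZ w hw
    have h2 : HasDerivAt (fun s => (s - 1) * Z s) (1 * Z s + (s - 1) * deriv Z s) s :=
      ((hasDerivAt_id s).sub_const 1).mul (hZd s hs).hasDerivAt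
    rw [h1.deriv_eq, h2.deriv, hd s hs, hFZ s hs]
    have := hs1 s hs
    field_simp
    ring
  have hlog : ∀ s : ℂ, 1 < s.re → F s ≠ 0 → deriv F s / F s = 1 / (s - 1) - L s := fun s hs h0 => by
    rw [hFdv s hs]; field_simp
  -- no zeros to the right of one
  have hright : ∀ z : ℂ, 1 < z.re → F z ≠ 0 := fun z hz h0 => by
    have hzH : z ∈ H := by simp only [hH, mem_setOf_eq]; linarith
    obtain ⟨k, hk, hk1, hk2⟩ := ord_lim F z (hFa z hzH) (hnz z hzH)
    have hlim : Tendsto (fun t : ℝ => (t : ℂ) * (1 / (z + t - 1) - L (z + t))) (𝓝[>] 0) (𝓝 (((0:ℝ):ℂ) * (1 / (z + ((0:ℝ):ℂ) - 1) - L (z + ((0:ℝ):ℂ))))) := by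
      have hcont : ContinuousAt (fun t : ℝ => (t : ℂ) * (1 / (z + t - 1) - L (z + t))) 0 := by
        have hL' : ContinuousAt (fun t : ℝ => L (z + t)) 0 := by
          refine ContinuousAt.comp (g := L) ?_ (by fun_prop)
          simpa using (hLd z hz).continuousAt
        refine ContinuousAt.mul (by fun_prop) (ContinuousAt.sub (ContinuousAt.div (by fun_prop) (by fun_prop) ?_) hL')
        simpa using hs1 z hz
      exact hcont.tendsto.mono_left nhdsWithin_le_nhds
    have heq : Tendsto (fun t : ℝ => (t : ℂ) * (deriv F (z + t) / F (z + t))) (𝓝[>] 0) (𝓝 0) := by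
      simp only [Complex.ofReal_zero, zero_mul] at hlim
      refine hlim.congr' ?_
      filter_upwards [hk2, self_mem_nhdsWithin] with t ht ht0
      rw [hlog _ _ ht]
      simp only [Complex.add_re, Complex.ofReal_re]
      have : (0:ℝ) < t := ht0
      linarith
    have := tendsto_nhds_unique hk heq
    have hk0 : k = 0 := by exact_mod_cast this
    have := hk1 h0
    omega
  -- the limits on the line
  have hline : ∀ y : ℝ, ∃ k : ℕ, (F (1 + y * Complex.I) = 0 → 1 ≤ k) ∧ Tendsto (fun t : ℝ => (t : ℂ) * L (1 + y * Complex.I + t)) (𝓝[>] 0) (𝓝 ((if y = 0 then 1 else 0) - k)) := fun y => by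
    have hzH : (1 + y * Complex.I) ∈ H := by simp [hH, hε]
    obtain ⟨k, hk, hk1, hk2⟩ := ord_lim F _ (hFa _ hzH) (hnz _ hzH)
    refine ⟨k, hk1, ?_⟩
    have h1 : Tendsto (fun t : ℝ => (t : ℂ) / (y * Complex.I + t)) (𝓝[>] 0) (𝓝 (if y = 0 then 1 else 0)) := by
      by_cases hy : y = 0
      · subst hy
        simp only [if_true]
        refine tendsto_const_nhds.congr' ?_
        filter_upwards [self_mem_nhdsWithin] with t ht
        have : (t:ℂ) ≠ 0 := by exact_mod_cast (ne_of_gt ht)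
        simp [this]
      · rw [if_neg hy]
        have hcont : ContinuousAt (fun t : ℝ => (t : ℂ) / (y * Complex.I + t)) 0 := by
          refine ContinuousAt.div (by fun_prop) (by fun_prop) ?_
          simp [hy]
        have := hcont.tendsto.mono_left (nhdsWithin_le_nhds (s := Ioi 0))
        simpa using this
    refine (h1.sub hk).congr' ?_
    filter_upwards [hk2, self_mem_nhdsWithin] with t ht ht0
    have ht0' : (0:ℝ) < t := ht0
    rw [hlog _ (by simp; linarith) ht]
    rw [show (1:ℂ) + y * Complex.I + t - 1 = y * Complex.I + t by ring]
    ring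
  have hpos : ∀ (y t : ℝ), 0 < t → 0 ≤ ((3:ℂ) * L (1 + (0:ℝ) * Complex.I + t) + 4 * L (1 + y * Complex.I + t) + L (1 + (2 * y : ℝ) * Complex.I + t)).re := fun y t ht => by
    have hsm : ∀ y : ℝ, LSeriesSummable (fun m => (b m : ℂ)) (1 + y * Complex.I + t) := fun y => hbs _ (by simp; linarith)
    simp only [hL, LSeries]
    rw [← tsum_mul_left, ← tsum_mul_left, ← Summable.tsum_add ((hsm 0).mul_left 3) ((hsm y).mul_left 4), ← Summable.tsum_add (((hsm 0).mul_left 3).add ((hsm y).mul_left 4)) (hsm (2 * y)),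
      Complex.re_tsum (((((hsm 0).mul_left 3).add ((hsm y).mul_left 4)).add (hsm (2 * y))))]
    refine tsum_nonneg fun m => ?_
    rcases Nat.eq_zero_or_pos m with rfl | hm
    · simp
    have hm0 : (0:ℝ) < m := by exact_mod_cast hm
    have hmc : (m:ℂ) ≠ 0 := by exact_mod_cast hm0.ne'
    rw [LS_term _ _ _ hm.ne', LS_term _ _ _ hm.ne', LS_term _ _ _ hm.ne']
    set w : ℂ := (m:ℂ) ^ (-(y * Complex.I)) with hw
    have hwn : ‖w‖ = 1 := by
      rw [hw, ← Complex.ofReal_natCast, Complex.norm_cpow_eq_rpow_re_of_pos hm0]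
      simp
    have e1 : (m:ℂ) ^ (-(1 + y * Complex.I + t)) = w * (m:ℂ) ^ (-(1 + t : ℂ)) := by
      rw [hw, ← Complex.cpow_add _ _ hmc]; congr 1; ring
    have e2 : (m:ℂ) ^ (-(1 + (2 * y : ℝ) * Complex.I + t)) = w ^ 2 * (m:ℂ) ^ (-(1 + t : ℂ)) := by
      rw [hw, pow_two, ← Complex.cpow_add _ _ hmc, ← Complex.cpow_add _ _ hmc]; congr 1; push_cast; ring
    have e0 : (m:ℂ) ^ (-(1 + (0:ℝ) * Complex.I + t)) = (m:ℂ) ^ (-(1 + t : ℂ)) := by simp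
    have er : (m:ℂ) ^ (-(1 + t : ℂ)) = (((m:ℝ) ^ (-(1 + t)) : ℝ) : ℂ) := by
      rw [Complex.ofReal_cpow hm0.le]; push_cast; rfl
    rw [e0, e1, e2, er]
    rw [show (3:ℂ) * (b m * (((m:ℝ) ^ (-(1 + t)) : ℝ) : ℂ)) + 4 * (b m * (w * (((m:ℝ) ^ (-(1 + t)) : ℝ) : ℂ))) + b m * (w ^ 2 * (((m:ℝ) ^ (-(1 + t)) : ℝ) : ℂ)) = ((b m * (m:ℝ) ^ (-(1 + t)) : ℝ) : ℂ) * (3 + 4 * w + w ^ 2) by push_cast; ring,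
      Complex.re_ofReal_mul]
    exact mul_nonneg (mul_nonneg (hb m) (by positivity)) (re341 w hwn)
  have hnv : ∀ s : ℂ, 1 ≤ s.re → F s ≠ 0 := fun s hs => by
    rcases hs.lt_or_eq with h | h
    · exact hright s h
    have hse : s = 1 + (s.im : ℝ) * Complex.I := by
      apply Complex.ext <;> simp [← h]
    by_cases hy : s.im = 0
    · rw [hse, hy]; simpa using hF1
    rw [hse]
    intro h0
    obtain ⟨k0, -, h3⟩ := hline 0
    obtain ⟨k1, hk1, h4⟩ := hline s.im
    obtain ⟨k2, -, h5⟩ := hline (2 * s.im)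
    have hk := hk1 h0
    have hlim := ((h3.const_mul 3).add (h4.const_mul 4)).add h5
    have hre := (Complex.continuous_re.tendsto _).comp hlim
    have hge : 0 ≤ ((3:ℂ) * ((if (0:ℝ) = 0 then 1 else 0) - k0) + 4 * ((if s.im = 0 then 1 else 0) - k1) + ((if 2 * s.im = 0 then 1 else 0) - k2)).re := by
      refine ge_of_tendsto hre ?_
      filter_upwards [self_mem_nhdsWithin] with t ht
      have h := hpos s.im t ht
      have ht' : (0:ℝ) < t := ht
      have e : (3:ℂ) * (t * L (1 + (0:ℝ) * Complex.I + t)) + 4 * (t * L (1 + s.im * Complex.I + t)) + t * L (1 + (2 * s.im : ℝ) * Complex.I + t)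
        = (t:ℂ) * ((3:ℂ) * L (1 + (0:ℝ) * Complex.I + t) + 4 * L (1 + s.im * Complex.I + t) + L (1 + (2 * s.im : ℝ) * Complex.I + t)) := by ring
      simp only [Function.comp_apply]
      rw [e, Complex.re_ofReal_mul]
      exact mul_nonneg ht'.le h
    simp [hy] at hge
    have h1 : (1:ℝ) ≤ k1 := by exact_mod_cast hk
    have h2 : (0:ℝ) ≤ k0 := by positivity
    have h3 : (0:ℝ) ≤ k2 := by positivity
    linarith
  refine wiener_ikehara b hb B hB (fun s => - (deriv F s / F s)) ?_ fun s hs => ?_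
  · intro s hs
    have hs' : (1:ℝ) ≤ s.re := hs
    have hsH : s ∈ H := by simp only [hH, mem_setOf_eq]; linarith
    exact (((hFa s hsH).deriv.continuousAt.div (hFa s hsH).continuousAt (hnv s hs)).neg).continuousWithinAt
  · rw [hlog s hs (hright s hs)]; ring

end WI
end

section
open Filter Topology Set

namespace WI
open NumberField Ideal IsDedekindDomain
open scoped Classical

variable (K : Type*) [Field K] [NumberField K]

/-- Pairs (prime, exponent minus one). -/
abbrev PP := HeightOneSpectrum (𝓞 K) × ℕ

variable {K}
/-- the prime power ideal -/
def PP.J (x : PP K) : Ideal (𝓞 K) := x.1.asIdeal ^ (x.2 + 1)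

noncomputable def PP.w (x : PP K) : ℝ := Real.log (absNorm x.1.asIdeal)

lemma two_le_norm (P : HeightOneSpectrum (𝓞 K)) : 2 ≤ absNorm P.asIdeal := by
  have h0 : absNorm P.asIdeal ≠ 0 := by
    rw [Ne, Ideal.absNorm_eq_zero_iff]; exact P.ne_bot
  have h1 : absNorm P.asIdeal ≠ 1 := by
    rw [Ne, Ideal.absNorm_eq_one_iff]; exact P.isPrime.ne_top
  omega

lemma PP.w_nonneg (x : PP K) : 0 ≤ x.w := Real.log_natCast_nonneg _

lemma PP.J_inj : Function.Injective (PP.J : PP K → Ideal (𝓞 K)) := by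
  rintro ⟨P, k⟩ ⟨Q, l⟩ h
  simp only [PP.J] at h
  have h1 : P = Q := by
    have : P.asIdeal ∣ Q.asIdeal := by
      refine P.prime.dvd_of_dvd_pow (n := l + 1) ?_
      rw [← h]; exact dvd_pow_self _ (by omega)
    have h2 : Q.asIdeal ≤ P.asIdeal := Ideal.le_of_dvd this
    have := (Q.isMaximal).eq_of_le P.isPrime.ne_top h2
    exact HeightOneSpectrum.ext this.symm
  subst h1
  have := congrArg absNorm h
  rw [map_pow, map_pow] at this
  have := Nat.pow_right_injective (two_le_norm P) this
  simp_all

lemma PP.J_ne (x : PP K) : x.J ≠ ⊥ := pow_ne_zero _ x.1.ne_bot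

lemma fI (m : ℕ) : {I : Ideal (𝓞 K) | absNorm I = m}.Finite := finite_setOf_absNorm_eq m
lemma fP (m : ℕ) : {x : PP K | absNorm x.J = m}.Finite :=
  (fI m).preimage PP.J_inj.injOn

/-- Divisors. -/
lemma pp_div (I : Ideal (𝓞 K)) (hI : I ≠ ⊥) : ∃ D : Finset (PP K), (∀ x, x ∈ D ↔ x.J ∣ I) ∧
    ∑ x ∈ D, x.w = Real.log (absNorm I) := by
  revert hI
  refine UniqueFactorizationMonoid.induction_on_prime I (fun h => absurd rfl h) ?_ ?_
  · intro U hU _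
    rw [Ideal.isUnit_iff] at hU
    refine ⟨∅, ?_, by simp [hU]⟩
    intro x
    simp only [Finset.notMem_empty, false_iff, hU]
    intro h
    have h1 := Ideal.le_of_dvd h
    have h2 : x.J ≤ x.1.asIdeal := Ideal.pow_le_self (by omega)
    exact x.1.isPrime.ne_top (top_le_iff.1 (h1.trans h2))
  · intro J P hJ hP ih hPJ
    obtain ⟨D, hD, hs⟩ := ih hJ
    let Q : HeightOneSpectrum (𝓞 K) := ⟨P, Ideal.isPrime_of_prime hP, hP.ne_zero⟩
    have hf : FiniteMultiplicity P J := FiniteMultiplicity.of_prime_left hP hJ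
    have hnot : ((Q, multiplicity P J) : PP K) ∉ D := by
      rw [hD]
      exact hf.not_pow_dvd_of_multiplicity_lt (by omega)
    refine ⟨insert (Q, multiplicity P J) D, ?_, ?_⟩
    · rintro ⟨R, k⟩
      rw [Finset.mem_insert, hD]
      simp only [PP.J, Prod.mk.injEq]
      by_cases hR : R = Q
      · subst hR
        show (Q = Q ∧ _) ∨ P ^ (k+1) ∣ J ↔ P ^ (k+1) ∣ P * J
        rw [pow_succ' P k, mul_dvd_mul_iff_left hP.ne_zero, ← pow_succ']
        rw [hf.pow_dvd_iff_le_multiplicity, hf.pow_dvd_iff_le_multiplicity]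
        simp only [true_and]; omega
      · simp only [hR, false_and, false_or]
        constructor
        · intro h; exact h.mul_left _
        · intro h
          refine R.prime.pow_dvd_of_dvd_mul_left _ ?_ h
          intro h2
          apply hR
          have := (Ideal.isPrime_of_prime hP).isMaximal hP.ne_zero
          exact HeightOneSpectrum.ext (this.eq_of_le R.isPrime.ne_top (Ideal.le_of_dvd h2)).symm
    · rw [Finset.sum_insert hnot, hs, map_mul, Nat.cast_mul, Real.log_mul]
      · rfl
      · exact Nat.cast_ne_zero.2 fun h => hP.ne_zero (Ideal.absNorm_eq_zero_iff.1 h)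
      · exact Nat.cast_ne_zero.2 fun h => hJ (Ideal.absNorm_eq_zero_iff.1 h)

variable (K)
noncomputable def FI (m : ℕ) : Finset (Ideal (𝓞 K)) := (fI m).toFinset
noncomputable def FP (m : ℕ) : Finset (PP K) := (fP m).toFinset
noncomputable def aK (m : ℕ) : ℝ := (FI K m).card
noncomputable def bK (m : ℕ) : ℝ := ∑ x ∈ FP K m, x.w

variable {K}
lemma mem_FI (m : ℕ) (I : Ideal (𝓞 K)) : I ∈ FI K m ↔ absNorm I = m := by simp [FI]
lemma mem_FP (m : ℕ) (x : PP K) : x ∈ FP K m ↔ absNorm x.J = m := by simp [FP]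

lemma aK_eq (m : ℕ) : aK K m = Nat.card {I : Ideal (𝓞 K) // absNorm I = m} := by
  rw [aK, FI, ← Set.ncard_eq_toFinset_card _ (fI m)]; rfl

lemma bK_nonneg (m : ℕ) : 0 ≤ bK K m := Finset.sum_nonneg fun x _ => x.w_nonneg

lemma conv_ab (m : ℕ) (hm : m ≠ 0) :
    ∑ q ∈ m.divisorsAntidiagonal, aK K q.1 * bK K q.2 = Real.log m * aK K m := by
  choose! D hD hs using pp_div (K := K)
  have hne : ∀ I ∈ FI K m, I ≠ ⊥ := by
    rintro I hI rfl
    rw [mem_FI] at hI; simp at hI; exact hm hI.symm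
  have h1 : Real.log m * aK K m = ∑ I ∈ FI K m, ∑ x ∈ D I, x.w := by
    rw [Finset.sum_congr rfl (fun I hI => ?_), Finset.sum_const, nsmul_eq_mul, aK, mul_comm]
    rw [hs I (hne I hI), (mem_FI m I).1 hI]
  have h2 : ∀ q : ℕ × ℕ, aK K q.1 * bK K q.2 = ∑ y ∈ FI K q.1 ×ˢ FP K q.2, y.2.w := by
    intro q
    rw [Finset.sum_product]; simp only [Finset.sum_const, nsmul_eq_mul]; rfl
  rw [h1, Finset.sum_sigma']
  simp_rw [h2]
  rw [Finset.sum_sigma']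
  refine Finset.sum_bij (fun y _ => ⟨y.2.1 * y.2.2.J, y.2.2⟩) ?_ ?_ ?_ ?_
  · rintro ⟨⟨d, e⟩, I, x⟩ h
    simp only [Finset.mem_sigma, Nat.mem_divisorsAntidiagonal, Finset.mem_product, mem_FI, mem_FP] at h ⊢
    have : absNorm (I * x.J) = m := by rw [map_mul, h.2.1, h.2.2, h.1.1]
    refine ⟨this, ?_⟩
    rw [hD _ (hne _ ((mem_FI _ _).2 this))]
    exact dvd_mul_left _ _
  · rintro ⟨⟨d, e⟩, I, x⟩ h ⟨⟨d', e'⟩, I', x'⟩ h' heq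
    simp only [Finset.mem_sigma, Nat.mem_divisorsAntidiagonal, Finset.mem_product, mem_FI, mem_FP] at h h'
    simp only [Sigma.mk.injEq, heq_eq_eq] at heq
    obtain ⟨h3, rfl⟩ := heq
    have h4 := mul_right_cancel₀ x.J_ne h3
    subst h4
    obtain ⟨-, rfl, rfl⟩ := h
    obtain ⟨-, rfl, rfl⟩ := h'
    rfl
  · rintro ⟨I, x⟩ h
    simp only [Finset.mem_sigma] at h
    have hI := hne I h.1
    obtain ⟨J, hJ⟩ := (hD I hI x).1 h.2
    have hN := (mem_FI _ _).1 h.1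
    refine ⟨⟨(absNorm J, absNorm x.J), J, x⟩, ?_, ?_⟩
    · simp only [Finset.mem_sigma, Nat.mem_divisorsAntidiagonal, Finset.mem_product, mem_FI, mem_FP]
      refine ⟨⟨?_, hm⟩, trivial, trivial⟩
      rw [← hN, hJ, map_mul, mul_comm]
    · simp [hJ, mul_comm]
  · intros; rfl

lemma norm_pp (P : HeightOneSpectrum (𝓞 K)) : ∃ p f : ℕ, p.Prime ∧ f ≠ 0 ∧ absNorm P.asIdeal = p ^ f ∧
    (p : 𝓞 K) ∈ P.asIdeal := by
  have : P.asIdeal.IsMaximal := P.isMaximal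
  let F : Field (𝓞 K ⧸ P.asIdeal) := Ideal.Quotient.field _
  have h0 : absNorm P.asIdeal ≠ 0 := by have := two_le_norm P; omega
  have hfin : Finite (𝓞 K ⧸ P.asIdeal) := Ideal.finiteQuotientOfFreeOfNeBot _ P.ne_bot
  have : Fintype (𝓞 K ⧸ P.asIdeal) := Fintype.ofFinite _
  have h := FiniteField.isPrimePow_card (𝓞 K ⧸ P.asIdeal)
  rw [← Nat.card_eq_fintype_card] at h
  obtain ⟨p, f, hp, hf, h⟩ := h
  have h' : absNorm P.asIdeal = p ^ f := h.symm
  refine ⟨p, f, hp.nat_prime, by omega, h', ?_⟩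
  have h1 := Ideal.absNorm_mem P.asIdeal
  rw [h', Nat.cast_pow] at h1
  exact P.isPrime.mem_of_pow_mem _ h1

lemma bK_le (m : ℕ) : bK K m ≤ Module.finrank ℚ K * ArithmeticFunction.vonMangoldt m := by
  rcases (FP K m).eq_empty_or_nonempty with h | ⟨x0, hx0⟩
  · rw [bK, h, Finset.sum_empty]
    exact mul_nonneg (Nat.cast_nonneg _) ArithmeticFunction.vonMangoldt_nonneg
  have key : ∀ x ∈ FP K m, ∃ f, f ≠ 0 ∧ m = m.minFac ^ f ∧ m.minFac.Prime ∧ ((m.minFac : ℕ) : 𝓞 K) ∈ x.1.asIdeal := by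
    intro x hx
    rw [mem_FP, PP.J, map_pow] at hx
    obtain ⟨p, f, hp, hf, h1, h2⟩ := norm_pp x.1
    rw [h1, ← pow_mul] at hx
    have h3 : m.minFac = p := by
      rw [← hx, Nat.Prime.pow_minFac hp (by positivity)]
    exact ⟨f * (x.2 + 1), by positivity, by rw [h3, hx], by rw [h3]; exact hp, by rw [h3]; exact h2⟩
  obtain ⟨f, hf, hm, hp, -⟩ := key x0 hx0
  set p := m.minFac with hpdef
  have hL : ArithmeticFunction.vonMangoldt m = Real.log p := by
    conv_lhs => rw [hm]
    rw [ArithmeticFunction.vonMangoldt_apply_pow hf, ArithmeticFunction.vonMangoldt_apply_prime hp]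
  rw [hL]
  have hinj : Set.InjOn (fun x : PP K => x.1.asIdeal) (FP K m : Set (PP K)) := by
    rintro ⟨P, k⟩ hx ⟨Q, l⟩ hy h
    have h1 : P = Q := HeightOneSpectrum.ext h
    subst h1
    rw [Finset.mem_coe, mem_FP, PP.J, map_pow] at hx hy
    have := Nat.pow_right_injective (two_le_norm P) (hx.trans hy.symm)
    have h9 : k = l := by simpa using this
    rw [h9]
  have hdvd : (∏ P ∈ (FP K m).image (fun x : PP K => x.1.asIdeal), P) ∣ Ideal.span {(p : 𝓞 K)} := by
    refine Finset.prod_primes_dvd _ ?_ ?_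
    · intro P hP
      obtain ⟨x, hx, rfl⟩ := Finset.mem_image.1 hP
      exact x.1.prime
    · intro P hP
      obtain ⟨x, hx, rfl⟩ := Finset.mem_image.1 hP
      obtain ⟨-, -, -, -, h⟩ := key x hx
      rw [Ideal.dvd_span_singleton]; exact h
  rw [Finset.prod_image hinj] at hdvd
  have h2 := map_dvd (absNorm (S := 𝓞 K)) hdvd
  rw [map_prod] at h2
  have h3 : absNorm (Ideal.span {(p : 𝓞 K)}) = p ^ Module.finrank ℚ K := by
    rw [Ideal.absNorm_span_natCast, NumberField.RingOfIntegers.rank]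
  rw [h3] at h2
  have h4 := Nat.le_of_dvd (pow_pos hp.pos _) h2
  have h5 : bK K m = Real.log (∏ x ∈ FP K m, absNorm x.1.asIdeal : ℕ) := by
    rw [bK, Nat.cast_prod, Real.log_prod]
    · rfl
    · intro x _
      have := two_le_norm x.1
      exact Nat.cast_ne_zero.2 (by omega)
  rw [h5, ← Real.log_pow, ← Nat.cast_pow]
  refine Real.log_le_log ?_ (by exact_mod_cast h4)
  refine Nat.cast_pos.2 (Finset.prod_pos fun x _ => ?_)
  have := two_le_norm x.1; omega

lemma bK_prime (p : ℕ) (hp : p.Prime) : bK K p = aK K p * Real.log p := by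
  have h : ∀ x ∈ FP K p, x.2 = 0 := by
    intro x hx
    rw [mem_FP, PP.J, map_pow] at hx
    have h1 : Nat.Prime (absNorm x.1.asIdeal ^ (x.2 + 1)) := by rw [hx]; exact hp
    have := Nat.Prime.eq_one_of_pow h1
    omega
  have h2 : aK K p = (FP K p).card := by
    rw [aK]
    congr 1
    symm
    refine Finset.card_bij (fun x _ => x.1.asIdeal) ?_ ?_ ?_
    · intro x hx
      have h3 := h x hx
      rw [mem_FP, PP.J, h3] at hx
      rw [mem_FI]; simpa using hx
    · intro x hx y hy hxy
      exact Prod.ext (HeightOneSpectrum.ext hxy) ((h x hx).trans (h y hy).symm)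
    · intro I hI
      rw [mem_FI] at hI
      refine ⟨(⟨I, Ideal.isPrime_of_irreducible_absNorm (by rw [hI]; exact hp), ?_⟩, 0), ?_, rfl⟩
      · rintro rfl
        simp at hI; exact hp.ne_zero hI.symm
      · rw [mem_FP]; simpa [PP.J] using hI
  rw [h2, bK, Finset.sum_congr rfl (g := fun _ => Real.log p), Finset.sum_const, nsmul_eq_mul]
  intro x hx
  have h3 := h x hx
  rw [mem_FP, PP.J, h3] at hx
  rw [PP.w, ← hx]; simp

end WI
end

section
open Filter Topology Set

namespace WI
open NumberField Ideal IsDedekindDomain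
open scoped Classical nonZeroDivisors

variable (K : Type*) [Field K] [NumberField K]

lemma aK_tend : Tendsto (fun n : ℕ => (∑ k ∈ Finset.Icc 1 n, aK K k) / n) atTop (𝓝 (dedekindZeta_residue K)) := by
  refine ((Ideal.tendsto_norm_le_div_atTop₀ K).comp tendsto_natCast_atTop_atTop).congr fun n ↦ ?_
  simp only [aK_eq, Function.comp_apply, Nat.cast_le, ← Nat.cast_sum]
  congr
  rw [← add_left_inj 1, ← card_norm_le_eq_card_norm_le_add_one,
    show Finset.Icc 1 n = Finset.Ioc 0 n from Finset.Icc_succ_left_eq_Ioc _ _,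
    show 1 = Nat.card {I : Ideal (𝓞 K) // absNorm I = 0} by simp [Ideal.absNorm_eq_zero_iff],
    Finset.sum_Ioc_add_eq_sum_Icc (n.zero_le),
    ← Finset.card_preimage_eq_sum_card_image_eq (fun k _ ↦ finite_setOfPred_absNorm_eq k)]
  simp [Set.coe_eq_subtype]

lemma aK_summ (s : ℂ) (hs : 1 < s.re) : LSeriesSummable (fun m => (aK K m : ℂ)) s := by
  refine LSeriesSummable_of_sum_norm_bigO_and_nonneg (f := aK K) (r := 1) ?_ (fun n => Nat.cast_nonneg _) zero_le_one hs
  have h1 := (aK_tend K).isBigO_one ℝ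
  have h2 := h1.mul (Asymptotics.isBigO_refl (fun n : ℕ => (n : ℝ)) atTop)
  refine (h2.congr' ?_ ?_)
  · filter_upwards [eventually_ne_atTop 0] with n hn
    field_simp
  · filter_upwards with n
    simp

lemma bK_summ (s : ℂ) (hs : 1 < s.re) : LSeriesSummable (fun m => (bK K m : ℂ)) s := by
  have h := (ArithmeticFunction.LSeriesSummable_vonMangoldt hs).smul (Module.finrank ℚ K : ℂ)
  rw [LSeriesSummable, ← summable_norm_iff] at h ⊢
  refine Summable.of_nonneg_of_le (fun _ => norm_nonneg _) (fun m => ?_) h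
  refine LSeries.norm_term_le s ?_
  simp only [Pi.smul_apply, smul_eq_mul, norm_mul, Complex.norm_real, Complex.norm_natCast, Real.norm_eq_abs, abs_of_nonneg (bK_nonneg m), abs_of_nonneg (ArithmeticFunction.vonMangoldt_nonneg (n := m))]
  exact bK_le m

lemma bK_sum (n : ℕ) : ∑ m ∈ Finset.Icc 1 n, bK K m ≤ (Module.finrank ℚ K * (Real.log 4 + 4)) * n := by
  have h := Chebyshev.psi_le_const_mul_self (x := n) (by positivity)
  rw [Chebyshev.psi, Nat.floor_natCast] at h
  rw [mul_assoc]
  refine le_trans ?_ (mul_le_mul_of_nonneg_left h (Nat.cast_nonneg _))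
  rw [Finset.mul_sum]
  exact Finset.sum_le_sum fun m _ => bK_le m

lemma aK_deriv (s : ℂ) (hs : 1 < s.re) : deriv (LSeries fun m => (aK K m : ℂ)) s = - (LSeries (fun m => (aK K m : ℂ)) s * LSeries (fun m => (bK K m : ℂ)) s) := by
  have hab : LSeries.abscissaOfAbsConv (fun m => (aK K m : ℂ)) < s.re := by
    refine lt_of_le_of_lt (LSeries.abscissaOfAbsConv_le_of_forall_lt_LSeriesSummable (x := 1) fun y hy => aK_summ K y (by simpa using hy)) (by exact_mod_cast hs)
  rw [LSeries_deriv hab, ← LSeries_convolution' (aK_summ K s hs) (bK_summ K s hs)]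
  congr 1
  refine LSeries_congr (fun {m} hm => ?_) s
  rw [LSeries.convolution_def]
  simp only [LSeries.logMul]
  rw [← Complex.natCast_log]
  have := conv_ab (K := K) m hm
  exact_mod_cast this.symm

lemma cut_conv (X : ℝ) (hX : 0 < X) : ∑' m : ℕ, aK K m * cut (m / X) = ∑' I : (Ideal (𝓞 K))⁰, cut ((Ideal.absNorm (I : Ideal (𝓞 K)) : ℝ) / X) := by
  have hz : ∀ m : ℕ, ⌈X⌉₊ ≤ m → cut (m / X) = 0 := by
    intro m hm
    by_contra h
    have h1 := cut_lt _ h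
    rw [div_lt_one hX] at h1
    have h2 := Nat.ceil_le.1 hm
    linarith
  have h1 : ∑' I : (Ideal (𝓞 K))⁰, cut ((Ideal.absNorm (I : Ideal (𝓞 K)) : ℝ) / X) = ∑' I : Ideal (𝓞 K), cut ((Ideal.absNorm I : ℝ) / X) := by
    refine tsum_subtype_eq_of_support_subset (s := ((Ideal (𝓞 K))⁰ : Set (Ideal (𝓞 K)))) (f := fun I : Ideal (𝓞 K) => cut ((Ideal.absNorm I : ℝ) / X)) ?_
    intro I hI
    simp only [SetLike.mem_coe, mem_nonZeroDivisors_iff_ne_zero]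
    rintro rfl
    simp [cut_zero] at hI
  have hdis : ((Finset.range ⌈X⌉₊ : Finset ℕ) : Set ℕ).PairwiseDisjoint (FI K) := by
    intro a _ b _ hab
    refine Finset.disjoint_left.2 fun I h1 h2 => hab ?_
    rw [mem_FI] at h1 h2
    exact h1.symm.trans h2
  rw [h1, tsum_eq_sum (s := Finset.range ⌈X⌉₊), tsum_eq_sum (s := (Finset.range ⌈X⌉₊).biUnion (FI K)), Finset.sum_biUnion hdis]
  · refine Finset.sum_congr rfl fun m _ => ?_
    rw [Finset.sum_congr rfl (g := fun _ => cut (m / X)), Finset.sum_const, nsmul_eq_mul, aK]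
    intro I hI
    rw [(mem_FI _ _).1 hI]
  · intro I hI
    refine hz _ ?_
    by_contra h
    apply hI
    rw [Finset.mem_biUnion]
    exact ⟨_, Finset.mem_range.2 (not_le.1 h), (mem_FI _ _).2 rfl⟩
  · intro m hm
    rw [hz m (by simpa using hm), mul_zero]

/-- prime ideal theorem, Chebyshev form -/
theorem bK_tend : Tendsto (fun x : ℝ => (∑ m ∈ Finset.Icc 1 ⌊x⌋₊, bK K m) / x) atTop (𝓝 1) := by
  obtain ⟨c, C, hC, h⟩ := ideal_sum K
  have hε : 0 < 1 / (Module.finrank ℚ K : ℝ) := one_div_pos.2 (by exact_mod_cast Module.finrank_pos)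
  obtain ⟨M, hM, hz⟩ := zeta_ext (aK K) (fun m => Nat.cast_nonneg _) (aK_summ K) c C _ hε hC (by
    intro X hX
    rw [cut_conv K X (by linarith)]
    exact h X hX)
  refine pnt_abs (aK K) (bK K) bK_nonneg (aK_summ K) (bK_summ K) c ?_ _ hε M hM hz (aK_deriv K) _ (bK_sum K)
  intro hc
  have h1 := tendsto_sub_one_mul_dedekindZeta_nhdsGT K
  have h2 : Tendsto (fun s : ℝ => ((s:ℂ) - 1) * dedekindZeta K s) (𝓝[>] 1) (𝓝 0) := by
    have h3 : Tendsto (fun s : ℝ => ((s:ℂ) - 1) * (((s:ℂ) + 1) * (s + 2) * M s)) (𝓝[>] 1) (𝓝 ((((1:ℝ):ℂ) - 1) * ((((1:ℝ):ℂ) + 1) * ((1:ℝ) + 2) * M (1:ℝ)))) := by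
      have hc : ContinuousAt (fun s : ℝ => ((s:ℂ) - 1) * (((s:ℂ) + 1) * (s + 2) * M s)) 1 := by
        have hMc : ContinuousAt (fun s : ℝ => M s) 1 := by
          refine ContinuousAt.comp (g := M) (f := fun s : ℝ => (s : ℂ)) (hM _ ?_).continuousAt Complex.continuous_ofReal.continuousAt
          simpa using hε
        have h5 : ContinuousAt (fun s : ℝ => ((s:ℂ) - 1)) 1 := by fun_prop
        have h6 : ContinuousAt (fun s : ℝ => ((s:ℂ) + 1) * (s + 2)) 1 := by fun_prop
        exact h5.mul (h6.mul hMc)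
      exact hc.tendsto.mono_left nhdsWithin_le_nhds
    simp only [Complex.ofReal_one, sub_self, zero_mul] at h3
    refine h3.congr' ?_
    filter_upwards [self_mem_nhdsWithin] with s hs
    have h4 := hz s (by simpa using hs)
    have h5 : dedekindZeta K s = LSeries (fun m => (aK K m : ℂ)) s := by
      rw [dedekindZeta]
      refine LSeries_congr (fun {m} hm => ?_) _
      rw [aK_eq]; simp
    rw [h5, h4, hc]
    simp
  have := tendsto_nhds_unique h1 h2
  exact dedekindZeta_residue_ne_zero K (by exact_mod_cast this)

end WI
end

section
open Filter Topology Set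

namespace WI
open NumberField Ideal

def prs (n : ℕ) : Finset ℕ := (Finset.Icc 1 n).filter Nat.Prime

lemma log_ratio : Tendsto (fun x : ℝ => Real.log x / Real.log (x / Real.log x ^ 2)) atTop (𝓝 1) := by
  have h1 : Tendsto (fun x : ℝ => Real.log (Real.log x) / Real.log x) atTop (𝓝 0) := by
    have := Real.isLittleO_log_id_atTop.tendsto_div_nhds_zero
    exact this.comp Real.tendsto_log_atTop
  have h2 : Tendsto (fun x : ℝ => (1 - 2 * (Real.log (Real.log x) / Real.log x))⁻¹) atTop (𝓝 1) := by
    have := (tendsto_const_nhds (x := (1:ℝ))).sub (h1.const_mul 2)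
    simpa using this.inv₀ (by norm_num)
  refine h2.congr' ?_
  filter_upwards [eventually_gt_atTop 1] with x hx
  have hl : 0 < Real.log x := Real.log_pos hx
  rw [Real.log_div (by positivity) (by positivity), Real.log_pow]
  push_cast
  rw [← inv_div]
  congr 1
  field_simp

lemma part_sum (a : ℕ → ℝ) (A : ℝ) (ha : ∀ p, p.Prime → 0 ≤ a p) (hA : ∀ p, p.Prime → a p ≤ A)
    (h : Tendsto (fun n : ℕ => (∑ p ∈ prs n, a p * Real.log p) / n) atTop (𝓝 1)) :
    Tendsto (fun n : ℕ => (∑ p ∈ prs n, a p) * (Real.log n / n)) atTop (𝓝 1) := by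
  have hA0 : 0 ≤ A := (ha 2 Nat.prime_two).trans (hA 2 Nat.prime_two)
  have h1 : Tendsto (fun n : ℕ => (∑ p ∈ prs n, a p * Real.log p) / n * (Real.log n / Real.log (n / Real.log n ^ 2)) + A / Real.log n) atTop (𝓝 (1 * 1 + 0)) := by
    refine (h.mul (log_ratio.comp tendsto_natCast_atTop_atTop)).add ?_
    exact (tendsto_const_nhds.div_atTop Real.tendsto_log_atTop).comp tendsto_natCast_atTop_atTop
  rw [mul_one, add_zero] at h1
  refine tendsto_of_tendsto_of_tendsto_of_le_of_le' h h1 ?_ ?_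
  · filter_upwards [eventually_gt_atTop 1] with n hn
    have hn0 : (0:ℝ) < n := by exact_mod_cast (by omega : 0 < n)
    rw [mul_div_assoc', div_le_div_iff_of_pos_right hn0, Finset.sum_mul]
    refine Finset.sum_le_sum fun p hp => ?_
    simp only [prs, Finset.mem_filter, Finset.mem_Icc] at hp
    refine mul_le_mul_of_nonneg_left (Real.log_le_log ?_ ?_) (ha p hp.2)
    · exact_mod_cast hp.2.pos
    · exact_mod_cast hp.1.2
  · have hy : Tendsto (fun n : ℕ => (n : ℝ) / Real.log n ^ 2) atTop atTop := by
      have h2 : Tendsto (fun x : ℝ => Real.log x ^ 2 / x) atTop (𝓝[>] 0) := by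
        refine tendsto_nhdsWithin_iff.2 ⟨(Real.isLittleO_pow_log_id_atTop (n := 2)).tendsto_div_nhds_zero, ?_⟩
        filter_upwards [eventually_gt_atTop 1] with x hx
        have hl : 0 < Real.log x := Real.log_pos hx
        exact div_pos (pow_pos hl 2) (by linarith : (0:ℝ) < x)
      have h3 := (tendsto_inv_nhdsGT_zero.comp h2).comp tendsto_natCast_atTop_atTop
      refine h3.congr fun n => ?_
      simp
    filter_upwards [eventually_gt_atTop 1, hy.eventually_gt_atTop 1] with n hn hyn
    have hn0 : (0:ℝ) < n := by exact_mod_cast (by omega : 0 < n)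
    have hl : 0 < Real.log n := Real.log_pos (by exact_mod_cast hn)
    set y : ℝ := n / Real.log n ^ 2 with hydef
    have hly : 0 < Real.log y := Real.log_pos hyn
    have key : ((∑ p ∈ prs n, a p) - A * y) * Real.log y ≤ ∑ p ∈ prs n, a p * Real.log p := by
      have h4 : ∑ p ∈ (prs n).filter (fun p : ℕ => (p : ℝ) ≤ y), a p ≤ A * y := by
        refine (Finset.sum_le_card_nsmul _ _ A ?_).trans ?_
        · intro p hp
          simp only [prs, Finset.mem_filter, Finset.mem_Icc] at hp
          exact hA p hp.1.2
        · rw [nsmul_eq_mul, mul_comm]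
          refine mul_le_mul_of_nonneg_left ?_ hA0
          have : (prs n).filter (fun p : ℕ => (p : ℝ) ≤ y) ⊆ Finset.Icc 1 ⌊y⌋₊ := by
            intro p hp
            simp only [prs, Finset.mem_filter, Finset.mem_Icc] at hp
            rw [Finset.mem_Icc]
            exact ⟨hp.1.1.1, Nat.le_floor hp.2⟩
          have := Finset.card_le_card this
          rw [Nat.card_Icc, Nat.add_sub_cancel] at this
          exact (Nat.cast_le.2 this).trans (Nat.floor_le (by linarith))
      have h5 := Finset.sum_filter_add_sum_filter_not (prs n) (fun p : ℕ => (p : ℝ) ≤ y) a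
      have h6 : ∑ p ∈ (prs n).filter (fun p : ℕ => ¬ (p : ℝ) ≤ y), a p * Real.log p ≤ ∑ p ∈ prs n, a p * Real.log p := by
        refine Finset.sum_le_sum_of_subset_of_nonneg (Finset.filter_subset _ _) ?_
        intro p hp _
        simp only [prs, Finset.mem_filter, Finset.mem_Icc] at hp
        exact mul_nonneg (ha p hp.2) (Real.log_natCast_nonneg _)
      refine le_trans ?_ h6
      have h8 : (∑ p ∈ prs n, a p) - A * y ≤ ∑ p ∈ (prs n).filter (fun p : ℕ => ¬ (p : ℝ) ≤ y), a p := by linarith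
      refine (mul_le_mul_of_nonneg_right h8 hly.le).trans ?_
      rw [Finset.sum_mul]
      refine Finset.sum_le_sum fun p hp => ?_
      simp only [prs, Finset.mem_filter, Finset.mem_Icc] at hp
      exact mul_le_mul_of_nonneg_left (Real.log_le_log (by linarith) (by linarith [not_le.1 hp.2])) (ha p hp.1.2)
    rw [← le_div_iff₀ hly] at key
    have h7 : ∑ p ∈ prs n, a p ≤ (∑ p ∈ prs n, a p * Real.log p) / Real.log y + A * y := by linarith
    refine (mul_le_mul_of_nonneg_right h7 (by positivity)).trans (le_of_eq ?_)
    rw [add_mul]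
    congr 1
    · field_simp
    · rw [hydef]; field_simp

variable (K : Type*) [Field K] [NumberField K]

lemma aK_le (p : ℕ) (hp : p.Prime) : aK K p ≤ Module.finrank ℚ K := by
  have h := bK_le (K := K) p
  rw [bK_prime p hp, ArithmeticFunction.vonMangoldt_apply_prime hp] at h
  exact le_of_mul_le_mul_right h (Real.log_pos (by exact_mod_cast hp.one_lt))

theorem aK_prime_tend : Tendsto (fun n : ℕ => (∑ p ∈ prs n, aK K p) * (Real.log n / n)) atTop (𝓝 1) := by
  refine part_sum _ _ (fun p _ => Nat.cast_nonneg _) (aK_le K) ?_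
  have h1 := (bK_tend K).comp tendsto_natCast_atTop_atTop
  have h2 : Tendsto (fun n : ℕ => (∑ m ∈ (Finset.Icc 1 n).filter (fun m => ¬ m.Prime), bK K m) / n) atTop (𝓝 0) := by
    have h3 : Tendsto (fun n : ℕ => (Module.finrank ℚ K : ℝ) * (2 * (Real.log n / (n:ℝ) ^ (1/2 : ℝ)))) atTop (𝓝 ((Module.finrank ℚ K : ℝ) * (2 * 0))) := by
      refine ((Tendsto.comp (g := fun x : ℝ => Real.log x / x ^ (1/2:ℝ)) ?_ tendsto_natCast_atTop_atTop).const_mul 2).const_mul _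
      exact (isLittleO_log_rpow_atTop (by norm_num)).tendsto_div_nhds_zero
    rw [mul_zero, mul_zero] at h3
    refine tendsto_of_tendsto_of_tendsto_of_le_of_le' tendsto_const_nhds h3 ?_ ?_
    · filter_upwards with n
      exact div_nonneg (Finset.sum_nonneg fun m _ => bK_nonneg m) (Nat.cast_nonneg _)
    · filter_upwards [eventually_gt_atTop 1] with n hn
      have hn0 : (0:ℝ) < n := by exact_mod_cast (by omega : 0 < n)
      have h4 := Chebyshev.psi_sub_theta_le (x := n) (by exact_mod_cast hn.le)
      rw [Chebyshev.psi_sub_theta_eq_sum_not_prime, Nat.floor_natCast] at h4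
      rw [div_le_iff₀ hn0]
      have h5 : ∑ m ∈ (Finset.Icc 1 n).filter (fun m => ¬ m.Prime), bK K m ≤ (Module.finrank ℚ K : ℝ) * ∑ m ∈ (Finset.Ioc 0 n).filter (fun m => ¬ m.Prime), ArithmeticFunction.vonMangoldt m := by
        rw [Finset.mul_sum]
        exact Finset.sum_le_sum fun m _ => bK_le m
      refine h5.trans ?_
      rw [mul_assoc]
      refine mul_le_mul_of_nonneg_left (h4.trans (le_of_eq ?_)) (Nat.cast_nonneg _)
      rw [← Real.sqrt_eq_rpow]
      have : (n:ℝ) = √n * √n := (Real.mul_self_sqrt hn0.le).symm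
      have h6 : 0 < √(n:ℝ) := Real.sqrt_pos.2 hn0
      field_simp
      rw [sq, ← this, mul_comm]
  have h3 := h1.sub h2
  rw [sub_zero] at h3
  refine h3.congr fun n => ?_
  simp only [Function.comp, Nat.floor_natCast]
  rw [← sub_div, ← Finset.sum_filter_add_sum_filter_not (Finset.Icc 1 n) Nat.Prime, add_sub_cancel_right]
  congr 1
  refine Finset.sum_congr rfl fun p hp => ?_
  rw [bK_prime p (Finset.mem_filter.1 hp).2]

end WI
end

section
open Filter Topology Set

namespace WI
open NumberField Ideal Polynomial
open scoped Classical

variable {L : Type*} [Field L] [NumberField L]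

/-- Frobenius data at `p`. -/
structure FrobAt (p : ℕ) (M : Ideal (𝓞 L)) (σ : Gal(L/ℚ)) : Prop where
  hp : p.Prime
  mx : M.IsMaximal
  mem : (p : 𝓞 L) ∈ M
  fr : ∀ x : 𝓞 L, σ • x - x ^ p ∈ M

lemma int_mem (p : ℕ) (hp : p.Prime) {A : Type*} [CommRing A] (M : Ideal A) (hM : M ≠ ⊤) (hpM : (p : A) ∈ M) (n : ℤ)
    : (n : A) ∈ M ↔ (p : ℤ) ∣ n := by
  constructor
  · intro h
    by_contra hn
    have hc : IsCoprime (p : ℤ) n := ((Nat.prime_iff_prime_int.1 hp).coprime_iff_not_dvd).2 hn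
    obtain ⟨a, b, hab⟩ := hc
    apply hM
    rw [Ideal.eq_top_iff_one]
    have : (1 : A) = a * (p : A) + b * (n : A) := by exact_mod_cast (congrArg (Int.cast : ℤ → A) hab).symm
    rw [this]
    exact M.add_mem (M.mul_mem_left _ hpM) (M.mul_mem_left _ h)
  · rintro ⟨k, rfl⟩
    push_cast
    exact M.mul_mem_right _ hpM

lemma frob_int (p : ℕ) (hp : p.Prime) {A : Type*} [CommRing A] (M : Ideal A) (hM : M.IsPrime) (hpM : (p : A) ∈ M) (x : A) :
    x ^ p - x ∈ M ↔ ∃ z : ℤ, x - z ∈ M := by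
  have := Fact.mk hp
  have hch : CharP (A ⧸ M) p := by
    refine (CharP.charP_iff_prime_eq_zero hp).2 ?_
    have := Ideal.Quotient.eq_zero_iff_mem.2 hpM
    simpa using this
  letI : Algebra (ZMod p) (A ⧸ M) := ZMod.algebra _ p
  constructor
  · intro h
    have h1 : (X ^ p - X : (ZMod p)[X]) = ∏ a : ZMod p, (X - C a) := by
      have h2 := FiniteField.roots_X_pow_card_sub_X (ZMod p)
      rw [ZMod.card] at h2
      have h4 : (X ^ p - X : (ZMod p)[X]).natDegree = p := FiniteField.X_pow_card_sub_X_natDegree_eq _ hp.one_lt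
      have h3 : (X ^ p - X : (ZMod p)[X]).Monic := by
        refine monic_X_pow_sub ?_
        rw [degree_X]; exact_mod_cast hp.one_lt
      have h5 := prod_multiset_X_sub_C_of_monic_of_roots_card_eq h3 (by rw [h2, h4]; simp [ZMod.card])
      rw [h2] at h5
      exact h5.symm
    have h2 := congrArg (aeval (Ideal.Quotient.mk M x)) h1
    simp only [map_sub, map_pow, aeval_X, map_prod, aeval_C] at h2
    rw [← map_pow, ← map_sub, Ideal.Quotient.eq_zero_iff_mem.2 h] at h2
    obtain ⟨a, -, ha⟩ := Finset.prod_eq_zero_iff.1 h2.symm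
    refine ⟨(a.val : ℤ), ?_⟩
    rw [← Ideal.Quotient.eq_zero_iff_mem, map_sub, ← ha]
    congr 1
    have h6 : a = ((a.val : ℕ) : ZMod p) := (ZMod.natCast_zmod_val a).symm
    rw [Int.cast_natCast, map_natCast]
    conv_rhs => rw [h6]
    rw [map_natCast]
  · rintro ⟨z, hz⟩
    have h1 : x ^ p - z ^ p ∈ M := by
      have := sub_dvd_pow_sub_pow x z p
      exact M.mem_of_dvd this hz
    have h2 : ((z ^ p - z : ℤ) : A) ∈ M := by
      rw [int_mem p hp M hM.ne_top hpM]
      rw [← ZMod.intCast_zmod_eq_zero_iff_dvd]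
      simp
    have h3 : x ^ p - x = (x ^ p - z ^ p) + ((z ^ p - z : ℤ) : A) - (x - z) := by push_cast; ring
    rw [h3]
    exact M.sub_mem (M.add_mem h1 h2) hz

lemma bad (x : 𝓞 L) (hx : x ≠ 0) : ∃ B : ℕ, ∀ p : ℕ, p.Prime → B < p → ∀ M : Ideal (𝓞 L), M ≠ ⊤ → (p : 𝓞 L) ∈ M → x ∉ M := by
  refine ⟨absNorm (span {x}), fun p hp hB M hM hpM hxM => ?_⟩
  have h1 : ((absNorm (span {x}) : ℕ) : 𝓞 L) ∈ M := by
    refine (span_singleton_le_iff_mem M).2 hxM ?_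
    exact Ideal.absNorm_mem _
  have h2 := (int_mem p hp M hM hpM (absNorm (span {x}) : ℤ)).1 (by exact_mod_cast h1)
  have h3 : p ∣ absNorm (span {x}) := by exact_mod_cast h2
  have h4 : absNorm (span {x}) ≠ 0 := by
    rw [Ne, Ideal.absNorm_eq_zero_iff]; simpa using hx
  exact absurd (Nat.le_of_dvd (by omega) h3) (by omega)

lemma bad_fin {ι : Type*} (S : Finset ι) (f : ι → 𝓞 L) : ∃ B : ℕ, ∀ p : ℕ, p.Prime → B < p → ∀ M : Ideal (𝓞 L), M ≠ ⊤ → (p : 𝓞 L) ∈ M →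
    ∀ i ∈ S, f i ∈ M → f i = 0 := by
  have h : ∀ i, ∃ B : ℕ, ∀ p : ℕ, p.Prime → B < p → ∀ M : Ideal (𝓞 L), M ≠ ⊤ → (p : 𝓞 L) ∈ M → f i ∈ M → f i = 0 := by
    intro i
    by_cases hi : f i = 0
    · exact ⟨0, fun _ _ _ _ _ _ _ => hi⟩
    · obtain ⟨B, hB⟩ := bad (f i) hi
      exact ⟨B, fun p hp h M hM hpM hf => absurd hf (hB p hp h M hM hpM)⟩
  choose B hB using h
  refine ⟨S.sup B, fun p hp h M hM hpM i hi => hB i p hp ?_ M hM hpM⟩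
  exact lt_of_le_of_lt (Finset.le_sup hi) h

lemma exists_frob [IsGalois ℚ L] (p : ℕ) (hp : p.Prime) : ∃ (M : Ideal (𝓞 L)) (σ : Gal(L/ℚ)), FrobAt p M σ := by
  have h1 : span {(p : 𝓞 L)} ≠ ⊤ := by
    intro h
    have h2 := congrArg absNorm h
    rw [Ideal.absNorm_span_natCast, NumberField.RingOfIntegers.rank, absNorm_top] at h2
    have : Module.finrank ℚ L ≠ 0 := Module.finrank_pos.ne'
    exact hp.ne_one ((pow_eq_one_iff.1 h2).resolve_right this)
  obtain ⟨M, hM, hle⟩ := Ideal.exists_le_maximal _ h1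
  have hpM : (p : 𝓞 L) ∈ M := hle (mem_span_singleton_self _)
  have hb : M ≠ ⊥ := by
    rintro rfl
    have : (p : 𝓞 L) = 0 := by simpa using hpM
    exact hp.ne_zero (by exact_mod_cast this)
  have hfin : Finite (𝓞 L ⧸ M) := Ideal.finiteQuotientOfFreeOfNeBot _ hb
  have hpr : M.IsPrime := hM.isPrime
  obtain ⟨σ, hσ⟩ := IsArithFrobAt.exists_of_isInvariant ℤ (Gal(L/ℚ)) M
  refine ⟨M, σ, hp, hM, hpM, fun x => ?_⟩
  have h2 := hσ x
  have h3 : M.under ℤ = span {(p : ℤ)} := by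
    ext n
    rw [Ideal.under_def, Ideal.mem_comap, mem_span_singleton, ← int_mem p hp M hM.ne_top hpM]
    simp
  rw [h3, Int.card_ideal_quot] at h2
  exact h2

lemma fix_iff (R : Finset (𝓞 L)) : ∃ B : ℕ, ∀ p : ℕ, p.Prime → B < p → ∀ (M : Ideal (𝓞 L)) (σ : Gal(L/ℚ)), FrobAt p M σ →
    ∀ x ∈ R, (σ • x = x ↔ ∃ z : ℤ, x - z ∈ M) := by
  obtain ⟨B, hB⟩ := bad_fin (R ×ˢ (Finset.univ : Finset Gal(L/ℚ))) (fun q => q.2 • q.1 - q.1)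
  refine ⟨B, fun p hp h M σ hF x hx => ?_⟩
  rw [← frob_int p hp M hF.mx.isPrime hF.mem]
  have h1 := hF.fr x
  constructor
  · intro h2
    rw [h2] at h1
    rw [← neg_sub]; exact M.neg_mem h1
  · intro h2
    have h3 := M.add_mem h1 h2
    rw [sub_add_sub_cancel] at h3
    exact sub_eq_zero.1 (hB p hp h M hF.mx.ne_top hF.mem (x, σ) (by simp [hx]) h3)

end WI
end

section
open Filter Topology Set

namespace WI
open NumberField Ideal Polynomial
open scoped Classical

variable {L : Type*} [Field L] [NumberField L]

/-- Stable under the Galois group. -/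
def Stab (R : Finset (𝓞 L)) : Prop := ∀ σ : Gal(L/ℚ), ∀ x ∈ R, σ • x ∈ R

lemma coe_smul (σ : Gal(L/ℚ)) (x : 𝓞 L) : ((σ • x : 𝓞 L) : L) = σ (x : L) := rfl

/-- existence of a root mod `p` via Frobenius. -/
lemma root_iff (f : ℤ[X]) (hf : f ≠ 0) (hs : (f.map (algebraMap ℤ L)).Splits) : ∃ R : Finset (𝓞 L), Stab R ∧ ∃ B : ℕ,
    ∀ p : ℕ, p.Prime → B < p → ∀ (M : Ideal (𝓞 L)) (σ : Gal(L/ℚ)), FrobAt p M σ →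
      ((∃ z : ZMod p, (f.map (Int.castRingHom (ZMod p))).eval z = 0) ↔ ∃ x ∈ R, σ • x = x) := by
  set d := f.leadingCoeff with hd
  have hd0 : d ≠ 0 := leadingCoeff_ne_zero.2 hf
  set g := f.map (algebraMap ℤ L) with hg
  have hinj : Function.Injective (algebraMap ℤ L) := (algebraMap ℤ L).injective_int
  have hg0 : g ≠ 0 := (Polynomial.map_ne_zero_iff hinj).2 hf
  have hInt : ∀ α ∈ g.roots, IsIntegral ℤ ((d : L) * α) := by
    intro α hα
    have := isIntegral_leadingCoeff_smul f α (by
      have := (mem_roots hg0).1 hα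
      rw [IsRoot, hg, eval_map_algebraMap] at this
      exact this)
    simpa using this
  have hex : ∀ α, ∃ x : 𝓞 L, α ∈ g.roots → algebraMap (𝓞 L) L x = d * α := by
    intro α
    by_cases hα : α ∈ g.roots
    · exact ⟨⟨_, hInt α hα⟩, fun _ => rfl⟩
    · exact ⟨0, fun h => absurd h hα⟩
  choose t ht using hex
  have hid : ∀ z : ℤ, ((d ^ f.natDegree * f.eval z : ℤ) : 𝓞 L) = (d : 𝓞 L) * (g.roots.map fun α => (d * z - t α : 𝓞 L)).prod := by
    intro z
    apply RingOfIntegers.coe_injective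
    have h1 : g.eval (z : L) = (d : L) * (g.roots.map fun α => (z : L) - α).prod := by
      conv_lhs => rw [hs.eq_prod_roots]
      rw [eval_mul, eval_C, eval_multiset_prod, Multiset.map_map, hg, leadingCoeff_map_of_injective hinj]
      simp [hd]
    have h2 : g.eval (z : L) = ((f.eval z : ℤ) : L) := by
      rw [hg, eval_intCast_map]; simp
    have h3 : g.roots.card = f.natDegree := by
      rw [← hs.natDegree_eq_card_roots, hg, natDegree_map_eq_of_injective hinj]
    simp only [map_mul, map_intCast, Int.cast_mul, Int.cast_pow, map_pow]
    rw [← h2, h1, map_multiset_prod, Multiset.map_map, ← h3, mul_left_comm]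
    congr 1
    rw [← Multiset.prod_replicate, ← Multiset.map_const', ← Multiset.prod_map_mul]
    congr 1
    refine Multiset.map_congr rfl fun α hα => ?_
    simp only [Function.comp, map_sub, map_mul, map_intCast]
    rw [ht α hα, mul_sub]
  refine ⟨g.roots.toFinset.image t, ?_, ?_⟩
  · intro σ x hx
    obtain ⟨α, hα, rfl⟩ := Finset.mem_image.1 hx
    rw [Multiset.mem_toFinset] at hα
    have hσ : σ α ∈ g.roots := by
      rw [mem_roots hg0, IsRoot, hg, eval_map_algebraMap] at hα ⊢
      have h9 := aeval_algHom_apply ((σ : L →+* L).toIntAlgHom) α f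
      rw [hα, map_zero] at h9
      exact h9
    refine Finset.mem_image.2 ⟨σ α, Multiset.mem_toFinset.2 hσ, ?_⟩
    apply RingOfIntegers.coe_injective
    rw [ht _ hσ, show algebraMap (𝓞 L) L (σ • t α) = σ (algebraMap (𝓞 L) L (t α)) from rfl, ht _ hα, map_mul, map_intCast]
  · obtain ⟨B, hB⟩ := fix_iff (g.roots.toFinset.image t)
    refine ⟨max B d.natAbs, fun p hp hBp M σ hF => ?_⟩
    have := Fact.mk hp
    have hpd : ¬ (p : ℤ) ∣ d := by
      intro h
      have := Int.natCast_dvd.1 h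
      have := Nat.le_of_dvd (Int.natAbs_pos.2 hd0) this
      have := le_max_right B d.natAbs
      omega
    have hM := hF.mx.isPrime
    have hzp : ∀ z : ℤ, (f.map (Int.castRingHom (ZMod p))).eval (z : ZMod p) = 0 ↔ (p : ℤ) ∣ f.eval z := by
      intro z
      rw [eval_intCast_map, eq_intCast, ZMod.intCast_zmod_eq_zero_iff_dvd, Int.cast_id]
    have key : ∀ z : ℤ, (p : ℤ) ∣ f.eval z ↔ ∃ α ∈ g.roots, (d * z - t α : 𝓞 L) ∈ M := by
      intro z
      have h1 : (p : ℤ) ∣ f.eval z ↔ (p : ℤ) ∣ d ^ f.natDegree * f.eval z := by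
        have hpp := Nat.prime_iff_prime_int.1 hp
        rw [hpp.dvd_mul]
        constructor
        · exact Or.inr
        · rintro (h | h)
          · exact absurd (hpp.dvd_of_dvd_pow h) hpd
          · exact h
      rw [h1, ← int_mem p hp M hF.mx.ne_top hF.mem, hid, hM.mul_mem_iff_mem_or_mem, int_mem p hp M hF.mx.ne_top hF.mem, or_iff_right hpd, hM.multiset_prod_mem_iff_exists_mem]
      simp
    rw [show (∃ x ∈ g.roots.toFinset.image t, σ • x = x) ↔ ∃ x ∈ g.roots.toFinset.image t, ∃ z : ℤ, x - z ∈ M from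
      exists_congr fun x => and_congr_right fun hx => hB p hp (lt_of_le_of_lt (le_max_left _ _) hBp) M σ hF x hx]
    constructor
    · rintro ⟨z, hz⟩
      obtain ⟨z, rfl⟩ := ZMod.intCast_surjective z
      obtain ⟨α, hα, h⟩ := (key z).1 ((hzp z).1 hz)
      refine ⟨t α, Finset.mem_image_of_mem _ (Multiset.mem_toFinset.2 hα), d * z, ?_⟩
      rw [← neg_sub]; push_cast
      exact M.neg_mem h
    · rintro ⟨x, hx, w, hw⟩
      obtain ⟨α, hα, rfl⟩ := Finset.mem_image.1 hx
      rw [Multiset.mem_toFinset] at hα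
      have hc : IsCoprime (p : ℤ) d := ((Nat.prime_iff_prime_int.1 hp).coprime_iff_not_dvd).2 hpd
      obtain ⟨a, b, hab⟩ := hc
      refine ⟨((b * w : ℤ) : ZMod p), ?_⟩
      rw [hzp, key]
      refine ⟨α, hα, ?_⟩
      have : (d * (b * w : ℤ) - t α : 𝓞 L) = - ((a * w : ℤ) : 𝓞 L) * (p : 𝓞 L) - (t α - w) := by
        have h9 : ((a * p + b * d : ℤ) : 𝓞 L) = 1 := by rw [hab]; simp
        push_cast at h9 ⊢
        linear_combination (w : 𝓞 L) * h9
      rw [this]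
      exact M.sub_mem (M.mul_mem_left _ hF.mem) hw

end WI
end

section
open Filter Topology Set

namespace WI
open NumberField Ideal Polynomial
open scoped Classical

section
variable {K : Type*} [Field K] [NumberField K]

lemma norm_eq_p (p : ℕ) (hp : p.Prime) (I : Ideal (𝓞 K)) (hI : I ≠ ⊤) (hpI : (p : 𝓞 K) ∈ I)
    (h : ∀ x : 𝓞 K, ∃ z : ℤ, x - z ∈ I) : absNorm I = p := by
  rw [Ideal.absNorm_apply, Submodule.cardQuot_apply]
  have hsurj : Function.Surjective (Int.castRingHom (𝓞 K ⧸ I)) := by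
    intro y
    obtain ⟨x, rfl⟩ := Ideal.Quotient.mk_surjective y
    obtain ⟨z, hz⟩ := h x
    refine ⟨z, ?_⟩
    have := Ideal.Quotient.eq_zero_iff_mem.2 hz
    rw [map_sub, sub_eq_zero] at this
    rw [this]; simp
  have hker : RingHom.ker (Int.castRingHom (𝓞 K ⧸ I)) = span {(p : ℤ)} := by
    ext n
    rw [RingHom.mem_ker, mem_span_singleton, ← int_mem p hp I hI hpI, ← Ideal.Quotient.eq_zero_iff_mem]
    simp
  have e := (RingHom.quotientKerEquivOfSurjective hsurj)
  exact (Nat.card_congr ((Ideal.quotEquivOfEq hker.symm).trans e).toEquiv).symm.trans (Int.card_ideal_quot p)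

lemma of_norm_p (p : ℕ) (hp : p.Prime) (I : Ideal (𝓞 K)) (h : absNorm I = p) :
    I ≠ ⊤ ∧ (p : 𝓞 K) ∈ I ∧ ∀ x : 𝓞 K, ∃ z : ℤ, x - z ∈ I := by
  have := Fact.mk hp
  have h0 : I ≠ ⊤ := by
    rintro rfl
    rw [absNorm_top] at h
    exact hp.ne_one h.symm
  have h1 : (p : 𝓞 K) ∈ I := by rw [← h]; exact absNorm_mem I
  refine ⟨h0, h1, fun x => ?_⟩
  have hnt : Nontrivial (𝓞 K ⧸ I) := Ideal.Quotient.nontrivial_iff.2 h0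
  have hch : CharP (𝓞 K ⧸ I) p := by
    refine (CharP.charP_iff_prime_eq_zero hp).2 ?_
    have := Ideal.Quotient.eq_zero_iff_mem.2 h1
    simpa using this
  have hb : I ≠ ⊥ := by
    rintro rfl
    simp at h; exact hp.ne_zero h.symm
  have hfin : Finite (𝓞 K ⧸ I) := Ideal.finiteQuotientOfFreeOfNeBot _ hb
  have : Fintype (𝓞 K ⧸ I) := Fintype.ofFinite _
  have hc : Fintype.card (𝓞 K ⧸ I) = p := by
    rw [← Nat.card_eq_fintype_card, ← h]; rfl
  obtain ⟨a, ha⟩ := (ZMod.castHom_bijective (R := 𝓞 K ⧸ I) hc).2 (Ideal.Quotient.mk I x)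
  obtain ⟨z, rfl⟩ := ZMod.intCast_surjective a
  refine ⟨z, ?_⟩
  rw [← Ideal.Quotient.eq_zero_iff_mem, map_sub, ← ha]
  simp

lemma index_int (B : PowerBasis ℚ K) (θ : 𝓞 K) (hθ : algebraMap (𝓞 K) K θ = B.gen) :
    ∃ n : ℤ, n ≠ 0 ∧ ∀ x : 𝓞 K, ∃ g : ℤ[X], (n : 𝓞 K) * x = aeval θ g := by
  have hi : IsIntegral ℤ B.gen := by rw [← hθ]; exact θ.2
  have h1 : IsIntegral ℤ (Algebra.discr ℚ B.basis) := by
    refine Algebra.discr_isIntegral ℚ fun i => ?_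
    rw [B.basis_eq_pow]; exact hi.pow _
  obtain ⟨n, hn⟩ := IsIntegrallyClosed.isIntegral_iff.1 h1
  refine ⟨n, ?_, fun x => ?_⟩
  · rintro rfl
    rw [map_zero] at hn
    exact Algebra.discr_not_zero_of_basis ℚ B.basis hn.symm
  · have h2 := Algebra.discr_mul_isIntegral_mem_adjoin (K := ℚ) (R := ℤ) (B := B) hi (z := algebraMap (𝓞 K) K x) x.2
    rw [Algebra.adjoin_singleton_eq_range_aeval] at h2
    obtain ⟨g, hg⟩ := h2
    refine ⟨g, ?_⟩
    apply RingOfIntegers.coe_injective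
    rw [← hn] at hg
    rw [← aeval_algebraMap_apply, hθ]
    refine Eq.trans ?_ hg.symm
    rw [Algebra.smul_def]; simp
end

variable {L : Type*} [Field L] [NumberField L]

lemma aeval_cong {A : Type*} [CommRing A] (I : Ideal A) (x : A) (z : ℤ) (h : x - z ∈ I) (g : ℤ[X]) :
    aeval x g - ((g.eval z : ℤ) : A) ∈ I := by
  have h1 := sub_dvd_eval_sub x (z : A) (g.map (Int.castRingHom A))
  have h2 := I.mem_of_dvd h1 h
  rw [eval_intCast_map] at h2
  rw [show aeval x g = eval x (g.map (Int.castRingHom A)) by rw [eval_map]; rfl]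
  simpa using h2

/-- restriction of an embedding to integers -/
def emb {K : Type*} [Field K] [NumberField K] (φ : K →ₐ[ℚ] L) : 𝓞 K →+* 𝓞 L := RingOfIntegers.mapRingHom (φ : K →+* L)

theorem aK_frob {K : Type*} [Field K] [NumberField K] (Bs : PowerBasis ℚ K) (θ : 𝓞 K) (hθ : algebraMap (𝓞 K) K θ = Bs.gen)
    (hs : ((minpoly ℚ Bs.gen).map (algebraMap ℚ L)).Splits) : ∃ B : ℕ,
    ∀ p : ℕ, p.Prime → B < p → ∀ (M : Ideal (𝓞 L)) (σ : Gal(L/ℚ)), FrobAt p M σ →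
      aK K p = ((Finset.univ.filter fun φ : K →ₐ[ℚ] L => σ • emb φ θ = emb φ θ).card : ℝ) := by
  obtain ⟨n, hn, hidx⟩ := index_int Bs θ hθ
  let T : (K →ₐ[ℚ] L) → 𝓞 L := fun φ => emb φ θ
  have hT : ∀ φ, algebraMap (𝓞 L) L (T φ) = φ Bs.gen := by intro φ; rw [← hθ]; rfl
  have hTinj : Function.Injective T := by
    intro φ ψ h
    refine Bs.algHom_ext ?_
    rw [← hT, ← hT, h]
  obtain ⟨B1, hB1⟩ := fix_iff (Finset.univ.image T)
  obtain ⟨B2, hB2⟩ := bad_fin (Finset.univ : Finset ((K →ₐ[ℚ] L) × (K →ₐ[ℚ] L))) (fun q => T q.1 - T q.2)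
  refine ⟨max (max B1 B2) n.natAbs, fun p hp hB M σ hF => ?_⟩
  have hl1 : B1 < p := lt_of_le_of_lt ((le_max_left _ _).trans (le_max_left _ _)) hB
  have hl2 : B2 < p := lt_of_le_of_lt ((le_max_right _ _).trans (le_max_left _ _)) hB
  have hpn : ¬ (p : ℤ) ∣ n := by
    intro h
    have h1 := Int.natCast_dvd.1 h
    have h2 := Nat.le_of_dvd (Int.natAbs_pos.2 hn) h1
    have h3 := le_max_right (max B1 B2) n.natAbs
    omega
  have hM := hF.mx.isPrime
  have hfix : ∀ φ, σ • T φ = T φ ↔ ∃ z : ℤ, T φ - z ∈ M := fun φ =>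
    hB1 p hp hl1 M σ hF (T φ) (by simp)
  have hae : ∀ (φ : K →ₐ[ℚ] L) (g : ℤ[X]), emb φ (aeval θ g) = aeval (T φ) g := by
    intro φ g
    exact (aeval_algHom_apply ((emb φ).toIntAlgHom) θ g).symm
  have hcop : ∃ a b : ℤ, a * p + b * n = 1 := ((Nat.prime_iff_prime_int.1 hp).coprime_iff_not_dvd).2 hpn
  obtain ⟨a, b, hab⟩ := hcop
  rw [aK]
  congr 1
  symm
  refine Finset.card_bij (fun φ _ => M.comap (emb φ)) ?_ ?_ ?_
  · intro φ hφ
    rw [Finset.mem_filter] at hφ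
    obtain ⟨z, hz⟩ := (hfix φ).1 hφ.2
    rw [mem_FI]
    have hpc : (p : 𝓞 K) ∈ M.comap (emb φ) := by
      rw [Ideal.mem_comap, map_natCast]; exact hF.mem
    refine norm_eq_p p hp _ (Ideal.comap_ne_top _ hF.mx.ne_top) hpc ?_
    intro x
    obtain ⟨g, hg⟩ := hidx x
    have h1 : aeval θ g - ((g.eval z : ℤ) : 𝓞 K) ∈ M.comap (emb φ) := by
      refine aeval_cong _ _ _ ?_ g
      rw [Ideal.mem_comap, map_sub, map_intCast]; exact hz
    rw [← hg] at h1
    refine ⟨b * g.eval z, ?_⟩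
    have h9 : ((a * p + b * n : ℤ) : 𝓞 K) = 1 := by rw [hab]; simp
    have : x - ((b * g.eval z : ℤ) : 𝓞 K) = (a * x) * (p : 𝓞 K) + b * (n * x - ((g.eval z : ℤ) : 𝓞 K)) := by
      push_cast at h9 ⊢
      linear_combination - x * h9
    rw [this]
    exact Ideal.add_mem _ (Ideal.mul_mem_left _ _ hpc) (Ideal.mul_mem_left _ _ h1)
  · intro φ hφ ψ hψ h
    rw [Finset.mem_filter] at hφ
    obtain ⟨z, hz⟩ := (hfix φ).1 hφ.2
    have h1 : θ - z ∈ M.comap (emb φ) := by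
      rw [Ideal.mem_comap, map_sub, map_intCast]; exact hz
    rw [h, Ideal.mem_comap, map_sub, map_intCast] at h1
    have h2 := M.sub_mem hz h1
    rw [sub_sub_sub_cancel_right] at h2
    exact hTinj (sub_eq_zero.1 (hB2 p hp hl2 M hF.mx.ne_top hF.mem (φ, ψ) (Finset.mem_univ _) h2))
  · intro I hI
    rw [mem_FI] at hI
    obtain ⟨hI1, hI2, hI3⟩ := of_norm_p p hp I hI
    have hImax : I.IsMaximal := by
      have h1 : I.IsPrime := Ideal.isPrime_of_irreducible_absNorm (by rw [hI]; exact hp)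
      refine h1.isMaximal ?_
      rintro rfl
      simp at hI; exact hp.ne_zero hI.symm
    obtain ⟨z, hz⟩ := hI3 θ
    let g := minpoly ℤ θ
    have hg0 : aeval θ g = 0 := minpoly.aeval ℤ θ
    have h1 : (p : ℤ) ∣ g.eval z := by
      have h2 := aeval_cong I θ z hz g
      rw [hg0, zero_sub, neg_mem_iff, int_mem p hp I hI1 hI2] at h2
      exact h2
    have hex : ∃ φ : K →ₐ[ℚ] L, T φ - z ∈ M := by
      have hgm : g.map (algebraMap ℤ ℚ) = minpoly ℚ Bs.gen := by
        rw [← hθ, minpoly.isIntegrallyClosed_eq_field_fractions ℚ K (RingOfIntegers.isIntegral θ)]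
      set G := (minpoly ℚ Bs.gen).map (algebraMap ℚ L) with hG
      have hGm : G.Monic := (minpoly.monic Bs.isIntegral_gen).map _
      have hGg : G = g.map (algebraMap ℤ L) := by
        rw [hG, ← hgm, Polynomial.map_map]; congr 1; exact RingHom.ext_int _ _
      have hrt : ∀ y, ∃ φ : K →ₐ[ℚ] L, y ∈ G.roots → φ Bs.gen = y := by
        intro y
        by_cases hy : y ∈ G.roots
        · rw [mem_roots hGm.ne_zero, IsRoot, hG, eval_map_algebraMap] at hy
          exact ⟨Bs.lift y hy, fun _ => Bs.lift_gen y hy⟩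
        · obtain ⟨φ⟩ : Nonempty (K →ₐ[ℚ] L) := by
            have hd : 0 < G.natDegree := by
              rw [hG, natDegree_map]; exact minpoly.natDegree_pos Bs.isIntegral_gen
            obtain ⟨w, hw⟩ := hs.exists_eval_eq_zero (by
              intro h
              rw [natDegree_eq_of_degree_eq_some h] at hd
              exact lt_irrefl _ hd)
            rw [eval_map_algebraMap] at hw
            exact ⟨Bs.lift w hw⟩
          exact ⟨φ, fun h => absurd h hy⟩
      choose t ht using hrt
      have hid : ((g.eval z : ℤ) : 𝓞 L) = (G.roots.map fun y => (z - T (t y) : 𝓞 L)).prod := by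
        apply RingOfIntegers.coe_injective
        have h1 : G.eval (z : L) = (G.roots.map fun α => (z : L) - α).prod := by
          conv_lhs => rw [hs.eq_prod_roots, hGm.leadingCoeff]
          rw [eval_mul, eval_C, eval_multiset_prod, Multiset.map_map]
          simp
        have h2 : G.eval (z : L) = ((g.eval z : ℤ) : L) := by
          rw [hGg, eval_intCast_map]; simp
        rw [map_intCast, ← h2, h1, map_multiset_prod, Multiset.map_map]
        congr 1
        refine Multiset.map_congr rfl fun α hα => ?_
        simp only [Function.comp, map_sub, map_intCast]
        rw [hT, ht α hα]
      have h2 := (int_mem p hp M hF.mx.ne_top hF.mem (g.eval z)).2 h1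
      rw [hid, hM.multiset_prod_mem_iff_exists_mem] at h2
      simp only [Multiset.mem_map] at h2
      obtain ⟨_, ⟨y, hy, rfl⟩, h3⟩ := h2
      refine ⟨t y, ?_⟩
      rw [← neg_sub]
      exact M.neg_mem h3
    obtain ⟨φ, hφ⟩ := hex
    refine ⟨φ, Finset.mem_filter.2 ⟨Finset.mem_univ _, (hfix φ).2 ⟨z, hφ⟩⟩, ?_⟩
    symm
    refine hImax.eq_of_le (Ideal.comap_ne_top _ hF.mx.ne_top) ?_
    intro x hx
    obtain ⟨g, hg⟩ := hidx x
    have h2 := aeval_cong I θ z hz g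
    rw [← hg] at h2
    have h3 := (I.sub_mem_iff_right (I.mul_mem_left _ hx)).1 h2
    rw [int_mem p hp I hI1 hI2, ← int_mem p hp M hF.mx.ne_top hF.mem] at h3
    have h4 := aeval_cong M (T φ) z hφ g
    have h5 := (M.sub_mem_iff_left h3).1 h4
    rw [← hae, ← hg, map_mul, map_intCast] at h5
    rcases hM.mem_or_mem h5 with h6 | h6
    · exact absurd ((int_mem p hp M hF.mx.ne_top hF.mem n).1 h6) hpn
    · exact h6

end WI
end

section
open Filter Topology Set

namespace WI
open NumberField Ideal Polynomial
open scoped Classical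

/-- average over primes -/
def HasAv (f : ℕ → ℝ) (a : ℝ) : Prop :=
  Tendsto (fun n : ℕ => (∑ p ∈ prs n, f p) * (Real.log n / n)) atTop (𝓝 a)

lemma logn_tend : Tendsto (fun n : ℕ => Real.log n / n) atTop (𝓝 0) := by
  have h := (Real.isLittleO_log_id_atTop.tendsto_div_nhds_zero).comp tendsto_natCast_atTop_atTop
  exact h

lemma HasAv.congr_large {f g : ℕ → ℝ} {a : ℝ} (h : HasAv f a) (B : ℕ)
    (hfg : ∀ p, p.Prime → B < p → f p = g p) : HasAv g a := by
  have h1 := h.add (logn_tend.const_mul (∑ p ∈ prs B, (g p - f p)))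
  rw [mul_zero, add_zero] at h1
  refine h1.congr' ?_
  filter_upwards [eventually_ge_atTop B] with n hn
  rw [← add_mul]
  congr 1
  have h2 : ∑ p ∈ prs B, (g p - f p) = ∑ p ∈ prs n, (g p - f p) := by
    refine Finset.sum_subset ?_ ?_
    · intro p hp
      simp only [prs, Finset.mem_filter, Finset.mem_Icc] at hp ⊢
      exact ⟨⟨hp.1.1, hp.1.2.trans hn⟩, hp.2⟩
    · intro p hp hp'
      simp only [prs, Finset.mem_filter, Finset.mem_Icc] at hp hp'
      have : B < p := by
        by_contra h9
        exact hp' ⟨⟨hp.1.1, not_lt.1 h9⟩, hp.2⟩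
      rw [hfg p hp.2 this, sub_self]
  rw [h2, Finset.sum_sub_distrib]; ring

lemma HasAv.add {f g : ℕ → ℝ} {a b : ℝ} (h : HasAv f a) (h' : HasAv g b) : HasAv (fun p => f p + g p) (a + b) := by
  refine (Tendsto.add h h').congr fun n => ?_
  rw [Finset.sum_add_distrib, add_mul]

lemma HasAv.smul {f : ℕ → ℝ} {a : ℝ} (c : ℝ) (h : HasAv f a) : HasAv (fun p => c * f p) (c * a) := by
  refine (Tendsto.const_mul c h).congr fun n => ?_
  rw [← Finset.mul_sum, mul_assoc]

lemma HasAv.zero : HasAv (fun _ => 0) 0 := by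
  simp [HasAv]

variable {L : Type*} [Field L] [NumberField L]

/-- number of fixed points -/
noncomputable def nf (R : Finset (𝓞 L)) (τ : Gal(L/ℚ)) : ℕ := (R.filter fun x => τ • x = x).card

lemma orbit_av [IsGalois ℚ L] (Fr : ℕ → Gal(L/ℚ)) (MM : ℕ → Ideal (𝓞 L)) (hF : ∀ p, p.Prime → FrobAt p (MM p) (Fr p))
    (θ : 𝓞 L) (O : Finset (𝓞 L)) (hO : ∀ y, y ∈ O ↔ ∃ τ : Gal(L/ℚ), y = τ • θ) :
    HasAv (fun p => (nf O (Fr p) : ℝ)) 1 := by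
  have hInt : IsIntegral ℤ (θ : L) := θ.2
  have hintQ : IsIntegral ℚ (θ : L) := hInt.tower_top
  let K := IntermediateField.adjoin ℚ {(θ : L)}
  let Bs := IntermediateField.adjoin.powerBasis hintQ
  have hgen : Bs.gen = IntermediateField.AdjoinSimple.gen ℚ (θ : L) := IntermediateField.adjoin.powerBasis_gen hintQ
  have hgc : ((Bs.gen : K) : L) = θ := by rw [hgen]; rfl
  have hgi : IsIntegral ℤ Bs.gen := by
    refine (isIntegral_algebraMap_iff (B := L) (algebraMap K L).injective).1 ?_
    rw [show algebraMap K L Bs.gen = (θ : L) from hgc]; exact hInt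
  let θ' : 𝓞 K := ⟨Bs.gen, hgi⟩
  have hmin : minpoly ℚ Bs.gen = minpoly ℚ (θ : L) := by
    exact (minpoly.algebraMap_eq (algebraMap K L).injective Bs.gen).symm.trans (congrArg _ hgc)
  obtain ⟨B, hB⟩ := aK_frob (L := L) Bs θ' rfl (by
    rw [hmin]; exact Normal.splits inferInstance _)
  refine HasAv.congr_large (aK_prime_tend K) B fun p hp hBp => ?_
  rw [hB p hp hBp _ _ (hF p hp)]
  congr 1
  have hemb : ∀ φ : K →ₐ[ℚ] L, ((emb φ θ' : 𝓞 L) : L) = φ Bs.gen := fun φ => rfl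
  refine Finset.card_bij (fun φ _ => emb φ θ') ?_ ?_ ?_
  · intro φ hφ
    rw [Finset.mem_filter] at hφ ⊢
    refine ⟨(hO _).2 ?_, hφ.2⟩
    have h1 : minpoly ℚ (φ Bs.gen) = minpoly ℚ (θ : L) := by
      rw [minpoly.algHom_eq φ φ.injective, hmin]
    obtain ⟨τ, hτ⟩ := (Normal.minpoly_eq_iff_mem_orbit L).1 h1
    refine ⟨τ, ?_⟩
    apply RingOfIntegers.coe_injective
    exact hτ.symm
  · intro φ _ ψ _ h
    refine Bs.algHom_ext ?_
    exact (hemb φ).symm.trans ((congrArg (algebraMap (𝓞 L) L) h).trans (hemb ψ))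
  · intro y hy
    rw [Finset.mem_filter] at hy
    obtain ⟨τ, rfl⟩ := (hO y).1 hy.1
    have h1 : emb ((τ : L →ₐ[ℚ] L).comp K.val) θ' = τ • θ := by
      apply RingOfIntegers.coe_injective
      change τ ((Bs.gen : K) : L) = τ θ
      rw [hgc]
    refine ⟨(τ : L →ₐ[ℚ] L).comp K.val, ?_, h1⟩
    rw [Finset.mem_filter, h1]
    exact ⟨Finset.mem_univ _, hy.2⟩

lemma stab_av [IsGalois ℚ L] (Fr : ℕ → Gal(L/ℚ)) (MM : ℕ → Ideal (𝓞 L)) (hF : ∀ p, p.Prime → FrobAt p (MM p) (Fr p))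
    (N : ℕ) : ∀ R : Finset (𝓞 L), Stab R → R.card ≤ N → ∃ k : ℕ, HasAv (fun p => (nf R (Fr p) : ℝ)) k := by
  induction N with
  | zero =>
    intro R _ h
    rw [Nat.le_zero, Finset.card_eq_zero] at h
    subst h
    refine ⟨0, ?_⟩
    simpa [nf] using HasAv.zero
  | succ N ih =>
    intro R hR hc
    rcases R.eq_empty_or_nonempty with h | ⟨θ, hθ⟩
    · exact ih R hR (by simp [h])
    · let O := R.filter fun y => ∃ τ : Gal(L/ℚ), y = τ • θ
      let R' := R.filter fun y => ¬ ∃ τ : Gal(L/ℚ), y = τ • θ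
      have hO : ∀ y, y ∈ O ↔ ∃ τ : Gal(L/ℚ), y = τ • θ := by
        intro y
        rw [Finset.mem_filter, and_iff_right_iff_imp]
        rintro ⟨τ, rfl⟩
        exact hR τ _ hθ
      have hR' : Stab R' := by
        intro τ x hx
        rw [Finset.mem_filter] at hx ⊢
        refine ⟨hR τ x hx.1, ?_⟩
        rintro ⟨τ', h⟩
        exact hx.2 ⟨τ⁻¹ * τ', by rw [mul_smul, ← h, inv_smul_smul]⟩
      have hlt : R'.card < R.card := by
        refine Finset.card_lt_card (Finset.filter_ssubset.2 ⟨θ, hθ, ?_⟩)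
        rw [not_not]; exact ⟨1, by simp⟩
      obtain ⟨k, hk⟩ := ih R' hR' (by omega)
      refine ⟨1 + k, ?_⟩
      have := (orbit_av Fr MM hF θ O hO).add hk
      push_cast
      convert this using 2 with p
      rw [← Nat.cast_add]
      congr 1
      simp only [nf, O, R']
      rw [Finset.filter_filter, Finset.filter_filter, ← Finset.card_union_of_disjoint]
      · congr 1
        ext x
        simp only [Finset.mem_filter, Finset.mem_union]
        tauto
      · rw [Finset.disjoint_left]
        intro x hx hx'
        rw [Finset.mem_filter] at hx hx'
        exact hx'.2.1 hx.2.1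

lemma stab_mul (R1 R2 : Finset (𝓞 L)) (h1 : Stab R1) (h2 : Stab R2) :
    ∃ R : Finset (𝓞 L), Stab R ∧ ∀ τ, nf R τ = nf R1 τ * nf R2 τ := by
  let bads : Finset L := ((R1 ×ˢ R1) ×ˢ (R2 ×ˢ R2)).image fun q => ((q.1.1 : L) - q.1.2) / ((q.2.2 : L) - q.2.1)
  obtain ⟨c, hc⟩ : ∃ c : ℕ, (c : L) ∉ bads := by
    obtain ⟨x, hx, hx'⟩ := (Set.infinite_range_of_injective (Nat.cast_injective (R := L))).exists_notMem_finset bads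
    obtain ⟨c, rfl⟩ := hx
    exact ⟨c, hx'⟩
  let m : 𝓞 L × 𝓞 L → 𝓞 L := fun q => q.1 + c * q.2
  have hinj : ∀ q ∈ R1 ×ˢ R2, ∀ q' ∈ R1 ×ˢ R2, m q = m q' → q = q' := by
    rintro ⟨x, y⟩ hq ⟨x', y'⟩ hq' h
    rw [Finset.mem_product] at hq hq'
    have h3 : (x : L) + c * y = x' + c * y' := by
      have := congrArg (algebraMap (𝓞 L) L) h
      simpa [m] using this
    by_cases hy : (y : L) = y'
    · have : (x : L) = x' := by rw [hy] at h3; exact add_right_cancel h3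
      rw [RingOfIntegers.coe_injective this, RingOfIntegers.coe_injective hy]
    · exfalso
      apply hc
      refine Finset.mem_image.2 ⟨((x, x'), (y, y')), ?_, ?_⟩
      · simp only [Finset.mem_product] at *
        exact ⟨⟨hq.1, hq'.1⟩, hq.2, hq'.2⟩
      · have : (y' : L) - y ≠ 0 := sub_ne_zero.2 (Ne.symm hy)
        rw [div_eq_iff this]
        linear_combination h3
  have hsm : ∀ (τ : Gal(L/ℚ)) q, τ • m q = m (τ • q.1, τ • q.2) := by
    intro τ q
    apply RingOfIntegers.coe_injective
    change τ (algebraMap (𝓞 L) L (m q)) = _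
    simp only [m, map_add, map_mul, map_natCast]
    rfl
  refine ⟨(R1 ×ˢ R2).image m, ?_, ?_⟩
  · intro τ x hx
    obtain ⟨q, hq, rfl⟩ := Finset.mem_image.1 hx
    rw [Finset.mem_product] at hq
    rw [hsm]
    exact Finset.mem_image_of_mem _ (Finset.mem_product.2 ⟨h1 τ _ hq.1, h2 τ _ hq.2⟩)
  · intro τ
    rw [nf, nf, nf, ← Finset.card_product]
    symm
    refine Finset.card_bij (fun q _ => m q) ?_ ?_ ?_
    · intro q hq
      rw [Finset.mem_product, Finset.mem_filter, Finset.mem_filter] at hq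
      rw [Finset.mem_filter, hsm, hq.1.2, hq.2.2]
      exact ⟨Finset.mem_image_of_mem _ (Finset.mem_product.2 ⟨hq.1.1, hq.2.1⟩), rfl⟩
    · intro q hq q' hq' h
      rw [Finset.mem_product, Finset.mem_filter, Finset.mem_filter] at hq hq'
      exact hinj q (Finset.mem_product.2 ⟨hq.1.1, hq.2.1⟩) q' (Finset.mem_product.2 ⟨hq'.1.1, hq'.2.1⟩) h
    · intro x hx
      rw [Finset.mem_filter] at hx
      obtain ⟨q, hq, rfl⟩ := Finset.mem_image.1 hx.1
      have hq' := Finset.mem_product.1 hq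
      have h3 := hx.2
      rw [hsm] at h3
      have h4 := hinj _ (Finset.mem_product.2 ⟨h1 τ _ hq'.1, h2 τ _ hq'.2⟩) _ hq h3
      refine ⟨q, ?_, rfl⟩
      rw [Finset.mem_product, Finset.mem_filter, Finset.mem_filter]
      exact ⟨⟨hq'.1, congrArg Prod.fst h4⟩, hq'.2, congrArg Prod.snd h4⟩

/-- the monoid of fixed point characters -/
def Mon (L : Type*) [Field L] [NumberField L] : Submonoid (Gal(L/ℚ) → ℚ) where
  carrier := {f | ∃ R : Finset (𝓞 L), Stab R ∧ ∀ τ, f τ = nf R τ}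
  one_mem' := by
    refine ⟨{0}, ?_, ?_⟩
    · intro σ x hx
      rw [Finset.mem_singleton] at hx ⊢
      rw [hx, smul_zero]
    · intro τ
      simp [nf, Finset.filter_singleton]
  mul_mem' := by
    rintro f g ⟨R1, h1, h1'⟩ ⟨R2, h2, h2'⟩
    obtain ⟨R, h, h'⟩ := stab_mul R1 R2 h1 h2
    exact ⟨R, h, fun τ => by rw [h']; push_cast; rw [← h1', ← h2']; rfl⟩

/-- the permutation character algebra -/
def CA (L : Type*) [Field L] [NumberField L] : Subalgebra ℚ (Gal(L/ℚ) → ℚ) := Algebra.adjoin ℚ (Mon L : Set (Gal(L/ℚ) → ℚ))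

lemma CA_av [IsGalois ℚ L] (Fr : ℕ → Gal(L/ℚ)) (MM : ℕ → Ideal (𝓞 L)) (hF : ∀ p, p.Prime → FrobAt p (MM p) (Fr p))
    (f : Gal(L/ℚ) → ℚ) (hf : f ∈ CA L) : ∃ q : ℚ, HasAv (fun p => (f (Fr p) : ℝ)) q := by
  have hf' : f ∈ Submodule.span ℚ (Mon L : Set (Gal(L/ℚ) → ℚ)) := by
    have := Algebra.adjoin_eq_span ℚ (Mon L : Set (Gal(L/ℚ) → ℚ))
    rw [Submonoid.closure_eq] at this
    rw [← this]; exact hf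
  induction hf' using Submodule.span_induction with
  | mem f h =>
    obtain ⟨R, h1, h2⟩ := h
    obtain ⟨k, hk⟩ := stab_av Fr MM hF _ R h1 le_rfl
    refine ⟨k, ?_⟩
    simpa [h2] using hk
  | zero => exact ⟨0, by simpa using HasAv.zero⟩
  | add f g hf1 hg1 ih1 ih2 =>
    obtain ⟨a, ha⟩ := ih1 (by rw [CA, ← Subalgebra.mem_toSubmodule, Algebra.adjoin_eq_span, Submonoid.closure_eq]; exact hf1)
    obtain ⟨b, hb⟩ := ih2 (by rw [CA, ← Subalgebra.mem_toSubmodule, Algebra.adjoin_eq_span, Submonoid.closure_eq]; exact hg1)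
    refine ⟨a + b, ?_⟩
    simpa using ha.add hb
  | smul c f hf1 ih =>
    obtain ⟨a, ha⟩ := ih (by rw [CA, ← Subalgebra.mem_toSubmodule, Algebra.adjoin_eq_span, Submonoid.closure_eq]; exact hf1)
    refine ⟨c * a, ?_⟩
    simpa using ha.smul c

lemma ind_mem (R : Finset (𝓞 L)) (hR : Stab R) :
    (fun τ : Gal(L/ℚ) => if ∃ x ∈ R, τ • x = x then (1 : ℚ) else 0) ∈ CA L := by
  have h1 : (fun τ => (nf R τ : ℚ)) ∈ CA L := Algebra.subset_adjoin ⟨R, hR, fun τ => rfl⟩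
  have h2 : (1 : Gal(L/ℚ) → ℚ) - ∏ j ∈ Finset.Icc 1 R.card, (1 - (1 / j : ℚ) • (fun τ => (nf R τ : ℚ))) ∈ CA L := by
    refine sub_mem (one_mem _) (prod_mem fun j _ => sub_mem (one_mem _) (Subalgebra.smul_mem _ h1 _))
  convert h2 using 1
  funext τ
  simp only [Pi.sub_apply, Pi.one_apply, Finset.prod_apply, Pi.smul_apply, smul_eq_mul]
  split_ifs with h
  · obtain ⟨x, hx, hx'⟩ := h
    have h3 : 0 < nf R τ := Finset.card_pos.2 ⟨x, Finset.mem_filter.2 ⟨hx, hx'⟩⟩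
    rw [Finset.prod_eq_zero (i := nf R τ)]
    · simp
    · exact Finset.mem_Icc.2 ⟨h3, Finset.card_filter_le _ _⟩
    · have : (nf R τ : ℚ) ≠ 0 := by positivity
      field_simp; simp
  · have h3 : nf R τ = 0 := by
      rw [nf, Finset.card_eq_zero, Finset.filter_eq_empty_iff]
      intro x hx hx'
      exact h ⟨x, hx, hx'⟩
    simp [h3]

lemma factor_mem {X ι : Type*} [Fintype X] (A : Subalgebra ℚ (X → ℚ)) (Γ : Finset ι) (e : ι → X → Prop)
    (he : ∀ i ∈ Γ, (fun τ => if e i τ then (1 : ℚ) else 0) ∈ A) (F : X → ℚ)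
    (hF : ∀ τ τ', (∀ i ∈ Γ, e i τ ↔ e i τ') → F τ = F τ') : F ∈ A := by
  let E : ι → X → ℚ := fun i τ => if e i τ then (1 : ℚ) else 0
  let N : X → ℕ := fun τ => (Finset.univ.filter fun τ' => ∀ i ∈ Γ, e i τ ↔ e i τ').card
  have h2 : ∑ τ, (F τ / N τ) • ∏ i ∈ Γ, (1 - (E i - algebraMap ℚ (X → ℚ) (E i τ)) ^ 2) ∈ A := by
    refine sum_mem fun τ _ => Subalgebra.smul_mem _ (prod_mem fun i hi => sub_mem (one_mem _) (pow_mem (sub_mem (he i hi) (Subalgebra.algebraMap_mem _ _)) _)) _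
  convert h2 using 1
  funext τ'
  simp only [Finset.sum_apply, Pi.smul_apply, smul_eq_mul, Finset.prod_apply, Pi.sub_apply, Pi.one_apply, Pi.pow_apply, Pi.algebraMap_apply, Algebra.algebraMap_self, RingHom.id_apply]
  have h3 : ∀ τ, ∏ i ∈ Γ, (1 - (E i τ' - E i τ) ^ 2) = if (∀ i ∈ Γ, e i τ' ↔ e i τ) then (1 : ℚ) else 0 := by
    intro τ
    split_ifs with h
    · refine Finset.prod_eq_one fun i hi => ?_
      simp [E, h i hi]
    · push Not at h
      obtain ⟨i, hi, h⟩ := h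
      refine Finset.prod_eq_zero hi ?_
      simp only [E]
      split_ifs <;> first | tauto | norm_num
  simp only [h3, mul_ite, mul_one, mul_zero]
  rw [← Finset.sum_filter]
  have h4 : ∀ τ ∈ Finset.univ.filter (fun τ => ∀ i ∈ Γ, e i τ' ↔ e i τ), F τ / N τ = F τ' / N τ' := by
    intro τ hτ
    have hτ' := (Finset.mem_filter.1 hτ).2
    rw [hF τ' τ hτ']
    congr 2
    simp only [N]
    congr 1
    refine Finset.filter_congr fun x _ => ?_
    exact forall₂_congr fun i hi => by rw [hτ' i hi]
  rw [Finset.sum_congr rfl h4, Finset.sum_const, nsmul_eq_mul]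
  have h5 : (N τ' : ℚ) ≠ 0 := by
    rw [Nat.cast_ne_zero]
    exact (Finset.card_pos.2 ⟨τ', by simp⟩).ne'
  change F τ' = (N τ' : ℚ) * _
  field_simp

end WI
end

section
open Filter Topology Set

namespace WI
open NumberField Ideal Polynomial
open scoped Classical

lemma root_data (L : Type*) [Field L] [NumberField L] (g : ℤ[X]) (hs : g ≠ 0 → (g.map (algebraMap ℤ L)).Splits) :
    ∃ e : Gal(L/ℚ) → Prop, (fun τ => if e τ then (1 : ℚ) else 0) ∈ CA L ∧ ∃ B : ℕ,
    ∀ p : ℕ, p.Prime → B < p → ∀ (M : Ideal (𝓞 L)) (σ : Gal(L/ℚ)), FrobAt p M σ →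
      ((∃ z : ZMod p, (g.map (Int.castRingHom (ZMod p))).eval z = 0) ↔ e σ) := by
  by_cases hg : g = 0
  · subst hg
    refine ⟨fun _ => True, ?_, 0, fun p hp _ M σ _ => ?_⟩
    · simp only [if_true]; exact one_mem _
    · simp
  · obtain ⟨R, hR, B, h⟩ := root_iff g hg (hs hg)
    exact ⟨_, by convert ind_mem R hR, B, h⟩

lemma split_aux (L : Type) [Field L] [CharZero L] (i : Algebra ℚ L) (f : ℚ[X]) (h : f.IsSplittingField ℚ L) :
    ∃ _ : NumberField L, IsGalois ℚ L ∧ (f.map (algebraMap ℚ L)).Splits := by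
  have hi : i = DivisionRing.toRatAlgebra := Subsingleton.elim _ _
  subst hi
  have : FiniteDimensional ℚ L := Polynomial.IsSplittingField.finiteDimensional L f
  have : Normal ℚ L := Normal.of_isSplittingField f
  exact ⟨{ to_charZero := inferInstance, to_finiteDimensional := inferInstance }, {}, h.splits'⟩

lemma split_ex (f : ℚ[X]) : ∃ (L : Type) (_ : Field L) (_ : NumberField L), IsGalois ℚ L ∧ (f.map (algebraMap ℚ L)).Splits := by
  have h0 : CharZero f.SplittingField := charZero_of_injective_algebraMap (algebraMap ℚ f.SplittingField).injective
  obtain ⟨h1, h2⟩ := split_aux f.SplittingField _ f (Polynomial.IsSplittingField.splittingField f)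
  exact ⟨_, _, h1, h2⟩

lemma exists_av (P : ℕ → Prop) (Γ : Finset ℤ[X]) (p0 : ℕ)
    (h : ∀ p q : ℕ, p.Prime → q.Prime → p0 ≤ p → p0 ≤ q →
      (∀ g ∈ Γ, (∃ z : ZMod p, (g.map (Int.castRingHom _)).eval z = 0) ↔ (∃ z : ZMod q, (g.map (Int.castRingHom _)).eval z = 0)) →
      (P p ↔ P q)) :
    HasAv (fun _ => 1) 1 ∧ ∃ q : ℚ, HasAv (fun p => if P p then 1 else 0) q := by
  let f : ℚ[X] := ∏ g ∈ Γ.filter (· ≠ 0), g.map (algebraMap ℤ ℚ)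
  have hf0 : f ≠ 0 := by
    refine Finset.prod_ne_zero_iff.2 fun g hg => ?_
    exact (Polynomial.map_ne_zero_iff (algebraMap ℤ ℚ).injective_int).2 (Finset.mem_filter.1 hg).2
  obtain ⟨L, _, _, _, h1⟩ := split_ex f
  have hsp : ∀ g ∈ Γ, g ≠ 0 → (g.map (algebraMap ℤ L)).Splits := by
    intro g hg hg0
    have h2 : (g.map (algebraMap ℤ ℚ)) ∣ f := Finset.dvd_prod_of_mem (fun g : ℤ[X] => g.map (algebraMap ℤ ℚ)) (Finset.mem_filter.2 ⟨hg, hg0⟩)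
    have h3 := Polynomial.map_dvd (algebraMap ℚ L) h2
    rw [Polynomial.map_map, show (algebraMap ℚ L).comp (algebraMap ℤ ℚ) = algebraMap ℤ L from RingHom.ext_int _ _] at h3
    exact h1.of_dvd ((Polynomial.map_ne_zero_iff (algebraMap ℚ L).injective).2 hf0) h3
  have hfr : ∀ p : ℕ, ∃ (M : Ideal (𝓞 L)) (σ : Gal(L/ℚ)), p.Prime → FrobAt p M σ := by
    intro p
    by_cases hp : p.Prime
    · obtain ⟨M, σ, h⟩ := exists_frob (L := L) p hp
      exact ⟨M, σ, fun _ => h⟩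
    · exact ⟨⊥, 1, fun h => absurd h hp⟩
  choose MM Fr hF using hfr
  have hone : HasAv (fun _ => 1) 1 := by
    have h1 := orbit_av Fr MM hF (0 : 𝓞 L) {0} (by simp)
    simpa [nf, Finset.filter_singleton] using h1
  refine ⟨hone, ?_⟩
  have hd : ∀ g : ℤ[X], ∃ (e : Gal(L/ℚ) → Prop) (B : ℕ), g ∈ Γ → (fun τ => if e τ then (1 : ℚ) else 0) ∈ CA L ∧
    ∀ p : ℕ, p.Prime → B < p → ∀ (M : Ideal (𝓞 L)) (σ : Gal(L/ℚ)), FrobAt p M σ →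
      ((∃ z : ZMod p, (g.map (Int.castRingHom (ZMod p))).eval z = 0) ↔ e σ) := by
    intro g
    by_cases hg : g ∈ Γ
    · obtain ⟨e, he, B, hB⟩ := root_data L g (hsp g hg)
      exact ⟨e, B, fun _ => ⟨he, hB⟩⟩
    · exact ⟨fun _ => True, 0, fun h => absurd h hg⟩
  choose e B hd using hd
  let B0 := Γ.sup B
  have hB0 : ∀ g ∈ Γ, B g ≤ B0 := fun g hg => Finset.le_sup hg
  let F : Gal(L/ℚ) → ℚ := fun τ => if (∃ p : ℕ, p.Prime ∧ p0 ≤ p ∧ B0 < p ∧ P p ∧ ∀ g ∈ Γ, e g (Fr p) ↔ e g τ) then 1 else 0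
  have hFm : F ∈ CA L := by
    refine factor_mem (CA L) Γ e (fun g hg => (hd g hg).1) F ?_
    intro τ τ' hτ
    simp only [F]
    congr 1
    refine propext (exists_congr fun p => ?_)
    refine and_congr_right fun _ => and_congr_right fun _ => and_congr_right fun _ => and_congr_right fun _ => ?_
    exact forall₂_congr fun g hg => by rw [hτ g hg]
  obtain ⟨q, hq⟩ := CA_av Fr MM hF F hFm
  refine ⟨q, hq.congr_large (max p0 B0) fun p hp hpB => ?_⟩
  have hp0 : p0 ≤ p := (le_max_left p0 B0).trans hpB.le
  have hpB0 : B0 < p := (le_max_right p0 B0).trans_lt hpB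
  by_cases hP : P p
  · rw [if_pos hP]
    simp only [F]
    rw [if_pos ⟨p, hp, hp0, hpB0, hP, fun g _ => Iff.rfl⟩]; simp
  · rw [if_neg hP]
    simp only [F]
    rw [if_neg]
    · simp
    · rintro ⟨p', hp', hp0', hB', hP', hh⟩
      refine hP ((h p' p hp' hp hp0' hp0 fun g hg => ?_).1 hP')
      rw [(hd g hg).2 p' hp' ((hB0 g hg).trans_lt hB') _ _ (hF p' hp'), (hd g hg).2 p hp ((hB0 g hg).trans_lt hpB0) _ _ (hF p hp)]
      exact hh g hg

lemma card_eq (P : ℕ → Prop) (x : ℕ) :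
    (Nat.card {p : ℕ // p ≤ x ∧ p.Prime ∧ P p} : ℝ) = ∑ p ∈ prs x, if P p then (1 : ℝ) else 0 := by
  rw [Finset.sum_boole, Nat.card_congr (Equiv.subtypeEquivRight (q := fun p => p ∈ (prs x).filter P) ?_), Nat.card_eq_fintype_card, Fintype.card_coe]
  intro p
  simp only [prs, Finset.mem_filter, Finset.mem_Icc]
  constructor
  · rintro ⟨h1, h2, h3⟩; exact ⟨⟨⟨h2.one_le, h1⟩, h2⟩, h3⟩
  · rintro ⟨⟨h1, h2⟩, h3⟩; exact ⟨h1.2, h2, h3⟩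

lemma final_tend (P : ℕ → Prop) (q : ℚ) (h1 : HasAv (fun _ => 1) 1) (h2 : HasAv (fun p => if P p then 1 else 0) q) :
    Tendsto (fun x : ℕ => (Nat.card {p : ℕ // p ≤ x ∧ p.Prime ∧ P p} : ℝ) / (Nat.card {p : ℕ // p ≤ x ∧ p.Prime} : ℝ)) atTop (𝓝 (q : ℝ)) := by
  have h3 := Tendsto.div h2 h1 one_ne_zero
  rw [div_one] at h3
  refine h3.congr' ?_
  filter_upwards [eventually_ge_atTop 2] with n hn
  have hl : Real.log n / n ≠ 0 := by
    have : 0 < Real.log n := Real.log_pos (by exact_mod_cast hn)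
    have : (0 : ℝ) < n := by positivity
    positivity
  simp only [Pi.div_apply]
  rw [mul_div_mul_right _ _ hl, card_eq P n]
  congr 1
  have := card_eq (fun _ => True) n
  simp only [and_true, if_true] at this
  exact this.symm

end WI
end

/-- Uniformity in `p` of the Galois stratification procedure: for every sentence `σ` of the
language of rings, the set of primes `p` with `ZMod p ⊨ σ` has a rational natural density
`δ` within the primes. -/
theorem sentence_prime_density (σ : Language.ring.Sentence) :
    ∃ δ : ℚ, Filter.Tendsto
      (fun x : ℕ =>
        (Nat.card {p : ℕ // p ≤ x ∧ p.Prime ∧ RingSentenceHolds σ (ZMod p)} : ℝ) /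
          (Nat.card {p : ℕ // p ≤ x ∧ p.Prime} : ℝ))
      Filter.atTop (nhds (δ : ℝ)) := by
  obtain ⟨Γ, p0, h⟩ := QE.sentence_det σ
  obtain ⟨h1, q, h2⟩ := WI.exists_av (fun p => RingSentenceHolds σ (ZMod p)) Γ p0
    (fun p q hp hq hp0 hq0 hh => h ⟨p, hp⟩ ⟨q, hq⟩ hp0 hq0 hh)
  exact ⟨q, WI.final_tend _ q h1 h2⟩
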